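/- Suppose Ω satisfies the non-degeneracy assumption and set M = sup over the closure of Ω of |F₀|². Then the function B ↦ λ₁(B) − M·B² is concave on (0,∞), so the one-sided derivatives λ₁'₊(B) and λ₁'₋(B) exist for all B > 0; moreover λ₁'₊(B) → Θ₀ and λ₁'₋(B) → Θ₀ as B → ∞, and in particular there exists B₀ > 0 such that λ₁ is strictly increasing on [B₀, ∞). -/

import Mathlib

open MeasureTheory Filter Set Topology

noncomputable section

namespace SC

/-- The plane `ℝ²`. -/
abbrev Plane := ℝ × ℝ

/-- Squared Euclidean norm on the plane. -/
def esq (v : Plane) : ℝ := v.1 ^ 2 + v.2 ^ 2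

/-- Euclidean dot product on the plane. -/
def dot2 (v w : Plane) : ℝ := v.1 * w.1 + v.2 * w.2

/-- The reference vector potential `F₀(x) = (-x₂/2, x₁/2)`, with `curl F₀ = 1`. -/
def F0 : Plane → Plane := fun x => (-x.2 / 2, x.1 / 2)

/-- `u` is of class `Cⁿ` on a neighborhood of the closure of `Ω`. -/
def CNearCl {E : Type*} [NormedAddCommGroup E] [NormedSpace ℝ E]
    (n : ℕ) (Ω : Set Plane) (u : Plane → E) : Prop :=
  ∃ U : Set Plane, IsOpen U ∧ closure Ω ⊆ U ∧ ContDiffOn ℝ n u U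

/-- The pointwise squared magnetic gradient `|(-i∇ - B·A)u|²`. -/
def magSq (B : ℝ) (A : Plane → Plane) (u : Plane → ℂ) (x : Plane) : ℝ :=
  ‖(-Complex.I) * fderiv ℝ u x ((1 : ℝ), (0 : ℝ)) - ((B * (A x).1 : ℝ) : ℂ) * u x‖ ^ 2 +
  ‖(-Complex.I) * fderiv ℝ u x ((0 : ℝ), (1 : ℝ)) - ((B * (A x).2 : ℝ) : ℂ) * u x‖ ^ 2

/-- `curl A = ∂₁A₂ - ∂₂A₁`. -/
def curl2 (A : Plane → Plane) (x : Plane) : ℝ :=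
  fderiv ℝ (fun y => (A y).2) x ((1 : ℝ), (0 : ℝ)) -
    fderiv ℝ (fun y => (A y).1) x ((0 : ℝ), (1 : ℝ))

/-- The variational ground state energy `λ₁(B·A)` of the magnetic Neumann Laplacian. -/
def lam1A (Ω : Set Plane) (B : ℝ) (A : Plane → Plane) : ℝ :=
  sInf { r : ℝ | ∃ u : Plane → ℂ, CNearCl 1 Ω u ∧ (∫ x in Ω, ‖u x‖ ^ 2) ≠ 0 ∧
    r = (∫ x in Ω, magSq B A u x) / (∫ x in Ω, ‖u x‖ ^ 2) }

/-- `λ₁(B) = λ₁(B·F₀)`. -/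
def lam1 (Ω : Set Plane) (B : ℝ) : ℝ := lam1A Ω B F0

/-- The Ginzburg–Landau energy functional. -/
def GLenergy (Ω : Set Plane) (κ H : ℝ) (ψ : Plane → ℂ) (A : Plane → Plane) : ℝ :=
  ∫ x in Ω, (magSq (κ * H) A ψ x - κ ^ 2 * ‖ψ x‖ ^ 2 + κ ^ 2 / 2 * ‖ψ x‖ ^ 4
    + κ ^ 2 * H ^ 2 * (curl2 A x - 1) ^ 2)

/-- Admissible Ginzburg–Landau configurations. -/
def GLadm (Ω : Set Plane) (ψ : Plane → ℂ) (A : Plane → Plane) : Prop :=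
  CNearCl 1 Ω ψ ∧ CNearCl 1 Ω A

/-- The normal state is a minimizer at `(κ, H)`. -/
def NormalMin (Ω : Set Plane) (κ H : ℝ) : Prop :=
  ∀ ψ A, GLadm Ω ψ A → 0 ≤ GLenergy Ω κ H ψ A

/-- The normal state is the unique minimizer at `(κ, H)`. -/
def NormalUnique (Ω : Set Plane) (κ H : ℝ) : Prop :=
  NormalMin Ω κ H ∧
  ∀ ψ A, GLadm Ω ψ A → (∫ x in Ω, ‖ψ x‖ ^ 2) ≠ 0 → 0 < GLenergy Ω κ H ψ A

/-- `(ψ, A)` is a minimizer of the Ginzburg–Landau energy at `(κ, H)`. -/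
def IsGLMin (Ω : Set Plane) (κ H : ℝ) (ψ : Plane → ℂ) (A : Plane → Plane) : Prop :=
  GLadm Ω ψ A ∧ ∀ ψ' A', GLadm Ω ψ' A' → GLenergy Ω κ H ψ A ≤ GLenergy Ω κ H ψ' A'

/-- Lower global critical field. -/
def HC3low (Ω : Set Plane) (κ : ℝ) : ℝ := sInf {H : ℝ | 0 < H ∧ NormalMin Ω κ H}

/-- Upper global critical field. -/
def HC3up (Ω : Set Plane) (κ : ℝ) : ℝ :=
  sInf {H : ℝ | 0 < H ∧ ∀ H', H < H' → NormalUnique Ω κ H'}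

/-- Lower local critical field. -/
def HlocLow (Ω : Set Plane) (κ : ℝ) : ℝ :=
  sInf {H : ℝ | 0 < H ∧ κ ^ 2 ≤ lam1 Ω (κ * H)}

/-- Upper local critical field. -/
def HlocUp (Ω : Set Plane) (κ : ℝ) : ℝ :=
  sInf {H : ℝ | 0 < H ∧ ∀ H', H < H' → κ ^ 2 ≤ lam1 Ω (κ * H')}

/-- The inward unit normal `ν(s) = (-γ₂'(s), γ₁'(s))`. -/
def nuVec (γ : ℝ → Plane) (s : ℝ) : Plane := (-(deriv γ s).2, (deriv γ s).1)

/-- The curvature `k(s) = ⟨γ''(s), ν(s)⟩`. -/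
def curvOf (γ : ℝ → Plane) (s : ℝ) : ℝ := dot2 (deriv (deriv γ) s) (nuVec γ s)

/-- The maximal curvature. -/
def kmaxOf (γ : ℝ → Plane) : ℝ := sSup (Set.range (curvOf γ))

/-- A smooth counterclockwise arclength parametrization of the boundary of `Ω`. -/
structure BoundaryParam (Ω : Set Plane) where
  γ : ℝ → Plane
  L : ℝ
  L_pos : 0 < L
  smooth : ContDiff ℝ (⊤ : ℕ∞) γ
  periodic : Function.Periodic γ L
  unit_speed : ∀ s, esq (deriv γ s) = 1
  injOn : Set.InjOn γ (Set.Ico 0 L)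
  range_eq : Set.range γ = frontier Ω
  inward : ∀ s, ∃ ε > 0, ∀ t ∈ Set.Ioo (0 : ℝ) ε, γ s + t • nuVec γ s ∈ Ω

/-- The non-degeneracy assumption: finitely many points of maximal curvature,
all of them non-degenerate maxima. -/
def NonDegen {Ω : Set Plane} (P : BoundaryParam Ω) : Prop :=
  ∃ (N : ℕ) (s : Fin N → ℝ), 0 < N ∧ (∀ j, s j ∈ Set.Ico 0 P.L) ∧
    (∀ j, curvOf P.γ (s j) = kmaxOf P.γ) ∧
    (∀ t ∈ Set.Ico 0 P.L, (∀ j, t ≠ s j) → curvOf P.γ t < kmaxOf P.γ) ∧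
    (∀ j, deriv (deriv (curvOf P.γ)) (s j) < 0)

/-- The ground state energy `μ(ζ)` of the de Gennes half-line model operator. -/
def muGen (ζ : ℝ) : ℝ :=
  sInf { r : ℝ | ∃ φ : ℝ → ℝ, ContDiff ℝ 1 φ ∧ HasCompactSupport φ ∧
    (∃ τ, 0 < τ ∧ φ τ ≠ 0) ∧
    r = (∫ τ in Set.Ioi (0 : ℝ), ((deriv φ τ) ^ 2 + (τ + ζ) ^ 2 * (φ τ) ^ 2)) /
        (∫ τ in Set.Ioi (0 : ℝ), (φ τ) ^ 2) }

/-- The de Gennes constant `Θ₀`. -/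
def Theta0 : ℝ := sInf (Set.range muGen)

/-- Standard facts about the de Gennes constant, taken as hypotheses. -/
structure DeGennes where
  ξ₀ : ℝ
  u₀ : ℝ → ℝ
  theta_lb : 1 / 2 < Theta0
  theta_ub : Theta0 < 1
  ξ₀_mem : ξ₀ ∈ Set.Ioo (-1 : ℝ) 0
  ξ₀_min : muGen ξ₀ = Theta0
  ξ₀_uniq : ∀ ζ, muGen ζ = Theta0 → ζ = ξ₀
  ξ₀_sq : ξ₀ ^ 2 = Theta0
  u₀_pos : ∀ τ, 0 ≤ τ → 0 < u₀ τ
  u₀_smooth : ContDiffOn ℝ 2 u₀ (Set.Ici 0)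
  u₀_sq_int : IntegrableOn (fun τ => (u₀ τ) ^ 2) (Set.Ioi 0)
  u₀_normalized : (∫ τ in Set.Ioi (0 : ℝ), (u₀ τ) ^ 2) = 1
  u₀_neumann : derivWithin u₀ (Set.Ici 0) 0 = 0
  u₀_ode : ∀ τ ∈ Set.Ioi (0 : ℝ),
    -(deriv (deriv u₀) τ) + (τ + ξ₀) ^ 2 * u₀ τ = Theta0 * u₀ τ

/-- The universal constant `C₁ = u₀(0)²/3`. -/
def DeGennes.C1 (D : DeGennes) : ℝ := (D.u₀ 0) ^ 2 / 3

/-- Condition (★) on a vector field `A` at field strength `B` with constant `C₀`. -/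
def StarCond (Ω : Set Plane) (C₀ B : ℝ) (A : Plane → Plane) : Prop :=
  CNearCl 2 Ω A ∧
  (∀ x ∈ closure Ω, ‖A x‖ ≤ C₀) ∧
  (∀ x ∈ closure Ω, ‖fderiv ℝ A x‖ ≤ C₀) ∧
  (∀ x ∈ closure Ω, ‖fderiv ℝ (fderiv ℝ A) x‖ ≤ C₀) ∧
  (∀ x ∈ closure Ω, |curl2 A x - 1| ≤ C₀ * B ^ (-(1 : ℝ) / 4)) ∧
  (∀ x ∈ closure Ω, ‖fderiv ℝ (curl2 A) x‖ ≤ C₀ * B ^ (-(1 : ℝ) / 4)) ∧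
  (∀ x ∈ frontier Ω, curl2 A x = 1)

/-- The open unit disc. -/
def unitDisc : Set Plane := {x : Plane | x.1 ^ 2 + x.2 ^ 2 < 1}

/-- `Δ_B`: distance from `B/2 + ξ₀√B + δ₀` to the nearest integer. -/
def DeltaB (ξ₀ δ₀ B : ℝ) : ℝ :=
  sInf (Set.range (fun m : ℤ => |(m : ℝ) - B / 2 - ξ₀ * Real.sqrt B - δ₀|))

/-- Euclidean distance to the boundary of `Ω`. -/
def distBdry (Ω : Set Plane) (x : Plane) : ℝ :=
  sInf ((fun y => Real.sqrt (esq (x - y))) '' frontier Ω)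

end SC

namespace SC

/-- Almost convexity of `f` at scale one: consequence of quadratic upper bounds. -/
lemma three_point {f : ℝ → ℝ} {K B₀ : ℝ}
    (h2 : ∀ B ≥ B₀, ∀ η > 0, ∃ D, ∀ β, 0 < B + β → f (B + β) ≤ f B + η + β * D + β ^ 2 * K / B)
    {x y z : ℝ} (hx0 : 0 < x) (hy : B₀ ≤ y) (hxy : x < y) (hyz : y < z) :
    (f z - f y) / (z - y) ≤ (f y - f x) / (y - x) + (z - x) * K / y := by
  have h1 : (z - y) * (f x - f y) + (y - x) * (f z - f y)
      ≤ (z - y) * (y - x) * ((z - x) * K / y) := by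
    refine le_of_forall_pos_le_add fun η hη => ?_
    obtain ⟨D, hD⟩ := h2 y hy (η / (z - x)) (div_pos hη (by linarith))
    have a := hD (x - y) (by linarith)
    have b := hD (z - y) (by linarith)
    rw [add_sub_cancel] at a b
    have a' := mul_le_mul_of_nonneg_left a (sub_nonneg.2 hyz.le)
    have b' := mul_le_mul_of_nonneg_left b (sub_nonneg.2 hxy.le)
    have e : η = (z - x) * (η / (z - x)) := by
      rw [mul_div_cancel₀]; linarith
    rw [e]
    have : (x - y) ^ 2 * K / y = (x - y) ^ 2 * (K / y) := by ring
    rw [this] at a'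
    have : (z - y) ^ 2 * K / y = (z - y) ^ 2 * (K / y) := by ring
    rw [this] at b'
    have : (z - x) * K / y = (z - x) * (K / y) := by ring
    rw [this]
    nlinarith
  have p1 : 0 < z - y := by linarith
  have p2 : 0 < y - x := by linarith
  rw [← sub_le_iff_le_add', div_sub_div _ _ p1.ne' p2.ne', div_le_iff₀ (mul_pos p1 p2)]
  linarith

lemma tendsto_quot_of_hasDerivWithinAt_Ici {f : ℝ → ℝ} {x d : ℝ}
    (h : HasDerivWithinAt f d (Ici x) x) :
    Tendsto (fun y => (f y - f x) / (y - x)) (𝓝[>] x) (𝓝 d) := by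
  have := (hasDerivWithinAt_iff_tendsto_slope' (by simp)).1 (h.mono Ioi_subset_Ici_self)
  refine this.congr fun y => ?_
  rw [slope_def_field]

lemma tendsto_quot_of_hasDerivWithinAt_Iic {f : ℝ → ℝ} {x d : ℝ}
    (h : HasDerivWithinAt f d (Iic x) x) :
    Tendsto (fun y => (f x - f y) / (x - y)) (𝓝[<] x) (𝓝 d) := by
  have := (hasDerivWithinAt_iff_tendsto_slope' (by simp)).1 (h.mono Iio_subset_Iic_self)
  refine this.congr fun y => ?_
  rw [slope_def_field, ← neg_sub (f x), ← neg_sub x, neg_div_neg_eq]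

lemma onesided_bounds {f : ℝ → ℝ} {K B₀ B b : ℝ} (hB₀ : 0 < B₀)
    (hc : ContinuousAt f B)
    (h2 : ∀ B ≥ B₀, ∀ η > 0, ∃ D, ∀ β, 0 < B + β → f (B + β) ≤ f B + η + β * D + β ^ 2 * K / B)
    (hB : B₀ < B) (hb : 0 < b) (hbB : b < B)
    {p m : ℝ} (hp : HasDerivWithinAt f p (Ici B) B) (hm : HasDerivWithinAt f m (Iic B) B) :
    ((f (B + b) - f B) / b - b * K / B ≤ p ∧ p ≤ (f B - f (B - b)) / b + b * K / B) ∧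
    ((f (B + b) - f B) / b - b * K / B ≤ m ∧ m ≤ (f B - f (B - b)) / b + b * K / B) := by
  have hBpos : 0 < B := hB₀.trans hB
  have tp := tendsto_quot_of_hasDerivWithinAt_Ici hp
  have tm := tendsto_quot_of_hasDerivWithinAt_Iic hm
  have cid : ∀ s : Set ℝ, Tendsto (fun y : ℝ => y) (𝓝[s] B) (𝓝 B) := fun s =>
    tendsto_id.mono_left nhdsWithin_le_nhds
  have cf : ∀ s : Set ℝ, Tendsto f (𝓝[s] B) (𝓝 (f B)) := fun s =>
    hc.tendsto.mono_left nhdsWithin_le_nhds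
  refine ⟨⟨?_, ?_⟩, ?_, ?_⟩
  · have lim : Tendsto (fun y => (f (B + b) - f y) / (B + b - y) - (B + b - B) * K / y)
        (𝓝[>] B) (𝓝 ((f (B + b) - f B) / (B + b - B) - (B + b - B) * K / B)) :=
      ((tendsto_const_nhds.sub (cf _)).div (tendsto_const_nhds.sub (cid _))
        (by simp [hb.ne'])).sub (tendsto_const_nhds.div (cid _) hBpos.ne')
    have : B + b - B = b := by ring
    rw [this] at lim
    refine le_of_tendsto_of_tendsto lim tp ?_
    filter_upwards [Ioo_mem_nhdsGT (show B < B + b by linarith)] with y hy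
    have := three_point h2 hBpos (hB.le.trans hy.1.le) hy.1 hy.2
    have e : B + b - B = b := by ring
    rw [e] at this
    linarith
  · have lim : Tendsto (fun y => (f B - f (B - b)) / (B - (B - b)) + (y - (B - b)) * K / B)
        (𝓝[>] B) (𝓝 ((f B - f (B - b)) / (B - (B - b)) + (B - (B - b)) * K / B)) :=
      tendsto_const_nhds.add ((((cid _).sub tendsto_const_nhds).mul_const _).div_const _)
    have : B - (B - b) = b := by ring
    rw [this] at lim
    refine le_of_tendsto_of_tendsto tp lim ?_
    filter_upwards [self_mem_nhdsWithin] with y hy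
    have := three_point h2 (by linarith : 0 < B - b) hB.le (by linarith) hy
    have e : B - (B - b) = b := by ring
    rwa [e] at this
  · have lim : Tendsto (fun y => (f (B + b) - f B) / (B + b - B) - (B + b - y) * K / B)
        (𝓝[<] B) (𝓝 ((f (B + b) - f B) / (B + b - B) - (B + b - B) * K / B)) :=
      tendsto_const_nhds.sub (((tendsto_const_nhds.sub (cid _)).mul_const _).div_const _)
    have : B + b - B = b := by ring
    rw [this] at lim
    refine le_of_tendsto_of_tendsto lim tm ?_
    filter_upwards [Ioo_mem_nhdsLT hBpos] with y hy
    have := three_point h2 hy.1 hB.le hy.2 (by linarith : B < B + b)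
    have e : B + b - B = b := by ring
    rw [e] at this
    linarith
  · have lim : Tendsto (fun y => (f y - f (B - b)) / (y - (B - b)) + (B - (B - b)) * K / y)
        (𝓝[<] B) (𝓝 ((f B - f (B - b)) / (B - (B - b)) + (B - (B - b)) * K / B)) :=
      (((cf _).sub tendsto_const_nhds).div ((cid _).sub tendsto_const_nhds)
        (by simp [hb.ne'])).add (tendsto_const_nhds.div (cid _) hBpos.ne')
    have e : B - (B - b) = b := by ring
    rw [e] at lim
    refine le_of_tendsto_of_tendsto tm lim ?_
    filter_upwards [Ioo_mem_nhdsLT (show max (B - b) B₀ < B by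
      simp only [max_lt_iff]; exact ⟨by linarith, hB⟩)] with y hy
    have := three_point h2 (by linarith : 0 < B - b) ((le_max_right _ _).trans hy.1.le)
      (lt_of_le_of_lt (le_max_left _ _) hy.1) hy.2
    rwa [e] at this

lemma tendsto_slope_atTop {f : ℝ → ℝ} {Θ c : ℝ} (hc : 0 < c) (hc1 : c ≠ 1)
    (h1 : Tendsto (fun B => f B / B) atTop (𝓝 Θ)) :
    Tendsto (fun B => (f (c * B) - f B) / ((c - 1) * B)) atTop (𝓝 Θ) := by
  have hs : c - 1 ≠ 0 := sub_ne_zero.2 hc1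
  have h2 := h1.comp (tendsto_id.const_mul_atTop hc)
  have h3 : Tendsto (fun B => (c * (f (c * B) / (c * B)) - f B / B) / (c - 1)) atTop
      (𝓝 ((c * Θ - Θ) / (c - 1))) := ((h2.const_mul c).sub h1).div_const _
  have : (c * Θ - Θ) / (c - 1) = Θ := by field_simp
  rw [this] at h3
  refine h3.congr' ?_
  filter_upwards [eventually_gt_atTop 0] with B hB
  field_simp

theorem onesided_of_bounds {f : ℝ → ℝ} {M Θ K B₀ : ℝ} (hΘ : 0 < Θ) (hK : 0 ≤ K) (hB₀ : 0 < B₀)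
    (hconc : ConcaveOn ℝ (Ioi 0) (fun B => f B - M * B ^ 2))
    (h1 : Tendsto (fun B => f B / B) atTop (𝓝 Θ))
    (h2 : ∀ B ≥ B₀, ∀ η > 0, ∃ D, ∀ β, 0 < B + β → f (B + β) ≤ f B + η + β * D + β ^ 2 * K / B) :
    (∀ B : ℝ, 0 < B → DifferentiableWithinAt ℝ f (Ici B) B ∧
      DifferentiableWithinAt ℝ f (Iic B) B) ∧
    Tendsto (fun B => derivWithin f (Ici B) B) atTop (𝓝 Θ) ∧
    Tendsto (fun B => derivWithin f (Iic B) B) atTop (𝓝 Θ) ∧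
    ∃ B₀ > 0, StrictMonoOn f (Ici B₀) := by
  have hconv := hconc.neg
  have hrep : f = fun B => - (-(fun B => f B - M * B ^ 2)) B + M * B ^ 2 := by
    funext B; simp
  have hdiff : ∀ B : ℝ, 0 < B → DifferentiableWithinAt ℝ f (Ici B) B ∧
      DifferentiableWithinAt ℝ f (Iic B) B := by
    intro B hB
    have hi : B ∈ interior (Ioi (0 : ℝ)) := by simpa using hB
    have q : ∀ s, DifferentiableWithinAt ℝ (fun B : ℝ => M * B ^ 2) s B := fun s =>
      (by fun_prop : Differentiable ℝ (fun B : ℝ => M * B ^ 2)).differentiableAt.differentiableWithinAt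
    constructor
    · rw [← differentiableWithinAt_Ioi_iff_Ici, hrep]
      exact (hconv.differentiableWithinAt_Ioi_of_mem_interior hi).neg.add (q _)
    · refine (DifferentiableWithinAt.insert ?_ : DifferentiableWithinAt ℝ f (insert B (Iio B)) B).mono
        (by simp)
      rw [hrep]
      exact (hconv.differentiableWithinAt_Iio_of_mem_interior hi).neg.add (q _)
  have hcont : ContinuousOn f (Ioi 0) := by
    intro B hB
    exact (continuousAt_iff_continuous_left_right.2 ⟨(hdiff B hB).2.continuousWithinAt,
      (hdiff B hB).1.continuousWithinAt⟩).continuousWithinAt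
  have key : ∀ ε > 0, ∀ᶠ B in atTop, |derivWithin f (Ici B) B - Θ| < ε ∧
      |derivWithin f (Iic B) B - Θ| < ε := by
    intro ε hε
    set c : ℝ := min (1 / 2) (ε / (2 * (K + 1))) with hcdef
    have hc0 : 0 < c := lt_min (by norm_num) (by positivity)
    have hc1 : c ≤ 1 / 2 := min_le_left _ _
    have hcK : c * K ≤ ε / 2 := by
      have : c * (K + 1) ≤ ε / 2 := by
        calc c * (K + 1) ≤ ε / (2 * (K + 1)) * (K + 1) := by gcongr; exact min_le_right _ _
          _ = ε / 2 := by field_simp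
      linarith
    have t1 := tendsto_slope_atTop (c := 1 + c) (by linarith) (by linarith) h1
    have t2 := tendsto_slope_atTop (c := 1 - c) (by linarith) (by linarith) h1
    have e1 := Metric.tendsto_nhds.1 t1 (ε / 2) (by linarith)
    have e2 := Metric.tendsto_nhds.1 t2 (ε / 2) (by linarith)
    filter_upwards [e1, e2, eventually_gt_atTop B₀] with B b1 b2 hB
    have hBpos : 0 < B := hB₀.trans hB
    have hd := hdiff B hBpos
    have := onesided_bounds (b := c * B) hB₀ (hcont.continuousAt (Ioi_mem_nhds hBpos)) h2 hB
      (by positivity) (by nlinarith) hd.1.hasDerivWithinAt hd.2.hasDerivWithinAt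
    have r1 : (f (B + c * B) - f B) / (c * B) = (f ((1 + c) * B) - f B) / ((1 + c - 1) * B) := by
      congr 1
      · congr 2; ring
      · ring
    have r2 : (f B - f (B - c * B)) / (c * B) = (f ((1 - c) * B) - f B) / ((1 - c - 1) * B) := by
      rw [← neg_div_neg_eq]
      congr 1
      · rw [neg_sub]; congr 2; ring
      · ring
    have r3 : c * B * K / B = c * K := by field_simp
    rw [r1, r2, r3] at this
    rw [Real.dist_eq, abs_lt] at b1 b2
    obtain ⟨⟨u1, u2⟩, u3, u4⟩ := this
    exact ⟨abs_lt.2 ⟨by linarith, by linarith⟩, abs_lt.2 ⟨by linarith, by linarith⟩⟩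
  have T1 : Tendsto (fun B => derivWithin f (Ici B) B) atTop (𝓝 Θ) :=
    Metric.tendsto_nhds.2 fun ε hε => (key ε hε).mono fun B h => by
      rw [Real.dist_eq]; exact h.1
  refine ⟨hdiff, T1, Metric.tendsto_nhds.2 fun ε hε => (key ε hε).mono fun B h => by
      rw [Real.dist_eq]; exact h.2, ?_⟩
  obtain ⟨b, hb⟩ := eventually_atTop.1 (T1.eventually (lt_mem_nhds (half_lt_self hΘ)))
  refine ⟨max b 1, by positivity, fun x hx y hy hxy => ?_⟩
  have hx' : b ≤ x ∧ 1 ≤ x := by simpa using hx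
  have hcIcc : ContinuousOn f (Icc x y) := hcont.mono fun w hw => by
    simp only [mem_Icc] at hw; simp only [mem_Ioi]; linarith
  have := image_le_of_deriv_right_le_deriv_boundary (f := fun w => - f w)
    (f' := fun w => - derivWithin f (Ici w) w)
    (B := fun w => - f x - Θ / 2 * (w - x)) (B' := fun _ => - (Θ / 2)) (a := x) (b := y)
    hcIcc.neg (fun w hw => ((hdiff w (by linarith [hw.1])).1.hasDerivWithinAt).neg)
    (by simp) (by fun_prop)
    (fun w _ => by
      have : HasDerivAt (fun w => - f x - Θ / 2 * (w - x)) (-(Θ / 2 * 1)) w := by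
        simpa using (((hasDerivAt_id w).sub_const x).const_mul (Θ / 2)).const_sub (- f x)
      simpa using this.hasDerivWithinAt)
    (fun w hw => by
      have := hb w (by linarith [hw.1])
      linarith) (right_mem_Icc.2 hxy.le)
  nlinarith

end SC

namespace SC

/-- A smooth function equal to `1` near the closed set `K` and to `0` near the complement of `U`. -/
lemma exists_cutoff {E : Type*} [NormedAddCommGroup E] [NormedSpace ℝ E] [FiniteDimensional ℝ E]
    {K U : Set E} (hK : IsClosed K) (hU : IsOpen U) (hKU : K ⊆ U) :
    ∃ χ : E → ℝ, ContDiff ℝ (⊤ : ℕ∞) χ ∧ (∀ᶠ x in 𝓝ˢ Uᶜ, χ x = 0) ∧ (∀ᶠ x in 𝓝ˢ K, χ x = 1) ∧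
      ∀ x, χ x ∈ Icc (0 : ℝ) 1 := by
  obtain ⟨f, h0, h1, h2⟩ := exists_contMDiffMap_zero_one_nhds_of_isClosed (M := E) (n := (⊤ : ℕ∞))
    (modelWithCornersSelf ℝ E) hU.isClosed_compl hK
    (disjoint_left.2 fun x hx hx' => hx (hKU hx'))
  exact ⟨f, contMDiff_iff_contDiff.1 f.contMDiff, h0, h1, h2⟩

lemma contDiff_cutoff_smul {E F : Type*} [NormedAddCommGroup E] [NormedSpace ℝ E]
    [NormedAddCommGroup F] [NormedSpace ℝ F] {U : Set E} {n : ℕ}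
    (hU : IsOpen U) {χ : E → ℝ} (hχ : ContDiff ℝ n χ) (h0 : ∀ᶠ x in 𝓝ˢ Uᶜ, χ x = 0)
    {u : E → F} (hu : ContDiffOn ℝ n u U) : ContDiff ℝ n (fun x => χ x • u x) := by
  rw [contDiff_iff_contDiffAt]
  intro x
  by_cases hx : x ∈ U
  · exact hχ.contDiffAt.smul (hu.contDiffAt (hU.mem_nhds hx))
  · have : (fun x => χ x • u x) =ᶠ[𝓝 x] fun _ => 0 := by
      filter_upwards [eventually_nhdsSet_iff_forall.1 h0 x hx] with y hy
      simp [hy]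
    exact contDiffAt_const.congr_of_eventuallyEq this

/-- The magnetic derivative of `u` in the direction `v`. -/
def Pv (B : ℝ) (u : Plane → ℂ) (x v : Plane) : ℂ :=
  (-Complex.I) * fderiv ℝ u x v - ((B * dot2 (F0 x) v : ℝ) : ℂ) * u x

/-- The two components of the magnetic gradient. -/
def P1 (B : ℝ) (u : Plane → ℂ) (x : Plane) : ℂ := Pv B u x (1, 0)

def P2 (B : ℝ) (u : Plane → ℂ) (x : Plane) : ℂ := Pv B u x (0, 1)

lemma magSq_eq (B : ℝ) (u : Plane → ℂ) (x : Plane) :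
    magSq B F0 u x = ‖P1 B u x‖ ^ 2 + ‖P2 B u x‖ ^ 2 := by
  simp [magSq, P1, P2, Pv, dot2]

lemma magSq_nonneg (B : ℝ) (A : Plane → Plane) (u : Plane → ℂ) (x : Plane) :
    0 ≤ magSq B A u x := by unfold magSq; positivity

/-- The magnetic quadratic form on `Ω`. -/
def Qf (Ω : Set Plane) (B : ℝ) (u : Plane → ℂ) : ℝ := ∫ x in Ω, magSq B F0 u x

/-- The squared `L²` norm on `Ω`. -/
def nsq (Ω : Set Plane) (u : Plane → ℂ) : ℝ := ∫ x in Ω, ‖u x‖ ^ 2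

lemma Qf_nonneg (Ω : Set Plane) (B : ℝ) (u : Plane → ℂ) : 0 ≤ Qf Ω B u :=
  integral_nonneg fun _ => magSq_nonneg _ _ _ _

lemma nsq_nonneg (Ω : Set Plane) (u : Plane → ℂ) : 0 ≤ nsq Ω u :=
  integral_nonneg fun _ => by positivity

lemma continuous_F0 : Continuous F0 := by unfold F0; fun_prop

lemma continuous_P1 {B : ℝ} {u : Plane → ℂ} (hu : ContDiff ℝ 1 u) : Continuous (P1 B u) := by
  have h := hu.continuous_fderiv (by norm_num)
  have h' := hu.continuous
  have := continuous_F0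
  unfold P1 Pv dot2; fun_prop

lemma continuous_P2 {B : ℝ} {u : Plane → ℂ} (hu : ContDiff ℝ 1 u) : Continuous (P2 B u) := by
  have h := hu.continuous_fderiv (by norm_num)
  have h' := hu.continuous
  have := continuous_F0
  unfold P2 Pv dot2; fun_prop

lemma continuous_magSq {B : ℝ} {u : Plane → ℂ} (hu : ContDiff ℝ 1 u) :
    Continuous (magSq B F0 u) := by
  have h1 := continuous_P1 (B := B) hu
  have h2 := continuous_P2 (B := B) hu
  simp only [funext fun x => magSq_eq B u x]
  fun_prop

lemma integrableOn_of_continuous {E : Type*} [NormedAddCommGroup E] {Ω : Set Plane}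
    (hb : Bornology.IsBounded Ω) {f : Plane → E} (hf : Continuous f) : IntegrableOn f Ω :=
  (hf.continuousOn.integrableOn_compact hb.isCompact_closure).mono_set subset_closure

lemma congr_on_open {Ω : Set Plane} (ho : IsOpen Ω) {B : ℝ} {u v : Plane → ℂ} (h : EqOn u v Ω) :
    Qf Ω B u = Qf Ω B v ∧ nsq Ω u = nsq Ω v := by
  constructor
  · refine setIntegral_congr_fun ho.measurableSet fun x hx => ?_
    have he : u =ᶠ[𝓝 x] v := h.eventuallyEq_of_mem (ho.mem_nhds hx)
    simp only [magSq, he.fderiv_eq, h hx]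
  · exact setIntegral_congr_fun ho.measurableSet fun x hx => by simp only [h hx]

lemma exists_global {Ω : Set Plane} {u : Plane → ℂ} (hu : CNearCl 1 Ω u) :
    ∃ v : Plane → ℂ, ContDiff ℝ 1 v ∧ EqOn u v Ω := by
  obtain ⟨U, hU, hΩU, hu⟩ := hu
  obtain ⟨χ, hχ, h0, h1, -⟩ := exists_cutoff isClosed_closure hU hΩU
  refine ⟨fun x => χ x • u x, ?_, fun x hx => ?_⟩
  · exact contDiff_cutoff_smul (n := 1) hU (hχ.of_le (by exact_mod_cast le_top)) h0 hu
  · simp [h1.self_of_nhdsSet x (subset_closure hx)]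

lemma cnear_of_contDiff {Ω : Set Plane} {u : Plane → ℂ} (hu : ContDiff ℝ 1 u) : CNearCl 1 Ω u :=
  ⟨univ, isOpen_univ, subset_univ _, hu.contDiffOn⟩

lemma lam1_bddBelow (Ω : Set Plane) (B : ℝ) :
    BddBelow { r : ℝ | ∃ u : Plane → ℂ, CNearCl 1 Ω u ∧ (∫ x in Ω, ‖u x‖ ^ 2) ≠ 0 ∧
    r = (∫ x in Ω, magSq B F0 u x) / (∫ x in Ω, ‖u x‖ ^ 2) } := by
  refine ⟨0, ?_⟩
  rintro r ⟨u, -, -, rfl⟩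
  exact div_nonneg (Qf_nonneg Ω B u) (nsq_nonneg Ω u)

lemma lam1_nonneg (Ω : Set Plane) (B : ℝ) : 0 ≤ lam1 Ω B := by
  refine Real.sInf_nonneg ?_
  rintro r ⟨u, -, -, rfl⟩
  exact div_nonneg (Qf_nonneg Ω B u) (nsq_nonneg Ω u)

lemma lam1_mul_le {Ω : Set Plane} (B : ℝ) {u : Plane → ℂ} (hu : ContDiff ℝ 1 u) :
    lam1 Ω B * nsq Ω u ≤ Qf Ω B u := by
  by_cases h : nsq Ω u = 0
  · rw [h, mul_zero]; exact Qf_nonneg _ _ _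
  · have h' : 0 < nsq Ω u := lt_of_le_of_ne (nsq_nonneg _ _) (Ne.symm h)
    rw [← le_div_iff₀ h']
    exact csInf_le (lam1_bddBelow Ω B) ⟨u, cnear_of_contDiff hu, h, rfl⟩

lemma fderiv_const_smul_plane {u : Plane → ℂ} (hu : ContDiff ℝ 1 u) (c : ℂ) (x v : Plane) :
    fderiv ℝ (fun y => c * u y) x v = c * fderiv ℝ u x v := by
  have hd : DifferentiableAt ℝ u x := (hu.differentiable (by norm_num)) x
  rw [fderiv_const_mul hd]; simp

lemma magSq_const_mul {u : Plane → ℂ} (hu : ContDiff ℝ 1 u) (B : ℝ) (c : ℂ) (x : Plane) :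
    magSq B F0 (fun y => c * u y) x = ‖c‖ ^ 2 * magSq B F0 u x := by
  simp only [magSq, fderiv_const_smul_plane hu]
  rw [mul_add, ← mul_pow, ← mul_pow, ← norm_mul, ← norm_mul]
  congr 3 <;> ring

lemma exists_near_min {Ω : Set Plane} (ho : IsOpen Ω) (hb : Bornology.IsBounded Ω)
    (hne : Ω.Nonempty) (B : ℝ) {ε : ℝ} (hε : 0 < ε) :
    ∃ u : Plane → ℂ, ContDiff ℝ 1 u ∧ nsq Ω u = 1 ∧ Qf Ω B u ≤ lam1 Ω B + ε := by
  have hvol : (volume Ω).toReal ≠ 0 := by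
    refine ENNReal.toReal_ne_zero.2 ⟨(ho.measure_pos _ hne).ne', hb.measure_lt_top.ne⟩
  have hn : { r : ℝ | ∃ u : Plane → ℂ, CNearCl 1 Ω u ∧ (∫ x in Ω, ‖u x‖ ^ 2) ≠ 0 ∧
    r = (∫ x in Ω, magSq B F0 u x) / (∫ x in Ω, ‖u x‖ ^ 2) }.Nonempty :=
    ⟨_, fun _ => 1, cnear_of_contDiff contDiff_const, by simpa [Measure.real] using hvol, rfl⟩
  obtain ⟨r, ⟨u, hu, hu0, rfl⟩, hr⟩ := Real.lt_sInf_add_pos hn hε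
  obtain ⟨v, hv, huv⟩ := exists_global hu
  obtain ⟨e1, e2⟩ := congr_on_open (B := B) ho huv
  change Qf Ω B u / nsq Ω u < lam1 Ω B + ε at hr
  have hu0' : nsq Ω u ≠ 0 := hu0
  rw [e1, e2] at hr
  rw [e2] at hu0'
  have hpos : 0 < nsq Ω v := lt_of_le_of_ne (nsq_nonneg _ _) (Ne.symm hu0')
  have hc : ‖((Real.sqrt (nsq Ω v))⁻¹ : ℂ)‖ ^ 2 = (nsq Ω v)⁻¹ := by
    rw [norm_inv, Complex.norm_real, Real.norm_of_nonneg (Real.sqrt_nonneg _), inv_pow,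
      Real.sq_sqrt hpos.le]
  refine ⟨fun x => ((Real.sqrt (nsq Ω v))⁻¹ : ℂ) * v x, contDiff_const.mul hv, ?_, ?_⟩
  · have : nsq Ω (fun x => ((Real.sqrt (nsq Ω v))⁻¹ : ℂ) * v x) = (nsq Ω v)⁻¹ * nsq Ω v := by
      rw [nsq, ← hc]
      simp only [norm_mul, mul_pow]
      rw [integral_const_mul, ← nsq]
    rw [this]; exact inv_mul_cancel₀ hu0'
  · have : Qf Ω B (fun x => ((Real.sqrt (nsq Ω v))⁻¹ : ℂ) * v x) = Qf Ω B v / nsq Ω v := by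
      rw [Qf]
      simp only [magSq_const_mul hv, hc]
      rw [integral_const_mul, ← Qf]; ring
    rw [this]; exact hr.le

lemma fderiv_mul_plane {u : Plane → ℂ} {w : Plane → ℝ} (hu : ContDiff ℝ 1 u) (hw : ContDiff ℝ 1 w)
    (x v : Plane) : fderiv ℝ (fun y => (w y : ℂ) * u y) x v =
      (w x : ℂ) * fderiv ℝ u x v + (fderiv ℝ w x v : ℝ) * u x := by
  have hd : HasFDerivAt u (fderiv ℝ u x) x := ((hu.differentiable (by norm_num)) x).hasFDerivAt
  have hw' : HasFDerivAt w (fderiv ℝ w x) x := ((hw.differentiable (by norm_num)) x).hasFDerivAt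
  have h2 : HasFDerivAt (fun y => (w y : ℂ)) (Complex.ofRealCLM ∘L fderiv ℝ w x) x :=
    Complex.ofRealCLM.hasFDerivAt.comp x hw'
  rw [(h2.fun_mul hd).fderiv]
  simp
  ring

lemma contDiff_ofReal {w : Plane → ℝ} {n : WithTop ℕ∞} (hw : ContDiff ℝ n w) :
    ContDiff ℝ n (fun y => (w y : ℂ)) := Complex.ofRealCLM.contDiff.comp hw

lemma Pv_mul {u : Plane → ℂ} {w : Plane → ℝ} (hu : ContDiff ℝ 1 u) (hw : ContDiff ℝ 1 w)
    (B : ℝ) (x v : Plane) : Pv B (fun y => (w y : ℂ) * u y) x v =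
      (w x : ℂ) * Pv B u x v + (-Complex.I) * (fderiv ℝ w x v : ℝ) * u x := by
  simp only [Pv, fderiv_mul_plane hu hw]; ring

lemma Pv_gauge {u : Plane → ℂ} {θ : Plane → ℝ} (hu : ContDiff ℝ 1 u) (hθ : ContDiff ℝ 1 θ)
    (B : ℝ) (x v : Plane) : Pv B (fun y => Complex.exp (θ y * Complex.I) * u y) x v =
      Complex.exp (θ x * Complex.I) * (Pv B u x v + (fderiv ℝ θ x v : ℝ) * u x) := by
  have hd : HasFDerivAt u (fderiv ℝ u x) x := ((hu.differentiable (by norm_num)) x).hasFDerivAt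
  have hw' : HasFDerivAt θ (fderiv ℝ θ x) x := ((hθ.differentiable (by norm_num)) x).hasFDerivAt
  have h2 : HasFDerivAt (fun y => (θ y : ℂ)) (Complex.ofRealCLM ∘L fderiv ℝ θ x) x :=
    Complex.ofRealCLM.hasFDerivAt.comp x hw'
  have h3 := (h2.mul_const Complex.I).cexp
  simp only [Pv]
  rw [(h3.fun_mul hd).fderiv]
  simp
  linear_combination (Complex.exp (θ x * Complex.I) * (fderiv ℝ θ x v : ℝ) * u x) * (-Complex.I_sq)

lemma contDiff_gauge {u : Plane → ℂ} {θ : Plane → ℝ} (hu : ContDiff ℝ 1 u) (hθ : ContDiff ℝ 1 θ) :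
    ContDiff ℝ 1 (fun y => Complex.exp (θ y * Complex.I) * u y) :=
  (((contDiff_ofReal hθ).mul contDiff_const).cexp).mul hu

lemma norm_sub_ofReal_mul_sq (z w : ℂ) (r : ℝ) :
    ‖z - r * w‖ ^ 2 = ‖z‖ ^ 2 - 2 * r * (z * (starRingEnd ℂ) w).re + r ^ 2 * ‖w‖ ^ 2 := by
  simp only [Complex.sq_norm, Complex.normSq_apply]
  simp
  ring

lemma Pv_add (B β : ℝ) (u : Plane → ℂ) (x v : Plane) :
    Pv (B + β) u x v = Pv B u x v - ((β * dot2 (F0 x) v : ℝ) : ℂ) * u x := by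
  simp only [Pv]; push_cast; ring

lemma magSq_convex_comb (B₁ B₂ a b : ℝ) (hab : a + b = 1) (u : Plane → ℂ) (x : Plane) :
    a * magSq B₁ F0 u x + b * magSq B₂ F0 u x = magSq (a * B₁ + b * B₂) F0 u x +
      a * b * (B₁ - B₂) ^ 2 * (esq (F0 x) * ‖u x‖ ^ 2) := by
  have e1 : B₁ = (a * B₁ + b * B₂) + b * (B₁ - B₂) := by linear_combination (-B₁) * hab
  have e2 : B₂ = (a * B₁ + b * B₂) + (- a * (B₁ - B₂)) := by linear_combination (-B₂) * hab
  have hb : b = 1 - a := by linarith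
  set Bm := a * B₁ + b * B₂
  have h1 : magSq B₁ F0 u x = magSq (Bm + b * (B₁ - B₂)) F0 u x := by rw [← e1]
  have h2 : magSq B₂ F0 u x = magSq (Bm + (- a * (B₁ - B₂))) F0 u x := by rw [← e2]
  rw [h1, h2]
  simp only [magSq_eq, P1, P2, Pv_add, norm_sub_ofReal_mul_sq]
  simp only [esq, dot2, hb]
  ring

lemma lam1_concave {Ω : Set Plane} (ho : IsOpen Ω) (hb : Bornology.IsBounded Ω)
    (hne : Ω.Nonempty) : ConcaveOn ℝ (Ioi 0)
      (fun B => lam1 Ω B - (sSup ((fun x => esq (F0 x)) '' closure Ω)) * B ^ 2) := by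
  refine ⟨convex_Ioi 0, fun B₁ _ B₂ _ a b ha hb' hab => ?_⟩
  simp only [smul_eq_mul]
  set M := sSup ((fun x => esq (F0 x)) '' closure Ω)
  have hcesq : Continuous fun x => esq (F0 x) := by
    have := continuous_F0; unfold esq; fun_prop
  have hM : ∀ x ∈ Ω, esq (F0 x) ≤ M := fun x hx =>
    le_csSup (hb.isCompact_closure.image hcesq).bddAbove ⟨x, subset_closure hx, rfl⟩
  have key : a * lam1 Ω B₁ + b * lam1 Ω B₂ ≤ lam1 Ω (a * B₁ + b * B₂) +
      a * b * (B₁ - B₂) ^ 2 * M := by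
    refine le_of_forall_pos_le_add fun ε hε => ?_
    obtain ⟨u, hu, hu1, hQ⟩ := exists_near_min ho hb hne (a * B₁ + b * B₂) hε
    have l1 := lam1_mul_le (Ω := Ω) B₁ hu
    have l2 := lam1_mul_le (Ω := Ω) B₂ hu
    rw [hu1, mul_one] at l1 l2
    have hu' := hu.continuous
    have i0 : IntegrableOn (fun x => esq (F0 x) * ‖u x‖ ^ 2) Ω :=
      integrableOn_of_continuous hb (by fun_prop)
    have I : a * Qf Ω B₁ u + b * Qf Ω B₂ u = Qf Ω (a * B₁ + b * B₂) u +
        a * b * (B₁ - B₂) ^ 2 * ∫ x in Ω, esq (F0 x) * ‖u x‖ ^ 2 := by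
      simp only [Qf]
      rw [← integral_const_mul, ← integral_const_mul, ← integral_const_mul, ← integral_add,
        ← integral_add]
      · simp only [magSq_convex_comb _ _ _ _ hab]
      · exact integrableOn_of_continuous hb (continuous_magSq hu)
      · exact i0.const_mul _
      · exact (integrableOn_of_continuous hb (continuous_magSq hu)).const_mul _
      · exact (integrableOn_of_continuous hb (continuous_magSq hu)).const_mul _
    have J : ∫ x in Ω, esq (F0 x) * ‖u x‖ ^ 2 ≤ M := by
      calc _ ≤ ∫ x in Ω, M * ‖u x‖ ^ 2 :=
            setIntegral_mono_on i0 (integrableOn_of_continuous hb (by fun_prop))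
              ho.measurableSet fun x hx => mul_le_mul_of_nonneg_right (hM x hx) (by positivity)
        _ = M := by rw [integral_const_mul]; change M * nsq Ω u = M; rw [hu1, mul_one]
    have J' := mul_le_mul_of_nonneg_left J (by positivity : 0 ≤ a * b * (B₁ - B₂) ^ 2)
    have := mul_le_mul_of_nonneg_left l1 ha
    have := mul_le_mul_of_nonneg_left l2 hb'
    linarith
  have e : b = 1 - a := by linarith
  subst e
  nlinarith

end SC

namespace SC

/-- Squared length of the gradient of a real function. -/
def gsq (W : Plane → ℝ) (x : Plane) : ℝ := fderiv ℝ W x (1, 0) ^ 2 + fderiv ℝ W x (0, 1) ^ 2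

lemma gsq_nonneg (W : Plane → ℝ) (x : Plane) : 0 ≤ gsq W x := by unfold gsq; positivity

lemma continuous_gsq {W : Plane → ℝ} (hW : ContDiff ℝ 1 W) : Continuous (gsq W) := by
  have := hW.continuous_fderiv (by norm_num)
  unfold gsq; fun_prop

lemma contDiff_wmul {u : Plane → ℂ} {w : Plane → ℝ} (hu : ContDiff ℝ 1 u) (hw : ContDiff ℝ 1 w) :
    ContDiff ℝ 1 (fun y => (w y : ℂ) * u y) := (contDiff_ofReal hw).mul hu

lemma fderiv_sq_plane {w : Plane → ℝ} (hw : ContDiff ℝ 1 w) (x v : Plane) :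
    fderiv ℝ (fun y => w y ^ 2) x v = 2 * w x * fderiv ℝ w x v := by
  have hw' : HasFDerivAt w (fderiv ℝ w x) x := ((hw.differentiable (by norm_num)) x).hasFDerivAt
  rw [(hw'.pow 2).fderiv]
  simp

lemma Pv_wmul_norm {u : Plane → ℂ} {w : Plane → ℝ} (hu : ContDiff ℝ 1 u) (hw : ContDiff ℝ 1 w)
    (B : ℝ) (x v : Plane) :
    (Pv B u x v * (starRingEnd ℂ) (Pv B (fun y => ((w y ^ 2 : ℝ) : ℂ) * u y) x v)).re =
      ‖Pv B (fun y => (w y : ℂ) * u y) x v‖ ^ 2 - (fderiv ℝ w x v) ^ 2 * ‖u x‖ ^ 2 := by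
  rw [Pv_mul hu hw, Pv_mul hu (hw.pow 2), fderiv_sq_plane hw]
  generalize Pv B u x v = p
  generalize u x = z
  generalize fderiv ℝ w x v = g
  simp only [Complex.sq_norm, Complex.normSq_apply]
  simp [pow_two]
  ring

lemma magSq_wmul_le {u : Plane → ℂ} {w : Plane → ℝ} (hu : ContDiff ℝ 1 u) (hw : ContDiff ℝ 1 w)
    (B : ℝ) (x : Plane) :
    magSq B F0 (fun y => (w y : ℂ) * u y) x ≤
      2 * (w x ^ 2 * magSq B F0 u x) + 2 * (gsq w x * ‖u x‖ ^ 2) := by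
  have key : ∀ v, ‖Pv B (fun y => (w y : ℂ) * u y) x v‖ ^ 2 ≤
      2 * (w x ^ 2 * ‖Pv B u x v‖ ^ 2) + 2 * ((fderiv ℝ w x v) ^ 2 * ‖u x‖ ^ 2) := by
    intro v
    rw [Pv_mul hu hw]
    have := norm_add_le ((w x : ℂ) * Pv B u x v) ((-Complex.I) * (fderiv ℝ w x v : ℝ) * u x)
    have e1 : ‖(w x : ℂ) * Pv B u x v‖ = |w x| * ‖Pv B u x v‖ := by simp
    have e2 : ‖(-Complex.I) * (fderiv ℝ w x v : ℝ) * u x‖ = |fderiv ℝ w x v| * ‖u x‖ := by simp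
    rw [e1, e2] at this
    have h3 := pow_le_pow_left₀ (norm_nonneg _) this 2
    refine h3.trans ?_
    rw [← sq_abs (w x), ← sq_abs (fderiv ℝ w x v)]
    nlinarith [sq_nonneg (|w x| * ‖Pv B u x v‖ - |fderiv ℝ w x v| * ‖u x‖)]
  have h1 := key (1, 0)
  have h2 := key (0, 1)
  simp only [magSq_eq, P1, P2, gsq]
  nlinarith

lemma Pv_sub_smul {u v : Plane → ℂ} (hu : ContDiff ℝ 1 u) (hv : ContDiff ℝ 1 v) (B τ : ℝ)
    (x e : Plane) : Pv B (fun y => u y - τ * v y) x e = Pv B u x e - τ * Pv B v x e := by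
  have hd : HasFDerivAt u (fderiv ℝ u x) x := ((hu.differentiable (by norm_num)) x).hasFDerivAt
  have hd' : HasFDerivAt v (fderiv ℝ v x) x := ((hv.differentiable (by norm_num)) x).hasFDerivAt
  simp only [Pv]
  rw [(hd.fun_sub (hd'.const_mul (τ : ℂ))).fderiv]
  simp; ring

/-- Localization formula for near-minimizers. -/
lemma ims {Ω : Set Plane} (ho : IsOpen Ω) (hb : Bornology.IsBounded Ω) {W : Plane → ℝ}
    (hW : ContDiff ℝ 1 W) : ∃ C ≥ 0, ∀ (B ε : ℝ) (ψ : Plane → ℂ), 0 < ε → ε ≤ 1 →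
      ContDiff ℝ 1 ψ → nsq Ω ψ = 1 → Qf Ω B ψ ≤ lam1 Ω B + ε →
      Qf Ω B (fun x => (W x : ℂ) * ψ x) ≤ lam1 Ω B * nsq Ω (fun x => (W x : ℂ) * ψ x) +
        (∫ x in Ω, gsq W x * ‖ψ x‖ ^ 2) + C * (Real.sqrt ε * (lam1 Ω B + 1)) := by
  have hW2 : ContDiff ℝ 1 (fun x => W x ^ 2) := hW.pow 2
  obtain ⟨c1, hc1⟩ := hb.isCompact_closure.bddAbove_image (hW2.continuous.pow 2).continuousOn
  obtain ⟨c2, hc2⟩ := hb.isCompact_closure.bddAbove_image (continuous_gsq hW2).continuousOn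
  set c := max (max c1 c2) 1
  have hcpos : 1 ≤ c := le_max_right _ _
  have b1 : ∀ x ∈ Ω, (W x ^ 2) ^ 2 ≤ c := fun x hx =>
    (hc1 ⟨x, subset_closure hx, rfl⟩).trans ((le_max_left _ _).trans (le_max_left _ _))
  have b2 : ∀ x ∈ Ω, gsq (fun x => W x ^ 2) x ≤ c := fun x hx =>
    (hc2 ⟨x, subset_closure hx, rfl⟩).trans ((le_max_right _ _).trans (le_max_left _ _))
  refine ⟨2 * c + 1, by linarith, fun B ε ψ hε hε1 hψ hn hQ => ?_⟩
  have hu := contDiff_wmul hψ hW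
  have hv := contDiff_wmul hψ hW2
  set τ := Real.sqrt ε with hτ
  have hτ0 : 0 < τ := Real.sqrt_pos.2 hε
  have hτ2 : τ ^ 2 = ε := Real.sq_sqrt hε.le
  have cψ := hψ.continuous
  have cW := hW.continuous
  have cg := continuous_gsq hW
  have cg2 := continuous_gsq hW2
  have cm := continuous_magSq (B := B) hψ
  have cmu := continuous_magSq (B := B) hu
  have cmv := continuous_magSq (B := B) hv
  have I := fun {f : Plane → ℝ} (hf : Continuous f) => integrableOn_of_continuous hb hf
  have key := lam1_mul_le (Ω := Ω) B (u := fun y => ψ y - τ * (((W y ^ 2 : ℝ) : ℂ) * ψ y))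
    (hψ.sub (contDiff_const.mul hv))
  have eQ : Qf Ω B (fun y => ψ y - τ * (((W y ^ 2 : ℝ) : ℂ) * ψ y)) = Qf Ω B ψ -
      2 * τ * (Qf Ω B (fun x => (W x : ℂ) * ψ x) - ∫ x in Ω, gsq W x * ‖ψ x‖ ^ 2) +
      τ ^ 2 * Qf Ω B (fun y => ((W y ^ 2 : ℝ) : ℂ) * ψ y) := by
    simp only [Qf]
    rw [← integral_sub (I cmu) (I (by fun_prop)), ← integral_const_mul, ← integral_const_mul,
      ← integral_sub (I cm) (I (by fun_prop)),
      ← integral_add (I (by fun_prop)) (I (by fun_prop))]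
    refine integral_congr_ae (Eventually.of_forall fun x => ?_)
    simp only [magSq_eq, P1, P2, Pv_sub_smul hψ hv, norm_sub_ofReal_mul_sq, Pv_wmul_norm hψ hW, gsq]
    ring
  have eN : nsq Ω (fun y => ψ y - τ * (((W y ^ 2 : ℝ) : ℂ) * ψ y)) = nsq Ω ψ -
      2 * τ * nsq Ω (fun x => (W x : ℂ) * ψ x) +
      τ ^ 2 * nsq Ω (fun y => ((W y ^ 2 : ℝ) : ℂ) * ψ y) := by
    simp only [nsq]
    rw [← integral_const_mul, ← integral_const_mul,
      ← integral_sub (I (by fun_prop)) (I (by fun_prop)),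
      ← integral_add (I (by fun_prop)) (I (by fun_prop))]
    refine integral_congr_ae (Eventually.of_forall fun x => ?_)
    simp only [norm_sub_ofReal_mul_sq]
    have : (ψ x * (starRingEnd ℂ) (((W x ^ 2 : ℝ) : ℂ) * ψ x)).re = ‖(W x : ℂ) * ψ x‖ ^ 2 := by
      simp only [Complex.sq_norm, Complex.normSq_apply]
      simp [pow_two]
      ring
    rw [this]
  have hQv : Qf Ω B (fun y => ((W y ^ 2 : ℝ) : ℂ) * ψ y) ≤ 2 * c * Qf Ω B ψ + 2 * c * nsq Ω ψ := by
    simp only [Qf, nsq]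
    rw [← integral_const_mul, ← integral_const_mul,
      ← integral_add (I (by fun_prop)) (I (by fun_prop))]
    refine setIntegral_mono_on (I cmv) (I (by fun_prop)) ho.measurableSet fun x hx => ?_
    refine (magSq_wmul_le hψ hW2 B x).trans ?_
    have h1 := mul_le_mul_of_nonneg_right (b1 x hx) (magSq_nonneg B F0 ψ x)
    have h2 := mul_le_mul_of_nonneg_right (b2 x hx) (sq_nonneg ‖ψ x‖)
    linarith
  rw [eQ, eN, hn] at key
  rw [hn] at hQv
  have hl := lam1_nonneg Ω B
  have hnv := nsq_nonneg Ω (fun y => ((W y ^ 2 : ℝ) : ℂ) * ψ y)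
  set N := nsq Ω (fun x => (W x : ℂ) * ψ x)
  set R := Qf Ω B (fun x => (W x : ℂ) * ψ x) - ∫ x in Ω, gsq W x * ‖ψ x‖ ^ 2 with hR
  have h1 : 2 * τ * R ≤ 2 * τ * (lam1 Ω B * N) + τ ^ 2 + τ ^ 2 * (2 * c * (lam1 Ω B + 2)) := by
    have : τ ^ 2 * Qf Ω B (fun y => ((W y ^ 2 : ℝ) : ℂ) * ψ y) ≤
        τ ^ 2 * (2 * c * (lam1 Ω B + 2)) := by
      refine mul_le_mul_of_nonneg_left (hQv.trans ?_) (sq_nonneg τ)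
      nlinarith
    have := mul_nonneg hl (mul_nonneg (sq_nonneg τ) hnv)
    nlinarith
  have h2 : 2 * R ≤ 2 * (lam1 Ω B * N) + τ + τ * (2 * c * (lam1 Ω B + 2)) := by
    have := le_of_mul_le_mul_left (a := τ)
      (show τ * (2 * R) ≤ τ * (2 * (lam1 Ω B * N) + τ + τ * (2 * c * (lam1 Ω B + 2))) by
        nlinarith) hτ0
    exact this
  have h3 : 0 ≤ τ * (c * lam1 Ω B) := by positivity
  have h4 : 0 ≤ τ * lam1 Ω B := by positivity
  nlinarith

/-- A quadratic upper bound for the ground state energy coming from a change of gauge. -/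
lemma lam1_quadratic_upper {Ω : Set Plane} (hb : Bornology.IsBounded Ω)
    {φ : Plane → ℝ} (hφ : ContDiff ℝ 2 φ) {B K η : ℝ} {ψ : Plane → ℂ} (hψ : ContDiff ℝ 1 ψ)
    (hn : nsq Ω ψ = 1) (hQ : Qf Ω B ψ ≤ lam1 Ω B + η)
    (hA : ∫ x in Ω, (((F0 x).1 - fderiv ℝ φ x (1, 0)) ^ 2 + ((F0 x).2 - fderiv ℝ φ x (0, 1)) ^ 2)
      * ‖ψ x‖ ^ 2 ≤ K) :
    ∃ D, ∀ β, lam1 Ω (B + β) ≤ lam1 Ω B + η + β * D + β ^ 2 * K := by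
  have hφ1 : ContDiff ℝ 1 φ := hφ.of_le (by norm_num)
  have cdφ := hφ1.continuous_fderiv (by norm_num)
  have cψ := hψ.continuous
  have cF := continuous_F0
  have c1 := continuous_P1 (B := B) hψ
  have c2 := continuous_P2 (B := B) hψ
  have cm := continuous_magSq (B := B) hψ
  have I := fun {f : Plane → ℝ} (hf : Continuous f) => integrableOn_of_continuous hb hf
  set D1 : Plane → ℝ := fun x => -2 * (((F0 x).1 - fderiv ℝ φ x (1, 0)) *
    (P1 B ψ x * (starRingEnd ℂ) (ψ x)).re + ((F0 x).2 - fderiv ℝ φ x (0, 1)) *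
    (P2 B ψ x * (starRingEnd ℂ) (ψ x)).re) with hD1
  have cre : Continuous Complex.re := Complex.continuous_re
  have cst : Continuous (starRingEnd ℂ) := Complex.continuous_conj
  have cD1 : Continuous D1 := by
    have a1 : Continuous fun x => (P1 B ψ x * (starRingEnd ℂ) (ψ x)).re :=
      cre.comp (c1.mul (cst.comp cψ))
    have a2 : Continuous fun x => (P2 B ψ x * (starRingEnd ℂ) (ψ x)).re :=
      cre.comp (c2.mul (cst.comp cψ))
    fun_prop
  refine ⟨∫ x in Ω, D1 x, fun β => ?_⟩
  set θ : Plane → ℝ := fun x => β * φ x with hθ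
  have hθ1 : ContDiff ℝ 1 θ := contDiff_const.mul hφ1
  have hdθ : ∀ x v, fderiv ℝ θ x v = β * fderiv ℝ φ x v := fun x v => by
    rw [hθ, fderiv_const_mul ((hφ1.differentiable (by norm_num)) x)]; simp
  have key := lam1_mul_le (Ω := Ω) (B + β) (contDiff_gauge hψ hθ1)
  have hexp : ∀ x, ‖Complex.exp (θ x * Complex.I)‖ = 1 := fun x =>
    Complex.norm_exp_ofReal_mul_I _
  have en : nsq Ω (fun y => Complex.exp (θ y * Complex.I) * ψ y) = 1 := by
    rw [← hn]; simp only [nsq, norm_mul, hexp, one_mul]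
  have eQ : Qf Ω (B + β) (fun y => Complex.exp (θ y * Complex.I) * ψ y) = Qf Ω B ψ +
      β * (∫ x in Ω, D1 x) + β ^ 2 * ∫ x in Ω, (((F0 x).1 - fderiv ℝ φ x (1, 0)) ^ 2 +
        ((F0 x).2 - fderiv ℝ φ x (0, 1)) ^ 2) * ‖ψ x‖ ^ 2 := by
    simp only [Qf]
    rw [← integral_const_mul, ← integral_const_mul, ← integral_add (I cm) (I (by fun_prop)),
      ← integral_add (I (by fun_prop)) (I (by fun_prop))]
    refine integral_congr_ae (Eventually.of_forall fun x => ?_)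
    have hp : ∀ v, ‖Pv (B + β) (fun y => Complex.exp (θ y * Complex.I) * ψ y) x v‖ ^ 2 =
        ‖Pv B ψ x v - ((β * (dot2 (F0 x) v - fderiv ℝ φ x v) : ℝ) : ℂ) * ψ x‖ ^ 2 := by
      intro v
      rw [Pv_gauge hψ hθ1, norm_mul, hexp, one_mul, hdθ, Pv_add]
      congr 2; push_cast; ring
    simp only [magSq_eq, P1, P2, hp, norm_sub_ofReal_mul_sq, hD1, dot2]
    ring
  rw [en, mul_one, eQ] at key
  have := mul_le_mul_of_nonneg_left hA (sq_nonneg β)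
  linarith

end SC

namespace SC

lemma hasDerivAt_of_contDiff_one {E : Type*} [NormedAddCommGroup E] [NormedSpace ℝ E] {v : ℝ → E}
    (hv : ContDiff ℝ 1 v) (τ : ℝ) : HasDerivAt v (deriv v τ) τ :=
  ((hv.differentiable (by norm_num)) τ).hasDerivAt

lemma continuous_deriv_of_contDiff_one {E : Type*} [NormedAddCommGroup E] [NormedSpace ℝ E]
    {v : ℝ → E} (hv : ContDiff ℝ 1 v) : Continuous (deriv v) := hv.continuous_deriv (by norm_num)

lemma riccati_general {v : ℝ → ℂ} (hv : ContDiff ℝ 1 v) {p p' q : ℝ → ℝ} {a b : ℝ} (hab : a ≤ b)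
    (hp : ∀ τ, HasDerivAt p (p' τ) τ) (hp' : Continuous p') (hq : Continuous q) :
    (∫ τ in a..b, (q τ + p' τ - p τ ^ 2) * ‖v τ‖ ^ 2) + p a * ‖v a‖ ^ 2 - p b * ‖v b‖ ^ 2 ≤
      ∫ τ in a..b, (‖deriv v τ‖ ^ 2 + q τ * ‖v τ‖ ^ 2) := by
  have cv := hv.continuous
  have cd := continuous_deriv_of_contDiff_one hv
  have cp : Continuous p := continuous_iff_continuousAt.2 fun τ => (hp τ).continuousAt
  have hder : ∀ τ, HasDerivAt (fun τ => p τ * ‖v τ‖ ^ 2)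
      (p' τ * ‖v τ‖ ^ 2 + p τ * (2 * inner ℝ (v τ) (deriv v τ))) τ := fun τ =>
    (hp τ).mul (hasDerivAt_of_contDiff_one hv τ).norm_sq
  have ftc := intervalIntegral.integral_eq_sub_of_hasDerivAt (a := a) (b := b)
    (fun τ _ => hder τ) ((by fun_prop : Continuous fun τ =>
      p' τ * ‖v τ‖ ^ 2 + p τ * (2 * inner ℝ (v τ) (deriv v τ))).intervalIntegrable _ _)
  have hpos : 0 ≤ ∫ τ in a..b, ‖deriv v τ + p τ • v τ‖ ^ 2 :=
    intervalIntegral.integral_nonneg hab fun τ _ => by positivity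
  have e : ∫ τ in a..b, (‖deriv v τ‖ ^ 2 + q τ * ‖v τ‖ ^ 2) =
      (∫ τ in a..b, ‖deriv v τ + p τ • v τ‖ ^ 2) +
      (∫ τ in a..b, (q τ + p' τ - p τ ^ 2) * ‖v τ‖ ^ 2) -
      ∫ τ in a..b, (p' τ * ‖v τ‖ ^ 2 + p τ * (2 * inner ℝ (v τ) (deriv v τ))) := by
    rw [← intervalIntegral.integral_add, ← intervalIntegral.integral_sub]
    · refine intervalIntegral.integral_congr fun τ _ => ?_
      simp only [norm_add_sq_real, norm_smul, inner_smul_right, real_inner_comm (v τ) (deriv v τ),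
        mul_pow, Real.norm_eq_abs, sq_abs]
      ring
    all_goals exact Continuous.intervalIntegrable (by fun_prop) _ _
  rw [e, ftc]
  linarith

lemma riccati {v : ℝ → ℂ} (hv : ContDiff ℝ 1 v) {T : ℝ} (hT : 0 ≤ T) (hvT : v T = 0)
    {p p' q : ℝ → ℝ}
    (hp : ∀ τ, HasDerivAt p (p' τ) τ) (hp' : Continuous p') (hq : Continuous q) :
    (∫ τ in 0..T, (q τ + p' τ - p τ ^ 2) * ‖v τ‖ ^ 2) + p 0 * ‖v 0‖ ^ 2 ≤
      ∫ τ in 0..T, (‖deriv v τ‖ ^ 2 + q τ * ‖v τ‖ ^ 2) := by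
  have := riccati_general hv hT hp hp' hq
  simpa [hvT] using this

/-- The de Gennes energy on `[0,T]`. -/
def en0 (T ζ : ℝ) (v : ℝ → ℂ) : ℝ := ∫ τ in 0..T, (‖deriv v τ‖ ^ 2 + (ζ + τ) ^ 2 * ‖v τ‖ ^ 2)

def mass (T : ℝ) (v : ℝ → ℂ) : ℝ := ∫ τ in 0..T, ‖v τ‖ ^ 2

lemma mass_nonneg {T : ℝ} (hT : 0 ≤ T) (v : ℝ → ℂ) : 0 ≤ mass T v :=
  intervalIntegral.integral_nonneg hT fun τ _ => by positivity

lemma en0_nonneg {T : ℝ} (hT : 0 ≤ T) (ζ : ℝ) (v : ℝ → ℂ) : 0 ≤ en0 T ζ v :=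
  intervalIntegral.integral_nonneg hT fun τ _ => by positivity

lemma en0_ge_boundary {v : ℝ → ℂ} (hv : ContDiff ℝ 1 v) {T : ℝ} (hT : 0 ≤ T) (hvT : v T = 0)
    (ζ : ℝ) : mass T v + ζ * ‖v 0‖ ^ 2 ≤ en0 T ζ v := by
  have := riccati hv hT hvT (p := fun τ => ζ + τ) (p' := fun _ => 1) (q := fun τ => (ζ + τ) ^ 2)
    (fun τ => by simpa using (hasDerivAt_id τ).const_add ζ) continuous_const (by fun_prop)
  simpa [mass, en0] using this

/-- Harmonic oscillator bound on an interval for functions vanishing at the end points. -/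
lemma harmonic_oscillator {v : ℝ → ℂ} (hv : ContDiff ℝ 1 v) {a b : ℝ} (hab : a ≤ b) (ha : v a = 0)
    (hb : v b = 0) {B : ℝ} (ω : ℝ) : B * (∫ τ in a..b, ‖v τ‖ ^ 2) ≤
      ∫ τ in a..b, (‖deriv v τ‖ ^ 2 + (ω + B * τ) ^ 2 * ‖v τ‖ ^ 2) := by
  have := riccati_general hv hab (p := fun τ => ω + B * τ) (p' := fun _ => B)
    (q := fun τ => (ω + B * τ) ^ 2)
    (fun τ => by simpa using ((hasDerivAt_id τ).const_mul B).const_add ω) continuous_const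
    (by fun_prop)
  simpa [ha, hb] using this

lemma hasDerivAt_max_sq (x : ℝ) :
    HasDerivAt (fun x : ℝ => (max 0 x) ^ 2) (2 * max 0 x) x := by
  rcases lt_trichotomy x 0 with h | h | h
  · rw [max_eq_left h.le]
    have : (fun x : ℝ => (max 0 x) ^ 2) =ᶠ[𝓝 x] fun _ => 0 := by
      filter_upwards [Iio_mem_nhds h] with y hy
      have hy' : y < 0 := hy
      simp [max_eq_left hy'.le]
    simpa using (hasDerivAt_const x (0 : ℝ)).congr_of_eventuallyEq this
  · subst h
    simp only [max_self, mul_zero]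
    rw [hasDerivAt_iff_isLittleO]
    simp only [max_self, sub_zero, smul_zero, ne_eq, OfNat.ofNat_ne_zero, not_false_eq_true,
      zero_pow]
    refine Asymptotics.IsBigO.trans_isLittleO (g := fun x : ℝ => x ^ 2) ?_
      (by simpa using Asymptotics.isLittleO_pow_pow (𝕜 := ℝ) (m := 1) (n := 2) (by norm_num))
    refine Asymptotics.IsBigO.of_bound 1 (Eventually.of_forall fun y => ?_)
    rw [one_mul, Real.norm_of_nonneg (sq_nonneg _), Real.norm_of_nonneg (sq_nonneg _)]
    rcases le_total 0 y with hy | hy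
    · rw [max_eq_right hy]
    · rw [max_eq_left hy]; nlinarith [sq_nonneg y]
  · rw [max_eq_right h.le]
    have : (fun x : ℝ => (max 0 x) ^ 2) =ᶠ[𝓝 x] fun x => x ^ 2 := by
      filter_upwards [Ioi_mem_nhds h] with y hy
      have hy' : 0 < y := hy
      simp [max_eq_right hy'.le]
    simpa using (hasDerivAt_pow 2 x).congr_of_eventuallyEq this

lemma en0_large_neg {v : ℝ → ℂ} (hv : ContDiff ℝ 1 v) {T : ℝ} (hT : 0 ≤ T) (hvT : v T = 0)
    {ζ : ℝ} (hζ : ζ < 0) (hζ2 : 8 ≤ ζ ^ 2) : (1 - 32 / ζ ^ 2) * mass T v ≤ en0 T ζ v := by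
  set h : ℝ → ℝ := fun τ => 1 - (max 0 (1 + 2 * τ / ζ)) ^ 2 with hh
  set h' : ℝ → ℝ := fun τ => - (2 * max 0 (1 + 2 * τ / ζ) * (2 / ζ)) with hh'
  have hd : ∀ τ, HasDerivAt h (h' τ) τ := fun τ => by
    have i : HasDerivAt (fun τ : ℝ => 1 + 2 * τ / ζ) (2 / ζ) τ := by
      simpa using (((hasDerivAt_id τ).const_mul 2).div_const ζ).const_add 1
    exact ((hasDerivAt_max_sq _).comp τ i).const_sub 1
  have key := riccati hv hT hvT (p := fun τ => (ζ + τ) * h τ)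
    (p' := fun τ => 1 * h τ + (ζ + τ) * h' τ)
    (q := fun τ => (ζ + τ) ^ 2)
    (fun τ => ((hasDerivAt_id τ).const_add ζ).mul (hd τ)) (by fun_prop) (by fun_prop)
  have h0 : h 0 = 0 := by simp [hh]
  simp only [h0, mul_zero, zero_mul, add_zero] at key
  refine le_trans ?_ key
  rw [mass, ← intervalIntegral.integral_const_mul]
  have cv := hv.continuous
  refine intervalIntegral.integral_mono_on hT (Continuous.intervalIntegrable (by fun_prop) _ _)
    (Continuous.intervalIntegrable (by fun_prop) _ _) fun τ hτ => ?_
  refine mul_le_mul_of_nonneg_right ?_ (by positivity)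
  have hτ0 : 0 ≤ τ := hτ.1
  have hζ0 : ζ ≠ 0 := hζ.ne
  have hζ2' : 0 < ζ ^ 2 := by positivity
  rcases le_total 0 (1 + 2 * τ / ζ) with hq | hq
  · simp only [hh, hh', max_eq_right hq]
    set q := 1 + 2 * τ / ζ with hqd
    have hτq : τ = (q - 1) * ζ / 2 := by rw [hqd]; field_simp; ring
    have hq1 : q ≤ 1 := by
      have : 2 * τ / ζ ≤ 0 := div_nonpos_of_nonneg_of_nonpos (by linarith) hζ.le
      linarith
    have e : (ζ + τ) * -(2 * q * (2 / ζ)) = - (2 * q * (1 + q)) := by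
      rw [hτq]; field_simp; ring
    have e2 : ζ + τ = ζ * ((1 + q) / 2) := by rw [hτq]; ring
    rw [e, e2]
    have e3 : 32 / ζ ^ 2 * ζ ^ 2 = 32 := by field_simp
    set Z := ζ ^ 2
    set R := 32 / Z
    have hR : 0 < R := by positivity
    have hR4 : R ≤ 4 := by rw [div_le_iff₀ (by positivity)]; linarith
    have hlow : Z / 4 * q ^ 2 ≤ Z * ((1 + q) / 2) ^ 2 * (1 - (1 - q ^ 2) ^ 2) := by
      have h1 : q ^ 2 ≤ 1 - (1 - q ^ 2) ^ 2 := by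
        have : 0 ≤ 1 - q ^ 2 := by nlinarith
        nlinarith [mul_nonneg (sq_nonneg q) this]
      have h2 : Z / 4 ≤ Z * ((1 + q) / 2) ^ 2 := by nlinarith [mul_nonneg hζ2'.le hq]
      exact mul_le_mul h2 h1 (sq_nonneg q) (by positivity)
    have : 0 ≤ R + (Z / 4 - 1) * q ^ 2 - 4 * q := by
      have hZ8 : 8 ≤ Z := hζ2
      nlinarith [sq_nonneg (R - 4 * q), sq_nonneg q, sq_nonneg (R/2 - 4 * q), mul_nonneg hR.le (sq_nonneg q)]
    have e4 : (ζ * ((1 + q) / 2)) ^ 2 = Z * ((1 + q) / 2) ^ 2 := by ring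
    have e5 : (ζ * ((1 + q) / 2) * (1 - q ^ 2)) ^ 2 = Z * ((1 + q) / 2) ^ 2 * (1 - q ^ 2) ^ 2 := by
      ring
    rw [e4, e5]
    nlinarith
  · simp only [hh, hh', max_eq_left hq]
    have : 0 ≤ 32 / ζ ^ 2 := by positivity
    ring_nf
    ring_nf at this
    linarith

end SC

namespace SC

lemma integral_Ioi_eq_interval {f : ℝ → ℝ} {T : ℝ} (hT : 0 ≤ T) (hf : ∀ τ, T < τ → f τ = 0) :
    ∫ τ in Ioi (0 : ℝ), f τ = ∫ τ in 0..T, f τ := by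
  rw [intervalIntegral.integral_of_le hT]
  refine (setIntegral_eq_of_subset_of_forall_sdiff_eq_zero measurableSet_Ioi
    Ioc_subset_Ioi_self fun τ hτ => hf τ ?_)
  by_contra h
  exact hτ.2 ⟨hτ.1, not_lt.1 h⟩

lemma deriv_eq_zero_of_zero_beyond {E : Type*} [NormedAddCommGroup E] [NormedSpace ℝ E]
    {v : ℝ → E} {T : ℝ} (hv : ∀ τ, T ≤ τ → v τ = 0) {τ : ℝ} (hτ : T < τ) : deriv v τ = 0 := by
  have : v =ᶠ[𝓝 τ] fun _ => 0 := by
    filter_upwards [Ioi_mem_nhds hτ] with y hy using hv y (le_of_lt hy)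
  rw [this.deriv_eq]; simp

lemma muGen_bddBelow (ζ : ℝ) : BddBelow { r : ℝ | ∃ φ : ℝ → ℝ, ContDiff ℝ 1 φ ∧ HasCompactSupport φ ∧
    (∃ τ, 0 < τ ∧ φ τ ≠ 0) ∧
    r = (∫ τ in Set.Ioi (0 : ℝ), ((deriv φ τ) ^ 2 + (τ + ζ) ^ 2 * (φ τ) ^ 2)) /
        (∫ τ in Set.Ioi (0 : ℝ), (φ τ) ^ 2) } := by
  refine ⟨0, ?_⟩
  rintro r ⟨φ, -, -, -, rfl⟩
  exact div_nonneg (integral_nonneg fun _ => by positivity) (integral_nonneg fun _ => by positivity)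

lemma muGen_nonneg (ζ : ℝ) : 0 ≤ muGen ζ := by
  refine Real.sInf_nonneg ?_
  rintro r ⟨φ, -, -, -, rfl⟩
  exact div_nonneg (integral_nonneg fun _ => by positivity) (integral_nonneg fun _ => by positivity)

lemma Theta0_le_muGen (ζ : ℝ) : Theta0 ≤ muGen ζ :=
  csInf_le ⟨0, by rintro _ ⟨ζ, rfl⟩; exact muGen_nonneg ζ⟩ ⟨ζ, rfl⟩

lemma theta_mul_le_real {φ : ℝ → ℝ} (hφ : ContDiff ℝ 1 φ) {T : ℝ} (hT : 0 ≤ T)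
    (hφT : ∀ τ, T ≤ τ → φ τ = 0) (ζ : ℝ) :
    Theta0 * (∫ τ in 0..T, φ τ ^ 2) ≤
      ∫ τ in 0..T, (deriv φ τ ^ 2 + (ζ + τ) ^ 2 * φ τ ^ 2) := by
  by_cases hne : ∃ τ, 0 < τ ∧ φ τ ≠ 0
  swap
  · push Not at hne
    have : ∫ τ in 0..T, φ τ ^ 2 = 0 := by
      rw [intervalIntegral.integral_of_le hT]
      exact setIntegral_eq_zero_of_forall_eq_zero fun τ hτ => by simp [hne τ hτ.1]
    rw [this, mul_zero]
    exact intervalIntegral.integral_nonneg hT fun τ _ => by positivity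
  obtain ⟨χ, hχ, h0, h1, -⟩ := exists_cutoff (E := ℝ) (K := Icc 0 T) (U := Ioo (-1) (T + 1))
    isClosed_Icc isOpen_Ioo (fun x hx => ⟨by linarith [hx.1], by linarith [hx.2]⟩)
  have hχ1 : ContDiff ℝ 1 χ := hχ.of_le (by exact_mod_cast le_top)
  set f : ℝ → ℝ := fun τ => χ τ * φ τ with hf
  have hfc : ContDiff ℝ 1 f := hχ1.mul hφ
  have hfs : HasCompactSupport f := by
    refine HasCompactSupport.of_support_subset_isCompact (isCompact_Icc (a := -1) (b := T + 1)) ?_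
    intro x hx
    by_contra h
    have : x ∈ (Ioo (-1) (T + 1))ᶜ := fun h' => h (Ioo_subset_Icc_self h')
    exact hx (by simp [hf, h0.self_of_nhdsSet x this])
  have hfφ : ∀ τ ∈ Icc 0 T, f τ = φ τ ∧ deriv f τ = deriv φ τ := by
    intro τ hτ
    have : ∀ᶠ x in 𝓝 τ, χ x = 1 := (eventually_nhdsSet_iff_forall.1 h1) τ hτ
    have e : f =ᶠ[𝓝 τ] φ := by filter_upwards [this] with x hx; simp [hf, hx]
    exact ⟨e.self_of_nhds, e.deriv_eq⟩
  have hfT : ∀ τ, T ≤ τ → f τ = 0 := fun τ h => by simp [hf, hφT τ h]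
  obtain ⟨τ₀, hτ₀, hn⟩ := hne
  have hτ₀T : τ₀ < T := by
    by_contra h; exact hn (hφT _ (not_lt.1 h))
  have mem : (∫ τ in Set.Ioi (0 : ℝ), ((deriv f τ) ^ 2 + (τ + ζ) ^ 2 * (f τ) ^ 2)) /
        (∫ τ in Set.Ioi (0 : ℝ), (f τ) ^ 2) ≥ Theta0 :=
    (Theta0_le_muGen ζ).trans (csInf_le (muGen_bddBelow ζ) ⟨f, hfc, hfs, ⟨τ₀, hτ₀, by
      rw [(hfφ τ₀ ⟨hτ₀.le, hτ₀T.le⟩).1]; exact hn⟩, rfl⟩)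
  rw [integral_Ioi_eq_interval hT (fun τ h => by
      simp [hfT τ h.le, deriv_eq_zero_of_zero_beyond hfT h]),
    integral_Ioi_eq_interval hT (fun τ h => by simp [hfT τ h.le])] at mem
  have e1 : ∫ τ in 0..T, f τ ^ 2 = ∫ τ in 0..T, φ τ ^ 2 :=
    intervalIntegral.integral_congr fun τ hτ => by
      rw [uIcc_of_le hT] at hτ; simp only [(hfφ τ hτ).1]
  have e2 : ∫ τ in 0..T, (deriv f τ ^ 2 + (τ + ζ) ^ 2 * f τ ^ 2) =
      ∫ τ in 0..T, (deriv φ τ ^ 2 + (ζ + τ) ^ 2 * φ τ ^ 2) :=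
    intervalIntegral.integral_congr fun τ hτ => by
      rw [uIcc_of_le hT] at hτ; simp only [(hfφ τ hτ).1, (hfφ τ hτ).2, add_comm τ ζ]
  rw [e1, e2] at mem
  have hnn : 0 ≤ ∫ τ in 0..T, φ τ ^ 2 :=
    intervalIntegral.integral_nonneg hT fun τ _ => by positivity
  rcases hnn.eq_or_lt with h | h
  · rw [← h, mul_zero]
    exact intervalIntegral.integral_nonneg hT fun τ _ => by positivity
  · exact (le_div_iff₀ h).1 mem

lemma theta_mul_le {v : ℝ → ℂ} (hv : ContDiff ℝ 1 v) {T : ℝ} (hT : 0 ≤ T)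
    (hvT : ∀ τ, T ≤ τ → v τ = 0) (ζ : ℝ) : Theta0 * mass T v ≤ en0 T ζ v := by
  have hre : ContDiff ℝ 1 (fun τ => (v τ).re) := Complex.reCLM.contDiff.comp hv
  have him : ContDiff ℝ 1 (fun τ => (v τ).im) := Complex.imCLM.contDiff.comp hv
  have h1 := theta_mul_le_real hre hT (fun τ h => by simp [hvT τ h]) ζ
  have h2 := theta_mul_le_real him hT (fun τ h => by simp [hvT τ h]) ζ
  have d1 : ∀ τ, deriv (fun τ => (v τ).re) τ = (deriv v τ).re := fun τ =>
    (Complex.reCLM.hasFDerivAt.comp_hasDerivAt τ (hasDerivAt_of_contDiff_one hv τ)).deriv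
  have d2 : ∀ τ, deriv (fun τ => (v τ).im) τ = (deriv v τ).im := fun τ =>
    (Complex.imCLM.hasFDerivAt.comp_hasDerivAt τ (hasDerivAt_of_contDiff_one hv τ)).deriv
  have cv := hv.continuous
  have cd := continuous_deriv_of_contDiff_one hv
  have c1 : Continuous fun τ => (v τ).re := hre.continuous
  have c2 : Continuous fun τ => (v τ).im := him.continuous
  have c3 : Continuous fun τ => (deriv v τ).re := Complex.continuous_re.comp cd
  have c4 : Continuous fun τ => (deriv v τ).im := Complex.continuous_im.comp cd
  simp only [d1, d2] at h1 h2
  have e1 : mass T v = (∫ τ in 0..T, (v τ).re ^ 2) + ∫ τ in 0..T, (v τ).im ^ 2 := by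
    rw [mass, ← intervalIntegral.integral_add (Continuous.intervalIntegrable (by fun_prop) _ _)
      (Continuous.intervalIntegrable (by fun_prop) _ _)]
    refine intervalIntegral.integral_congr fun τ _ => ?_
    simp only [Complex.sq_norm, Complex.normSq_apply]; ring
  have e2 : en0 T ζ v = (∫ τ in 0..T, ((deriv v τ).re ^ 2 + (ζ + τ) ^ 2 * (v τ).re ^ 2)) +
      ∫ τ in 0..T, ((deriv v τ).im ^ 2 + (ζ + τ) ^ 2 * (v τ).im ^ 2) := by
    rw [en0, ← intervalIntegral.integral_add (Continuous.intervalIntegrable (by fun_prop) _ _)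
      (Continuous.intervalIntegrable (by fun_prop) _ _)]
    refine intervalIntegral.integral_congr fun τ _ => ?_
    simp only [Complex.sq_norm, Complex.normSq_apply]; ring
  rw [e1, e2]; linarith

lemma exists_bump_half (T : ℝ) (hT : 0 < T) : ∃ φ : ℝ → ℝ, ContDiff ℝ 1 φ ∧ HasCompactSupport φ ∧
    ∃ τ, 0 < τ ∧ φ τ ≠ 0 := by
  obtain ⟨χ, hχ, h0, h1, -⟩ := exists_cutoff (E := ℝ) (K := Icc 0 T) (U := Ioo (-1) (T + 1))
    isClosed_Icc isOpen_Ioo (fun x hx => ⟨by linarith [hx.1], by linarith [hx.2]⟩)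
  refine ⟨χ, hχ.of_le (by exact_mod_cast le_top), ?_, T, hT, by
    simp [h1.self_of_nhdsSet T ⟨hT.le, le_rfl⟩]⟩
  refine HasCompactSupport.of_support_subset_isCompact (isCompact_Icc (a := -1) (b := T + 1)) ?_
  intro x hx
  by_contra h
  have : x ∈ (Ioo (-1) (T + 1))ᶜ := fun h' => h (Ioo_subset_Icc_self h')
  exact hx (by simp [h0.self_of_nhdsSet x this])

/-- Reduction of test functions in the definition of `muGen` to intervals. -/
lemma muGen_test {φ : ℝ → ℝ} (hφ : ContDiff ℝ 1 φ) (hs : HasCompactSupport φ)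
    (hne : ∃ τ, 0 < τ ∧ φ τ ≠ 0) (ζ : ℝ) : ∃ (T : ℝ) (v : ℝ → ℂ), 0 < T ∧ ContDiff ℝ 1 v ∧
      (∀ τ, T ≤ τ → v τ = 0) ∧ 0 < mass T v ∧
      (∫ τ in Set.Ioi (0 : ℝ), ((deriv φ τ) ^ 2 + (τ + ζ) ^ 2 * (φ τ) ^ 2)) = en0 T ζ v ∧
      (∫ τ in Set.Ioi (0 : ℝ), (φ τ) ^ 2) = mass T v := by
  obtain ⟨R, hR⟩ := hs.isCompact.isBounded.subset_closedBall 0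
  have hRφ : ∀ τ, |R| + 1 ≤ τ → φ τ = 0 := fun τ hτ => by
    by_contra h
    have h1 := hR (subset_tsupport _ h)
    rw [Metric.mem_closedBall, Real.dist_eq, sub_zero] at h1
    have := le_abs_self τ; have := le_abs_self R
    linarith
  have hT : 0 < |R| + 1 := by positivity
  have hv : ContDiff ℝ 1 (fun τ => (φ τ : ℂ)) := Complex.ofRealCLM.contDiff.comp hφ
  have hd : ∀ τ, deriv (fun τ => (φ τ : ℂ)) τ = (deriv φ τ : ℝ) := fun τ =>
    (Complex.ofRealCLM.hasFDerivAt.comp_hasDerivAt τ (hasDerivAt_of_contDiff_one hφ τ)).deriv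
  have e2 : (∫ τ in Set.Ioi (0 : ℝ), (φ τ) ^ 2) = mass (|R| + 1) (fun τ => (φ τ : ℂ)) := by
    rw [integral_Ioi_eq_interval hT.le (fun τ h => by simp [hRφ τ h.le])]
    simp [mass]
  refine ⟨|R| + 1, fun τ => (φ τ : ℂ), hT, hv, fun τ h => by simp [hRφ τ h], ?_, ?_, e2⟩
  · rw [mass]
    obtain ⟨τ₀, h0, hn⟩ := hne
    have cv := hv.continuous
    refine intervalIntegral.integral_pos hT (Continuous.continuousOn (by fun_prop))
      (fun _ _ => by positivity) ⟨τ₀, ⟨h0.le, ?_⟩, ?_⟩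
    · by_contra h
      exact hn (hRφ _ (not_le.1 h).le)
    · have : (φ τ₀ : ℂ) ≠ 0 := by exact_mod_cast hn
      positivity
  · rw [integral_Ioi_eq_interval hT.le (fun τ h => by
      simp [hRφ τ h.le, deriv_eq_zero_of_zero_beyond hRφ h])]
    simp only [en0, hd, Complex.norm_real, Real.norm_eq_abs, sq_abs, add_comm]

lemma exists_trial {ε : ℝ} (hε : 0 < ε) : ∃ (ζ T : ℝ) (v : ℝ → ℂ), 0 < T ∧ ContDiff ℝ 1 v ∧
    (∀ τ, T ≤ τ → v τ = 0) ∧ 0 < mass T v ∧ en0 T ζ v < (Theta0 + ε) * mass T v := by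
  obtain ⟨_, ⟨ζ, rfl⟩, hζ⟩ := exists_lt_of_csInf_lt (range_nonempty muGen)
    (show sInf (range muGen) < Theta0 + ε by simpa [Theta0] using hε)
  obtain ⟨φ₀, h1, h2, h3⟩ := exists_bump_half 1 one_pos
  have hne : { r : ℝ | ∃ φ : ℝ → ℝ, ContDiff ℝ 1 φ ∧ HasCompactSupport φ ∧
    (∃ τ, 0 < τ ∧ φ τ ≠ 0) ∧
    r = (∫ τ in Set.Ioi (0 : ℝ), ((deriv φ τ) ^ 2 + (τ + ζ) ^ 2 * (φ τ) ^ 2)) /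
        (∫ τ in Set.Ioi (0 : ℝ), (φ τ) ^ 2) }.Nonempty := ⟨_, φ₀, h1, h2, h3, rfl⟩
  obtain ⟨_, ⟨φ, hφ, hs, hn, rfl⟩, hr⟩ := exists_lt_of_csInf_lt hne hζ
  obtain ⟨T, v, hT, hv, hvT, hm, e1, e2⟩ := muGen_test hφ hs hn ζ
  refine ⟨ζ, T, v, hT, hv, hvT, hm, ?_⟩
  rw [e1, e2, div_lt_iff₀ hm] at hr
  exact hr

lemma Theta0_pos : 0 < Theta0 := by
  refine lt_of_lt_of_le (show (0 : ℝ) < 1 / 40 by norm_num) ?_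
  refine le_csInf (range_nonempty muGen) ?_
  rintro _ ⟨ζ, rfl⟩
  obtain ⟨φ₀, h1, h2, h3⟩ := exists_bump_half 1 one_pos
  refine le_csInf ⟨_, φ₀, h1, h2, h3, rfl⟩ ?_
  rintro _ ⟨φ, hφ, hs, hn, rfl⟩
  obtain ⟨T, v, hT, hv, hvT, hm, e1, e2⟩ := muGen_test hφ hs hn ζ
  rw [e1, e2, le_div_iff₀ hm]
  have key := riccati hv hT.le (hvT T le_rfl)
    (p := fun τ => (1 / 20) * (Real.arctan (ζ + τ) - Real.arctan ζ))
    (p' := fun τ => (1 / 20) * (1 / (1 + (ζ + τ) ^ 2)))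
    (q := fun τ => (ζ + τ) ^ 2)
    (fun τ => by
      have := (Real.hasDerivAt_arctan (ζ + τ)).comp τ ((hasDerivAt_id τ).const_add ζ)
      simpa using (this.sub_const (Real.arctan ζ)).const_mul (1 / 20 : ℝ))
    (by
      refine continuous_const.mul (continuous_const.div (by fun_prop) fun τ => ?_)
      positivity) (by fun_prop)
  simp only [add_zero, sub_self, mul_zero, zero_mul] at key
  refine le_trans ?_ key
  have cv := hv.continuous
  have ca : Continuous Real.arctan := Real.continuous_arctan
  rw [mass, ← intervalIntegral.integral_const_mul]
  have cp : Continuous fun τ => (1 / 20 : ℝ) * (1 / (1 + (ζ + τ) ^ 2)) := by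
    refine continuous_const.mul (continuous_const.div (by fun_prop) fun τ => ?_)
    positivity
  refine intervalIntegral.integral_mono_on hT.le (Continuous.intervalIntegrable (by fun_prop) _ _)
    (Continuous.intervalIntegrable (by fun_prop) _ _) fun τ hτ => ?_
  refine mul_le_mul_of_nonneg_right ?_ (by positivity)
  set x := ζ + τ
  have b1 := Real.arctan_lt_pi_div_two x
  have b2 := Real.neg_pi_div_two_lt_arctan x
  have b3 := Real.arctan_lt_pi_div_two ζ
  have b4 := Real.neg_pi_div_two_lt_arctan ζ
  have hpi := Real.pi_lt_d2
  have h3 : (Real.arctan x - Real.arctan ζ) ^ 2 ≤ 10 := by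
    have : |Real.arctan x - Real.arctan ζ| ≤ 3.15 := abs_le.2 ⟨by linarith, by linarith⟩
    calc _ = |Real.arctan x - Real.arctan ζ| ^ 2 := (sq_abs _).symm
      _ ≤ 3.15 ^ 2 := by gcongr
      _ ≤ 10 := by norm_num
  have h4 : 1 - x ^ 2 ≤ 1 / (1 + x ^ 2) := by
    rw [le_div_iff₀ (by positivity)]; nlinarith [sq_nonneg (x ^ 2)]
  nlinarith [sq_nonneg x]

lemma contDiff_max_sq : ContDiff ℝ 1 (fun x : ℝ => (max 0 x) ^ 2) := by
  rw [contDiff_one_iff_deriv]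
  refine ⟨fun x => (hasDerivAt_max_sq x).differentiableAt, ?_⟩
  rw [funext fun x => (hasDerivAt_max_sq x).deriv]
  fun_prop

lemma Theta0_lt_one : Theta0 < 1 := by
  set v : ℝ → ℂ := fun τ => (((max 0 (1 - τ / 4)) ^ 2 : ℝ) : ℂ) with hv
  have hφ : ContDiff ℝ 1 fun τ : ℝ => (max 0 (1 - τ / 4)) ^ 2 :=
    contDiff_max_sq.comp (contDiff_const.sub (contDiff_id.div_const 4))
  have hvc : ContDiff ℝ 1 v := Complex.ofRealCLM.contDiff.comp hφ
  have hd0 : ∀ τ, HasDerivAt (fun τ : ℝ => (max 0 (1 - τ / 4)) ^ 2)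
      (2 * max 0 (1 - τ / 4) * (-(1 / 4))) τ := fun τ => by
    have i : HasDerivAt (fun τ : ℝ => 1 - τ / 4) (-(1 / 4)) τ := by
      simpa using ((hasDerivAt_id τ).div_const 4).const_sub 1
    exact (hasDerivAt_max_sq _).comp τ i
  have hd : ∀ τ, deriv v τ = ((2 * max 0 (1 - τ / 4) * (-(1 / 4)) : ℝ) : ℂ) := fun τ =>
    (Complex.ofRealCLM.hasFDerivAt.comp_hasDerivAt τ (hd0 τ)).deriv
  have key := theta_mul_le hvc (T := 4) (by norm_num) (fun τ h => by
    simp only [hv]; rw [max_eq_left (by linarith)]; simp) (-2 / 3)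
  have hmax : ∀ τ ∈ uIcc (0 : ℝ) 4, max 0 (1 - τ / 4) = 1 - τ / 4 := fun τ h => by
    rw [uIcc_of_le (by norm_num)] at h
    exact max_eq_right (by linarith [h.2])
  have e1 : mass 4 v = 4 / 5 := by
    have : mass 4 v = ∫ τ in (0 : ℝ)..4, (1 - τ / 4) ^ 4 := by
      refine intervalIntegral.integral_congr fun τ h => ?_
      simp only [hv, hmax τ h, Complex.norm_real, Real.norm_eq_abs, sq_abs]; ring
    rw [this, intervalIntegral.integral_eq_sub_of_hasDerivAt
      (f := fun τ => -(4 / 5) * (1 - τ / 4) ^ 5) (fun τ _ => ?_)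
      (Continuous.intervalIntegrable (by fun_prop) _ _)]
    · norm_num
    · have i : HasDerivAt (fun τ : ℝ => 1 - τ / 4) (-(1 / 4)) τ := by
        simpa using ((hasDerivAt_id τ).div_const 4).const_sub 1
      exact ((i.pow 5).const_mul (-(4 / 5) : ℝ)).congr_deriv (by push_cast; ring)
  have e2 : en0 4 (-2 / 3) v = 37 / 63 := by
    have : en0 4 (-2 / 3) v = ∫ τ in (0 : ℝ)..4,
        ((1 - τ / 4) ^ 2 / 4 + (10 / 3 - 4 * (1 - τ / 4)) ^ 2 * (1 - τ / 4) ^ 4) := by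
      refine intervalIntegral.integral_congr fun τ h => ?_
      simp only [hd]
      simp only [hv, hmax τ h, Complex.norm_real, Real.norm_eq_abs, sq_abs]; ring
    rw [this, intervalIntegral.integral_eq_sub_of_hasDerivAt
      (f := fun τ => -4 * ((1 - τ / 4) ^ 3 / 12 + 100 / 45 * (1 - τ / 4) ^ 5
        - 80 / 18 * (1 - τ / 4) ^ 6 + 16 / 7 * (1 - τ / 4) ^ 7)) (fun τ _ => ?_)
      (Continuous.intervalIntegrable (by fun_prop) _ _)]
    · norm_num
    · have i : HasDerivAt (fun τ : ℝ => 1 - τ / 4) (-(1 / 4)) τ := by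
        simpa using ((hasDerivAt_id τ).div_const 4).const_sub 1
      exact ((((((i.pow 3).div_const 12).add ((i.pow 5).const_mul (100 / 45 : ℝ))).sub
        ((i.pow 6).const_mul (80 / 18 : ℝ))).add ((i.pow 7).const_mul (16 / 7 : ℝ))).const_mul
        (-4 : ℝ)).congr_deriv (by push_cast; ring)
  rw [e1, e2] at key
  linarith

end SC

namespace SC

/-- Parameters of the one-dimensional comparison. -/
structure Pt where
  κ : ℝ
  ζ : ℝ
  E : ℝ
  τ : ℝ

def Pt.Adm (K : ℝ) (p : Pt) : Prop := 0 ≤ p.κ ∧ p.κ ≤ 1 ∧ |p.ζ| ≤ K ∧ 0 ≤ p.E ∧ p.E ≤ 1 ∧ 0 ≤ p.τ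

/-- Polynomial growth in `τ`, uniformly in the other parameters. -/
def PolyBdd (K : ℝ) (f : Pt → ℝ) : Prop :=
  ∃ (C : ℝ) (m : ℕ), 0 ≤ C ∧ ∀ p, p.Adm K → |f p| ≤ C * (1 + p.τ) ^ m

lemma PolyBdd.add {K : ℝ} {f g : Pt → ℝ} (hf : PolyBdd K f) (hg : PolyBdd K g) :
    PolyBdd K (fun p => f p + g p) := by
  obtain ⟨C, m, hC, h⟩ := hf
  obtain ⟨C', m', hC', h'⟩ := hg
  refine ⟨C + C', m + m', by positivity, fun p hp => ?_⟩
  have h1 : (1 : ℝ) ≤ 1 + p.τ := by linarith [hp.2.2.2.2.2]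
  have e1 : (1 + p.τ) ^ m ≤ (1 + p.τ) ^ (m + m') := pow_le_pow_right₀ h1 (by omega)
  have e2 : (1 + p.τ) ^ m' ≤ (1 + p.τ) ^ (m + m') := pow_le_pow_right₀ h1 (by omega)
  calc |f p + g p| ≤ |f p| + |g p| := abs_add_le _ _
    _ ≤ C * (1 + p.τ) ^ m + C' * (1 + p.τ) ^ m' := add_le_add (h p hp) (h' p hp)
    _ ≤ C * (1 + p.τ) ^ (m + m') + C' * (1 + p.τ) ^ (m + m') := by gcongr
    _ = _ := by ring

lemma PolyBdd.mul {K : ℝ} {f g : Pt → ℝ} (hf : PolyBdd K f) (hg : PolyBdd K g) :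
    PolyBdd K (fun p => f p * g p) := by
  obtain ⟨C, m, hC, h⟩ := hf
  obtain ⟨C', m', hC', h'⟩ := hg
  refine ⟨C * C', m + m', by positivity, fun p hp => ?_⟩
  have h1 : 0 ≤ 1 + p.τ := by linarith [hp.2.2.2.2.2]
  calc |f p * g p| = |f p| * |g p| := abs_mul _ _
    _ ≤ (C * (1 + p.τ) ^ m) * (C' * (1 + p.τ) ^ m') :=
        mul_le_mul (h p hp) (h' p hp) (abs_nonneg _) (by positivity)
    _ = _ := by ring

lemma PolyBdd.const (K c : ℝ) : PolyBdd K (fun _ => c) :=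
  ⟨|c|, 0, abs_nonneg _, fun p _ => by simp⟩

lemma polyBdd_κ (K : ℝ) : PolyBdd K Pt.κ :=
  ⟨1, 0, zero_le_one, fun p hp => by rw [abs_of_nonneg hp.1]; simpa using hp.2.1⟩

lemma polyBdd_E (K : ℝ) : PolyBdd K Pt.E :=
  ⟨1, 0, zero_le_one, fun p hp => by rw [abs_of_nonneg hp.2.2.2.1]; simpa using hp.2.2.2.2.1⟩

lemma polyBdd_τ (K : ℝ) : PolyBdd K Pt.τ :=
  ⟨1, 1, zero_le_one, fun p hp => by rw [abs_of_nonneg hp.2.2.2.2.2]; simp⟩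

lemma polyBdd_ζ (K : ℝ) : PolyBdd K Pt.ζ :=
  ⟨|K|, 0, abs_nonneg _, fun p hp => by simpa using hp.2.2.1.trans (le_abs_self K)⟩

/-- Second-order expansion in `κ` with polynomially bounded coefficients. -/
def Jet (K : ℝ) (f f0 f1 : Pt → ℝ) : Prop :=
  PolyBdd K f0 ∧ PolyBdd K f1 ∧ ∃ r, PolyBdd K r ∧
    ∀ p, f p = f0 p + p.κ * f1 p + p.κ ^ 2 * r p

lemma Jet.of_polyBdd {K : ℝ} {f : Pt → ℝ} (hf : PolyBdd K f) : Jet K f f (fun _ => 0) :=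
  ⟨hf, PolyBdd.const K 0, fun _ => 0, PolyBdd.const K 0, fun p => by ring⟩

lemma Jet.const (K c : ℝ) : Jet K (fun _ => c) (fun _ => c) (fun _ => 0) :=
  Jet.of_polyBdd (PolyBdd.const K c)

lemma jet_κ (K : ℝ) : Jet K Pt.κ (fun _ => 0) (fun _ => 1) :=
  ⟨PolyBdd.const K 0, PolyBdd.const K 1, fun _ => 0, PolyBdd.const K 0, fun p => by ring⟩

lemma Jet.add {K : ℝ} {f f0 f1 g g0 g1 : Pt → ℝ} (hf : Jet K f f0 f1) (hg : Jet K g g0 g1) :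
    Jet K (fun p => f p + g p) (fun p => f0 p + g0 p) (fun p => f1 p + g1 p) := by
  obtain ⟨a, b, r, hr, h⟩ := hf
  obtain ⟨a', b', r', hr', h'⟩ := hg
  exact ⟨a.add a', b.add b', fun p => r p + r' p, hr.add hr', fun p => by simp only [h p, h' p]; ring⟩

lemma Jet.mul {K : ℝ} {f f0 f1 g g0 g1 : Pt → ℝ} (hf : Jet K f f0 f1) (hg : Jet K g g0 g1) :
    Jet K (fun p => f p * g p) (fun p => f0 p * g0 p) (fun p => f0 p * g1 p + f1 p * g0 p) := by
  obtain ⟨a, b, r, hr, h⟩ := hf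
  obtain ⟨a', b', r', hr', h'⟩ := hg
  have hκ := polyBdd_κ K
  refine ⟨a.mul a', (a.mul b').add (b.mul a'), fun p => (f0 p * r' p + f1 p * g1 p + r p * g0 p) +
    (p.κ * (f1 p * r' p + r p * g1 p) + p.κ * p.κ * (r p * r' p)), ?_, fun p => by simp only [h p, h' p]; ring⟩
  exact (((a.mul hr').add (b.mul b')).add (hr.mul a')).add
    ((hκ.mul ((b.mul hr').add (hr.mul b'))).add ((hκ.mul hκ).mul (hr.mul hr')))

lemma Jet.neg {K : ℝ} {f f0 f1 : Pt → ℝ} (hf : Jet K f f0 f1) :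
    Jet K (fun p => - f p) (fun p => - f0 p) (fun p => - f1 p) := by
  have := (Jet.const K (-1)).mul hf
  simpa using this

lemma Jet.sub {K : ℝ} {f f0 f1 g g0 g1 : Pt → ℝ} (hf : Jet K f f0 f1) (hg : Jet K g g0 g1) :
    Jet K (fun p => f p - g p) (fun p => f0 p - g0 p) (fun p => f1 p - g1 p) := by
  simpa [sub_eq_add_neg] using hf.add hg.neg

lemma Jet.sub_bound {K : ℝ} {f f0 f1 g g0 g1 : Pt → ℝ} (hf : Jet K f f0 f1) (hg : Jet K g g0 g1)
    (h0 : ∀ p, f0 p = g0 p) (h1 : ∀ p, f1 p = g1 p) :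
    ∃ (C : ℝ) (m : ℕ), 0 ≤ C ∧ ∀ p, p.Adm K → |f p - g p| ≤ C * p.κ ^ 2 * (1 + p.τ) ^ m := by
  obtain ⟨a, b, r, hr, h⟩ := hf
  obtain ⟨a', b', r', hr', h'⟩ := hg
  obtain ⟨C, m, hC, hb⟩ := hr.add ((PolyBdd.const K (-1)).mul hr')
  refine ⟨C, m, hC, fun p hp => ?_⟩
  have : f p - g p = p.κ ^ 2 * (r p + -1 * r' p) := by rw [h, h', h0, h1]; ring
  rw [this, abs_mul, abs_of_nonneg (sq_nonneg p.κ)]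
  calc _ ≤ p.κ ^ 2 * (C * (1 + p.τ) ^ m) := by gcongr; exact hb p hp
    _ = _ := by ring

/-- The change of variables used to compare two curvatures. -/
def yMap (σ ζ τ : ℝ) : ℝ := τ + σ * (τ ^ 2 * (1 / 6) + ζ * τ * (1 / 3))
def yMap' (σ ζ τ : ℝ) : ℝ := 1 + σ * (τ * (1 / 3) + ζ * (1 / 3))
def fMul (σ ζ τ : ℝ) : ℝ := 1 + σ * (τ * (1 / 3) - ζ * (1 / 6))
def zMap (σ ζ E : ℝ) : ℝ := ζ + σ * ((ζ * ζ - E) * (1 / 3))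

/-- Potential of the curved model operator. -/
def pot (κ ζ τ : ℝ) : ℝ :=
  (1 + κ * τ) * ((ζ + τ - κ * (τ * τ) * (1 / 2)) * (ζ + τ - κ * (τ * τ) * (1 / 2)))

section
variable (K k : ℝ)
lemma jet_lin : Jet K (fun p => p.κ * k) (fun _ => 0 * k) (fun _ => 0 * 0 + 1 * k) :=
  (jet_κ K).mul (Jet.const K k)
lemma jet_τ : Jet K Pt.τ Pt.τ (fun _ => 0) := Jet.of_polyBdd (polyBdd_τ K)
lemma jet_ζ : Jet K Pt.ζ Pt.ζ (fun _ => 0) := Jet.of_polyBdd (polyBdd_ζ K)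
lemma jet_E : Jet K Pt.E Pt.E (fun _ => 0) := Jet.of_polyBdd (polyBdd_E K)
end

lemma Jet.congr {K : ℝ} {f f0 f1 f0' f1' : Pt → ℝ} (hf : Jet K f f0 f1) (h0 : ∀ p, f0 p = f0' p)
    (h1 : ∀ p, f1 p = f1' p) : Jet K f f0' f1' := by
  rwa [← funext h0, ← funext h1]

lemma jet_lin' (K k : ℝ) : Jet K (fun p => p.κ * k) (fun _ => 0) (fun _ => k) :=
  (jet_lin K k).congr (fun p => by ring) (fun p => by ring)

lemma jet_yMap (K k : ℝ) : Jet K (fun p => yMap (p.κ * k) p.ζ p.τ) Pt.τ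
    (fun p => k * (p.τ ^ 2 * (1 / 6) + p.ζ * p.τ * (1 / 3))) := by
  have := (jet_τ K).add ((jet_lin' K k).mul ((((jet_τ K).mul (jet_τ K)).mul (Jet.const K (1/6))).add
    (((jet_ζ K).mul (jet_τ K)).mul (Jet.const K (1/3)))))
  simp only [← pow_two] at this
  exact this.congr (fun p => by ring) (fun p => by ring)

lemma jet_yMap' (K k : ℝ) : Jet K (fun p => yMap' (p.κ * k) p.ζ p.τ) (fun _ => 1)
    (fun p => k * (p.τ * (1 / 3) + p.ζ * (1 / 3))) :=
  ((Jet.const K 1).add ((jet_lin' K k).mul (((jet_τ K).mul (Jet.const K (1/3))).add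
    ((jet_ζ K).mul (Jet.const K (1/3)))))).congr (fun p => by ring) (fun p => by ring)

lemma jet_fMul (K k : ℝ) : Jet K (fun p => fMul (p.κ * k) p.ζ p.τ) (fun _ => 1)
    (fun p => k * (p.τ * (1 / 3) - p.ζ * (1 / 6))) :=
  ((Jet.const K 1).add ((jet_lin' K k).mul (((jet_τ K).mul (Jet.const K (1/3))).sub
    ((jet_ζ K).mul (Jet.const K (1/6)))))).congr (fun p => by ring) (fun p => by ring)

lemma jet_zMap (K k : ℝ) : Jet K (fun p => zMap (p.κ * k) p.ζ p.E) Pt.ζ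
    (fun p => k * ((p.ζ * p.ζ - p.E) * (1 / 3))) :=
  ((jet_ζ K).add ((jet_lin' K k).mul ((((jet_ζ K).mul (jet_ζ K)).sub (jet_E K)).mul
    (Jet.const K (1/3))))).congr (fun p => by ring) (fun p => by ring)

lemma jet_pot {K k : ℝ} {z z0 z1 t t0 t1 : Pt → ℝ} (hz : Jet K z z0 z1) (ht : Jet K t t0 t1) :
    Jet K (fun p => pot (p.κ * k) (z p) (t p)) (fun p => (z0 p + t0 p) ^ 2)
      (fun p => k * t0 p * (z0 p + t0 p) ^ 2 +
        2 * (z0 p + t0 p) * (z1 p + t1 p - k * t0 p ^ 2 * (1 / 2))) := by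
  have hx := (hz.add ht).sub (((jet_lin' K k).mul (ht.mul ht)).mul (Jet.const K (1/2)))
  exact (((Jet.const K 1).add ((jet_lin' K k).mul ht)).mul (hx.mul hx)).congr
    (fun p => by ring) (fun p => by ring)

lemma jet_one_sub {K k : ℝ} {t t0 t1 : Pt → ℝ} (ht : Jet K t t0 t1) :
    Jet K (fun p => 1 - p.κ * k * t p) (fun _ => 1) (fun p => - (k * t0 p)) :=
  ((Jet.const K 1).sub ((jet_lin' K k).mul ht)).congr (fun p => by ring) (fun p => by ring)

lemma coeff_deriv_bound (K k₁ k₂ : ℝ) : ∃ (C : ℝ) (m : ℕ), 0 ≤ C ∧ ∀ p : Pt, p.Adm K →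
    |(1 - p.κ * k₂ * p.τ) * (fMul (p.κ * (k₂ - k₁)) p.ζ p.τ * fMul (p.κ * (k₂ - k₁)) p.ζ p.τ) *
      (yMap' (p.κ * (k₂ - k₁)) p.ζ p.τ * yMap' (p.κ * (k₂ - k₁)) p.ζ p.τ) -
    (1 - p.κ * k₁ * yMap (p.κ * (k₂ - k₁)) p.ζ p.τ) * yMap' (p.κ * (k₂ - k₁)) p.ζ p.τ| ≤
      C * p.κ ^ 2 * (1 + p.τ) ^ m := by
  have hF := jet_fMul K (k₂ - k₁)
  have hy' := jet_yMap' K (k₂ - k₁)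
  exact (((jet_one_sub (jet_τ K)).mul (hF.mul hF)).mul (hy'.mul hy')).sub_bound
    ((jet_one_sub (jet_yMap K (k₂ - k₁))).mul hy') (fun p => by ring) (fun p => by ring)

lemma coeff_cross_bound (K k₁ k₂ : ℝ) : ∃ (C : ℝ) (m : ℕ), 0 ≤ C ∧ ∀ p : Pt, p.Adm K →
    |(1 - p.κ * k₂ * p.τ) * (fMul (p.κ * (k₂ - k₁)) p.ζ p.τ * (p.κ * (k₂ - k₁) * (2 / 3))) *
      yMap' (p.κ * (k₂ - k₁)) p.ζ p.τ -
    (p.κ * (k₂ - k₁) * (2 / 3)) * yMap' (p.κ * (k₂ - k₁)) p.ζ p.τ| ≤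
      C * p.κ ^ 2 * (1 + p.τ) ^ m := by
  have hF := jet_fMul K (k₂ - k₁)
  have hy' := jet_yMap' K (k₂ - k₁)
  have hσ := (jet_lin' K (k₂ - k₁)).mul (Jet.const K (2 / 3))
  exact (((jet_one_sub (jet_τ K)).mul (hF.mul hσ)).mul hy').sub_bound
    (hσ.mul hy') (fun p => by ring) (fun p => by ring)

lemma coeff_zero_bound (K k₁ k₂ : ℝ) : ∃ (C : ℝ) (m : ℕ), 0 ≤ C ∧ ∀ p : Pt, p.Adm K →
    |((1 - p.κ * k₂ * p.τ) * ((p.κ * (k₂ - k₁) * (1 / 3)) * (p.κ * (k₂ - k₁) * (1 / 3))) +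
      (pot (p.κ * k₂) (zMap (p.κ * (k₂ - k₁)) p.ζ p.E) p.τ - p.E * (1 - p.κ * k₂ * p.τ)) *
        (fMul (p.κ * (k₂ - k₁)) p.ζ p.τ * fMul (p.κ * (k₂ - k₁)) p.ζ p.τ)) -
    (pot (p.κ * k₁) p.ζ (yMap (p.κ * (k₂ - k₁)) p.ζ p.τ) -
      p.E * (1 - p.κ * k₁ * yMap (p.κ * (k₂ - k₁)) p.ζ p.τ)) * yMap' (p.κ * (k₂ - k₁)) p.ζ p.τ| ≤
      C * p.κ ^ 2 * (1 + p.τ) ^ m := by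
  have hF := jet_fMul K (k₂ - k₁)
  have hy' := jet_yMap' K (k₂ - k₁)
  have hy := jet_yMap K (k₂ - k₁)
  have hσ := (jet_lin' K (k₂ - k₁)).mul (Jet.const K (1 / 3))
  have h1 := (jet_one_sub (k := k₂) (jet_τ K))
  exact ((h1.mul (hσ.mul hσ)).add (((jet_pot (jet_zMap K (k₂ - k₁)) (jet_τ K)).sub
    ((jet_E K).mul h1)).mul (hF.mul hF))).sub_bound
    (((jet_pot (k := k₁) (jet_ζ K) hy).sub ((jet_E K).mul (jet_one_sub hy))).mul hy')
    (fun p => by ring) (fun p => by ring)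

end SC

namespace SC

/-- The energy of the curved model operator on `[0,T]`. -/
def nrg (T κ ζ : ℝ) (v : ℝ → ℂ) : ℝ :=
  ∫ τ in 0..T, ((1 - κ * τ) * ‖deriv v τ‖ ^ 2 + pot κ ζ τ * ‖v τ‖ ^ 2)

def dens (T κ : ℝ) (v : ℝ → ℂ) : ℝ := ∫ τ in 0..T, (1 - κ * τ) * ‖v τ‖ ^ 2

/-- Weighted energy with polynomial weight. -/
def wen (T : ℝ) (m : ℕ) (v : ℝ → ℂ) : ℝ :=
  ∫ τ in 0..T, (1 + τ) ^ m * (‖deriv v τ‖ ^ 2 + ‖v τ‖ ^ 2)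

def wenx (T ζ : ℝ) (m : ℕ) (v : ℝ → ℂ) : ℝ :=
  ∫ τ in 0..T, (1 + τ) ^ m * (‖deriv v τ‖ ^ 2 + ((ζ + τ) ^ 2 + 1) * ‖v τ‖ ^ 2)

lemma continuous_pot (κ ζ : ℝ) : Continuous (pot κ ζ) := by unfold pot; fun_prop

section
variable {v : ℝ → ℂ} (hv : ContDiff ℝ 1 v) {T : ℝ}
include hv

lemma wen_mono (hT : 0 ≤ T) {m n : ℕ} (h : m ≤ n) : wen T m v ≤ wen T n v := by
  have cv := hv.continuous
  have cd := continuous_deriv_of_contDiff_one hv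
  refine intervalIntegral.integral_mono_on hT (Continuous.intervalIntegrable (by fun_prop) _ _)
    (Continuous.intervalIntegrable (by fun_prop) _ _) fun τ hτ => ?_
  have h1 : (1 : ℝ) ≤ 1 + τ := by linarith [hτ.1]
  exact mul_le_mul_of_nonneg_right (pow_le_pow_right₀ h1 h) (by positivity)

lemma wenx_mono (hT : 0 ≤ T) (ζ : ℝ) {m n : ℕ} (h : m ≤ n) : wenx T ζ m v ≤ wenx T ζ n v := by
  have cv := hv.continuous
  have cd := continuous_deriv_of_contDiff_one hv
  refine intervalIntegral.integral_mono_on hT (Continuous.intervalIntegrable (by fun_prop) _ _)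
    (Continuous.intervalIntegrable (by fun_prop) _ _) fun τ hτ => ?_
  have h1 : (1 : ℝ) ≤ 1 + τ := by linarith [hτ.1]
  exact mul_le_mul_of_nonneg_right (pow_le_pow_right₀ h1 h) (by positivity)

lemma wen_le_wenx (hT : 0 ≤ T) (ζ : ℝ) (m : ℕ) : wen T m v ≤ wenx T ζ m v := by
  have cv := hv.continuous
  have cd := continuous_deriv_of_contDiff_one hv
  refine intervalIntegral.integral_mono_on hT (Continuous.intervalIntegrable (by fun_prop) _ _)
    (Continuous.intervalIntegrable (by fun_prop) _ _) fun τ hτ => ?_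
  have h1 : (0 : ℝ) ≤ 1 + τ := by linarith [hτ.1]
  gcongr
  nlinarith [sq_nonneg ((ζ + τ) * ‖v τ‖)]

end

lemma wenx_nonneg {T : ℝ} (hT : 0 ≤ T) (ζ : ℝ) (m : ℕ) (v : ℝ → ℂ) : 0 ≤ wenx T ζ m v :=
  intervalIntegral.integral_nonneg hT fun τ hτ => by
    have h1 : (0 : ℝ) ≤ 1 + τ := by linarith [hτ.1]
    positivity

lemma deriv_eq_zero_of_zero_beyond' {v : ℝ → ℂ} (hv : ContDiff ℝ 1 v) {T : ℝ}
    (hvT : ∀ τ, T ≤ τ → v τ = 0) {τ : ℝ} (hτ : T ≤ τ) : deriv v τ = 0 := by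
  have hc : IsClosed {τ | deriv v τ = 0} :=
    isClosed_eq (continuous_deriv_of_contDiff_one hv) continuous_const
  have := hc.closure_subset_iff.2 (fun x hx => deriv_eq_zero_of_zero_beyond hvT hx : Ioi T ⊆ _)
  rw [closure_Ioi] at this
  exact this hτ

lemma hasDerivAt_yMap (σ ζ τ : ℝ) : HasDerivAt (yMap σ ζ) (yMap' σ ζ τ) τ := by
  have h := ((hasDerivAt_id τ).add ((((hasDerivAt_pow 2 τ).mul_const (1 / 6)).add
    (((hasDerivAt_id τ).const_mul ζ).mul_const (1 / 3))).const_mul σ))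
  exact h.congr_deriv (by simp only [yMap']; push_cast; ring)

lemma hasDerivAt_fMul (σ ζ τ : ℝ) : HasDerivAt (fMul σ ζ) (σ * (1 / 3)) τ := by
  have h := ((((hasDerivAt_id τ).mul_const (1 / 3)).sub_const (ζ * (1 / 6))).const_mul σ).const_add 1
  exact h.congr_deriv (by simp)

/-- Integrals over the stretched interval. -/
lemma integral_comp_yMap {σ ζ T : ℝ} (hσ : 0 ≤ σ) (hσζ : σ * |ζ| ≤ 1) (hT : 0 ≤ T) {g : ℝ → ℝ}
    (hg : Continuous g) (hgT : ∀ τ, T ≤ τ → g τ = 0) :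
    ∫ τ in 0..(2 * T), g (yMap σ ζ τ) * yMap' σ ζ τ = ∫ τ in 0..T, g τ := by
  have h := intervalIntegral.integral_comp_mul_deriv (a := 0) (b := 2 * T) (f := yMap σ ζ)
    (f' := yMap' σ ζ) (g := g) (fun τ _ => hasDerivAt_yMap σ ζ τ)
    (by unfold yMap'; fun_prop) hg
  simp only [Function.comp] at h
  rw [h]
  have h0 : yMap σ ζ 0 = 0 := by simp [yMap]
  have h1 : T ≤ yMap σ ζ (2 * T) := by
    have : -(σ * |ζ|) ≤ σ * ζ := by nlinarith [neg_abs_le ζ]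
    unfold yMap
    nlinarith [mul_nonneg hσ (sq_nonneg (2 * T))]
  rw [h0, ← intervalIntegral.integral_add_adjacent_intervals (b := T) (hg.intervalIntegrable _ _)
    (hg.intervalIntegrable _ _)]
  have : ∫ τ in T..(yMap σ ζ (2 * T)), g τ = 0 := by
    rw [intervalIntegral.integral_congr (g := fun _ => 0)]
    · simp
    · intro τ hτ
      rw [uIcc_of_le h1] at hτ
      exact hgT τ hτ.1
  rw [this, add_zero]

lemma two_inner_le (a b : ℂ) : 2 * |inner ℝ a b| ≤ ‖a‖ ^ 2 + ‖b‖ ^ 2 := by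
  have := abs_real_inner_le_norm a b
  nlinarith [sq_nonneg (‖a‖ - ‖b‖)]

set_option maxHeartbeats 2000000 in
/-- Transplantation of a function from curvature `k₁` to the larger curvature `k₂`. -/
lemma exists_transplant (K k₁ k₂ : ℝ) (hk : k₁ < k₂) (j : ℕ) :
    ∃ (κ₀ C : ℝ) (m : ℕ), 0 < κ₀ ∧ 0 ≤ C ∧ ∀ κ ζ E T : ℝ, 0 ≤ κ → κ ≤ κ₀ → |ζ| ≤ K → 0 ≤ E → E ≤ 1 →
      0 ≤ T → ∀ v : ℝ → ℂ, ContDiff ℝ 1 v → (∀ τ, T ≤ τ → v τ = 0) →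
      ∃ (ζ' : ℝ) (w : ℝ → ℂ), |ζ'| ≤ K + 1 ∧ ContDiff ℝ 1 w ∧ (∀ τ, 2 * T ≤ τ → w τ = 0) ∧
        nrg (2 * T) (κ * k₂) ζ' w - E * dens (2 * T) (κ * k₂) w ≤
          nrg T (κ * k₁) ζ v - E * dens T (κ * k₁) v - κ * (k₂ - k₁) * (1 / 3) * ‖v 0‖ ^ 2
            + C * κ ^ 2 * wen T m v ∧
        wen (2 * T) j w ≤ C * wen T m v := by
  obtain ⟨C₁, m₁, hC₁, h₁⟩ := coeff_deriv_bound K k₁ k₂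
  obtain ⟨C₂, m₂, hC₂, h₂⟩ := coeff_cross_bound K k₁ k₂
  obtain ⟨C₃, m₃, hC₃, h₃⟩ := coeff_zero_bound K k₁ k₂
  by_cases hK : 0 ≤ K
  swap
  · exact ⟨1, 0, 0, one_pos, le_rfl, fun κ ζ E T _ _ hζ => absurd ((abs_nonneg ζ).trans hζ) hK⟩
  set M := m₁ + m₂ + m₃ + j + 4 with hM
  set A := C₁ + C₂ + C₃ + 100 with hA
  refine ⟨min 1 (1 / ((k₂ - k₁) * (K ^ 2 + K + 1))), A * 2 ^ (M + 1), M, ?_, by positivity, ?_⟩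
  · have : 0 < (k₂ - k₁) * (K ^ 2 + K + 1) := mul_pos (by linarith) (by positivity)
    positivity
  intro κ ζ E T hκ0 hκ hζ hE0 hE1 hT v hv hvT
  have hσs : κ * (k₂ - k₁) * (K ^ 2 + K + 1) ≤ 1 := by
    have h := hκ.trans (min_le_right _ _)
    rw [le_div_iff₀ (mul_pos (by linarith) (by positivity))] at h
    linarith
  have hκ1 : κ ≤ 1 := hκ.trans (min_le_left _ _)
  set σ := κ * (k₂ - k₁) with hσ
  have hσ0 : 0 ≤ σ := mul_nonneg hκ0 (by linarith)
  have hσe : σ * (K ^ 2 + K + 1) = σ * K ^ 2 + σ * K + σ := by ring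
  have hσp1 : 0 ≤ σ * K := mul_nonneg hσ0 hK
  have hσp2 : 0 ≤ σ * K ^ 2 := mul_nonneg hσ0 (sq_nonneg K)
  have hσ1 : σ ≤ 1 := by linarith
  have hσK : σ * K ≤ 1 := by linarith
  have hσζ : σ * |ζ| ≤ 1 := (mul_le_mul_of_nonneg_left hζ hσ0).trans hσK
  have hσζ' := abs_le.1 (show |σ * ζ| ≤ 1 by rwa [abs_mul, abs_of_nonneg hσ0])
  have hζ2 : ζ ^ 2 ≤ K ^ 2 := sq_le_sq' (by linarith [(abs_le.1 hζ).1]) (abs_le.1 hζ).2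
  -- geometry of the change of variables
  have y'pos : ∀ τ, 0 ≤ τ → 1 / 2 ≤ yMap' σ ζ τ := fun τ hτ => by
    have e : yMap' σ ζ τ = 1 + σ * τ / 3 + σ * ζ / 3 := by unfold yMap'; ring
    rw [e]; linarith [mul_nonneg hσ0 hτ]
  have ylow : ∀ τ, 0 ≤ τ → τ ≤ 2 * yMap σ ζ τ := fun τ hτ => by
    unfold yMap; nlinarith [mul_nonneg hσ0 (sq_nonneg τ)]
  have y'up : ∀ τ, 0 ≤ τ → yMap' σ ζ τ ≤ 2 * (1 + τ) := fun τ hτ => by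
    have e : yMap' σ ζ τ = 1 + σ * τ / 3 + σ * ζ / 3 := by unfold yMap'; ring
    have e2 := mul_le_mul_of_nonneg_right hσ1 hτ
    rw [e]; linarith
  have fup : ∀ τ, 0 ≤ τ → |fMul σ ζ τ| ≤ 2 * (1 + τ) := fun τ hτ => by
    have e : fMul σ ζ τ = 1 + σ * τ / 3 - σ * ζ / 6 := by unfold fMul; ring
    have e1 := mul_nonneg hσ0 hτ
    have e2 := mul_le_mul_of_nonneg_right hσ1 hτ
    rw [e, abs_le]; constructor <;> linarith
  have cy : Continuous (yMap σ ζ) := by unfold yMap; fun_prop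
  have cy' : Continuous (yMap' σ ζ) := by unfold yMap'; fun_prop
  have cf : Continuous (fMul σ ζ) := by unfold fMul; fun_prop
  have cv := hv.continuous
  have cd := continuous_deriv_of_contDiff_one hv
  have dvT : ∀ τ, T ≤ τ → deriv v τ = 0 := fun τ hτ => deriv_eq_zero_of_zero_beyond' hv hvT hτ
  set w : ℝ → ℂ := fun τ => fMul σ ζ τ • v (yMap σ ζ τ) with hw
  have wd : ∀ τ, HasDerivAt w (fMul σ ζ τ • (yMap' σ ζ τ • deriv v (yMap σ ζ τ)) +
      (σ * (1 / 3)) • v (yMap σ ζ τ)) τ := fun τ =>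
    (hasDerivAt_fMul σ ζ τ).smul
      ((hasDerivAt_of_contDiff_one hv (yMap σ ζ τ)).scomp τ (hasDerivAt_yMap σ ζ τ))
  have hwc : ContDiff ℝ 1 w := by
    have a1 : ContDiff ℝ 1 (fMul σ ζ) := by unfold fMul; fun_prop
    have a2 : ContDiff ℝ 1 (yMap σ ζ) := by unfold yMap; fun_prop
    exact a1.smul (hv.comp a2)
  have cw := hwc.continuous
  have cdw := continuous_deriv_of_contDiff_one hwc
  -- transfer of weighted energies
  set g : ℝ → ℝ := fun y => (1 + |y|) ^ M * (‖deriv v y‖ ^ 2 + ‖v y‖ ^ 2) with hg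
  have cg : Continuous g := by
    have : Continuous fun y : ℝ => |y| := continuous_abs
    fun_prop
  have gT : ∀ τ, T ≤ τ → g τ = 0 := fun τ hτ => by simp [hg, hvT τ hτ, dvT τ hτ]
  have gint : ∫ τ in 0..(2 * T), g (yMap σ ζ τ) * yMap' σ ζ τ = wen T M v := by
    rw [integral_comp_yMap hσ0 hσζ hT cg gT]
    refine intervalIntegral.integral_congr fun τ hτ => ?_
    rw [uIcc_of_le hT] at hτ
    simp only [hg, abs_of_nonneg hτ.1]
  have gbound : ∀ τ, 0 ≤ τ → ∀ i, i ≤ M →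
      (1 + τ) ^ i * (‖deriv v (yMap σ ζ τ)‖ ^ 2 + ‖v (yMap σ ζ τ)‖ ^ 2) ≤
        2 ^ (M + 1) * (g (yMap σ ζ τ) * yMap' σ ζ τ) := fun τ hτ i hi => by
    have e0 : 0 ≤ yMap σ ζ τ := by linarith [ylow τ hτ]
    have e1 : (1 + τ) ^ i ≤ 2 ^ M * (1 + |yMap σ ζ τ|) ^ M := by
      rw [← mul_pow, abs_of_nonneg e0]
      calc (1 + τ) ^ i ≤ (1 + τ) ^ M := pow_le_pow_right₀ (by linarith) hi
        _ ≤ _ := by gcongr; linarith [ylow τ hτ]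
    have e2 := y'pos τ hτ
    set S := ‖deriv v (yMap σ ζ τ)‖ ^ 2 + ‖v (yMap σ ζ τ)‖ ^ 2 with hS
    have hS0 : 0 ≤ S := by positivity
    have e3 : (1 + τ) ^ i * S ≤ 2 ^ M * g (yMap σ ζ τ) := by
      simp only [hg, ← hS]
      rw [← mul_assoc]; exact mul_le_mul_of_nonneg_right e1 hS0
    have e4 : 0 ≤ g (yMap σ ζ τ) := by simp only [hg]; positivity
    rw [pow_succ]
    have e5 := mul_le_mul_of_nonneg_left e2 (mul_nonneg (show (0 : ℝ) ≤ 2 ^ M by positivity) e4)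
    linarith
  have cgi : IntervalIntegrable (fun τ => g (yMap σ ζ τ) * yMap' σ ζ τ) volume 0 (2 * T) :=
    ((cg.comp cy).mul cy').intervalIntegrable _ _
  refine ⟨zMap σ ζ E, w, ?_, hwc, ?_, ?_, ?_⟩
  · have : |zMap σ ζ E - ζ| ≤ 1 := by
      have e : zMap σ ζ E - ζ = (σ * ζ ^ 2 - σ * E) / 3 := by unfold zMap; ring
      have a1 : σ * ζ ^ 2 ≤ σ * K ^ 2 := mul_le_mul_of_nonneg_left hζ2 hσ0
      have a2 : σ * E ≤ σ * 1 := mul_le_mul_of_nonneg_left hE1 hσ0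
      have a3 : σ * K ^ 2 ≤ 1 := by linarith
      rw [e, abs_le]
      constructor <;> linarith [mul_nonneg hσ0 (sq_nonneg ζ), mul_nonneg hσ0 hE0]
    have := abs_le.1 this
    have := abs_le.1 hζ
    rw [abs_le]; constructor <;> linarith
  · intro τ hτ
    have : T ≤ yMap σ ζ τ := by linarith [ylow τ (by linarith)]
    simp [hw, hvT _ this]
  · set r : ℝ → ℝ := fun y => (1 - κ * k₁ * y) * ‖deriv v y‖ ^ 2 + (pot (κ * k₁) ζ y -
      E * (1 - κ * k₁ * y)) * ‖v y‖ ^ 2 + σ * (2 / 3) * inner ℝ (v y) (deriv v y) with hr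
    have cpot := continuous_pot
    have cr : Continuous r := by
      have := cpot (κ * k₁) ζ
      fun_prop
    have rT : ∀ τ, T ≤ τ → r τ = 0 := fun τ hτ => by simp [hr, hvT τ hτ, dvT τ hτ]
    have rint := integral_comp_yMap hσ0 hσζ hT cr rT
    have rval : ∫ τ in 0..T, r τ = nrg T (κ * k₁) ζ v - E * dens T (κ * k₁) v -
        σ * (1 / 3) * ‖v 0‖ ^ 2 := by
      have ftc := intervalIntegral.integral_eq_sub_of_hasDerivAt (a := 0) (b := T)
        (fun τ _ => (hasDerivAt_of_contDiff_one hv τ).norm_sq)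
        ((by fun_prop : Continuous fun τ => 2 * inner ℝ (v τ) (deriv v τ)).intervalIntegrable _ _)
      rw [hvT T le_rfl] at ftc
      have c1 := cpot (κ * k₁) ζ
      have : ∫ τ in 0..T, r τ = nrg T (κ * k₁) ζ v - E * dens T (κ * k₁) v +
          σ * (1 / 3) * ∫ τ in 0..T, 2 * inner ℝ (v τ) (deriv v τ) := by
        rw [nrg, dens, ← intervalIntegral.integral_const_mul, ← intervalIntegral.integral_const_mul,
          ← intervalIntegral.integral_sub, ← intervalIntegral.integral_add]
        · refine intervalIntegral.integral_congr fun τ _ => ?_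
          simp only [hr]; ring
        all_goals exact Continuous.intervalIntegrable (by fun_prop) _ _
      rw [this, ftc]; simp; ring
    have cp2 := cpot (κ * k₂) (zMap σ ζ E)
    have key : nrg (2 * T) (κ * k₂) (zMap σ ζ E) w - E * dens (2 * T) (κ * k₂) w ≤
        ∫ τ in 0..(2 * T), (r (yMap σ ζ τ) * yMap' σ ζ τ +
          A * κ ^ 2 * (2 ^ (M + 1) * (g (yMap σ ζ τ) * yMap' σ ζ τ))) := by
      rw [nrg, dens, ← intervalIntegral.integral_const_mul, ← intervalIntegral.integral_sub]
      rotate_left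
      · exact Continuous.intervalIntegrable (by fun_prop) _ _
      · exact Continuous.intervalIntegrable (by fun_prop) _ _
      refine intervalIntegral.integral_mono_on (by linarith)
        (Continuous.intervalIntegrable (by fun_prop) _ _)
        (Continuous.intervalIntegrable (by fun_prop) _ _) fun τ hτ => ?_
      have hτ0 := hτ.1
      rw [(wd τ).deriv]
      have adm : Pt.Adm K ⟨κ, ζ, E, τ⟩ := ⟨hκ0, hκ1, hζ, hE0, hE1, hτ0⟩
      have b₁ := (abs_le.1 (h₁ _ adm)).2
      have b₂ := h₂ _ adm
      have b₃ := (abs_le.1 (h₃ _ adm)).2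
      have g₁ := gbound τ hτ0 m₁ (by omega)
      have g₂ := gbound τ hτ0 m₂ (by omega)
      have g₃ := gbound τ hτ0 m₃ (by omega)
      simp only [← hσ] at b₁ b₂ b₃
      simp only [hr]
      set a := v (yMap σ ζ τ)
      set b := deriv v (yMap σ ζ τ)
      set Z := 2 ^ (M + 1) * (g (yMap σ ζ τ) * yMap' σ ζ τ)
      set F := fMul σ ζ τ with hF
      set y := yMap σ ζ τ
      set y' := yMap' σ ζ τ
      have hwv : ‖w τ‖ ^ 2 = F * F * ‖a‖ ^ 2 := by
        simp only [hw, norm_smul, mul_pow, Real.norm_eq_abs, sq_abs, ← hF]; ring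
      have hwd : ‖F • (y' • b) + (σ * (1 / 3)) • a‖ ^ 2 = F * F * (y' * y') * ‖b‖ ^ 2 +
          F * (σ * (2 / 3)) * y' * inner ℝ a b +
          (σ * (1 / 3)) * (σ * (1 / 3)) * ‖a‖ ^ 2 := by
        rw [norm_add_sq_real]
        simp only [norm_smul, inner_smul_left, inner_smul_right, mul_pow, Real.norm_eq_abs, sq_abs,
          real_inner_comm b a, RCLike.conj_to_real]
        ring
      rw [hwv, hwd]
      have i₂ := two_inner_le a b
      have n1 : 0 ≤ ‖a‖ ^ 2 := by positivity
      have n2 : 0 ≤ ‖b‖ ^ 2 := by positivity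
      have k1 := mul_le_mul_of_nonneg_right b₁ n2
      have k3 := mul_le_mul_of_nonneg_right b₃ n1
      have k2 := (le_abs_self _).trans ((abs_mul _ (inner ℝ a b)).le.trans
        (mul_le_mul_of_nonneg_right b₂ (abs_nonneg (inner ℝ a b))))
      have p1 : C₁ * κ ^ 2 * (1 + τ) ^ m₁ * ‖b‖ ^ 2 ≤ C₁ * κ ^ 2 * Z := by
        rw [mul_assoc]
        refine mul_le_mul_of_nonneg_left (le_trans ?_ g₁) (by positivity)
        exact mul_le_mul_of_nonneg_left (by linarith) (by positivity)
      have p3 : C₃ * κ ^ 2 * (1 + τ) ^ m₃ * ‖a‖ ^ 2 ≤ C₃ * κ ^ 2 * Z := by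
        rw [mul_assoc]
        refine mul_le_mul_of_nonneg_left (le_trans ?_ g₃) (by positivity)
        exact mul_le_mul_of_nonneg_left (by linarith) (by positivity)
      have p2 : C₂ * κ ^ 2 * (1 + τ) ^ m₂ * |inner ℝ a b| ≤ C₂ * κ ^ 2 * Z := by
        rw [mul_assoc]
        refine mul_le_mul_of_nonneg_left (le_trans ?_ g₂) (by positivity)
        refine mul_le_mul_of_nonneg_left ?_ (by positivity)
        linarith [abs_nonneg (inner ℝ a b)]
      have Z0 : 0 ≤ κ ^ 2 * Z := by
        refine mul_nonneg (sq_nonneg _) (le_trans ?_ g₁); positivity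
      have hAZ : C₁ * κ ^ 2 * Z + C₂ * κ ^ 2 * Z + C₃ * κ ^ 2 * Z ≤ A * κ ^ 2 * Z := by
        rw [hA]; linarith
      linarith
    have s1 : ∫ τ in 0..(2 * T), (r (yMap σ ζ τ) * yMap' σ ζ τ +
          A * κ ^ 2 * (2 ^ (M + 1) * (g (yMap σ ζ τ) * yMap' σ ζ τ))) =
        (∫ τ in 0..T, r τ) + A * κ ^ 2 * (2 ^ (M + 1) * wen T M v) := by
      rw [intervalIntegral.integral_add (Continuous.intervalIntegrable (by fun_prop) _ _)
        (Continuous.intervalIntegrable (by fun_prop) _ _), rint,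
        intervalIntegral.integral_const_mul, intervalIntegral.integral_const_mul, gint]
    rw [s1, rval] at key
    calc _ ≤ _ := key
      _ = _ := by ring
  · rw [mul_assoc, ← gint, ← intervalIntegral.integral_const_mul,
      ← intervalIntegral.integral_const_mul]
    refine intervalIntegral.integral_mono_on (by linarith)
        (Continuous.intervalIntegrable (by fun_prop) _ _)
        (Continuous.intervalIntegrable (by fun_prop) _ _) fun τ hτ => ?_
    have hτ0 := hτ.1
    rw [(wd τ).deriv]
    refine le_trans ?_ (mul_le_mul_of_nonneg_left (gbound τ hτ0 (j + 4) (by omega))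
      (show 0 ≤ A by positivity))
    have q1 := fup τ hτ0
    have q2 := y'up τ hτ0
    have q3 := y'pos τ hτ0
    set a := v (yMap σ ζ τ)
    set b := deriv v (yMap σ ζ τ)
    set F := fMul σ ζ τ with hF
    set y' := yMap' σ ζ τ
    have hwv : ‖w τ‖ ^ 2 = F ^ 2 * ‖a‖ ^ 2 := by
      simp only [hw, norm_smul, mul_pow, Real.norm_eq_abs, sq_abs, ← hF]; rfl
    have hF2 : F ^ 2 ≤ 4 * (1 + τ) ^ 2 := by
      have := sq_le_sq' (by linarith [(abs_le.1 q1).1]) (abs_le.1 q1).2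
      linarith
    have hy2 : y' ^ 2 ≤ 4 * (1 + τ) ^ 2 := by
      have := pow_le_pow_left₀ (by linarith) q2 2
      linarith
    have hwd : ‖F • (y' • b) + (σ * (1 / 3)) • a‖ ^ 2 ≤ 2 * (F ^ 2 * y' ^ 2 * ‖b‖ ^ 2) +
        2 * ‖a‖ ^ 2 := by
      have e : ‖F • (y' • b) + (σ * (1 / 3)) • a‖ ≤ |F| * |y'| * ‖b‖ + 1 * ‖a‖ := by
        refine (norm_add_le _ _).trans ?_
        simp only [norm_smul, Real.norm_eq_abs, ← mul_assoc]
        gcongr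
        rw [abs_le]; constructor <;> linarith
      have e2 := pow_le_pow_left₀ (norm_nonneg _) e 2
      have e3 : (|F| * |y'| * ‖b‖) ^ 2 = F ^ 2 * y' ^ 2 * ‖b‖ ^ 2 := by
        rw [mul_pow, mul_pow, sq_abs, sq_abs]
      linarith [sq_nonneg (|F| * |y'| * ‖b‖ - ‖a‖), add_sq (|F| * |y'| * ‖b‖) (1 * ‖a‖),
        sub_sq (|F| * |y'| * ‖b‖) ‖a‖]
    have hX : (1 : ℝ) ≤ (1 + τ) ^ 2 := one_le_pow₀ (by linarith)
    set X := (1 + τ) ^ 2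
    have hFy : F ^ 2 * y' ^ 2 ≤ (4 * X) * (4 * X) := by gcongr
    have n1 : 0 ≤ ‖a‖ ^ 2 := by positivity
    have n2 : 0 ≤ ‖b‖ ^ 2 := by positivity
    have fin : ‖F • (y' • b) + (σ * (1 / 3)) • a‖ ^ 2 + ‖w τ‖ ^ 2 ≤
        100 * (X * X * (‖b‖ ^ 2 + ‖a‖ ^ 2)) := by
      rw [hwv]
      have t1 := mul_le_mul_of_nonneg_right hFy n2
      have t2 := mul_le_mul_of_nonneg_right hF2 n1
      have t3 : X ≤ X * X := le_mul_of_one_le_left (by linarith) hX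
      have t4 : ‖a‖ ^ 2 ≤ X * X * ‖a‖ ^ 2 := le_mul_of_one_le_left n1 (by linarith)
      have t5 := mul_le_mul_of_nonneg_right t3 n1
      have t6 : 0 ≤ X * X * ‖b‖ ^ 2 := mul_nonneg (by linarith) n2
      linarith
    have hXX : (1 + τ) ^ (j + 4) = (1 + τ) ^ j * (X * X) := by simp only [X]; ring
    rw [hXX]
    calc _ ≤ (1 + τ) ^ j * (100 * (X * X * (‖b‖ ^ 2 + ‖a‖ ^ 2))) := by gcongr
      _ = 100 * ((1 + τ) ^ j * (X * X) * (‖b‖ ^ 2 + ‖a‖ ^ 2)) := by ring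
      _ ≤ _ := by
        refine mul_le_mul_of_nonneg_right (by rw [hA]; linarith) (by positivity)

end SC

namespace SC

section
variable {v : ℝ → ℂ} (hv : ContDiff ℝ 1 v) {T : ℝ} (hT : 0 ≤ T)
include hv

lemma wenx_zero (ζ : ℝ) : wenx T ζ 0 v = en0 T ζ v + mass T v := by
  have cv := hv.continuous
  have cd := continuous_deriv_of_contDiff_one hv
  rw [en0, mass, ← intervalIntegral.integral_add]
  · exact intervalIntegral.integral_congr fun τ _ => by simp only [pow_zero]; ring
  all_goals exact Continuous.intervalIntegrable (by fun_prop) _ _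

include hT

lemma wenx_interp (ζ : ℝ) {g : ℝ} (hg : 0 < g) (b C : ℝ) :
    b * C * wenx T ζ 2 v ≤ g / 2 * b ^ 2 * wenx T ζ 0 v + C ^ 2 / (2 * g) * wenx T ζ 4 v := by
  have cv := hv.continuous
  have cd := continuous_deriv_of_contDiff_one hv
  simp only [wenx]
  rw [← intervalIntegral.integral_const_mul, ← intervalIntegral.integral_const_mul,
    ← intervalIntegral.integral_const_mul, ← intervalIntegral.integral_add]
  rotate_left
  · exact Continuous.intervalIntegrable (by fun_prop) _ _
  · exact Continuous.intervalIntegrable (by fun_prop) _ _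
  refine intervalIntegral.integral_mono_on hT (Continuous.intervalIntegrable (by fun_prop) _ _)
    (Continuous.intervalIntegrable (by fun_prop) _ _) fun τ hτ => ?_
  have h : b * C * (1 + τ) ^ 2 ≤ g / 2 * b ^ 2 + C ^ 2 / (2 * g) * (1 + τ) ^ 4 := by
    have e : g / 2 * b ^ 2 + C ^ 2 / (2 * g) * (1 + τ) ^ 4 - b * C * (1 + τ) ^ 2 =
      (g * b - C * (1 + τ) ^ 2) ^ 2 / (2 * g) := by field_simp; ring
    have : 0 ≤ (g * b - C * (1 + τ) ^ 2) ^ 2 / (2 * g) := by positivity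
    linarith
  have := mul_le_mul_of_nonneg_right h
    (show 0 ≤ ‖deriv v τ‖ ^ 2 + ((ζ + τ) ^ 2 + 1) * ‖v τ‖ ^ 2 by positivity)
  linarith

lemma dens_le (ζ κ : ℝ) : dens T κ v ≤ mass T v + |κ| * wenx T ζ 2 v := by
  have cv := hv.continuous
  have cd := continuous_deriv_of_contDiff_one hv
  simp only [wenx, dens, mass]
  rw [← intervalIntegral.integral_const_mul, ← intervalIntegral.integral_add]
  rotate_left
  · exact Continuous.intervalIntegrable (by fun_prop) _ _
  · exact Continuous.intervalIntegrable (by fun_prop) _ _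
  refine intervalIntegral.integral_mono_on hT (Continuous.intervalIntegrable (by fun_prop) _ _)
    (Continuous.intervalIntegrable (by fun_prop) _ _) fun τ hτ => ?_
  have h0 := hτ.1
  have h1 : -(κ * τ) ≤ |κ| * (1 + τ) ^ 2 := by
    have := mul_le_mul_of_nonneg_right (neg_le_abs κ) h0
    nlinarith [abs_nonneg κ, mul_nonneg (abs_nonneg κ) h0]
  have h2 := mul_le_mul_of_nonneg_right h1 (show 0 ≤ ‖v τ‖ ^ 2 by positivity)
  have h3 : 0 ≤ |κ| * ((1 + τ) ^ 2 * (‖deriv v τ‖ ^ 2 + (ζ + τ) ^ 2 * ‖v τ‖ ^ 2)) := by positivity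
  linarith

lemma nrg_ge (ζ κ : ℝ) (hκ : |κ| * T ≤ 1) : en0 T ζ v - 2 * |κ| * wenx T ζ 2 v ≤ nrg T κ ζ v := by
  have cv := hv.continuous
  have cd := continuous_deriv_of_contDiff_one hv
  have cp := continuous_pot κ ζ
  simp only [wenx, nrg, en0]
  rw [← intervalIntegral.integral_const_mul, ← intervalIntegral.integral_sub]
  rotate_left
  · exact Continuous.intervalIntegrable (by fun_prop) _ _
  · exact Continuous.intervalIntegrable (by fun_prop) _ _
  refine intervalIntegral.integral_mono_on hT (Continuous.intervalIntegrable (by fun_prop) _ _)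
    (Continuous.intervalIntegrable (by fun_prop) _ _) fun τ hτ => ?_
  have h0 := hτ.1
  have hκτ : |κ * τ| ≤ 1 := by
    rw [abs_mul, abs_of_nonneg h0]
    exact (mul_le_mul_of_nonneg_left hτ.2 (abs_nonneg κ)).trans hκ
  have hk := abs_le.1 hκτ
  have h1 : κ * τ ≤ |κ| * (1 + τ) ^ 2 := by
    have := mul_le_mul_of_nonneg_right (le_abs_self κ) h0
    nlinarith [abs_nonneg κ, mul_nonneg (abs_nonneg κ) h0]
  have h2 : (ζ + τ) ^ 2 - 2 * |κ| * ((1 + τ) ^ 2 * ((ζ + τ) ^ 2 + 1)) ≤ pot κ ζ τ := by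
    set x := ζ + τ
    have e : pot κ ζ τ = x ^ 2 + κ * τ * x ^ 2 - κ * τ ^ 2 * x - (κ * τ) * (κ * τ ^ 2 * x) +
        (1 + κ * τ) * (κ * τ ^ 2 / 2) ^ 2 := by unfold pot; ring
    have e1 : 0 ≤ (1 + κ * τ) * (κ * τ ^ 2 / 2) ^ 2 := mul_nonneg (by linarith) (sq_nonneg _)
    have e2 : -(|κ| * τ * x ^ 2) ≤ κ * τ * x ^ 2 := by
      have := mul_le_mul_of_nonneg_right (neg_abs_le κ) (mul_nonneg h0 (sq_nonneg x))
      linarith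
    have e3 : |κ * τ ^ 2 * x| ≤ |κ| * τ ^ 2 * ((x ^ 2 + 1) / 2) := by
      rw [abs_mul, abs_mul, abs_of_nonneg (sq_nonneg τ)]
      refine mul_le_mul_of_nonneg_left ?_ (by positivity)
      nlinarith [sq_nonneg (|x| - 1), sq_abs x]
    have e4 : (κ * τ) * (κ * τ ^ 2 * x) ≤ |κ * τ ^ 2 * x| := by
      refine (le_abs_self _).trans ?_
      rw [abs_mul]
      exact mul_le_of_le_one_left (abs_nonneg _) hκτ
    have e5 := le_abs_self (κ * τ ^ 2 * x)
    have e6 : 0 ≤ |κ| * (x ^ 2 + 1) := by positivity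
    have e7 := mul_nonneg e6 h0
    have e8 := mul_nonneg e7 h0
    have e9 : 0 ≤ |κ| * τ := by positivity
    rw [e]
    linarith
  have n1 : 0 ≤ ‖v τ‖ ^ 2 := by positivity
  have n2 : 0 ≤ ‖deriv v τ‖ ^ 2 := by positivity
  have p1 := mul_le_mul_of_nonneg_right h1 n2
  have p2 := mul_le_mul_of_nonneg_right h2 n1
  have p3 : 0 ≤ |κ| * ((1 + τ) ^ 2 * ‖deriv v τ‖ ^ 2) := by positivity
  linarith

end

lemma en0_large {v : ℝ → ℂ} (hv : ContDiff ℝ 1 v) {T : ℝ} (hT : 0 ≤ T) (hvT : v T = 0)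
    {K ζ g : ℝ} (hK : 8 ≤ K) (hζ : K < |ζ|) (hg : 0 ≤ g) (hgK : 32 ≤ g * K ^ 2) :
    (1 - g) * mass T v ≤ en0 T ζ v := by
  have hm := mass_nonneg hT v
  rcases le_or_gt 0 ζ with h | h
  · have := en0_ge_boundary hv hT hvT ζ
    have : 0 ≤ ζ * ‖v 0‖ ^ 2 := by positivity
    nlinarith
  · have h2 : K ^ 2 ≤ ζ ^ 2 := by
      rw [← sq_abs ζ]; exact pow_le_pow_left₀ (by linarith) hζ.le 2
    have := en0_large_neg hv hT hvT h (by nlinarith)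
    refine le_trans (mul_le_mul_of_nonneg_right ?_ hm) this
    have : 32 / ζ ^ 2 ≤ g := by
      rw [div_le_iff₀ (by nlinarith)]
      exact hgK.trans (mul_le_mul_of_nonneg_left h2 hg)
    linarith

set_option maxHeartbeats 2000000 in
/-- Modewise lower bound at curvature `k₁`, given an upper bound on the ground state energy through
trial states living at the larger curvature `k₂`. -/
lemma per_mode {k₁ k₂ E₀ : ℝ} (hk : k₁ < k₂) (hE0 : 0 ≤ E₀) (hE1 : E₀ < 1) (m₀ : ℕ) :
    ∃ (K c C b₀ : ℝ) (m : ℕ), 0 < c ∧ 0 ≤ C ∧ 1 ≤ b₀ ∧ ∀ b l T A : ℝ, b₀ ≤ b → 0 ≤ l →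
      l ≤ E₀ * b ^ 2 → 0 ≤ T → |k₁| * T ≤ b → 0 ≤ A →
      (∀ (ζ : ℝ) (w : ℝ → ℂ), |ζ| ≤ K → ContDiff ℝ 1 w → (∀ τ, 2 * T ≤ τ → w τ = 0) →
        l * dens (2 * T) (b⁻¹ * k₂) w ≤
          b ^ 2 * nrg (2 * T) (b⁻¹ * k₂) ζ w + A * wen (2 * T) m₀ w) →
      ∀ (ζ : ℝ) (v : ℝ → ℂ), ContDiff ℝ 1 v → (∀ τ, T ≤ τ → v τ = 0) →
        c * b * (mass T v - en0 T ζ v) - C * (A + 1) * wenx T ζ m v ≤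
          b ^ 2 * nrg T (b⁻¹ * k₁) ζ v - l * dens T (b⁻¹ * k₁) v := by
  set K := 64 / (1 - E₀) with hK
  have hE : 0 < 1 - E₀ := by linarith
  have hK8 : 64 ≤ K := by rw [hK, le_div_iff₀ hE]; linarith
  have hKE : K * (1 - E₀) = 64 := by rw [hK]; field_simp
  obtain ⟨κ₀, C₁, m₁, hκ₀, hC₁, htr⟩ := exists_transplant K k₁ k₂ hk m₀
  set g := (1 - E₀) / 4 with hg
  have hg0 : 0 < g := by positivity
  set C₂ := 3 * |k₁| with hC₂
  have hkk : 0 < k₂ - k₁ := by linarith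
  refine ⟨K + 1, min ((k₂ - k₁) / (3 * K)) (g / 2), C₁ + C₂ ^ 2 / (2 * g), max 1 κ₀⁻¹, m₁ + 4,
    by positivity, by positivity, le_max_left _ _, ?_⟩
  intro b l T A hb hl0 hl hT hkT hA TR ζ v hv hvT
  have hb1 : 1 ≤ b := (le_max_left _ _).trans hb
  have hbκ : b⁻¹ ≤ κ₀ := inv_le_of_inv_le₀ hκ₀ ((le_max_right _ _).trans hb)
  have hb0 : 0 < b := by linarith
  set c := min ((k₂ - k₁) / (3 * K)) (g / 2) with hc
  have hc0 : 0 ≤ c := by positivity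
  have hw4 := wenx_nonneg hT ζ (m₁ + 4) v
  rcases le_or_gt |ζ| K with hζ | hζ
  · have hEb : 0 ≤ l / b ^ 2 := by positivity
    have hEb1 : l / b ^ 2 ≤ 1 := by
      rw [div_le_one (by positivity)]; nlinarith [sq_nonneg b]
    obtain ⟨ζ', w, hζ', hw, hwT, e1, e2⟩ := htr b⁻¹ ζ (l / b ^ 2) T (by positivity) hbκ hζ hEb hEb1
      hT v hv hvT
    have tr := TR ζ' w hζ' hw hwT
    have e1' := mul_le_mul_of_nonneg_left e1 (sq_nonneg b)
    have i1 : b ^ 2 * (nrg (2 * T) (b⁻¹ * k₂) ζ' w - l / b ^ 2 * dens (2 * T) (b⁻¹ * k₂) w) =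
        b ^ 2 * nrg (2 * T) (b⁻¹ * k₂) ζ' w - l * dens (2 * T) (b⁻¹ * k₂) w := by field_simp
    have i2 : b ^ 2 * (nrg T (b⁻¹ * k₁) ζ v - l / b ^ 2 * dens T (b⁻¹ * k₁) v -
        b⁻¹ * (k₂ - k₁) * (1 / 3) * ‖v 0‖ ^ 2 + C₁ * b⁻¹ ^ 2 * wen T m₁ v) =
        b ^ 2 * nrg T (b⁻¹ * k₁) ζ v - l * dens T (b⁻¹ * k₁) v -
        b * (k₂ - k₁) / 3 * ‖v 0‖ ^ 2 + C₁ * wen T m₁ v := by field_simp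
    rw [i1, i2] at e1'
    have bd := en0_ge_boundary hv hT (hvT T le_rfl) ζ
    have hw1 : wen T m₁ v ≤ wenx T ζ (m₁ + 4) v :=
      (wen_mono hv hT (by omega)).trans (wen_le_wenx hv hT ζ _)
    have hcK : c * K ≤ (k₂ - k₁) / 3 := by
      calc c * K ≤ (k₂ - k₁) / (3 * K) * K :=
            mul_le_mul_of_nonneg_right (min_le_left _ _) (by linarith)
        _ = _ := by field_simp
    have d1 : mass T v - en0 T ζ v ≤ K * ‖v 0‖ ^ 2 := by
      have : -ζ * ‖v 0‖ ^ 2 ≤ K * ‖v 0‖ ^ 2 :=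
        mul_le_mul_of_nonneg_right ((neg_le_abs ζ).trans hζ) (by positivity)
      linarith
    have d2 : c * b * (mass T v - en0 T ζ v) ≤ b * (k₂ - k₁) / 3 * ‖v 0‖ ^ 2 := by
      calc _ ≤ c * b * (K * ‖v 0‖ ^ 2) := mul_le_mul_of_nonneg_left d1 (by positivity)
        _ = (c * K) * (b * ‖v 0‖ ^ 2) := by ring
        _ ≤ (k₂ - k₁) / 3 * (b * ‖v 0‖ ^ 2) := mul_le_mul_of_nonneg_right hcK (by positivity)
        _ = _ := by ring
    have d3 : A * wen (2 * T) m₀ w ≤ A * (C₁ * wenx T ζ (m₁ + 4) v) :=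
      mul_le_mul_of_nonneg_left (e2.trans (mul_le_mul_of_nonneg_left hw1 hC₁)) hA
    have d4 := mul_le_mul_of_nonneg_left hw1 hC₁
    have d5 : 0 ≤ C₂ ^ 2 / (2 * g) * (A + 1) * wenx T ζ (m₁ + 4) v := by positivity
    linarith
  · have hm := mass_nonneg hT v
    have en := en0_large hv hT (hvT T le_rfl) (by linarith) hζ (g := 2 * g) (by positivity)
      (by rw [hg]; nlinarith)
    have hen := en0_nonneg hT ζ v
    have habs : |b⁻¹ * k₁| = b⁻¹ * |k₁| := by rw [abs_mul, abs_of_pos (inv_pos.2 hb0)]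
    have n1 := nrg_ge hv hT ζ (b⁻¹ * k₁) (by
      rw [habs, mul_assoc, inv_mul_le_iff₀ hb0]; linarith)
    have n2 := dens_le hv hT ζ (b⁻¹ * k₁)
    rw [habs] at n1 n2
    have w2 := wenx_nonneg hT ζ 2 v
    have n1' := mul_le_mul_of_nonneg_left n1 (sq_nonneg b)
    have n2' := mul_le_mul_of_nonneg_left n2 hl0
    have i1 : b ^ 2 * (en0 T ζ v - 2 * (b⁻¹ * |k₁|) * wenx T ζ 2 v) =
        b ^ 2 * en0 T ζ v - 2 * (b * |k₁| * wenx T ζ 2 v) := by field_simp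
    rw [i1] at n1'
    have hlb : l ≤ b ^ 2 := by nlinarith [sq_nonneg b]
    have i2 : l * (b⁻¹ * |k₁| * wenx T ζ 2 v) ≤ b * |k₁| * wenx T ζ 2 v := by
      calc _ ≤ b ^ 2 * (b⁻¹ * |k₁| * wenx T ζ 2 v) :=
            mul_le_mul_of_nonneg_right hlb (by positivity)
        _ = _ := by field_simp
    have i3 : l * mass T v ≤ E₀ * b ^ 2 * mass T v := mul_le_mul_of_nonneg_right hl hm
    have ip := wenx_interp hv hT ζ hg0 b C₂
    have z0 := wenx_zero (T := T) hv ζ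
    have i4 : g * wenx T ζ 0 v ≤ en0 T ζ v - E₀ * mass T v := by
      rw [z0]
      have : 0 ≤ (1 - E₀) ^ 2 / 8 * mass T v := by positivity
      have h2 := mul_le_mul_of_nonneg_left en (show 0 ≤ 1 - g by rw [hg]; linarith)
      have h3 : (1 - g) * ((1 - 2 * g) * mass T v) - (E₀ + g) * mass T v =
        (1 - E₀) ^ 2 / 8 * mass T v := by rw [hg]; ring
      linarith
    have i5 := mul_le_mul_of_nonneg_left i4 (sq_nonneg b)
    have w0 := wenx_nonneg hT ζ 0 v
    have i6 : c * b * (mass T v - en0 T ζ v) ≤ g / 2 * b ^ 2 * wenx T ζ 0 v := by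
      have a1 : mass T v - en0 T ζ v ≤ wenx T ζ 0 v := by rw [z0]; linarith
      calc _ ≤ c * b * wenx T ζ 0 v := mul_le_mul_of_nonneg_left a1 (by positivity)
        _ ≤ _ := by
          refine mul_le_mul_of_nonneg_right ?_ w0
          exact mul_le_mul (min_le_right _ _) (by nlinarith) hb0.le (by positivity)
    have i7 : C₂ ^ 2 / (2 * g) * wenx T ζ 4 v ≤ C₂ ^ 2 / (2 * g) * (A + 1) * wenx T ζ (m₁ + 4) v := by
      refine mul_le_mul ?_ (wenx_mono hv hT ζ (by omega)) (wenx_nonneg hT ζ 4 v) (by positivity)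
      exact le_mul_of_one_le_right (by positivity) (by linarith)
    have i8 : 0 ≤ C₁ * (A + 1) * wenx T ζ (m₁ + 4) v := by positivity
    have i9 : b * C₂ * wenx T ζ 2 v = 3 * (b * |k₁| * wenx T ζ 2 v) := by rw [hC₂]; ring
    linarith

end SC

namespace SC

/-- Frequencies of quasi-periodic functions. -/
def freq (L α : ℝ) (n : ℤ) : ℝ := 2 * Real.pi * n / L + α

/-- Normalized Fourier coefficients in the first variable of a quasi-periodic function. -/
def cf (L α : ℝ) (n : ℤ) (X : Plane → ℂ) (t : ℝ) : ℂ :=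
  ((Real.sqrt L)⁻¹ : ℝ) * ∫ s in 0..L, Complex.exp (-(freq L α n * s : ℝ) * Complex.I) * X (s, t)

section
variable {L α : ℝ} {n : ℤ}

lemma continuous_cf {X : Plane → ℂ} (hX : Continuous X) : Continuous (cf L α n X) := by
  unfold cf
  refine continuous_const.mul
    (intervalIntegral.continuous_parametric_intervalIntegral_of_continuous' (f := fun t s =>
      Complex.exp (-(freq L α n * s : ℝ) * Complex.I) * X (s, t)) ?_ _ _)
  simp only [Function.uncurry_def]
  fun_prop

lemma cf_eq_fourierCoeffOn (hL : 0 < L) (X : Plane → ℂ) (t : ℝ) :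
    cf L α n X t = (Real.sqrt L : ℝ) *
      fourierCoeffOn hL (fun s => Complex.exp (-(α * s : ℝ) * Complex.I) * X (s, t)) n := by
  rw [cf, fourierCoeffOn_eq_integral]
  simp only [fourier_coe_apply, sub_zero, Complex.real_smul, smul_eq_mul]
  rw [← mul_assoc, ← Complex.ofReal_mul]
  congr 1
  · congr 1
    have h := Real.sq_sqrt hL.le
    have h' : 0 < Real.sqrt L := Real.sqrt_pos.2 hL
    field_simp
    linarith
  · refine intervalIntegral.integral_congr fun s _ => ?_
    rw [← mul_assoc, ← Complex.exp_add]
    congr 2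
    simp only [freq]
    push_cast
    ring

lemma parseval_slice (hL : 0 < L) {X : Plane → ℂ} (hX : Continuous X) (t : ℝ) :
    HasSum (fun n : ℤ => ‖cf L α n X t‖ ^ 2) (∫ s in 0..L, ‖X (s, t)‖ ^ 2) := by
  have hc : Continuous fun s : ℝ => Complex.exp (-(α * s : ℝ) * Complex.I) * X (s, t) := by fun_prop
  have hm : MemLp (fun s : ℝ => Complex.exp (-(α * s : ℝ) * Complex.I) * X (s, t)) 2
      (volume.restrict (Ioc 0 L)) :=
    (memLp_two_iff_integrable_sq_norm hc.aestronglyMeasurable).2 (hc.norm.pow 2).integrableOn_Ioc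
  have h := (hasSum_sq_fourierCoeffOn hL hm).mul_left L
  have he : ∀ s : ℝ, ‖Complex.exp (-(α * s : ℝ) * Complex.I)‖ = 1 := fun s => by
    rw [← Complex.ofReal_neg]; exact Complex.norm_exp_ofReal_mul_I _
  simp only [norm_mul, he, one_mul, sub_zero, smul_eq_mul] at h
  rw [← mul_assoc, mul_inv_cancel₀ hL.ne', one_mul] at h
  refine h.congr_fun fun n => ?_
  rw [cf_eq_fourierCoeffOn hL, norm_mul, mul_pow, Complex.norm_real,
    Real.norm_of_nonneg (Real.sqrt_nonneg _), Real.sq_sqrt hL.le]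

/-- Parseval's identity integrated against a weight in the transversal variable. -/
lemma parseval (hL : 0 < L) {X : Plane → ℂ} (hX : Continuous X) {p : ℝ → ℝ} (hp : Continuous p)
    (a b : ℝ) :
    HasSum (fun n : ℤ => ∫ t in a..b, p t * ‖cf L α n X t‖ ^ 2)
      (∫ t in a..b, p t * ∫ s in 0..L, ‖X (s, t)‖ ^ 2) := by
  have hS : Continuous fun t => ∫ s in 0..L, ‖X (s, t)‖ ^ 2 :=
    intervalIntegral.continuous_parametric_intervalIntegral_of_continuous' (f := fun t s =>
      ‖X (s, t)‖ ^ 2) (by simp only [Function.uncurry_def]; fun_prop) _ _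
  have hcf : ∀ n, Continuous (cf L α n X) := fun n => continuous_cf hX
  refine intervalIntegral.hasSum_integral_of_dominated_convergence
    (fun n t => |p t| * ‖cf L α n X t‖ ^ 2) (fun n => ?_) (fun n => ?_) ?_ ?_ ?_
  · have := hcf n
    exact Continuous.aestronglyMeasurable (by fun_prop)
  · exact Eventually.of_forall fun t _ => by
      rw [norm_mul, Real.norm_eq_abs, Real.norm_of_nonneg (by positivity)]
  · exact Eventually.of_forall fun t _ => ((parseval_slice hL hX t).mul_left _).summable
  · have : (fun t => ∑' n : ℤ, |p t| * ‖cf L α n X t‖ ^ 2) =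
        fun t => |p t| * ∫ s in 0..L, ‖X (s, t)‖ ^ 2 :=
      funext fun t => ((parseval_slice hL hX t).mul_left _).tsum_eq
    rw [this]
    exact Continuous.intervalIntegrable (by fun_prop) _ _
  · exact Eventually.of_forall fun t _ => (parseval_slice hL hX t).mul_left _

lemma hasDerivAt_cf {Y : Plane → ℂ} (hY : ContDiff ℝ 1 Y) (t : ℝ) :
    HasDerivAt (cf L α n Y) (cf L α n (fun x => fderiv ℝ Y x (0, 1)) t) t := by
  have hf := hY.continuous_fderiv (by norm_num)
  have hYc := hY.continuous
  have hd : ∀ s t' : ℝ, HasDerivAt (fun t' => Y (s, t')) (fderiv ℝ Y (s, t') (0, 1)) t' :=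
    fun s t' => by
      have h1 : HasFDerivAt Y (fderiv ℝ Y (s, t')) (s, t') :=
        (hY.differentiable (by norm_num) _).hasFDerivAt
      exact h1.comp_hasDerivAt t' ((hasDerivAt_const t' s).prodMk (hasDerivAt_id t'))
  set F' : ℝ → ℝ → ℂ := fun t' s =>
    Complex.exp (-(freq L α n * s : ℝ) * Complex.I) * fderiv ℝ Y (s, t') (0, 1) with hF'
  have hF'c : Continuous fun p : ℝ × ℝ => F' p.2 p.1 := by
    simp only [hF']; fun_prop
  obtain ⟨C, hC⟩ := (isCompact_uIcc (a := (0:ℝ)) (b := L)).prod (isCompact_Icc (a := t - 1) (b := t + 1))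
    |>.exists_bound_of_continuousOn hF'c.continuousOn
  have h := intervalIntegral.hasDerivAt_integral_of_dominated_loc_of_deriv_le (μ := volume)
    (a := 0) (b := L) (x₀ := t)
    (s := Icc (t - 1) (t + 1)) (bound := fun _ => C) (F' := F')
    (F := fun t' s => Complex.exp (-(freq L α n * s : ℝ) * Complex.I) * Y (s, t'))
    (Icc_mem_nhds (by linarith) (by linarith))
    (Eventually.of_forall fun t' => Continuous.aestronglyMeasurable (by fun_prop))
    (Continuous.intervalIntegrable (by fun_prop) _ _)
    (Continuous.aestronglyMeasurable (by simp only [hF']; fun_prop))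
    (Eventually.of_forall fun s hs t' ht' => hC (s, t') ⟨uIoc_subset_uIcc hs, ht'⟩)
    intervalIntegrable_const
    (Eventually.of_forall fun s _ t' _ => (hd s t').const_mul _)
  exact h.2.const_mul _

lemma contDiff_cf {Y : Plane → ℂ} (hY : ContDiff ℝ 1 Y) : ContDiff ℝ 1 (cf L α n Y) := by
  have hf := hY.continuous_fderiv (by norm_num)
  rw [contDiff_one_iff_deriv]
  refine ⟨fun t => (hasDerivAt_cf hY t).differentiableAt, ?_⟩
  rw [show deriv (cf L α n Y) = _ from funext fun t => (hasDerivAt_cf hY t).deriv]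
  exact continuous_cf (by fun_prop)

/-- The tangential derivative acts on Fourier coefficients by multiplication. -/
lemma cf_fderiv_fst {Y : Plane → ℂ} (hL : 0 < L) (hY : ContDiff ℝ 1 Y)
    (hq : ∀ t, Y (L, t) = Complex.exp ((α * L : ℝ) * Complex.I) * Y (0, t)) (t : ℝ) :
    cf L α n (fun x => fderiv ℝ Y x (1, 0)) t = (freq L α n : ℂ) * Complex.I * cf L α n Y t := by
  have hf := hY.continuous_fderiv (by norm_num)
  have hYc := hY.continuous
  set e : ℝ → ℂ := fun s => Complex.exp (-(freq L α n * s : ℝ) * Complex.I) with he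
  have hde : ∀ s, HasDerivAt e (-(freq L α n : ℂ) * Complex.I * e s) s := fun s => by
    have h0 : HasDerivAt (fun s : ℝ => (-(freq L α n * s : ℝ) : ℂ) * Complex.I)
        (-(freq L α n : ℂ) * Complex.I) s := by
      have := (((hasDerivAt_id s).const_mul (freq L α n)).ofReal_comp).neg.mul_const Complex.I
      simpa using this
    have := h0.cexp
    rwa [mul_comm] at this
  have hdY : ∀ s, HasDerivAt (fun s => Y (s, t)) (fderiv ℝ Y (s, t) (1, 0)) s := fun s => by
    have h1 : HasFDerivAt Y (fderiv ℝ Y (s, t)) (s, t) :=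
      (hY.differentiable (by norm_num) _).hasFDerivAt
    exact h1.comp_hasDerivAt s ((hasDerivAt_id s).prodMk (hasDerivAt_const s t))
  have hec : Continuous e := by simp only [he]; fun_prop
  have ibp := intervalIntegral.integral_mul_deriv_eq_deriv_mul (a := 0) (b := L)
    (fun s _ => hde s) (fun s _ => hdY s) (Continuous.intervalIntegrable (by fun_prop) _ _)
    (Continuous.intervalIntegrable (by fun_prop) _ _)
  have hb : e L * Y (L, t) = e 0 * Y (0, t) := by
    rw [hq, ← mul_assoc]
    simp only [he]
    rw [← Complex.exp_add]
    congr 1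
    rw [Complex.exp_eq_exp_iff_exists_int]
    refine ⟨-n, ?_⟩
    simp only [freq]
    have : (L : ℂ) ≠ 0 := by exact_mod_cast hL.ne'
    push_cast
    field_simp
    ring
  rw [hb, sub_self, zero_sub] at ibp
  simp only [cf]
  change _ * (∫ s in 0..L, e s * fderiv ℝ Y (s, t) (1, 0)) = _ * (_ * ∫ s in 0..L, e s * Y (s, t))
  rw [ibp]
  simp only [mul_assoc]
  rw [intervalIntegral.integral_const_mul, intervalIntegral.integral_const_mul]
  ring

lemma cf_covariant {Y : Plane → ℂ} (hL : 0 < L) (hY : ContDiff ℝ 1 Y)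
    (hq : ∀ t, Y (L, t) = Complex.exp ((α * L : ℝ) * Complex.I) * Y (0, t)) (q : ℝ → ℝ)
    (t : ℝ) : ‖cf L α n (fun x => fderiv ℝ Y x (1, 0) + (q x.2 : ℂ) * Complex.I * Y x) t‖ ^ 2 =
      (freq L α n + q t) ^ 2 * ‖cf L α n Y t‖ ^ 2 := by
  have hf := hY.continuous_fderiv (by norm_num)
  have hYc := hY.continuous
  have : cf L α n (fun x => fderiv ℝ Y x (1, 0) + (q x.2 : ℂ) * Complex.I * Y x) t =
      cf L α n (fun x => fderiv ℝ Y x (1, 0)) t + (q t : ℂ) * Complex.I * cf L α n Y t := by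
    simp only [cf]
    rw [mul_left_comm ((q t : ℂ) * Complex.I), ← mul_add]
    congr 1
    rw [← intervalIntegral.integral_const_mul,
      ← intervalIntegral.integral_add (Continuous.intervalIntegrable (by fun_prop) _ _)
      (Continuous.intervalIntegrable (by fun_prop) _ _)]
    exact intervalIntegral.integral_congr fun s _ => by ring
  rw [this, cf_fderiv_fst hL hY hq, ← add_mul, ← add_mul, norm_mul, norm_mul, Complex.norm_I,
    mul_one, mul_pow, ← Complex.ofReal_add, Complex.norm_real, Real.norm_eq_abs, sq_abs]

end

end SC

namespace SC

lemma setIntegral_rect {F : Plane → ℝ} (hF : Continuous F) {a b c d : ℝ} (hab : a ≤ b)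
    (hcd : c ≤ d) : ∫ x in Ioc a b ×ˢ Ioc c d, F x = ∫ t in c..d, ∫ s in a..b, F (s, t) := by
  have hsw := setIntegral_prod_swap (μ := (volume : Measure ℝ)) (ν := (volume : Measure ℝ))
    (Ioc a b) (Ioc c d) F
  have hi : IntegrableOn (fun z : ℝ × ℝ => F z.swap) (Ioc c d ×ˢ Ioc a b)
      ((volume : Measure ℝ).prod volume) := by
    rw [← Measure.volume_eq_prod]
    exact ((hF.comp continuous_swap).continuousOn.integrableOn_compact
      (isCompact_Icc.prod isCompact_Icc)).mono_set
      (prod_mono Ioc_subset_Icc_self Ioc_subset_Icc_self)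
  rw [Measure.volume_eq_prod, ← hsw, setIntegral_prod _ hi]
  simp only [Prod.swap_prod_mk, intervalIntegral.integral_of_le hab,
      intervalIntegral.integral_of_le hcd]

/-- Weighted square integral over the strip `[0,L] × [a,b]`. -/
def strp (L a b : ℝ) (p : ℝ → ℝ) (X : Plane → ℂ) : ℝ :=
  ∫ t in a..b, p t * ∫ s in 0..L, ‖X (s, t)‖ ^ 2

/-- The covariant derivative of `Y` along the first variable. -/
def cov (q : ℝ → ℝ) (Y : Plane → ℂ) (x : Plane) : ℂ :=
  fderiv ℝ Y x (1, 0) + (q x.2 : ℂ) * Complex.I * Y x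

def dtv (Y : Plane → ℂ) (x : Plane) : ℂ := fderiv ℝ Y x (0, 1)

section
variable {Y : Plane → ℂ} (hY : ContDiff ℝ 1 Y)
include hY

lemma continuous_cov {q : ℝ → ℝ} (hq : Continuous q) : Continuous (cov q Y) := by
  have hf := hY.continuous_fderiv (by norm_num)
  have hYc := hY.continuous
  unfold cov; fun_prop

lemma continuous_dtv : Continuous (dtv Y) := by
  have hf := hY.continuous_fderiv (by norm_num)
  unfold dtv; fun_prop

variable {L α : ℝ} (hL : 0 < L)
  (hq : ∀ t, Y (L, t) = Complex.exp ((α * L : ℝ) * Complex.I) * Y (0, t))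
include hL

lemma hasSum_mass {p : ℝ → ℝ} (hp : Continuous p) (a b : ℝ) :
    HasSum (fun n : ℤ => ∫ t in a..b, p t * ‖cf L α n Y t‖ ^ 2) (strp L a b p Y) :=
  parseval hL hY.continuous hp a b

lemma hasSum_dt {p : ℝ → ℝ} (hp : Continuous p) (a b : ℝ) :
    HasSum (fun n : ℤ => ∫ t in a..b, p t * ‖deriv (cf L α n Y) t‖ ^ 2)
      (strp L a b p (dtv Y)) := by
  have h := parseval (α := α) hL (continuous_dtv hY) hp a b
  simp only [(hasDerivAt_cf hY _).deriv]
  exact h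

include hq

lemma hasSum_cov {p q : ℝ → ℝ} (hp : Continuous p) (hqc : Continuous q) (a b : ℝ) :
    HasSum (fun n : ℤ => ∫ t in a..b, p t * ((freq L α n + q t) ^ 2 * ‖cf L α n Y t‖ ^ 2))
      (strp L a b p (cov q Y)) := by
  have h := parseval (α := α) hL (continuous_cov hY hqc) hp a b
  have he : ∀ n t, ‖cf L α n (cov q Y) t‖ ^ 2 = (freq L α n + q t) ^ 2 * ‖cf L α n Y t‖ ^ 2 :=
    fun n t => cf_covariant hL hY hq q t
  simp only [he] at h
  exact h

/-- The strip form of the harmonic oscillator bound. -/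
lemma strip_oscillator {a b : ℝ} (hab : a ≤ b) (ha : ∀ s, Y (s, a) = 0) (hb : ∀ s, Y (s, b) = 0)
    (B : ℝ) : B * strp L a b (fun _ => 1) Y ≤
      strp L a b (fun _ => 1) (dtv Y) + strp L a b (fun _ => 1) (cov (fun t => B * t) Y) := by
  have h1 := (hasSum_mass (α := α) hY hL (p := fun _ => 1) continuous_const a b).mul_left B
  have h2 := (hasSum_dt (α := α) hY hL (p := fun _ => 1) continuous_const a b).add
    (hasSum_cov hY hL hq (p := fun _ => 1) (q := fun t => B * t) continuous_const (by fun_prop) a b)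
  refine hasSum_le (fun n => ?_) h1 h2
  have hc := contDiff_cf (L := L) (α := α) (n := n) hY
  have h := harmonic_oscillator hc hab (by simp [cf, ha]) (by simp [cf, hb]) (B := B)
    (freq L α n)
  have c1 := hc.continuous
  have c2 := continuous_deriv_of_contDiff_one hc
  simp only [one_mul]
  rwa [intervalIntegral.integral_add (Continuous.intervalIntegrable (by fun_prop) _ _)
    (Continuous.intervalIntegrable (by fun_prop) _ _)] at h

/-- The modewise bound summed over all Fourier modes. -/
lemma strip_modes {k₁ c C b l T A t₁ : ℝ} {m : ℕ} (hb : 0 < b) (hT : T = b * t₁)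
    (hYt : ∀ s t, t₁ ≤ t → Y (s, t) = 0)
    (hmode : ∀ ζ v, ContDiff ℝ 1 v → (∀ τ, T ≤ τ → v τ = 0) →
        c * b * (mass T v - en0 T ζ v) - C * (A + 1) * wenx T ζ m v ≤
          b ^ 2 * nrg T (b⁻¹ * k₁) ζ v - l * dens T (b⁻¹ * k₁) v) :
    c * b * (strp L 0 t₁ (fun _ => 1) Y - (b ^ 2)⁻¹ * (strp L 0 t₁ (fun _ => 1) (dtv Y) +
        strp L 0 t₁ (fun _ => 1) (cov (fun t => b ^ 2 * t) Y))) -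
      C * (A + 1) * ((b ^ 2)⁻¹ * (strp L 0 t₁ (fun t => (1 + b * t) ^ m) (dtv Y) +
        strp L 0 t₁ (fun t => (1 + b * t) ^ m) (cov (fun t => b ^ 2 * t) Y)) +
        strp L 0 t₁ (fun t => (1 + b * t) ^ m) Y) ≤
      strp L 0 t₁ (fun t => 1 - t * k₁) (dtv Y) +
        strp L 0 t₁ (fun t => 1 + t * k₁) (cov (fun t => b ^ 2 * (t - t ^ 2 * k₁ / 2)) Y) -
        l * strp L 0 t₁ (fun t => 1 - t * k₁) Y := by
  have M := fun {p : ℝ → ℝ} (hp : Continuous p) => hasSum_mass (α := α) hY hL hp 0 t₁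
  have D := fun {p : ℝ → ℝ} (hp : Continuous p) => hasSum_dt (α := α) hY hL hp 0 t₁
  have V := fun {p q : ℝ → ℝ} (hp : Continuous p) (hqc : Continuous q) =>
    hasSum_cov hY hL hq hp hqc 0 t₁
  have c1 : Continuous fun _ : ℝ => (1 : ℝ) := continuous_const
  have c2 : Continuous fun t : ℝ => b ^ 2 * t := by fun_prop
  have c3 : Continuous fun t : ℝ => (1 + b * t) ^ m := by fun_prop
  have c4 : Continuous fun t : ℝ => 1 - t * k₁ := by fun_prop
  have c5 : Continuous fun t : ℝ => 1 + t * k₁ := by fun_prop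
  have c6 : Continuous fun t : ℝ => b ^ 2 * (t - t ^ 2 * k₁ / 2) := by fun_prop
  refine hasSum_le (fun n => ?_) ((((M c1).sub (((D c1).add (V c1 c2)).mul_left _)).mul_left _).sub
    (((((D c3).add (V c3 c2)).mul_left _).add (M c3)).mul_left _))
    (((D c4).add (V c5 c6)).sub ((M c4).mul_left l))
  set f := cf L α n Y with hf
  have hc : ContDiff ℝ 1 f := contDiff_cf hY
  set v : ℝ → ℂ := fun τ => f (b⁻¹ * τ) with hv
  have hvc : ContDiff ℝ 1 v := hc.comp (by fun_prop)
  have hdv : ∀ τ, deriv v τ = (b⁻¹ : ℝ) • deriv f (b⁻¹ * τ) := fun τ => deriv_comp_mul_left _ _ _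
  have hv' : ∀ τ, v τ = f (b⁻¹ * τ) := fun _ => rfl
  have hv0 : ∀ τ, T ≤ τ → v τ = 0 := fun τ hτ => by
    have : t₁ ≤ b⁻¹ * τ := by rw [hT] at hτ; rwa [le_inv_mul_iff₀ hb]
    simp [hv, hf, cf, hYt _ _ this]
  have h := hmode (b⁻¹ * freq L α n) v hvc hv0
  have cf0 := hc.continuous
  have cf1 := continuous_deriv_of_contDiff_one hc
  have sub : ∀ g : ℝ → ℝ, ∫ τ in 0..T, g (b⁻¹ * τ) = b * ∫ t in 0..t₁, g t := fun g => by
    rw [intervalIntegral.integral_comp_mul_left _ (inv_ne_zero hb.ne'), hT, mul_zero,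
      inv_mul_cancel_left₀ hb.ne', inv_inv, smul_eq_mul]
  have I := fun {g : ℝ → ℝ} (hg : Continuous g) => hg.intervalIntegrable (μ := volume) 0 t₁
  have e1 : mass T v = b * ∫ t in 0..t₁, 1 * ‖f t‖ ^ 2 := by
    rw [mass, ← sub]; simp [hv]
  have e2 : en0 T (b⁻¹ * freq L α n) v = b * ((b ^ 2)⁻¹ * ((∫ t in 0..t₁, 1 * ‖deriv f t‖ ^ 2) +
      ∫ t in 0..t₁, 1 * ((freq L α n + b ^ 2 * t) ^ 2 * ‖f t‖ ^ 2))) := by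
    rw [← intervalIntegral.integral_add (I (by fun_prop)) (I (by fun_prop)),
      ← intervalIntegral.integral_const_mul, ← sub, en0]
    refine intervalIntegral.integral_congr fun τ _ => ?_
    simp only [hdv, hv', norm_smul, norm_inv, Real.norm_of_nonneg hb.le]
    field_simp
  have e3 : wenx T (b⁻¹ * freq L α n) m v = b * ((b ^ 2)⁻¹ *
      ((∫ t in 0..t₁, (1 + b * t) ^ m * ‖deriv f t‖ ^ 2) +
      ∫ t in 0..t₁, (1 + b * t) ^ m * ((freq L α n + b ^ 2 * t) ^ 2 * ‖f t‖ ^ 2)) +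
      ∫ t in 0..t₁, (1 + b * t) ^ m * ‖f t‖ ^ 2) := by
    rw [← intervalIntegral.integral_add (I (by fun_prop)) (I (by fun_prop)),
      ← intervalIntegral.integral_const_mul,
      ← intervalIntegral.integral_add (I (by fun_prop)) (I (by fun_prop)), ← sub, wenx]
    refine intervalIntegral.integral_congr fun τ _ => ?_
    simp only [hdv, hv', norm_smul, norm_inv, Real.norm_of_nonneg hb.le, mul_inv_cancel_left₀ hb.ne']
    field_simp
    ring
  have e4 : b ^ 2 * nrg T (b⁻¹ * k₁) (b⁻¹ * freq L α n) v = b *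
      ((∫ t in 0..t₁, (1 - t * k₁) * ‖deriv f t‖ ^ 2) +
      ∫ t in 0..t₁, (1 + t * k₁) *
        ((freq L α n + b ^ 2 * (t - t ^ 2 * k₁ / 2)) ^ 2 * ‖f t‖ ^ 2)) := by
    rw [← intervalIntegral.integral_add (I (by fun_prop)) (I (by fun_prop)), ← sub, nrg,
      ← intervalIntegral.integral_const_mul]
    refine intervalIntegral.integral_congr fun τ _ => ?_
    simp only [hdv, hv', norm_smul, norm_inv, Real.norm_of_nonneg hb.le, pot]
    field_simp
    ring
  have e5 : dens T (b⁻¹ * k₁) v = b * ∫ t in 0..t₁, (1 - t * k₁) * ‖f t‖ ^ 2 := by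
    rw [← sub, dens]
    refine intervalIntegral.integral_congr fun τ _ => ?_
    simp only [hv]
    ring_nf
  rw [e1, e2, e3, e4, e5] at h
  refine le_of_mul_le_mul_left ?_ hb
  linarith

end

/-- Compactly supported functions in the whole plane satisfy the harmonic oscillator bound. -/
lemma plane_oscillator {Ω : Set Plane} (hbd : Bornology.IsBounded Ω) {f : Plane → ℂ}
    (hf : ContDiff ℝ 1 f) (h0 : ∀ x ∉ Ω, f x = 0) (h1 : ∀ x ∉ Ω, fderiv ℝ f x = 0) (B : ℝ) :
    B * nsq Ω f ≤ Qf Ω B f := by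
  obtain ⟨R, hR, hΩ⟩ : ∃ R > 0, ∀ x ∈ Ω, ‖x‖ < R := by
    obtain ⟨R, hR⟩ := hbd.exists_norm_le
    exact ⟨|R| + 1, by positivity, fun x hx => by linarith [hR x hx, le_abs_self R]⟩
  have hsub : Ω ⊆ Ioc (-R) R ×ˢ Ioc (-R) R := fun x hx => by
    have h := hΩ x hx
    have a := abs_lt.1 ((norm_fst_le x).trans_lt h)
    have b := abs_lt.1 ((norm_snd_le x).trans_lt h)
    exact ⟨⟨a.1, a.2.le⟩, b.1, b.2.le⟩
  have hrect : ∀ F : Plane → ℝ, Continuous F → (∀ x ∉ Ω, F x = 0) →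
      ∫ x in Ω, F x = ∫ t in (-R)..R, ∫ s in 0..(2 * R), F ((s, t) - (R, 0)) := by
    intro F hF hF0
    rw [← setIntegral_eq_of_subset_of_forall_sdiff_eq_zero
      (measurableSet_Ioc.prod measurableSet_Ioc) hsub (fun x hx => hF0 x hx.2),
      setIntegral_rect hF (by linarith) (by linarith)]
    refine intervalIntegral.integral_congr fun t _ => ?_
    have := intervalIntegral.integral_comp_sub_right (fun s => F (s, t)) R (a := 0) (b := 2 * R)
    simp only [Prod.mk_sub_mk, sub_zero]
    rw [this]
    congr 1 <;> ring
  set θ : Plane → ℝ := fun x => -(B * x.1 * x.2 / 2) with hθ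
  have hθc : ContDiff ℝ 1 θ := by fun_prop
  set Z : Plane → ℂ := fun x => Complex.exp (θ x * Complex.I) * f x with hZ
  have hZc : ContDiff ℝ 1 Z := contDiff_gauge hf hθc
  set Y : Plane → ℂ := fun x => Z (x - (R, 0)) with hY
  have hYc : ContDiff ℝ 1 Y := hZc.comp (by fun_prop)
  have hout : ∀ s t, R ≤ |t| ∨ R ≤ |s| → Z (s, t) = 0 := fun s t h => by
    have : ((s, t) : Plane) ∉ Ω := fun hm => by
      have h2 := hΩ _ hm
      have a := (norm_fst_le ((s, t) : Plane)).trans_lt h2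
      have b := (norm_snd_le ((s, t) : Plane)).trans_lt h2
      simp only [Real.norm_eq_abs] at a b
      rcases h with h | h <;> linarith
    simp [hZ, h0 _ this]
  have hRR : R ≤ |R| := le_abs_self R
  have hRR' : R ≤ |-R| := by rw [abs_neg]; exact hRR
  have key := strip_oscillator (α := 0) hYc (L := 2 * R) (by linarith) (a := -R) (b := R)
    (fun t => by simp [hY, hout, hRR, two_mul]) (by linarith)
    (fun s => by simpa [hY] using hout _ _ (.inl hRR'))
    (fun s => by simpa [hY] using hout _ _ (.inl hRR)) B
  have hdY : ∀ x v, fderiv ℝ Y x v = fderiv ℝ Z (x - (R, 0)) v := fun x v => by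
    rw [hY, fderiv_comp_sub]
  have hdθ : ∀ x v, fderiv ℝ θ x v = -(B * (v.1 * x.2 + x.1 * v.2) / 2) := fun x v => by
    have h1 : HasFDerivAt (fun x : Plane => x.1) (ContinuousLinearMap.fst ℝ ℝ ℝ) x :=
      hasFDerivAt_fst
    have h2 : HasFDerivAt (fun x : Plane => x.2) (ContinuousLinearMap.snd ℝ ℝ ℝ) x :=
      hasFDerivAt_snd
    have h : HasFDerivAt θ _ x := (((h1.const_mul B).mul h2).mul_const (1 / 2)).neg.congr_of_eventuallyEq
      (Eventually.of_forall fun y => by simp [hθ]; ring)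
    rw [h.fderiv]
    simp
    ring
  have hg : ∀ x v, -Complex.I * fderiv ℝ Z x v = Complex.exp (θ x * Complex.I) *
      (-Complex.I * fderiv ℝ f x v + (fderiv ℝ θ x v : ℝ) * f x) := fun x v => by
    have := Pv_gauge hf hθc 0 x v
    simpa [Pv] using this
  have hnI : ∀ z : ℂ, ‖z‖ = ‖-Complex.I * z‖ := fun z => by simp
  have hc1 : ∀ x, ‖cov (fun t => B * t) Y x‖ = ‖P1 B f (x - (R, 0))‖ := fun x => by
    have : -Complex.I * cov (fun t => B * t) Y x =
        Complex.exp (θ (x - (R, 0)) * Complex.I) * P1 B f (x - (R, 0)) := by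
      have h := hg (x - (R, 0)) (1, 0)
      simp only [cov, hdY, P1, Pv, F0, dot2, mul_add]
      rw [h, hdθ]
      simp only [hY, hZ, Prod.snd_sub, Prod.fst_sub]
      push_cast
      linear_combination (-(B * x.2 : ℂ) * Complex.exp (θ (x - (R, 0)) * Complex.I) *
        f (x - (R, 0))) * Complex.I_sq
    rw [hnI, this, norm_mul, Complex.norm_exp_ofReal_mul_I, one_mul]
  have hc2 : ∀ x, ‖dtv Y x‖ = ‖P2 B f (x - (R, 0))‖ := fun x => by
    have : -Complex.I * dtv Y x =
        Complex.exp (θ (x - (R, 0)) * Complex.I) * P2 B f (x - (R, 0)) := by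
      have h := hg (x - (R, 0)) (0, 1)
      simp only [dtv, hdY, P2, Pv, F0, dot2]
      rw [h, hdθ]
      simp only [Prod.snd_sub, Prod.fst_sub]
      push_cast
      ring
    rw [hnI, this, norm_mul, Complex.norm_exp_ofReal_mul_I, one_mul]
  have hc0 : ∀ x, ‖Y x‖ = ‖f (x - (R, 0))‖ := fun x => by
    simp only [hY, hZ]
    rw [norm_mul, Complex.norm_exp_ofReal_mul_I, one_mul]
  simp only [strp, hc0, hc1, hc2, one_mul] at key
  have q0 := hrect (fun x => ‖f x‖ ^ 2) (by have := hf.continuous; fun_prop)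
    (fun x hx => by simp [h0 x hx])
  have q1 := hrect (fun x => ‖P1 B f x‖ ^ 2) (by have := continuous_P1 (B := B) hf; fun_prop)
    (fun x hx => by simp [P1, Pv, h0 x hx, h1 x hx])
  have q2 := hrect (fun x => ‖P2 B f x‖ ^ 2) (by have := continuous_P2 (B := B) hf; fun_prop)
    (fun x hx => by simp [P2, Pv, h0 x hx, h1 x hx])
  have q3 : Qf Ω B f = (∫ x in Ω, ‖P1 B f x‖ ^ 2) + ∫ x in Ω, ‖P2 B f x‖ ^ 2 := by
    rw [Qf, ← integral_add (integrableOn_of_continuous hbd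
      (by have := continuous_P1 (B := B) hf; fun_prop)) (integrableOn_of_continuous hbd
      (by have := continuous_P2 (B := B) hf; fun_prop))]
    exact integral_congr_ae (Eventually.of_forall fun x => magSq_eq B f x)
  rw [q3, nsq, q0, q1, q2]
  linarith

end SC

namespace SC

/-- The linear map of the plane with given columns. -/
def colMap (v w : Plane) : Plane →L[ℝ] Plane :=
  (ContinuousLinearMap.fst ℝ ℝ ℝ).smulRight v + (ContinuousLinearMap.snd ℝ ℝ ℝ).smulRight w

lemma colMap_apply (v w h : Plane) : colMap v w h = h.1 • v + h.2 • w := by simp [colMap]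

lemma colMap_det (v w : Plane) : (colMap v w).det = v.1 * w.2 - v.2 * w.1 := by
  rw [ContinuousLinearMap.det, ← LinearMap.det_toMatrix (Module.Basis.finTwoProd ℝ),
    Matrix.det_fin_two]
  simp [LinearMap.toMatrix_apply, colMap_apply]
  ring

lemma hasDerivAt_fst' {f : ℝ → Plane} {f' : Plane} {s : ℝ} (h : HasDerivAt f f' s) :
    HasDerivAt (fun x => (f x).1) f'.1 s :=
  (ContinuousLinearMap.fst ℝ ℝ ℝ).hasFDerivAt.comp_hasDerivAt s h

lemma hasDerivAt_snd' {f : ℝ → Plane} {f' : Plane} {s : ℝ} (h : HasDerivAt f f' s) :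
    HasDerivAt (fun x => (f x).2) f'.2 s :=
  (ContinuousLinearMap.snd ℝ ℝ ℝ).hasFDerivAt.comp_hasDerivAt s h

variable {Ω : Set Plane} (P : BoundaryParam Ω)

/-- Tubular coordinates near the boundary. -/
def tub (p : Plane) : Plane := P.γ p.1 + p.2 • nuVec P.γ p.1

/-- The curvature as a function of arclength. -/
def kap (s : ℝ) : ℝ := curvOf P.γ s

namespace BoundaryParam

lemma contDiff_deriv : ContDiff ℝ (⊤ : ℕ∞) (deriv P.γ) :=
  (contDiff_infty_iff_deriv.1 P.smooth).2

lemma contDiff_deriv₂ : ContDiff ℝ (⊤ : ℕ∞) (deriv (deriv P.γ)) :=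
  (contDiff_infty_iff_deriv.1 P.contDiff_deriv).2

lemma contDiff_nu : ContDiff ℝ (⊤ : ℕ∞) (nuVec P.γ) := by
  have h := P.contDiff_deriv
  unfold nuVec; fun_prop

lemma contDiff_kap : ContDiff ℝ (⊤ : ℕ∞) (kap P) := by
  have h := P.contDiff_nu
  have h' := P.contDiff_deriv₂
  exact (h'.fst.mul h.fst).add (h'.snd.mul h.snd)

lemma contDiff_tub : ContDiff ℝ (⊤ : ℕ∞) (tub P) := by
  have h := P.contDiff_nu
  have h' := P.smooth
  unfold tub; fun_prop

lemma hasDerivAt (s : ℝ) : HasDerivAt P.γ (deriv P.γ s) s :=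
  (P.smooth.differentiable (by simp) s).hasDerivAt

lemma unit (s : ℝ) : (deriv P.γ s).1 ^ 2 + (deriv P.γ s).2 ^ 2 = 1 := P.unit_speed s

/-- First Frenet equation. -/
lemma deriv₂_eq (s : ℝ) : deriv (deriv P.γ) s = kap P s • nuVec P.γ s := by
  have h : HasDerivAt (deriv P.γ) (deriv (deriv P.γ) s) s :=
    (P.contDiff_deriv.differentiable (by simp) s).hasDerivAt
  have h1 := hasDerivAt_fst' h
  have h2 := hasDerivAt_snd' h
  have h3 := (h1.pow 2).add (h2.pow 2)
  have h4 : HasDerivAt (fun s => (deriv P.γ s).1 ^ 2 + (deriv P.γ s).2 ^ 2) 0 s := by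
    simp only [P.unit]; exact hasDerivAt_const _ _
  have h5 := h3.unique h4
  have u := P.unit s
  simp only [Nat.cast_ofNat, Nat.add_one_sub_one, pow_one] at h5
  ext
  · simp only [kap, curvOf, dot2, nuVec, Prod.smul_fst, smul_eq_mul]
    linear_combination (-(deriv (deriv P.γ) s).1) * u + (deriv P.γ s).1 / 2 * h5
  · simp only [kap, curvOf, dot2, nuVec, Prod.smul_snd, smul_eq_mul]
    linear_combination (-(deriv (deriv P.γ) s).2) * u + (deriv P.γ s).2 / 2 * h5

lemma hasDerivAt_deriv (s : ℝ) : HasDerivAt (deriv P.γ) (kap P s • nuVec P.γ s) s := by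
  rw [← P.deriv₂_eq]
  exact (P.contDiff_deriv.differentiable (by simp) s).hasDerivAt

/-- Second Frenet equation. -/
lemma hasDerivAt_nu (s : ℝ) : HasDerivAt (nuVec P.γ) (-(kap P s) • deriv P.γ s) s := by
  have h := P.hasDerivAt_deriv s
  convert (hasDerivAt_snd' h).neg.prodMk (hasDerivAt_fst' h) using 1
  · rfl
  · ext <;> simp [nuVec]

lemma hasFDerivAt_tub (p : Plane) : HasFDerivAt (tub P)
    (colMap ((1 - p.2 * kap P p.1) • deriv P.γ p.1) (nuVec P.γ p.1)) p := by
  have h1 : HasFDerivAt (fun p : Plane => p.1) (ContinuousLinearMap.fst ℝ ℝ ℝ) p := hasFDerivAt_fst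
  have h2 : HasFDerivAt (fun p : Plane => p.2) (ContinuousLinearMap.snd ℝ ℝ ℝ) p := hasFDerivAt_snd
  have a := (P.hasDerivAt p.1).hasFDerivAt.comp p h1
  have b := (P.hasDerivAt_nu p.1).hasFDerivAt.comp p h1
  refine (a.add (h2.smul b)).congr_fderiv ?_
  ext <;> simp [colMap_apply] <;> ring

lemma det_tub (p : Plane) :
    (colMap ((1 - p.2 * kap P p.1) • deriv P.γ p.1) (nuVec P.γ p.1)).det = 1 - p.2 * kap P p.1 := by
  rw [colMap_det]
  simp only [nuVec, Prod.smul_fst, Prod.smul_snd, smul_eq_mul]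
  linear_combination (1 - p.2 * kap P p.1) * P.unit p.1

lemma periodic_deriv : Function.Periodic (deriv P.γ) P.L := fun s => by
  have : (fun x => P.γ (x + P.L)) = P.γ := funext P.periodic
  rw [← deriv_comp_add_const, this]

lemma periodic_nu : Function.Periodic (nuVec P.γ) P.L := fun s => by
  simp only [nuVec, P.periodic_deriv s]

lemma periodic_kap : Function.Periodic (kap P) P.L := fun s => by
  have : (fun x => deriv P.γ (x + P.L)) = deriv P.γ := funext P.periodic_deriv
  simp only [kap, curvOf, P.periodic_nu s]
  rw [← deriv_comp_add_const, this]

lemma tub_add_zsmul (p : Plane) (n : ℤ) : tub P (p.1 + n * P.L, p.2) = tub P p := by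
  have h1 := P.periodic.int_mul n p.1
  have h2 := P.periodic_nu.int_mul n p.1
  simp only [tub, h1, h2]

lemma exists_reduce (s : ℝ) : ∃ n : ℤ, s + n * P.L ∈ Ico 0 P.L := by
  refine ⟨-toIcoDiv P.L_pos 0 s, ?_⟩
  have := toIcoMod_mem_Ico P.L_pos 0 s
  rw [zero_add, toIcoMod, zsmul_eq_mul] at this
  convert this using 1
  push_cast; ring

lemma kap_bdd : ∃ K : ℝ, 0 < K ∧ ∀ s, |kap P s| ≤ K := by
  obtain ⟨K, hK⟩ := (isCompact_Icc (a := (0 : ℝ)) (b := P.L)).exists_bound_of_continuousOn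
    P.contDiff_kap.continuous.continuousOn
  refine ⟨|K| + 1, by positivity, fun s => ?_⟩
  obtain ⟨n, hn⟩ := P.exists_reduce s
  have := hK _ (Ico_subset_Icc_self hn)
  rw [P.periodic_kap.int_mul n s] at this
  exact this.trans (by linarith [le_abs_self K])

lemma eq_of_gamma_eq {s s' : ℝ} (h : P.γ s = P.γ s') : ∃ n : ℤ, s = s' + n * P.L := by
  obtain ⟨n, hn⟩ := P.exists_reduce s
  obtain ⟨m, hm⟩ := P.exists_reduce s'
  have := P.injOn hn hm (by rw [P.periodic.int_mul n s, P.periodic.int_mul m s', h])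
  exact ⟨m - n, by push_cast; linarith⟩

lemma gamma_notMem (ho : IsOpen Ω) (s : ℝ) : P.γ s ∉ Ω := fun h => by
  have h2 : P.γ s ∈ frontier Ω := P.range_eq ▸ mem_range_self s
  rw [ho.frontier_eq] at h2
  exact h2.2 h

lemma map_nhds_tub {p : Plane} (hp : 1 - p.2 * kap P p.1 ≠ 0) :
    ∃ e : OpenPartialHomeomorph Plane Plane, p ∈ e.source ∧ (e : Plane → Plane) = tub P ∧
      ∀ n : WithTop ℕ∞, n ≤ (⊤ : ℕ∞) → ContDiffAt ℝ n e.symm (tub P p) := by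
  have hdet : (colMap ((1 - p.2 * kap P p.1) • deriv P.γ p.1) (nuVec P.γ p.1)).det ≠ 0 := by
    rwa [P.det_tub]
  set A := ContinuousLinearMap.toContinuousLinearEquivOfDetNeZero _ hdet with hA
  have hf : HasFDerivAt (tub P) (A : Plane →L[ℝ] Plane) p := by
    rw [hA, ContinuousLinearMap.coe_toContinuousLinearEquivOfDetNeZero]
    exact P.hasFDerivAt_tub p
  have hc : ContDiffAt ℝ (⊤ : ℕ∞) (tub P) p := P.contDiff_tub.contDiffAt
  refine ⟨hc.toOpenPartialHomeomorph _ hf (by simp),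
    hc.mem_toOpenPartialHomeomorph_source hf (by simp), rfl, fun n hn => ?_⟩
  exact (hc.to_localInverse hf (by simp)).of_le hn

end BoundaryParam

/-- A tubular neighbourhood of the boundary of half-width `t₀`. -/
structure Tube where
  t₀ : ℝ
  pos : 0 < t₀
  le_one : t₀ ≤ 1
  curv : ∀ s, |kap P s| * t₀ ≤ 1 / 2
  inj : ∀ p q : Plane, |p.2| < t₀ → |q.2| < t₀ → tub P p = tub P q →
    p.2 = q.2 ∧ ∃ n : ℤ, p.1 = q.1 + n * P.L
  mem : ∀ p : Plane, 0 < p.2 → p.2 < t₀ → tub P p ∈ Ω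
  notMem : ∀ p : Plane, -t₀ < p.2 → p.2 ≤ 0 → tub P p ∉ Ω

lemma tub_inj : ∃ t₀ > 0, ∀ p q : Plane, |p.2| < t₀ → |q.2| < t₀ → tub P p = tub P q →
    p.2 = q.2 ∧ ∃ n : ℤ, p.1 = q.1 + n * P.L := by
  have hcT := P.contDiff_tub.continuous
  have key : ∀ᶠ t : ℝ × ℝ in 𝓝 (0, 0), ∀ σ ∈ Icc 0 P.L ×ˢ Icc 0 P.L,
      tub P (σ.1, t.1) = tub P (σ.2, t.2) → t.1 = t.2 ∧ ∃ n : ℤ, σ.1 = σ.2 + n * P.L := by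
    refine (isCompact_Icc.prod isCompact_Icc).eventually_forall_of_forall_eventually
      fun σ _ => ?_
    by_cases hσ : P.γ σ.1 = P.γ σ.2
    · obtain ⟨n, hn⟩ := P.eq_of_gamma_eq hσ
      obtain ⟨e, he, heq, -⟩ := P.map_nhds_tub (p := (σ.1, 0)) (by simp)
      have hs := e.open_source.mem_nhds he
      have c1 : Tendsto (fun z : (ℝ × ℝ) × (ℝ × ℝ) => ((z.2.1, z.1.1) : Plane)) (𝓝 ((0, 0), σ))
          (𝓝 (σ.1, 0)) := Continuous.tendsto' (by fun_prop) _ _ rfl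
      have c2 : Tendsto (fun z : (ℝ × ℝ) × (ℝ × ℝ) => ((z.2.2 + n * P.L, z.1.2) : Plane))
          (𝓝 ((0, 0), σ)) (𝓝 (σ.1, 0)) := Continuous.tendsto' (by fun_prop) _ _ (by simp [hn])
      filter_upwards [c1 hs, c2 hs] with z h1 h2 hz
      have h3 := e.injOn h1 h2 (by rw [heq, hz]; exact (P.tub_add_zsmul (z.2.2, z.1.2) n).symm)
      simp only [Prod.mk.injEq] at h3
      exact ⟨h3.2, n, h3.1⟩
    · have c1 : ContinuousAt (fun z : (ℝ × ℝ) × (ℝ × ℝ) => tub P (z.2.1, z.1.1)) ((0, 0), σ) :=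
        Continuous.continuousAt (by fun_prop)
      have c2 : ContinuousAt (fun z : (ℝ × ℝ) × (ℝ × ℝ) => tub P (z.2.2, z.1.2)) ((0, 0), σ) :=
        Continuous.continuousAt (by fun_prop)
      have hne : tub P (σ.1, 0) ≠ tub P (σ.2, 0) := by simpa [tub] using hσ
      filter_upwards [(ContinuousAt.ne_iff_eventually_ne c1 c2).1 hne] with z hz h
      exact absurd h hz
  obtain ⟨t₀, ht₀, h⟩ := Metric.eventually_nhds_iff.1 key
  refine ⟨t₀, ht₀, fun p q hp hq hpq => ?_⟩
  obtain ⟨n, hn⟩ := P.exists_reduce p.1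
  obtain ⟨m, hm⟩ := P.exists_reduce q.1
  have h1 := @h (p.2, q.2) (by simpa [Prod.dist_eq, Real.dist_eq] using ⟨hp, hq⟩)
    (p.1 + n * P.L, q.1 + m * P.L) ⟨Ico_subset_Icc_self hn, Ico_subset_Icc_self hm⟩
    (by simp only; rw [P.tub_add_zsmul p n, P.tub_add_zsmul q m, hpq])
  obtain ⟨h2, l, h3⟩ := h1
  exact ⟨h2, l + m - n, by simp only at h3; push_cast; linarith⟩

lemma tube_curve_disjoint {t₀ : ℝ} (ht₀ : 0 < t₀)
    (hinj : ∀ p q : Plane, |p.2| < t₀ → |q.2| < t₀ → tub P p = tub P q →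
      p.2 = q.2 ∧ ∃ n : ℤ, p.1 = q.1 + n * P.L) {p : Plane} (hp : |p.2| < t₀) (h0 : p.2 ≠ 0) :
    tub P p ∉ frontier Ω := fun h => by
  rw [← P.range_eq] at h
  obtain ⟨s, hs⟩ := h
  exact h0 (hinj p (s, 0) hp (by simpa using ht₀) (by rw [← hs]; simp [tub])).1

lemma tub_side {I : Set ℝ} (hI : IsPreconnected I) (ho : IsOpen Ω)
    (hfr : ∀ s, ∀ t ∈ I, tub P (s, t) ∉ frontier Ω) {s₀ t₀ : ℝ} (ht₀ : t₀ ∈ I)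
    (h0 : tub P (s₀, t₀) ∈ Ω) (s t : ℝ) (ht : t ∈ I) : tub P (s, t) ∈ Ω := by
  have hpre : IsPreconnected (tub P '' (univ ×ˢ I)) :=
    (isPreconnected_univ.prod hI).image _ P.contDiff_tub.continuous.continuousOn
  have hsub : tub P '' (univ ×ˢ I) ⊆ Ω ∪ (closure Ω)ᶜ := by
    rintro _ ⟨⟨a, b⟩, hp, rfl⟩
    by_contra hcon
    simp only [mem_union, mem_compl_iff, not_or, not_not] at hcon
    exact hfr a b hp.2 (ho.frontier_eq ▸ ⟨hcon.2, hcon.1⟩)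
  exact hpre.subset_left_of_subset_union ho isClosed_closure.isOpen_compl
    (disjoint_compl_right.mono_left subset_closure) hsub
    ⟨_, mem_image_of_mem _ (⟨mem_univ s₀, ht₀⟩ : (s₀, t₀) ∈ univ ×ˢ I), h0⟩
    (mem_image_of_mem _ (⟨mem_univ s, ht⟩ : (s, t) ∈ univ ×ˢ I))

lemma exists_tube (ho : IsOpen Ω) (hb : Bornology.IsBounded Ω) : Nonempty (Tube P) := by
  obtain ⟨t₁, ht₁, hinj⟩ := tub_inj P
  obtain ⟨K, hK, hkap⟩ := P.kap_bdd
  set t₀ := min (min t₁ 1) (1 / (2 * K)) with ht₀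
  have hpos : 0 < t₀ := by positivity
  have hle : t₀ ≤ t₁ := (min_le_left _ _).trans (min_le_left _ _)
  have hinj' : ∀ p q : Plane, |p.2| < t₀ → |q.2| < t₀ → tub P p = tub P q →
      p.2 = q.2 ∧ ∃ n : ℤ, p.1 = q.1 + n * P.L :=
    fun p q hp hq => hinj p q (hp.trans_le hle) (hq.trans_le hle)
  have hcurv : ∀ s, |kap P s| * t₀ ≤ 1 / 2 := fun s =>
    (mul_le_mul (hkap s) (min_le_right _ _) hpos.le hK.le).trans (le_of_eq (by field_simp))
  have hfr := fun (p : Plane) => tube_curve_disjoint P hpos hinj' (p := p)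
  have hmem : ∀ p : Plane, 0 < p.2 → p.2 < t₀ → tub P p ∈ Ω := by
    intro p hp0 hp1
    obtain ⟨ε, hε, h⟩ := P.inward 0
    have hm : min ε t₀ / 2 < min ε t₀ := half_lt_self (by positivity)
    exact tub_side P (I := Ioo 0 t₀) isPreconnected_Ioo ho
      (fun s t ht => hfr (s, t) (abs_lt.2 ⟨by linarith [ht.1], ht.2⟩) ht.1.ne')
      (s₀ := 0) (t₀ := min ε t₀ / 2) ⟨by positivity, hm.trans_le (min_le_right _ _)⟩
      (h _ ⟨by positivity, hm.trans_le (min_le_left _ _)⟩) p.1 p.2 ⟨hp0, hp1⟩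
  refine ⟨⟨t₀, hpos, (min_le_left _ _).trans (min_le_right _ _), hcurv, hinj', hmem, ?_⟩⟩
  intro p hp0 hp1 hpΩ
  rcases hp1.eq_or_lt with hp1 | hp1
  · exact P.gamma_notMem ho p.1 (by simpa [tub, hp1] using hpΩ)
  have hneg := tub_side P (I := Ioo (-t₀) 0) isPreconnected_Ioo ho
    (fun s t ht => hfr (s, t) (abs_lt.2 ⟨ht.1, by linarith [ht.2]⟩) ht.2.ne)
    (s₀ := p.1) (t₀ := p.2) ⟨hp0, hp1⟩ hpΩ
  have hall : ∀ q : Plane, |q.2| < t₀ → tub P q ∈ closure Ω := fun q hq => by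
    rw [abs_lt] at hq
    rcases lt_trichotomy q.2 0 with h | h | h
    · exact subset_closure (hneg q.1 q.2 ⟨hq.1, h⟩)
    · have : P.γ q.1 ∈ frontier Ω := P.range_eq ▸ mem_range_self q.1
      simpa [tub, h] using frontier_subset_closure this
    · exact subset_closure (hmem q h hq.2)
  have hopen : IsOpen (closure Ω) := by
    refine isOpen_iff_mem_nhds.2 fun x hx => ?_
    by_cases hxΩ : x ∈ Ω
    · exact mem_of_superset (ho.mem_nhds hxΩ) subset_closure
    have : x ∈ frontier Ω := by rw [ho.frontier_eq]; exact ⟨hx, hxΩ⟩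
    rw [← P.range_eq] at this
    obtain ⟨s, rfl⟩ := this
    obtain ⟨e, he, heq, -⟩ := P.map_nhds_tub (p := (s, 0)) (by simp)
    have h1 := e.map_nhds_eq he
    rw [heq] at h1
    have h2 : tub P (s, 0) = P.γ s := by simp [tub]
    rw [← h2, ← h1, mem_map]
    have h3 : ∀ᶠ q : Plane in 𝓝 (s, 0), |q.2| < t₀ :=
      (continuous_abs.comp continuous_snd).continuousAt.eventually_lt continuousAt_const
        (by simpa using hpos)
    filter_upwards [h3] with q hq using hall q hq
  have huniv : closure Ω = univ :=
    IsClopen.eq_univ ⟨isClosed_closure, hopen⟩ ⟨_, hall p (abs_lt.2 ⟨hp0, by linarith⟩)⟩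
  have := hb.closure
  rw [huniv] at this
  exact NormedSpace.unbounded_univ ℝ Plane this

end SC

namespace SC

variable {Ω : Set Plane} {P : BoundaryParam Ω}

lemma Tube.jac_ge (T : Tube P) {p : Plane} (hp : |p.2| ≤ T.t₀) : 1 / 2 ≤ 1 - p.2 * kap P p.1 := by
  have h1 : |p.2 * kap P p.1| ≤ 1 / 2 := by
    rw [abs_mul, mul_comm]
    exact (mul_le_mul_of_nonneg_left hp (abs_nonneg _)).trans (T.curv _)
  linarith [le_abs_self (p.2 * kap P p.1)]

lemma Tube.eq_of_window (T : Tube P) {p q : Plane} (hp : |p.2| < T.t₀) (hq : |q.2| < T.t₀)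
    (hpq : |p.1 - q.1| < P.L) (h : tub P p = tub P q) : p = q := by
  obtain ⟨h2, n, hn⟩ := T.inj p q hp hq h
  have hL := P.L_pos
  have : |(n : ℝ)| * P.L < 1 * P.L := by
    rw [hn, add_sub_cancel_left, abs_mul, abs_of_pos hL] at hpq; linarith
  have h3 : |(n : ℝ)| < 1 := lt_of_mul_lt_mul_right this hL.le
  have h4 : n = 0 := by rw [← Int.abs_lt_one_iff]; exact_mod_cast h3
  rw [h4] at hn
  exact Prod.ext (by simpa using hn) h2

variable (P) in
open Classical in
/-- Transport of a function from tubular coordinates to the plane. -/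
def push {E : Type*} [Zero E] (S : Set Plane) (G : Plane → E) (x : Plane) : E :=
  if h : ∃ p ∈ S, tub P p = x then G h.choose else 0

section push
variable {E : Type*} [NormedAddCommGroup E] {S K : Set Plane} {G : Plane → E}

lemma push_tub (hc : ∀ p ∈ S, ∀ q ∈ S, tub P p = tub P q → G p = G q) {p : Plane} (hp : p ∈ S) :
    push P S G (tub P p) = G p := by
  have h : ∃ q ∈ S, tub P q = tub P p := ⟨p, hp, rfl⟩
  rw [push, dif_pos h]
  exact hc _ h.choose_spec.1 _ hp h.choose_spec.2

lemma push_zero {x : Plane} (hx : ∀ p ∈ S, tub P p ≠ x) : push P S G x = 0 := by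
  rw [push, dif_neg]
  rintro ⟨p, hp, h⟩
  exact hx p hp h

variable [NormedSpace ℝ E]

lemma push_contDiff (T : Tube P) (hS : IsOpen S) (hSt : ∀ p ∈ S, |p.2| < T.t₀) {n : WithTop ℕ∞}
    (hn : n ≤ (⊤ : ℕ∞)) (hG : ContDiff ℝ n G)
    (hc : ∀ p ∈ S, ∀ q ∈ S, tub P p = tub P q → G p = G q) (hK : IsCompact K) (hKS : K ⊆ S)
    (h0 : ∀ p ∈ S, tub P p ∉ tub P '' K → G p = 0) :
    ContDiff ℝ n (push P S G) ∧ tsupport (push P S G) ⊆ tub P '' K := by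
  have hKc : IsClosed (tub P '' K) := (hK.image P.contDiff_tub.continuous).isClosed
  have hoff : ∀ x ∉ tub P '' K, push P S G x = 0 := fun x hx => by
    by_cases h : ∃ p ∈ S, tub P p = x
    · obtain ⟨p, hp, rfl⟩ := h
      rw [push_tub hc hp, h0 p hp hx]
    · push Not at h
      exact push_zero h
  refine ⟨contDiff_iff_contDiffAt.2 fun x => ?_,
    closure_minimal (fun x hx => not_not.1 fun h => hx (hoff x h)) hKc⟩
  by_cases hx : x ∈ tub P '' K
  · obtain ⟨p, hp, rfl⟩ := hx
    have hpS := hKS hp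
    obtain ⟨e, he, heq, hsm⟩ := P.map_nhds_tub (p := p)
      (by linarith [T.jac_ge (hSt p hpS).le] : 1 - p.2 * kap P p.1 ≠ 0)
    have hs := hsm n hn
    have hsp : e.symm (tub P p) = p := by rw [← heq, e.left_inv he]
    have htar : tub P p ∈ e.target := by rw [← heq]; exact e.map_source he
    have h1 : ∀ᶠ y in 𝓝 (tub P p), e.symm y ∈ S :=
      hs.continuousAt.eventually_mem (by rw [hsp]; exact hS.mem_nhds hpS)
    refine ContDiffAt.congr_of_eventuallyEq (hG.contDiffAt.comp _ hs) ?_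
    filter_upwards [h1, e.open_target.mem_nhds htar] with y hy hyt
    have := push_tub hc hy
    rwa [← heq, e.right_inv hyt] at this
  · refine ContDiffAt.congr_of_eventuallyEq (contDiffAt_const (c := (0 : E))) ?_
    filter_upwards [hKc.isOpen_compl.mem_nhds hx] with y hy using hoff y hy

end push

/-- A function of the distance variable, cut off inside the tube, is smooth on the plane. -/
lemma exists_strip_fn (T : Tube P) {t₁ : ℝ} (h1 : t₁ < T.t₀) {h : ℝ → ℝ}
    (hh : ContDiff ℝ (⊤ : ℕ∞) h) (h0 : ∀ t, t₁ < |t| → h t = 0) :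
    ∃ F : Plane → ℝ, ContDiff ℝ (⊤ : ℕ∞) F ∧ (∀ p : Plane, |p.2| < T.t₀ → F (tub P p) = h p.2) ∧
      (∀ x, (∀ p : Plane, |p.2| < T.t₀ → tub P p ≠ x) → F x = 0) ∧
      tsupport F ⊆ tub P '' (Icc 0 P.L ×ˢ Icc (-t₁) t₁) := by
  set S : Set Plane := {p | |p.2| < T.t₀} with hS
  have hSo : IsOpen S := isOpen_lt (by fun_prop) continuous_const
  have hc : ∀ p ∈ S, ∀ q ∈ S, tub P p = tub P q → h p.2 = h q.2 := fun p hp q hq hpq => by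
    rw [(T.inj p q hp hq hpq).1]
  have hp := push_contDiff (G := fun p : Plane => h p.2) (K := Icc 0 P.L ×ˢ Icc (-t₁) t₁) T hSo
    (fun p hp => hp) le_rfl (hh.comp contDiff_snd) hc (isCompact_Icc.prod isCompact_Icc)
    (fun p hp => (abs_le.2 hp.2).trans_lt h1) (fun p hp hpK => h0 _ (by
      by_contra hcon
      obtain ⟨n, hn⟩ := P.exists_reduce p.1
      exact hpK ⟨(p.1 + n * P.L, p.2), ⟨Ico_subset_Icc_self hn, abs_le.1 (not_lt.1 hcon)⟩, P.tub_add_zsmul p n⟩))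
  exact ⟨_, hp.1, fun p hp => push_tub hc hp, fun x hx => push_zero hx, hp.2⟩

/-- A function supported in a coordinate window is smooth on the plane. -/
lemma exists_window_fn {E : Type*} [NormedAddCommGroup E] [NormedSpace ℝ E] (T : Tube P)
    {a b a' b' t₁ : ℝ} (h1 : t₁ < T.t₀) (ha : a < a') (hb : b' < b) (hab : b ≤ a + P.L)
    {n : WithTop ℕ∞} (hn : n ≤ (⊤ : ℕ∞)) {G : Plane → E}
    (hG : ContDiff ℝ n G) (h0 : ∀ p ∉ Icc a' b' ×ˢ Icc (-t₁) t₁, G p = 0) :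
    ∃ F : Plane → E, ContDiff ℝ n F ∧
      (∀ p ∈ Ioo a b ×ˢ Ioo (-T.t₀) T.t₀, F (tub P p) = G p) ∧
      (∀ x, (∀ p ∈ Ioo a b ×ˢ Ioo (-T.t₀) T.t₀, tub P p ≠ x) → F x = 0) ∧
      tsupport F ⊆ tub P '' (Icc a' b' ×ˢ Icc (-t₁) t₁) := by
  set S : Set Plane := Ioo a b ×ˢ Ioo (-T.t₀) T.t₀ with hS
  have hinj : ∀ p ∈ S, ∀ q ∈ S, tub P p = tub P q → p = q := fun p hp q hq hpq =>
    T.eq_of_window (abs_lt.2 hp.2) (abs_lt.2 hq.2)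
      (abs_lt.2 ⟨by linarith [hp.1.1, hq.1.2], by linarith [hp.1.2, hq.1.1]⟩) hpq
  have hc : ∀ p ∈ S, ∀ q ∈ S, tub P p = tub P q → G p = G q := fun p hp q hq hpq => by
    rw [hinj p hp q hq hpq]
  have hp := push_contDiff (K := Icc a' b' ×ˢ Icc (-t₁) t₁) T (isOpen_Ioo.prod isOpen_Ioo)
    (fun p hp => abs_lt.2 hp.2) hn hG hc (isCompact_Icc.prod isCompact_Icc)
    (fun p hp => ⟨⟨ha.trans_le hp.1.1, hp.1.2.trans_lt hb⟩, by linarith [hp.2.1],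
      hp.2.2.trans_lt h1⟩) (fun p hp hpK => h0 p fun hcon => hpK ⟨p, hcon, rfl⟩)
  exact ⟨_, hp.1, fun p hp => push_tub hc hp, fun x hx => push_zero hx, hp.2⟩

/-- Change of variables to tubular coordinates. -/
lemma setIntegral_tub (T : Tube P) (ho : IsOpen Ω) {t₁ : ℝ} (ht₁ : 0 ≤ t₁) (h1 : t₁ < T.t₀)
    {F : Plane → ℝ} (hF : Continuous F)
    (h0 : ∀ x ∈ Ω, (∀ p : Plane, 0 < p.2 → p.2 ≤ t₁ → tub P p ≠ x) → F x = 0) (a : ℝ) :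
    ∫ x in Ω, F x = ∫ t in 0..t₁, ∫ s in a..(a + P.L), (1 - t * kap P s) * F (tub P (s, t)) := by
  have hL := P.L_pos
  set R : Set Plane := Ioc a (a + P.L) ×ˢ Ioc 0 t₁ with hR
  have hRm : MeasurableSet R := measurableSet_Ioc.prod measurableSet_Ioc
  have hRt : ∀ p ∈ R, |p.2| < T.t₀ := fun p hp => abs_lt.2 ⟨by linarith [hp.2.1], by linarith [hp.2.2]⟩
  have hinj : InjOn (tub P) R := fun p hp q hq h =>
    T.eq_of_window (hRt p hp) (hRt q hq)
      (abs_lt.2 ⟨by linarith [hp.1.1, hq.1.2], by linarith [hp.1.2, hq.1.1]⟩) h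
  have hsub : tub P '' R ⊆ Ω := by
    rintro _ ⟨p, hp, rfl⟩
    exact T.mem p hp.2.1 (by linarith [hp.2.2])
  have hk := P.contDiff_kap.continuous
  have ht := P.contDiff_tub.continuous
  rw [← setIntegral_rect (F := fun p => (1 - p.2 * kap P p.1) * F (tub P p)) (by fun_prop)
    (by linarith) ht₁, setIntegral_eq_of_subset_of_forall_sdiff_eq_zero ho.measurableSet hsub,
    integral_image_eq_integral_abs_det_fderiv_smul volume hRm
      (fun p _ => (P.hasFDerivAt_tub p).hasFDerivWithinAt) hinj]
  · refine setIntegral_congr_fun hRm fun p hp => ?_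
    simp only [P.det_tub, smul_eq_mul]
    rw [abs_of_pos]
    linarith [T.jac_ge (hRt p hp).le]
  · rintro x ⟨hx, hxR⟩
    refine h0 x hx fun p hp0 hp1 hpx => hxR ?_
    have := toIocMod_mem_Ioc hL a p.1
    refine ⟨(p.1 + (-toIocDiv hL a p.1 : ℤ) * P.L, p.2), ⟨?_, hp0, hp1⟩,
      (P.tub_add_zsmul p _).trans hpx⟩
    rw [toIocMod, zsmul_eq_mul] at this
    convert this using 1
    push_cast; ring

end SC

namespace SC

variable {Ω : Set Plane} (P : BoundaryParam Ω)

/-- Normal component of the reference potential along the boundary. -/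
def nrmPot (s : ℝ) : ℝ := dot2 (F0 (P.γ s)) (nuVec P.γ s)

/-- Tangential component of the reference potential along the boundary. -/
def tanPot (s : ℝ) : ℝ := dot2 (F0 (P.γ s)) (deriv P.γ s)

/-- Circulation of the reference potential along the boundary. -/
def circ (s : ℝ) : ℝ := ∫ σ in 0..s, tanPot P σ

/-- The gauge function in tubular coordinates. -/
def gau (p : Plane) : ℝ := p.2 * nrmPot P p.1 + circ P p.1

lemma contDiff_tanPot : ContDiff ℝ (⊤ : ℕ∞) (tanPot P) := by
  have h := P.smooth
  have h' := P.contDiff_deriv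
  exact ((h.snd.neg.div_const 2).mul h'.fst).add ((h.fst.div_const 2).mul h'.snd)

lemma contDiff_nrmPot : ContDiff ℝ (⊤ : ℕ∞) (nrmPot P) := by
  have h := P.smooth
  have h' := P.contDiff_nu
  exact ((h.snd.neg.div_const 2).mul h'.fst).add ((h.fst.div_const 2).mul h'.snd)

lemma hasDerivAt_circ (s : ℝ) : HasDerivAt (circ P) (tanPot P s) s :=
  intervalIntegral.integral_hasDerivAt_right
    ((contDiff_tanPot P).continuous.intervalIntegrable _ _)
    ((contDiff_tanPot P).continuous.stronglyMeasurableAtFilter _ _)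
    (contDiff_tanPot P).continuous.continuousAt

lemma contDiff_circ : ContDiff ℝ (⊤ : ℕ∞) (circ P) := by
  refine contDiff_infty_iff_deriv.2 ⟨fun s => (hasDerivAt_circ P s).differentiableAt, ?_⟩
  rw [funext fun s => (hasDerivAt_circ P s).deriv]
  exact contDiff_tanPot P

lemma contDiff_gau : ContDiff ℝ (⊤ : ℕ∞) (gau P) :=
  (contDiff_snd.mul ((contDiff_nrmPot P).comp contDiff_fst)).add
    ((contDiff_circ P).comp contDiff_fst)

lemma circ_add (s : ℝ) : circ P (s + P.L) = circ P s + circ P P.L := by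
  have hper : Function.Periodic (tanPot P) P.L := fun s => by
    simp only [tanPot, P.periodic s, P.periodic_deriv s]
  have hi := fun a b => (contDiff_tanPot P).continuous.intervalIntegrable (μ := volume) a b
  have := hper.intervalIntegral_add_eq s 0
  rw [zero_add] at this
  rw [circ, circ, circ, ← this, intervalIntegral.integral_add_adjacent_intervals (hi _ _) (hi _ _)]

lemma gau_add (s t : ℝ) : gau P (s + P.L, t) = gau P (s, t) + circ P P.L := by
  have : nrmPot P (s + P.L) = nrmPot P s := by
    simp only [nrmPot, P.periodic s, P.periodic_nu s]
  simp only [gau, this, circ_add]; ring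

lemma hasDerivAt_nrmPot (s : ℝ) : HasDerivAt (nrmPot P) (1 / 2 - kap P s * tanPot P s) s := by
  have g := P.hasDerivAt s
  have v := P.hasDerivAt_nu s
  have h := (((hasDerivAt_snd' g).neg.div_const 2).mul (hasDerivAt_fst' v)).add
    (((hasDerivAt_fst' g).div_const 2).mul (hasDerivAt_snd' v))
  refine h.congr_deriv ?_
  have u := P.unit s
  simp only [tanPot, dot2, F0, nuVec, Prod.smul_fst, Prod.smul_snd, smul_eq_mul, Pi.neg_apply]
  linear_combination u / 2

lemma fderiv_gau (p h : Plane) : fderiv ℝ (gau P) p h =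
    h.2 * nrmPot P p.1 + h.1 * (p.2 * (1 / 2 - kap P p.1 * tanPot P p.1) + tanPot P p.1) := by
  have h1 : HasFDerivAt (fun p : Plane => p.1) (ContinuousLinearMap.fst ℝ ℝ ℝ) p := hasFDerivAt_fst
  have h2 : HasFDerivAt (fun p : Plane => p.2) (ContinuousLinearMap.snd ℝ ℝ ℝ) p := hasFDerivAt_snd
  have a := (hasDerivAt_nrmPot P p.1).hasFDerivAt.comp p h1
  have b := (hasDerivAt_circ P p.1).hasFDerivAt.comp p h1
  have c : HasFDerivAt (gau P) _ p := (h2.mul a).add b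
  rw [c.fderiv]
  simp
  ring

lemma F0_tub_nu (p : Plane) : dot2 (F0 (tub P p)) (nuVec P.γ p.1) = nrmPot P p.1 := by
  simp [nrmPot, tub, dot2, F0]; ring

lemma F0_tub_tan (p : Plane) : (1 - p.2 * kap P p.1) * dot2 (F0 (tub P p)) (deriv P.γ p.1) =
    fderiv ℝ (gau P) p (1, 0) - (p.2 - p.2 ^ 2 * kap P p.1 / 2) := by
  rw [fderiv_gau]
  have u := P.unit p.1
  simp [tanPot, tub, dot2, F0, nuVec]
  linear_combination (-(1 - p.2 * kap P p.1) * p.2 / 2) * u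

lemma Pv_linear (B : ℝ) (u : Plane → ℂ) (x v : Plane) :
    Pv B u x v = v.1 * P1 B u x + v.2 * P2 B u x := by
  have : v = v.1 • ((1, 0) : Plane) + v.2 • ((0, 1) : Plane) := by ext <;> simp
  have h : fderiv ℝ u x v = v.1 * fderiv ℝ u x (1, 0) + v.2 * fderiv ℝ u x (0, 1) := by
    conv_lhs => rw [this, map_add, map_smul, map_smul]
    simp
  simp only [P1, P2, Pv, h, dot2]
  push_cast
  ring

lemma magSq_frame (B : ℝ) (u : Plane → ℂ) (x : Plane) (s : ℝ) :
    magSq B F0 u x = ‖Pv B u x (deriv P.γ s)‖ ^ 2 + ‖Pv B u x (nuVec P.γ s)‖ ^ 2 := by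
  have h := P.unit s
  rw [magSq_eq, Pv_linear, Pv_linear]
  simp only [nuVec, Complex.sq_norm, Complex.normSq_apply]
  simp
  linear_combination (-((P1 B u x).re ^ 2 + (P1 B u x).im ^ 2 + (P2 B u x).re ^ 2 +
    (P2 B u x).im ^ 2)) * h

/-- The magnetic energy density in tubular coordinates. -/
lemma magSq_tub {u : Plane → ℂ} (hu : ContDiff ℝ 1 u) {B : ℝ} {Y : Plane → ℂ} {p : Plane}
    (hp : 1 - p.2 * kap P p.1 ≠ 0)
    (hY : Y =ᶠ[𝓝 p] fun q => Complex.exp ((-(B * gau P q) : ℝ) * Complex.I) * u (tub P q)) :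
    magSq B F0 u (tub P p) = ‖dtv Y p‖ ^ 2 + ((1 - p.2 * kap P p.1) ^ 2)⁻¹ *
      ‖cov (fun t => B * (t - t ^ 2 * kap P p.1 / 2)) Y p‖ ^ 2 := by
  set w : Plane → ℂ := fun q => u (tub P q) with hw
  have ht1 : ContDiff ℝ 1 (tub P) := P.contDiff_tub.of_le (by exact_mod_cast le_top)
  have hwc : ContDiff ℝ 1 w := hu.comp ht1
  set θ : Plane → ℝ := fun q => -(B * gau P q) with hθ
  have hg1 : ContDiff ℝ 1 (gau P) := (contDiff_gau P).of_le (by exact_mod_cast le_top)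
  have hY' : Y =ᶠ[𝓝 p] fun q => Complex.exp (θ q * Complex.I) * w q := hY
  have hθc : ContDiff ℝ 1 θ := (contDiff_const.mul hg1).neg
  have hdθ : ∀ v, fderiv ℝ θ p v = -(B * fderiv ℝ (gau P) p v) := fun v => by
    have h : HasFDerivAt θ _ p :=
      (((hg1.differentiable (by norm_num)) p).hasFDerivAt.const_mul B).neg
    rw [h.fderiv]; simp
  have hdw : ∀ v, fderiv ℝ w p v = fderiv ℝ u (tub P p)
      (v.1 • (1 - p.2 * kap P p.1) • deriv P.γ p.1 + v.2 • nuVec P.γ p.1) := fun v => by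
    have h : HasFDerivAt w _ p :=
      ((hu.differentiable (by norm_num)) (tub P p)).hasFDerivAt.comp p (P.hasFDerivAt_tub p)
    rw [h.fderiv, ContinuousLinearMap.comp_apply, colMap_apply]
  have hdY : ∀ v, -Complex.I * fderiv ℝ Y p v = Complex.exp (θ p * Complex.I) *
      (-Complex.I * fderiv ℝ w p v + (fderiv ℝ θ p v : ℝ) * w p) := fun v => by
    rw [hY'.fderiv_eq]
    have := Pv_gauge hwc hθc 0 p v
    simpa only [Pv, zero_mul, Complex.ofReal_zero, sub_zero] using this
  have hYp : Y p = Complex.exp (θ p * Complex.I) * w p := hY'.eq_of_nhds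
  have hnI : ∀ z : ℂ, ‖z‖ = ‖-Complex.I * z‖ := fun z => by simp
  have e1 : ‖dtv Y p‖ = ‖Pv B u (tub P p) (nuVec P.γ p.1)‖ := by
    have : -Complex.I * dtv Y p =
        Complex.exp (θ p * Complex.I) * Pv B u (tub P p) (nuVec P.γ p.1) := by
      simp only [dtv, hdY, hdw, hdθ, fderiv_gau, Pv, F0_tub_nu]
      simp
      ring
    rw [hnI, this, norm_mul, Complex.norm_exp_ofReal_mul_I, one_mul]
  have e2 : ‖cov (fun t => B * (t - t ^ 2 * kap P p.1 / 2)) Y p‖ =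
      ‖((1 - p.2 * kap P p.1 : ℝ) : ℂ) * Pv B u (tub P p) (deriv P.γ p.1)‖ := by
    have : -Complex.I * cov (fun t => B * (t - t ^ 2 * kap P p.1 / 2)) Y p =
        Complex.exp (θ p * Complex.I) *
          (((1 - p.2 * kap P p.1 : ℝ) : ℂ) * Pv B u (tub P p) (deriv P.γ p.1)) := by
      have h := congrArg (fun r : ℝ => (r : ℂ)) (F0_tub_tan P p)
      simp only [cov, mul_add, hdY, hdw, hdθ, Pv, hYp]
      push_cast at h ⊢
      simp only [one_smul, zero_smul, add_zero, map_smul, Complex.real_smul]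
      push_cast
      linear_combination (B * Complex.exp (θ p * Complex.I) * w p) * h -
        (B * (p.2 - p.2 ^ 2 * kap P p.1 / 2) * Complex.exp (θ p * Complex.I) * w p) *
        Complex.I_sq
    rw [hnI, this, norm_mul, Complex.norm_exp_ofReal_mul_I, one_mul]
  rw [magSq_frame P B u _ p.1, e1, e2, norm_mul, mul_pow, Complex.norm_real, Real.norm_eq_abs,
    sq_abs, inv_mul_cancel_left₀ (pow_ne_zero 2 hp), add_comm]

end SC

namespace SC

lemma exists_bump {a a' b' b : ℝ} (ha : a < a') (hb : b' < b) :
    ∃ χ : ℝ → ℝ, ContDiff ℝ (⊤ : ℕ∞) χ ∧ (∀ t ∈ Icc a' b', χ t = 1) ∧ (∀ t ∉ Ioo a b, χ t = 0) ∧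
      ∀ t, χ t ∈ Icc (0 : ℝ) 1 := by
  obtain ⟨χ, h1, h2, h3, h4⟩ := exists_cutoff (isClosed_Icc (a := a') (b := b'))
    (isOpen_Ioo (a := a) (b := b)) (Icc_subset_Ioo ha hb)
  exact ⟨χ, h1, fun t ht => h3.self_of_nhdsSet t ht, fun t ht => h2.self_of_nhdsSet t ht, h4⟩

variable {Ω : Set Plane} {P : BoundaryParam Ω}

lemma Tube.exists_bump (T : Tube P) {r : ℝ} (h : r < T.t₀) : ∃ (χ : ℝ → ℝ) (r' : ℝ),
    r < r' ∧ r' < T.t₀ ∧ ContDiff ℝ (⊤ : ℕ∞) χ ∧ (∀ t, |t| ≤ r → χ t = 1) ∧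
    (∀ t, r' < |t| → χ t = 0) ∧ ∀ t, χ t ∈ Icc (0 : ℝ) 1 := by
  obtain ⟨r', h1, h2⟩ := exists_between h
  obtain ⟨χ, c1, c2, c3, c4⟩ := SC.exists_bump (neg_lt_neg h1) h1
  exact ⟨χ, r', h1, h2, c1, fun t ht => c2 t (abs_le.1 ht),
    fun t ht => c3 t fun hc => by linarith [abs_lt.2 hc], c4⟩

/-- A function supported in the tube is represented by a quasi-periodic function in tubular
coordinates. -/
lemma exists_rep (T : Tube P) {t₁ t₂ : ℝ} (h12 : t₁ < t₂) (h0 : 0 < t₂) (h2 : t₂ < T.t₀) (B : ℝ)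
    {u : Plane → ℂ} (hu : ContDiff ℝ 1 u) (hs : tsupport u ⊆ tub P '' {p | |p.2| ≤ t₁}) :
    ∃ (Y : Plane → ℂ) (α : ℝ), ContDiff ℝ 1 Y ∧
      (∀ t, Y (P.L, t) = Complex.exp ((α * P.L : ℝ) * Complex.I) * Y (0, t)) ∧
      (∀ s t, t₂ ≤ t → Y (s, t) = 0) ∧
      ∀ p : Plane, |p.2| ≤ t₂ → Y =ᶠ[𝓝 p] fun q =>
        Complex.exp ((-(B * gau P q) : ℝ) * Complex.I) * u (tub P q) := by
  obtain ⟨t₃, h23, h3⟩ := exists_between h2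
  obtain ⟨χ, r', hr, hr', c1, c2, c3, -⟩ := T.exists_bump h3
  have hg1 : ContDiff ℝ 1 (gau P) := (contDiff_gau P).of_le (by exact_mod_cast le_top)
  have ht1 : ContDiff ℝ 1 (tub P) := P.contDiff_tub.of_le (by exact_mod_cast le_top)
  have hχ : ContDiff ℝ 1 (fun q : Plane => (χ q.2 : ℂ)) :=
    contDiff_ofReal ((c1.of_le (by exact_mod_cast le_top)).comp contDiff_snd)
  have hZ : ContDiff ℝ 1 fun q => Complex.exp ((-(B * gau P q) : ℝ) * Complex.I) * u (tub P q) :=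
    contDiff_gauge (hu.comp ht1) (contDiff_const.mul hg1).neg
  have hL := P.L_pos.ne'
  refine ⟨fun q => χ q.2 * (Complex.exp ((-(B * gau P q) : ℝ) * Complex.I) * u (tub P q)),
    -(B * circ P P.L) / P.L, hχ.mul hZ, fun t => ?_, fun s t ht => ?_, fun p hp => ?_⟩
  · have e1 := gau_add P 0 t
    have e2 := P.tub_add_zsmul (0, t) 1
    simp only [Int.cast_one, one_mul, zero_add] at e1 e2
    dsimp only
    rw [e1, e2, div_mul_cancel₀ _ hL,
      show -(B * (gau P (0, t) + circ P P.L)) = -(B * circ P P.L) + -(B * gau P (0, t)) by ring,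
      Complex.ofReal_add, add_mul, Complex.exp_add]
    ring
  · dsimp only
    rcases lt_or_ge t T.t₀ with h | h
    · have : u (tub P (s, t)) = 0 := by
        by_contra hne
        obtain ⟨p, hp, hpe⟩ := hs (subset_tsupport u hne)
        have hp' : |p.2| ≤ t₁ := hp
        have := (T.inj p (s, t) (by linarith) (abs_lt.2 ⟨by dsimp only; linarith [T.pos], h⟩) hpe).1
        have h' := le_abs_self p.2
        dsimp only at this
        linarith
      rw [this]; simp
    · rw [c3 t (by rw [abs_of_pos (by linarith)]; linarith)]; simp
  · have hp' : |p.2| < t₃ := hp.trans_lt h23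
    filter_upwards [(isOpen_lt (by fun_prop : Continuous fun q : Plane => |q.2|)
      continuous_const).mem_nhds hp'] with q hq
    have hq' : |q.2| < t₃ := hq
    rw [c2 q.2 hq'.le]; simp

/-- A smooth substitute for the distance to the boundary. -/
lemma exists_dist (T : Tube P) (ho : IsOpen Ω) {r : ℝ} (h0 : 0 < r) (hr : r < T.t₀) :
    ∃ d : Plane → ℝ, ContDiff ℝ (⊤ : ℕ∞) d ∧ (∀ x ∈ Ω, 0 < d x) ∧ (∀ x ∉ Ω, d x ≤ 0) ∧
      (∀ p : Plane, 0 ≤ p.2 → p.2 < T.t₀ → p.2 ≤ d (tub P p)) ∧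
      ∀ x ∈ Ω, (∀ p : Plane, |p.2| < r → tub P p ≠ x) → 1 ≤ d x := by
  obtain ⟨χ, r', hr1, hr2, c1, c2, c3, c4⟩ := T.exists_bump hr
  obtain ⟨F, f1, f2, f3, -⟩ := exists_strip_fn T hr2 (h := fun t => t * χ t) (contDiff_id.mul c1)
    (fun t ht => by rw [c3 t ht, mul_zero])
  have htube : IsOpen (tub P '' {p | |p.2| < r}) := by
    rw [isOpen_iff_mem_nhds]
    rintro _ ⟨p, hp, rfl⟩
    have hp' : |p.2| < r := hp
    obtain ⟨e, he, heq, -⟩ := P.map_nhds_tub (p := p)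
      (by linarith [T.jac_ge (hp'.trans hr).le] : 1 - p.2 * kap P p.1 ≠ 0)
    have := (e.isOpen_image_source_inter (isOpen_lt (by fun_prop : Continuous fun q : Plane => |q.2|)
      (continuous_const (y := r)))).mem_nhds ⟨p, ⟨he, hp⟩, rfl⟩
    rw [heq] at this
    exact mem_of_superset this (image_mono inter_subset_right)
  have hKU : closure Ω \ tub P '' {p | |p.2| < r} ⊆ Ω := fun x hx => by
    by_contra hxo
    have : x ∈ frontier Ω := ⟨hx.1, by rwa [ho.interior_eq]⟩
    rw [← P.range_eq] at this
    obtain ⟨s, rfl⟩ := this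
    exact hx.2 ⟨(s, 0), by simpa using h0, by simp [tub]⟩
  obtain ⟨θ, t1, t2, t3, t4⟩ := exists_cutoff (isClosed_closure.sdiff htube) ho hKU
  have hθ1 : ∀ x ∈ Ω, (∀ p : Plane, |p.2| < r → tub P p ≠ x) → θ x = 1 := fun x hx h =>
    t3.self_of_nhdsSet x ⟨subset_closure hx, by rintro ⟨p, hp, hpx⟩; exact h p hp hpx⟩
  have hF0 : ∀ x ∈ Ω, 0 ≤ F x := fun x hx => by
    by_cases h : ∃ p : Plane, |p.2| < T.t₀ ∧ tub P p = x
    · obtain ⟨p, hp, rfl⟩ := h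
      rw [f2 p hp]
      have : 0 < p.2 := by
        by_contra hcon
        exact T.notMem p (abs_lt.1 hp).1 (not_lt.1 hcon) hx
      exact mul_nonneg this.le (c4 _).1
    · push Not at h
      rw [f3 x h]
  have hfar : ∀ x ∈ Ω, (∀ p : Plane, |p.2| < r → tub P p ≠ x) → 1 ≤ F x + θ x := fun x hx h => by
    linarith [hF0 x hx, hθ1 x hx h]
  refine ⟨fun x => F x + θ x, f1.add t1, fun x hx => ?_, fun x hx => ?_, fun p hp0 hp => ?_, hfar⟩
  · by_cases h : ∃ p : Plane, |p.2| < r ∧ tub P p = x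
    · obtain ⟨p, hp, rfl⟩ := h
      have : 0 < p.2 := by
        by_contra hcon
        exact T.notMem p (abs_lt.1 (hp.trans hr)).1 (not_lt.1 hcon) hx
      have h1 := f2 p (hp.trans hr)
      rw [c2 _ hp.le, mul_one] at h1
      linarith [(t4 (tub P p)).1]
    · push Not at h
      linarith [hfar x hx h]
  · have hθ0 : θ x = 0 := t2.self_of_nhdsSet x hx
    dsimp only
    rw [hθ0, add_zero]
    by_cases h : ∃ p : Plane, |p.2| < T.t₀ ∧ tub P p = x
    · obtain ⟨p, hp, rfl⟩ := h
      rw [f2 p hp]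
      have : p.2 ≤ 0 := by
        by_contra hcon
        exact hx (T.mem p (not_le.1 hcon) (abs_lt.1 hp).2)
      exact mul_nonpos_of_nonpos_of_nonneg this (c4 _).1
    · push Not at h
      rw [f3 x h]
  · have hpa : |p.2| < T.t₀ := abs_lt.2 ⟨by linarith [T.pos], hp⟩
    rcases lt_or_ge p.2 r with h | h
    · have h1 := f2 p hpa
      rw [c2 _ (abs_le.2 ⟨by linarith, h.le⟩), mul_one] at h1
      linarith [(t4 (tub P p)).1]
    · have := hfar (tub P p) (T.mem p (by linarith) hp) fun q hq hqp => by
        have := (T.inj q p (hq.trans hr) hpa hqp).1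
        have h' := le_abs_self q.2
        linarith
      linarith [T.le_one]

/-- A gauge transformation removing most of the vector potential near the boundary, away from a
boundary arc. -/
lemma exists_gauge_fn (T : Tube P) (hbd : Bornology.IsBounded Ω) {r : ℝ}
    (hr : r < T.t₀) {d W : Plane → ℝ} (hd1 : ∀ p : Plane, 0 ≤ p.2 → p.2 < T.t₀ → p.2 ≤ d (tub P p))
    (hd2 : ∀ x ∈ Ω, (∀ p : Plane, |p.2| < r → tub P p ≠ x) → 1 ≤ d x) {s₁ ℓ : ℝ} (hℓ : 0 < ℓ)
    (hW : ∀ p : Plane, |p.1 - s₁| ≤ ℓ → 0 < p.2 → p.2 < r → W (tub P p) = 1) :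
    ∃ φ : Plane → ℝ, ContDiff ℝ 2 φ ∧ ∃ C ≥ 0, ∀ x ∈ Ω,
      ((F0 x).1 - fderiv ℝ φ x (1, 0)) ^ 2 + ((F0 x).2 - fderiv ℝ φ x (0, 1)) ^ 2 ≤
        C * (d x ^ 2 + W x ^ 4) := by
  obtain ⟨χ, r', hr1, hr2, c1, c2, c3, c4⟩ := T.exists_bump hr
  obtain ⟨ρ, q1, q2, q3, -⟩ := exists_bump (a := s₁ + ℓ / 2) (a' := s₁ + ℓ) (b' := s₁ + P.L - ℓ)
    (b := s₁ + P.L - ℓ / 2) (by linarith) (by linarith)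
  obtain ⟨φ, f1, f2, f3, -⟩ := exists_window_fn T hr2 (a := s₁) (b := s₁ + P.L)
    (a' := s₁ + ℓ / 2) (b' := s₁ + P.L - ℓ / 2) (by linarith) (by linarith) le_rfl
    (n := 2) (WithTop.coe_le_coe.2 (le_top : (2 : ℕ∞) ≤ ⊤))
    (G := fun p => ρ p.1 * (χ p.2 * gau P p))
    (((q1.comp contDiff_fst).mul ((c1.comp contDiff_snd).mul (contDiff_gau P))).of_le
      (WithTop.coe_le_coe.2 (le_top : (2 : ℕ∞) ≤ ⊤))) (fun p hp => by
        by_cases h : p.1 ∈ Icc (s₁ + ℓ / 2) (s₁ + P.L - ℓ / 2)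
        · rw [c3 p.2 (by by_contra hc; exact hp ⟨h, abs_le.1 (not_lt.1 hc)⟩)]; ring
        · rw [q3 p.1 fun hc => h (Ioo_subset_Icc_self hc)]; ring)
  have hcont : Continuous fun x : Plane =>
      ((F0 x).1 - fderiv ℝ φ x (1, 0)) ^ 2 + ((F0 x).2 - fderiv ℝ φ x (0, 1)) ^ 2 := by
    have := f1.continuous_fderiv (by norm_num)
    have := continuous_F0
    fun_prop
  obtain ⟨C, hC⟩ := hbd.isCompact_closure.exists_bound_of_continuousOn hcont.continuousOn
  refine ⟨φ, f1, max C 7, by positivity, fun x hx => ?_⟩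
  have hCx := (le_abs_self _).trans (hC x (subset_closure hx))
  have hC1 := le_max_left C 7
  have hC0 : 0 ≤ max C 7 := by positivity
  have hbig : 1 ≤ d x ^ 2 + W x ^ 4 → ((F0 x).1 - fderiv ℝ φ x (1, 0)) ^ 2 +
      ((F0 x).2 - fderiv ℝ φ x (0, 1)) ^ 2 ≤ max C 7 * (d x ^ 2 + W x ^ 4) := fun h => by
    have := mul_le_mul_of_nonneg_left h hC0
    linarith
  by_cases h : ∃ p : Plane, |p.2| < r ∧ tub P p = x
  swap
  · push Not at h
    have := hd2 x hx h
    exact hbig (by nlinarith [pow_nonneg (sq_nonneg (W x)) 2])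
  obtain ⟨p, hp, rfl⟩ := h
  obtain ⟨n, hn⟩ := P.exists_reduce (p.1 - s₁)
  rw [← P.tub_add_zsmul p n] at *
  generalize hq : ((p.1 + n * P.L, p.2) : Plane) = q at *
  have hqr : |q.2| < r := by rw [← hq]; exact hp
  have hq0 : 0 < q.2 := by
    by_contra hcon
    exact T.notMem q (abs_lt.1 (hqr.trans hr)).1 (not_lt.1 hcon) hx
  have hqI : q.1 - s₁ ∈ Ico 0 P.L := by rw [← hq]; convert hn using 1; ring
  have hqr' := (abs_lt.1 hqr).2
  rcases le_or_gt q.1 (s₁ + ℓ) with ha | ha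
  · exact hbig (by rw [hW q (abs_le.2 ⟨by linarith [hqI.1], by linarith⟩) hq0 hqr']; nlinarith [sq_nonneg (d (tub P q))])
  rcases le_or_gt (s₁ + P.L - ℓ) q.1 with hb | hb
  · have h1 := hW (q.1 + (-1 : ℤ) * P.L, q.2)
      (abs_le.2 ⟨by push_cast; linarith, by push_cast; linarith [hqI.2]⟩) hq0 hqr'
    rw [P.tub_add_zsmul q (-1)] at h1
    exact hbig (by rw [h1]; nlinarith [sq_nonneg (d (tub P q))])
  have hev : (fun p => φ (tub P p)) =ᶠ[𝓝 q] gau P := by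
    have hopen : IsOpen (Ioo (s₁ + ℓ) (s₁ + P.L - ℓ) ×ˢ Ioo (-r) r) := isOpen_Ioo.prod isOpen_Ioo
    filter_upwards [hopen.mem_nhds ⟨⟨ha, hb⟩, abs_lt.1 hqr⟩] with p hp
    rw [f2 p ⟨⟨by linarith [hp.1.1], by linarith [hp.1.2]⟩, by linarith [hp.2.1], by linarith [hp.2.2]⟩,
      q2 p.1 (Ioo_subset_Icc_self hp.1), c2 p.2 (abs_lt.2 hp.2).le]
    ring
  have hdd : ∀ v, fderiv ℝ (gau P) q v = fderiv ℝ φ (tub P q)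
      (v.1 • (1 - q.2 * kap P q.1) • deriv P.γ q.1 + v.2 • nuVec P.γ q.1) := fun v => by
    have h : HasFDerivAt (fun p => φ (tub P p)) _ q :=
      ((f1.differentiable (by norm_num)) (tub P q)).hasFDerivAt.comp q (P.hasFDerivAt_tub q)
    rw [← hev.fderiv_eq, h.fderiv, ContinuousLinearMap.comp_apply, colMap_apply]
  have hlin : ∀ v : Plane, fderiv ℝ φ (tub P q) v =
      v.1 * fderiv ℝ φ (tub P q) (1, 0) + v.2 * fderiv ℝ φ (tub P q) (0, 1) := fun v => by
    have : v = v.1 • ((1, 0) : Plane) + v.2 • ((0, 1) : Plane) := by ext <;> simp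
    conv_lhs => rw [this, map_add, map_smul, map_smul]
    simp
  have en := hdd (0, 1)
  have et := hdd (1, 0)
  have en' := F0_tub_nu P q
  have et' := F0_tub_tan P q
  rw [fderiv_gau] at en
  simp only [one_smul, zero_smul, add_zero, zero_add, map_smul, smul_eq_mul] at en et
  rw [hlin] at en et
  have hu := P.unit q.1
  have hJ := T.jac_ge (hqr.trans hr).le
  have hd := hd1 q hq0.le (by linarith)
  set e1 := (F0 (tub P q)).1 - fderiv ℝ φ (tub P q) (1, 0) with he1
  set e2 := (F0 (tub P q)).2 - fderiv ℝ φ (tub P q) (0, 1) with he2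
  set J := 1 - q.2 * kap P q.1 with hJd
  simp only [nuVec, dot2] at en en' et'
  have k1 : -(e1 * (deriv P.γ q.1).2) + e2 * (deriv P.γ q.1).1 = 0 := by
    rw [he1, he2]; linarith
  have k2 : J * (e1 * (deriv P.γ q.1).1 + e2 * (deriv P.γ q.1).2) =
      -(q.2 - q.2 ^ 2 * kap P q.1 / 2) := by
    rw [he1, he2]; linarith
  have k3 : e1 ^ 2 + e2 ^ 2 = (e1 * (deriv P.γ q.1).1 + e2 * (deriv P.γ q.1).2) ^ 2 := by
    linear_combination (-(e1 ^ 2 + e2 ^ 2)) * hu + (-(e1 * (deriv P.γ q.1).2) + e2 * (deriv P.γ q.1).1) * k1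
  have hk : |q.2 * kap P q.1| ≤ 1 / 2 := by
    rw [abs_mul, mul_comm]
    exact (mul_le_mul_of_nonneg_left (hqr.trans hr).le (abs_nonneg _)).trans (T.curv _)
  obtain ⟨hk1, hk2⟩ := abs_le.1 hk
  have k4 : J ^ 2 * (e1 ^ 2 + e2 ^ 2) = q.2 ^ 2 * (1 - q.2 * kap P q.1 / 2) ^ 2 := by
    rw [k3, ← mul_pow, k2]; ring
  have k5 : (1 - q.2 * kap P q.1 / 2) ^ 2 ≤ (5 / 4) ^ 2 := pow_le_pow_left₀ (by linarith) (by linarith) 2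
  have k6 : (1 / 2) ^ 2 ≤ J ^ 2 := pow_le_pow_left₀ (by norm_num) hJ 2
  have k7 := mul_le_mul_of_nonneg_left k5 (sq_nonneg q.2)
  have k8 := mul_le_mul_of_nonneg_right k6 (by positivity : 0 ≤ e1 ^ 2 + e2 ^ 2)
  have k9 : q.2 ^ 2 ≤ d (tub P q) ^ 2 := pow_le_pow_left₀ hq0.le hd 2
  have k10 := mul_le_mul_of_nonneg_right (le_max_right C 7)
    (by positivity : 0 ≤ d (tub P q) ^ 2 + W (tub P q) ^ 4)
  have k11 : 0 ≤ W (tub P q) ^ 4 := by positivity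
  rw [k4] at k8
  have k12 := k8.trans k7
  linarith only [k12, k9, k10, k11, sq_nonneg (d (tub P q))]

end SC

namespace SC

lemma norm_add_rot_sq_le {b r : ℝ} (hb : 0 < b) (z y : ℂ) :
    ‖z + r * Complex.I * y‖ ^ 2 ≤ ‖z‖ ^ 2 + |r| * b * (‖z‖ ^ 2 / b ^ 2 + ‖y‖ ^ 2) + r ^ 2 * ‖y‖ ^ 2 := by
  have h1 : ‖z + r * Complex.I * y‖ ≤ ‖z‖ + |r| * ‖y‖ := by
    refine (norm_add_le _ _).trans ?_
    rw [norm_mul, norm_mul, Complex.norm_I, Complex.norm_real, Real.norm_eq_abs, mul_one]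
  have h2 := pow_le_pow_left₀ (norm_nonneg _) h1 2
  have h3 : 2 * (‖z‖ * ‖y‖) ≤ b * (‖z‖ ^ 2 / b ^ 2 + ‖y‖ ^ 2) := by
    have h := mul_nonneg hb.le (sq_nonneg (‖z‖ / b - ‖y‖))
    have e : b * (‖z‖ / b - ‖y‖) ^ 2 =
        b * (‖z‖ ^ 2 / b ^ 2 + ‖y‖ ^ 2) - 2 * (‖z‖ * ‖y‖) := by field_simp; ring
    linarith
  have h4 := mul_le_mul_of_nonneg_left h3 (abs_nonneg r)
  have h5 : (‖z‖ + |r| * ‖y‖) ^ 2 = ‖z‖ ^ 2 + |r| * (2 * (‖z‖ * ‖y‖)) + r ^ 2 * ‖y‖ ^ 2 := by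
    rw [← sq_abs r]; ring
  linarith

/-- Replacing the curvature by a nearby constant in the energy density. -/
lemma point_model {a b t k k₁ δ l : ℝ} {z y : ℂ} (ha : 0 ≤ a) (hb : 0 < b) (ht : 0 ≤ t)
    (hk : |t * k| ≤ 1 / 2) (hk₁ : |t * k₁| ≤ 1 / 2) (hδ : |k - k₁| ≤ δ) (hδt : δ * t ≤ 1)
    (hl0 : 0 ≤ l) (hl : l ≤ b ^ 2) :
    (1 - t * k₁) * a + (1 + t * k₁) * ‖z + (b ^ 2 * t ^ 2 * (k - k₁) / 2 : ℝ) * Complex.I * y‖ ^ 2 -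
        l * (1 - t * k₁) * ‖y‖ ^ 2 ≤
      (1 - t * k) * (a + ((1 - t * k) ^ 2)⁻¹ * ‖z‖ ^ 2 - l * ‖y‖ ^ 2) +
        5 * δ * b * ((1 - t * k) * ((1 + b * t) ^ 3 *
          ((a + ((1 - t * k) ^ 2)⁻¹ * ‖z‖ ^ 2) / b ^ 2 + ‖y‖ ^ 2))) := by
  obtain ⟨hk1, hk2⟩ := abs_le.1 hk
  obtain ⟨hj1, hj2⟩ := abs_le.1 hk₁
  obtain ⟨hd1, hd2⟩ := abs_le.1 hδ
  have hδ0 : 0 ≤ δ := (abs_nonneg _).trans hδ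
  set J := 1 - t * k with hJ
  have hJ0 : 0 < J := by linarith
  obtain ⟨A, rfl⟩ : ∃ A, a = b ^ 2 * A := ⟨a / b ^ 2, by field_simp⟩
  have hA : 0 ≤ A := nonneg_of_mul_nonneg_right ha (by positivity)
  obtain ⟨q, hq⟩ : ∃ q, ‖z‖ ^ 2 = b ^ 2 * (J ^ 2 * q) := ⟨‖z‖ ^ 2 / b ^ 2 / J ^ 2, by field_simp⟩
  have hq0 : 0 ≤ q := by
    have : 0 ≤ b ^ 2 * (J ^ 2 * q) := hq ▸ sq_nonneg _
    exact nonneg_of_mul_nonneg_right (nonneg_of_mul_nonneg_right this (by positivity))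
      (by positivity)
  set N := ‖y‖ ^ 2 with hN
  have hN0 : 0 ≤ N := sq_nonneg _
  have hx := norm_add_rot_sq_le (r := b ^ 2 * t ^ 2 * (k - k₁) / 2) hb z y
  set x1 := ‖z + (b ^ 2 * t ^ 2 * (k - k₁) / 2 : ℝ) * Complex.I * y‖ ^ 2
  rw [← hN, hq, mul_div_cancel_left₀ _ (by positivity)] at hx
  have e1 : (J ^ 2)⁻¹ * ‖z‖ ^ 2 = b ^ 2 * q := by rw [hq]; field_simp
  rw [e1, show (b ^ 2 * A + b ^ 2 * q) / b ^ 2 = A + q by field_simp]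
  set τ := b * t with hτ
  have hτ0 : 0 ≤ τ := by positivity
  set E := δ * b with hE
  have hE0 : 0 ≤ E := by positivity
  set X := J ^ 2 * q with hX
  have hX0 : 0 ≤ X := by positivity
  have hr : |b ^ 2 * t ^ 2 * (k - k₁) / 2| * b ≤ E * (τ ^ 2 / 2) := by
    rw [abs_div, abs_mul, abs_of_nonneg (by positivity : 0 ≤ b ^ 2 * t ^ 2), abs_two, hE, hτ]
    have := mul_le_mul_of_nonneg_left hδ (by positivity : 0 ≤ b ^ 2 * t ^ 2 / 2 * b)
    linarith
  have hr2 : (b ^ 2 * t ^ 2 * (k - k₁) / 2) ^ 2 ≤ E * (τ ^ 3 / 4) := by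
    have h1 : (k - k₁) ^ 2 ≤ δ ^ 2 := by rw [← sq_abs]; exact pow_le_pow_left₀ (abs_nonneg _) hδ 2
    have h2 := mul_le_mul_of_nonneg_left h1 (by positivity : 0 ≤ b ^ 4 * t ^ 4 / 4)
    have h3 := mul_le_mul_of_nonneg_left hδt (by positivity : 0 ≤ δ * b ^ 4 * t ^ 3 / 4)
    rw [hE, hτ]
    linarith
  have hx1 : x1 ≤ b ^ 2 * X + E * (τ ^ 2 / 2 * (X + N) + τ ^ 3 / 4 * N) := by
    have h1 := mul_le_mul_of_nonneg_right hr (by positivity : 0 ≤ X + N)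
    have h2 := mul_le_mul_of_nonneg_right hr2 hN0
    linarith
  have hx10 : 0 ≤ x1 := sq_nonneg _
  have htd : t * (k - k₁) ≤ t * δ := mul_le_mul_of_nonneg_left hd2 ht
  have htd' : -(t * δ) ≤ t * (k - k₁) := by
    have := mul_le_mul_of_nonneg_left hd1 ht
    linarith
  have t1 : (1 - t * k₁) * (b ^ 2 * A) ≤ J * (b ^ 2 * A) + E * τ * A := by
    have := mul_le_mul_of_nonneg_right htd (by positivity : 0 ≤ b ^ 2 * A)
    rw [hJ, hE, hτ]
    linarith
  have t2 : (1 + t * k₁) * (b ^ 2 * X) ≤ J * (b ^ 2 * q) + E * τ * X := by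
    have h1 := mul_le_mul_of_nonneg_right htd' (by positivity : 0 ≤ b ^ 2 * X)
    have h2 : (1 + t * k) * J ≤ 1 := by rw [hJ]; linarith [sq_nonneg (t * k)]
    have h3 := mul_le_mul_of_nonneg_right h2 (by positivity : 0 ≤ b ^ 2 * (J * q))
    rw [hE, hτ, hX] at *
    linarith
  have t3 : (1 + t * k₁) * x1 ≤ (1 + t * k₁) * (b ^ 2 * X) +
      3 / 2 * (E * (τ ^ 2 / 2 * (X + N) + τ ^ 3 / 4 * N)) := by
    have h1 := mul_le_mul_of_nonneg_left hx1 (by linarith : 0 ≤ 1 + t * k₁)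
    have h2 := mul_le_mul_of_nonneg_right (by linarith : 1 + t * k₁ ≤ 3 / 2)
      (by positivity : 0 ≤ E * (τ ^ 2 / 2 * (X + N) + τ ^ 3 / 4 * N))
    linarith
  have t4 : -(l * (1 - t * k₁) * N) ≤ -(J * (l * N)) + E * τ * N := by
    have h1 := mul_le_mul_of_nonneg_right htd' (by positivity : 0 ≤ l * N)
    have h2 := mul_le_mul_of_nonneg_right hl (by positivity : 0 ≤ t * δ * N)
    rw [hJ, hE, hτ]
    linarith
  have hXq : X ≤ 9 / 4 * q := by
    rw [hX]
    have := pow_le_pow_left₀ hJ0.le (by linarith : J ≤ 3 / 2) 2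
    have := mul_le_mul_of_nonneg_right this hq0
    linarith
  have t5 : E * τ * A + E * τ * X + 3 / 2 * (E * (τ ^ 2 / 2 * (X + N) + τ ^ 3 / 4 * N)) + E * τ * N ≤
      E * ((1 + τ) ^ 3 * (A + X + N)) := by
    have h : 0 ≤ E * ((1 + 2 * τ + 3 * τ ^ 2 + τ ^ 3) * A + (1 + 2 * τ + 9 / 4 * τ ^ 2 + τ ^ 3) * X +
      (1 + 2 * τ + 9 / 4 * τ ^ 2 + 5 / 8 * τ ^ 3) * N) := by positivity
    linarith
  have t6 : E * ((1 + τ) ^ 3 * (A + X + N)) ≤ 5 * E * (J * ((1 + τ) ^ 3 * (A + q + N))) := by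
    have h1 := mul_le_mul_of_nonneg_left (by linarith : A + X + N ≤ 9 / 4 * (A + q + N))
      (by positivity : 0 ≤ E * (1 + τ) ^ 3)
    have h2 := mul_le_mul_of_nonneg_right (by linarith : 9 / 4 ≤ 5 * J)
      (by positivity : 0 ≤ E * (1 + τ) ^ 3 * (A + q + N))
    linarith
  linarith

/-- Bound for the weighted model density. -/
lemma point_weight {a b t k : ℝ} {z y : ℂ} (ha : 0 ≤ a) (hb : 0 < b) (ht : 0 ≤ t)
    (hk : |t * k| ≤ 1 / 2) (m : ℕ) :
    (1 + b * t) ^ m * ((b ^ 2)⁻¹ * (a + ‖z + (b ^ 2 * t ^ 2 * k / 2 : ℝ) * Complex.I * y‖ ^ 2) +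
        ‖y‖ ^ 2) ≤
      20 * ((1 - t * k) * ((1 + b * t) ^ (m + 3) *
          ((a + ((1 - t * k) ^ 2)⁻¹ * ‖z‖ ^ 2) / b ^ 2 + ‖y‖ ^ 2))) := by
  obtain ⟨hk1, hk2⟩ := abs_le.1 hk
  set J := 1 - t * k with hJ
  have hJ0 : 0 < J := by linarith
  obtain ⟨A, rfl⟩ : ∃ A, a = b ^ 2 * A := ⟨a / b ^ 2, by field_simp⟩
  have hA : 0 ≤ A := nonneg_of_mul_nonneg_right ha (by positivity)
  obtain ⟨q, hq⟩ : ∃ q, ‖z‖ ^ 2 = b ^ 2 * (J ^ 2 * q) := ⟨‖z‖ ^ 2 / b ^ 2 / J ^ 2, by field_simp⟩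
  have hq0 : 0 ≤ q := by
    have : 0 ≤ b ^ 2 * (J ^ 2 * q) := hq ▸ sq_nonneg _
    exact nonneg_of_mul_nonneg_right (nonneg_of_mul_nonneg_right this (by positivity))
      (by positivity)
  set N := ‖y‖ ^ 2 with hN
  have hN0 : 0 ≤ N := sq_nonneg _
  set τ := b * t with hτ
  have hτ0 : 0 ≤ τ := by positivity
  have hx : ‖z + (b ^ 2 * t ^ 2 * k / 2 : ℝ) * Complex.I * y‖ ^ 2 ≤
      b ^ 2 * (2 * (J ^ 2 * q) + τ ^ 2 * N) := by
    have h1 : ‖z + (b ^ 2 * t ^ 2 * k / 2 : ℝ) * Complex.I * y‖ ≤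
        ‖z‖ + |b ^ 2 * t ^ 2 * k / 2| * ‖y‖ := by
      refine (norm_add_le _ _).trans ?_
      rw [norm_mul, norm_mul, Complex.norm_I, Complex.norm_real, Real.norm_eq_abs, mul_one]
    have h2 := pow_le_pow_left₀ (norm_nonneg _) h1 2
    have h3 := sq_nonneg (‖z‖ - |b ^ 2 * t ^ 2 * k / 2| * ‖y‖)
    have h4 : (b ^ 2 * t ^ 2 * k / 2) ^ 2 ≤ b ^ 2 * τ ^ 2 / 2 := by
      have h5 : (t * k) ^ 2 ≤ (1 / 2) ^ 2 := by
        rw [← sq_abs]; exact pow_le_pow_left₀ (abs_nonneg _) hk 2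
      have h6 := mul_le_mul_of_nonneg_left h5 (by positivity : 0 ≤ b ^ 4 * t ^ 2 / 4)
      have h7 : 0 ≤ b ^ 4 * t ^ 2 := by positivity
      rw [hτ]
      linarith
    have h8 := mul_le_mul_of_nonneg_right h4 hN0
    have h9 : (|b ^ 2 * t ^ 2 * k / 2| * ‖y‖) ^ 2 = (b ^ 2 * t ^ 2 * k / 2) ^ 2 * N := by
      rw [mul_pow, sq_abs]
    linarith
  set x := ‖z + (b ^ 2 * t ^ 2 * k / 2 : ℝ) * Complex.I * y‖ ^ 2
  rw [hq, show (b ^ 2 * A + (J ^ 2)⁻¹ * (b ^ 2 * (J ^ 2 * q))) / b ^ 2 = A + q by field_simp]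
  have h1 : (b ^ 2)⁻¹ * (b ^ 2 * A + x) ≤ A + (2 * (J ^ 2 * q) + τ ^ 2 * N) := by
    have := mul_le_mul_of_nonneg_left hx (by positivity : 0 ≤ (b ^ 2)⁻¹)
    rw [inv_mul_cancel_left₀ (by positivity)] at this
    rw [mul_add, inv_mul_cancel_left₀ (by positivity)]
    linarith
  have hXq : J ^ 2 * q ≤ 9 / 4 * q := by
    have := pow_le_pow_left₀ hJ0.le (by linarith : J ≤ 3 / 2) 2
    have := mul_le_mul_of_nonneg_right this hq0
    linarith
  have h2 : A + (2 * (J ^ 2 * q) + τ ^ 2 * N) + N ≤ 10 * ((1 + τ) ^ 3 * (A + q + N)) := by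
    have h : 0 ≤ (9 + 30 * τ + 30 * τ ^ 2 + 10 * τ ^ 3) * A +
      (5.5 + 30 * τ + 30 * τ ^ 2 + 10 * τ ^ 3) * q +
      (9 + 30 * τ + 29 * τ ^ 2 + 10 * τ ^ 3) * N := by positivity
    linarith
  have h3 := mul_le_mul_of_nonneg_left ((add_le_add_left h1 N).trans h2)
    (by positivity : 0 ≤ (1 + τ) ^ m)
  have h4 := mul_le_mul_of_nonneg_right (by linarith : 10 ≤ 20 * J)
    (by positivity : 0 ≤ (1 + τ) ^ (m + 3) * (A + q + N))
  refine h3.trans (le_trans (le_of_eq ?_) (h4.trans (le_of_eq ?_))) <;> ring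

lemma magSq_eq_zero {B : ℝ} {u : Plane → ℂ} {x : Plane} (h : u =ᶠ[𝓝 x] 0) :
    magSq B F0 u x = 0 := by
  have h1 : fderiv ℝ u x = 0 := by rw [h.fderiv_eq]; simp
  simp [magSq, h1, h.self_of_nhds]

lemma strp_eq_rect {L t₂ : ℝ} (hL : 0 ≤ L) (ht : 0 ≤ t₂) {p : ℝ → ℝ} (hp : Continuous p)
    {X : Plane → ℂ} (hX : Continuous X) :
    strp L 0 t₂ p X = ∫ x in Ioc 0 L ×ˢ Ioc 0 t₂, p x.2 * ‖X x‖ ^ 2 := by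
  rw [setIntegral_rect (by fun_prop) hL ht, strp]
  simp only [intervalIntegral.integral_const_mul]

lemma integrableOn_rect {L t₂ : ℝ} {F : Plane → ℝ} (hF : Continuous F) :
    IntegrableOn F (Ioc 0 L ×ˢ Ioc 0 t₂) :=
  (hF.continuousOn.integrableOn_compact (isCompact_Icc.prod isCompact_Icc)).mono_set
    (prod_mono Ioc_subset_Icc_self Ioc_subset_Icc_self)

variable {Ω : Set Plane} {P : BoundaryParam Ω}

lemma rect_le_tub (T : Tube P) (ho : IsOpen Ω) {t₂ : ℝ} (ht : 0 ≤ t₂) (h2 : t₂ < T.t₀)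
    {Φ F : Plane → ℝ} (hΦ : Continuous Φ) (hF : Continuous F)
    (h0 : ∀ x ∈ Ω, (∀ p : Plane, 0 < p.2 → p.2 ≤ t₂ → tub P p ≠ x) → F x = 0)
    (h : ∀ p : Plane, 0 ≤ p.2 → p.2 ≤ t₂ → Φ p ≤ (1 - p.2 * kap P p.1) * F (tub P p)) :
    ∫ x in Ioc 0 P.L ×ˢ Ioc 0 t₂, Φ x ≤ ∫ x in Ω, F x := by
  have hk := P.contDiff_kap.continuous
  have ht' := P.contDiff_tub.continuous
  have hG : Continuous fun p : Plane => (1 - p.2 * kap P p.1) * F (tub P p) := by fun_prop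
  rw [setIntegral_tub T ho ht h2 hF h0 0, zero_add,
    ← setIntegral_rect (F := fun p : Plane => (1 - p.2 * kap P p.1) * F (tub P p)) hG P.L_pos.le ht]
  exact setIntegral_mono_on (integrableOn_rect hΦ) (integrableOn_rect hG)
    (measurableSet_Ioc.prod measurableSet_Ioc) fun p hp => h p hp.2.1.le hp.2.2

/-- Weighted energy at the boundary length scale `b⁻¹`. -/
def Gw (Ω : Set Plane) (b : ℝ) (d : Plane → ℝ) (m : ℕ) (u : Plane → ℂ) : ℝ :=
  ∫ x in Ω, (1 + b * d x) ^ m * (magSq (b ^ 2) F0 u x / b ^ 2 + ‖u x‖ ^ 2)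

/-- Comparison of a function supported in the tube with its straightened version. -/
lemma exists_strip_model (T : Tube P) (ho : IsOpen Ω) (hbd : Bornology.IsBounded Ω)
    {d : Plane → ℝ} (hdc : Continuous d)
    (hd : ∀ p : Plane, 0 ≤ p.2 → p.2 < T.t₀ → p.2 ≤ d (tub P p)) {t₁ t₂ : ℝ} (h12 : t₁ < t₂)
    (h0 : 0 < t₂) (h2 : t₂ < T.t₀) {b : ℝ} (hb : 0 < b) {u : Plane → ℂ} (hu : ContDiff ℝ 1 u)
    (hs : tsupport u ⊆ tub P '' {p | |p.2| ≤ t₁}) :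
    ∃ (Y : Plane → ℂ) (α : ℝ), ContDiff ℝ 1 Y ∧
      (∀ t, Y (P.L, t) = Complex.exp ((α * P.L : ℝ) * Complex.I) * Y (0, t)) ∧
      (∀ s t, t₂ ≤ t → Y (s, t) = 0) ∧
      (∀ k₁ δ l : ℝ, |k₁| * T.t₀ ≤ 1 / 2 → δ * T.t₀ ≤ 1 → 0 ≤ l → l ≤ b ^ 2 →
        (∀ p : Plane, |p.2| < T.t₀ → |kap P p.1 - k₁| ≤ δ ∨ u =ᶠ[𝓝 (tub P p)] 0) →
        strp P.L 0 t₂ (fun t => 1 - t * k₁) (dtv Y) +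
          strp P.L 0 t₂ (fun t => 1 + t * k₁) (cov (fun t => b ^ 2 * (t - t ^ 2 * k₁ / 2)) Y) -
          l * strp P.L 0 t₂ (fun t => 1 - t * k₁) Y ≤
        Qf Ω (b ^ 2) u - l * nsq Ω u + 5 * δ * b * Gw Ω b d 3 u) ∧
      (nsq Ω u ≤ strp P.L 0 t₂ (fun _ => 1) Y + T.t₀⁻¹ * b⁻¹ * Gw Ω b d 3 u) ∧
      ∀ m : ℕ, (b ^ 2)⁻¹ * (strp P.L 0 t₂ (fun t => (1 + b * t) ^ m) (dtv Y) +
        strp P.L 0 t₂ (fun t => (1 + b * t) ^ m) (cov (fun t => b ^ 2 * t) Y)) +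
        strp P.L 0 t₂ (fun t => (1 + b * t) ^ m) Y ≤ 20 * Gw Ω b d (m + 3) u := by
  obtain ⟨Y, α, hY, hq, hv, hrep⟩ := exists_rep T h12 h0 h2 (b ^ 2) hu hs
  have hL := P.L_pos
  have hYc := hY.continuous
  have hdt := continuous_dtv hY
  have huc := hu.continuous
  have hm := continuous_magSq (B := b ^ 2) hu
  have hzero : ∀ x ∈ Ω, (∀ p : Plane, 0 < p.2 → p.2 ≤ t₂ → tub P p ≠ x) →
      magSq (b ^ 2) F0 u x = 0 ∧ u x = 0 := fun x hx h => by
    have : x ∉ tsupport u := fun hxs => by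
      obtain ⟨p, hp, rfl⟩ := hs hxs
      have hp' : |p.2| ≤ t₁ := hp
      have hp2 := abs_le.1 hp'
      refine h p ?_ (by linarith) rfl
      by_contra hcon
      exact T.notMem p (by linarith) (not_lt.1 hcon) hx
    have := notMem_tsupport_iff_eventuallyEq.1 this
    exact ⟨magSq_eq_zero this, this.self_of_nhds⟩
  have habs : ∀ p : Plane, 0 ≤ p.2 → p.2 ≤ t₂ → |p.2| ≤ t₂ := fun p h1 h2 => by rwa [abs_of_nonneg h1]
  have hk : ∀ p : Plane, 0 ≤ p.2 → p.2 ≤ t₂ → |p.2 * kap P p.1| ≤ 1 / 2 := fun p hp hp2 => by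
    rw [abs_mul, mul_comm]
    exact (mul_le_mul_of_nonneg_left ((habs p hp hp2).trans h2.le) (abs_nonneg _)).trans (T.curv _)
  have hJ : ∀ p : Plane, 0 ≤ p.2 → p.2 ≤ t₂ → 1 / 2 ≤ 1 - p.2 * kap P p.1 := fun p hp hp2 =>
    T.jac_ge ((habs p hp hp2).trans h2.le)
  have hN : ∀ p : Plane, 0 ≤ p.2 → p.2 ≤ t₂ → ‖u (tub P p)‖ ^ 2 = ‖Y p‖ ^ 2 := fun p hp hp2 => by
    rw [(hrep p (habs p hp hp2)).self_of_nhds, norm_mul, Complex.norm_exp_ofReal_mul_I, one_mul]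
  have hM : ∀ p : Plane, 0 ≤ p.2 → p.2 ≤ t₂ → magSq (b ^ 2) F0 u (tub P p) = ‖dtv Y p‖ ^ 2 +
      ((1 - p.2 * kap P p.1) ^ 2)⁻¹ *
      ‖cov (fun t => b ^ 2 * (t - t ^ 2 * kap P p.1 / 2)) Y p‖ ^ 2 := fun p hp hp2 =>
    magSq_tub P hu (by linarith [hJ p hp hp2]) (hrep p (habs p hp hp2))
  have hcov : ∀ (p : Plane) (k₁ : ℝ), cov (fun t => b ^ 2 * (t - t ^ 2 * k₁ / 2)) Y p =
      cov (fun t => b ^ 2 * (t - t ^ 2 * kap P p.1 / 2)) Y p +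
        (b ^ 2 * p.2 ^ 2 * (kap P p.1 - k₁) / 2 : ℝ) * Complex.I * Y p := fun p k₁ => by
    simp only [cov]; push_cast; ring
  have hcov0 : ∀ p : Plane, cov (fun t => b ^ 2 * t) Y p =
      cov (fun t => b ^ 2 * (t - t ^ 2 * kap P p.1 / 2)) Y p +
        (b ^ 2 * p.2 ^ 2 * kap P p.1 / 2 : ℝ) * Complex.I * Y p := fun p => by
    simp only [cov]; push_cast; ring
  have hw : ∀ (p : Plane) (n : ℕ), 0 ≤ p.2 → p.2 ≤ t₂ → (1 + b * p.2) ^ n ≤ (1 + b * d (tub P p)) ^ n :=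
    fun p n hp hp2 => pow_le_pow_left₀ (by positivity)
      (by linarith [mul_le_mul_of_nonneg_left (hd p hp (by linarith)) hb.le]) n
  have hG : ∀ (p : Plane) (n : ℕ), 0 ≤ p.2 → p.2 ≤ t₂ → (1 - p.2 * kap P p.1) * ((1 + b * p.2) ^ n *
      ((‖dtv Y p‖ ^ 2 + ((1 - p.2 * kap P p.1) ^ 2)⁻¹ *
        ‖cov (fun t => b ^ 2 * (t - t ^ 2 * kap P p.1 / 2)) Y p‖ ^ 2) / b ^ 2 + ‖Y p‖ ^ 2)) ≤
      (1 - p.2 * kap P p.1) * ((1 + b * d (tub P p)) ^ n *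
        (magSq (b ^ 2) F0 u (tub P p) / b ^ 2 + ‖u (tub P p)‖ ^ 2)) := fun p n hp hp2 => by
    rw [hM p hp hp2, hN p hp hp2]
    have := hJ p hp hp2
    exact mul_le_mul_of_nonneg_left (mul_le_mul_of_nonneg_right (hw p n hp hp2) (by positivity))
      (by linarith)
  have hGc : ∀ n : ℕ, Continuous fun x : Plane => (1 + b * d x) ^ n *
      (magSq (b ^ 2) F0 u x / b ^ 2 + ‖u x‖ ^ 2) := fun n => by fun_prop
  have hGi := fun n => integrableOn_of_continuous hbd (hGc n)
  have hNi := integrableOn_of_continuous hbd (show Continuous fun x => ‖u x‖ ^ 2 by fun_prop)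
  have hMi := integrableOn_of_continuous hbd hm
  refine ⟨Y, α, hY, hq, hv, fun k₁ δ l hk₁ hδ hl0 hl hloc => ?_, ?_, fun m => ?_⟩
  · have hc := continuous_cov hY (q := fun t => b ^ 2 * (t - t ^ 2 * k₁ / 2)) (by fun_prop)
    rw [strp_eq_rect hL.le h0.le (by fun_prop) hdt, strp_eq_rect hL.le h0.le (by fun_prop) hc,
      strp_eq_rect hL.le h0.le (by fun_prop) hYc, ← integral_const_mul l,
      ← integral_add (integrableOn_rect (by fun_prop)) (integrableOn_rect (by fun_prop)),
      ← integral_sub (integrableOn_rect (by fun_prop)) (integrableOn_rect (by fun_prop)),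
      Qf, nsq, Gw, ← integral_const_mul l, ← integral_const_mul (5 * δ * b),
      ← integral_sub hMi (hNi.const_mul l),
      ← integral_add (integrableOn_of_continuous hbd (by fun_prop)) ((hGi 3).const_mul _)]
    refine rect_le_tub T ho h0.le h2 (by fun_prop) (by fun_prop) (fun x hx h => ?_)
      fun p hp hp2 => ?_
    · obtain ⟨h1, h2⟩ := hzero x hx h
      simp [h1, h2]
    · have hJp := hJ p hp hp2
      rcases hloc p ((habs p hp hp2).trans_lt h2) with hkp | hup
      · have hδ0 : 0 ≤ δ := (abs_nonneg _).trans hkp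
        have h1 := point_model (y := Y p) (z := cov (fun t => b ^ 2 * (t - t ^ 2 * kap P p.1 / 2)) Y p)
          (sq_nonneg ‖dtv Y p‖) hb hp (hk p hp hp2) (k₁ := k₁) (by
            rw [abs_mul, mul_comm]
            exact (mul_le_mul_of_nonneg_left ((habs p hp hp2).trans h2.le) (abs_nonneg _)).trans hk₁)
          hkp ((mul_le_mul_of_nonneg_left (hp2.trans h2.le) hδ0).trans hδ) hl0 hl
        have h3 := mul_le_mul_of_nonneg_left (hG p 3 hp hp2) (by positivity : 0 ≤ 5 * δ * b)
        rw [← hcov, ← hM p hp hp2] at h1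
        rw [← hM p hp hp2] at h3
        rw [← hN p hp hp2] at h1 h3 ⊢
        linarith
      · have hYz : Y =ᶠ[𝓝 p] 0 := by
          filter_upwards [hrep p (habs p hp hp2),
            (P.contDiff_tub.continuous.continuousAt (x := p)).eventually hup] with q h1 h3
          rw [h1, h3]; simp
        have h4 : fderiv ℝ Y p = 0 := by rw [hYz.fderiv_eq]; simp
        have h5 : Y p = 0 := hYz.self_of_nhds
        simp [dtv, cov, h4, h5, magSq_eq_zero hup, hup.self_of_nhds]
  · rw [← sub_le_iff_le_add, strp_eq_rect hL.le h0.le (by fun_prop) hYc, nsq, Gw,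
      ← integral_const_mul, ← integral_sub hNi ((hGi 3).const_mul _), ← neg_le_neg_iff,
      ← integral_neg, ← integral_neg]
    refine rect_le_tub T ho h0.le h2 (by fun_prop) (by fun_prop) (fun x hx h => ?_)
      fun p hp hp2 => ?_
    · obtain ⟨h1, h2⟩ := hzero x hx h
      simp [h1, h2]
    · have hJp := hJ p hp hp2
      have h1 := hG p 3 hp hp2
      rw [← hM p hp hp2] at h1
      set g := (1 - p.2 * kap P p.1) * ((1 + b * d (tub P p)) ^ 3 *
        (magSq (b ^ 2) F0 u (tub P p) / b ^ 2 + ‖u (tub P p)‖ ^ 2)) with hg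
      have h3 : (1 - p.2 * kap P p.1) * ‖Y p‖ ^ 2 ≤ ‖Y p‖ ^ 2 + T.t₀⁻¹ * b⁻¹ * g := by
        have e1 : -(p.2 * kap P p.1) ≤ p.2 * (T.t₀⁻¹ / 2) := by
          have h5 := T.curv p.1
          rw [← le_div_iff₀ T.pos] at h5
          have h6 := mul_le_mul_of_nonneg_left ((neg_le_abs _).trans h5) hp
          rw [div_eq_mul_inv] at h6
          linarith
        have e2 : p.2 = b⁻¹ * (b * p.2) := by field_simp
        have e3 : b * p.2 * ‖Y p‖ ^ 2 ≤ 2 * g := by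
          refine le_trans ?_ (mul_le_mul_of_nonneg_left h1 zero_le_two)
          have h5 : b * p.2 ≤ (1 + b * p.2) ^ 3 := by
            have : 0 ≤ b * p.2 := by positivity
            have : 0 ≤ 1 + 2 * (b * p.2) + 3 * (b * p.2) ^ 2 + (b * p.2) ^ 3 := by positivity
            linarith
          have h6 : ‖Y p‖ ^ 2 ≤ magSq (b ^ 2) F0 u (tub P p) / b ^ 2 + ‖Y p‖ ^ 2 := by
            have := magSq_nonneg (b ^ 2) F0 u (tub P p)
            have : 0 ≤ magSq (b ^ 2) F0 u (tub P p) / b ^ 2 := by positivity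
            linarith
          have h7 := mul_le_mul h5 h6 (sq_nonneg _) (by positivity)
          have h8 := mul_le_mul_of_nonneg_right (by linarith : 1 ≤ 2 * (1 - p.2 * kap P p.1))
            ((by positivity : 0 ≤ b * p.2 * ‖Y p‖ ^ 2).trans h7)
          linarith
        have e4 := mul_le_mul_of_nonneg_right e1 (sq_nonneg ‖Y p‖)
        have e5 := mul_le_mul_of_nonneg_left e3
          (by have := T.pos; positivity : 0 ≤ T.t₀⁻¹ * b⁻¹ / 2)
        have e6 : T.t₀⁻¹ * b⁻¹ / 2 * (b * p.2 * ‖Y p‖ ^ 2) = p.2 * (T.t₀⁻¹ / 2) * ‖Y p‖ ^ 2 := by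
          field_simp
        linarith
      rw [hN p hp hp2] at hg ⊢
      rw [hg] at h3
      linarith
  · have hc := continuous_cov hY (q := fun t => b ^ 2 * t) (by fun_prop)
    rw [strp_eq_rect hL.le h0.le (by fun_prop) hdt, strp_eq_rect hL.le h0.le (by fun_prop) hc,
      strp_eq_rect hL.le h0.le (by fun_prop) hYc,
      ← integral_add (integrableOn_rect (by fun_prop)) (integrableOn_rect (by fun_prop)),
      ← integral_const_mul (b ^ 2)⁻¹,
      ← integral_add (integrableOn_rect (by fun_prop)) (integrableOn_rect (by fun_prop)),
      Gw, ← integral_const_mul 20]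
    refine rect_le_tub T ho h0.le h2 (by fun_prop) (by fun_prop) (fun x hx h => ?_)
      fun p hp hp2 => ?_
    · obtain ⟨h1, h2⟩ := hzero x hx h
      simp [h1, h2]
    · have h1 := point_weight (y := Y p) (z := cov (fun t => b ^ 2 * (t - t ^ 2 * kap P p.1 / 2)) Y p)
        (sq_nonneg ‖dtv Y p‖) hb hp (hk p hp hp2) m
      have h3 := mul_le_mul_of_nonneg_left (hG p (m + 3) hp hp2) (by positivity : (0 : ℝ) ≤ 20)
      rw [← hcov0] at h1
      refine (le_of_eq ?_).trans (h1.trans (h3.trans (le_of_eq ?_))) <;> ring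

end SC

namespace SC

variable {Ω : Set Plane} {P : BoundaryParam Ω}

lemma Gw_mono (ho : IsOpen Ω) (hbd : Bornology.IsBounded Ω) {d : Plane → ℝ} (hdc : Continuous d)
    (hd0 : ∀ x ∈ Ω, 0 ≤ d x) {b : ℝ} (hb : 0 < b) {u : Plane → ℂ} (hu : ContDiff ℝ 1 u)
    {m n : ℕ} (hmn : m ≤ n) : Gw Ω b d m u ≤ Gw Ω b d n u := by
  have hm := continuous_magSq (B := b ^ 2) hu
  have huc := hu.continuous
  refine setIntegral_mono_on (integrableOn_of_continuous hbd (by fun_prop))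
    (integrableOn_of_continuous hbd (by fun_prop)) ho.measurableSet fun x hx => ?_
  have := magSq_nonneg (b ^ 2) F0 u x
  exact mul_le_mul_of_nonneg_right (pow_le_pow_right₀ (by
    have := mul_nonneg hb.le (hd0 x hx); linarith) hmn) (by positivity)

lemma Gw_nonneg (ho : IsOpen Ω) {d : Plane → ℝ} (hd0 : ∀ x ∈ Ω, 0 ≤ d x) {b : ℝ} (hb : 0 < b)
    (m : ℕ) (u : Plane → ℂ) : 0 ≤ Gw Ω b d m u := by
  refine setIntegral_nonneg ho.measurableSet fun x hx => ?_
  have := magSq_nonneg (b ^ 2) F0 u x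
  have := hd0 x hx
  positivity

lemma nrg_zero (T ζ : ℝ) (v : ℝ → ℂ) : nrg T 0 ζ v = en0 T ζ v := by
  simp only [nrg, en0, pot]
  congr 1; ext τ; ring

lemma dens_zero (T : ℝ) (v : ℝ → ℂ) : dens T 0 v = mass T v := by
  simp only [dens, mass, zero_mul, sub_zero, one_mul]

section
variable (T : Tube P) (ho : IsOpen Ω) (hbd : Bornology.IsBounded Ω)
    {d : Plane → ℝ} (hdc : Continuous d) (hd0 : ∀ x ∈ Ω, 0 ≤ d x)
    (hd : ∀ p : Plane, 0 ≤ p.2 → p.2 < T.t₀ → p.2 ≤ d (tub P p)) {t₁ t₂ : ℝ} (h12 : t₁ < t₂)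
    (h0 : 0 < t₂) (h2 : t₂ < T.t₀) {b : ℝ} (hb : 0 < b) {u : Plane → ℂ} (hu : ContDiff ℝ 1 u)
    (hs : tsupport u ⊆ tub P '' {p | |p.2| ≤ t₁})
include ho hbd hdc hd0 hd h12 h0 h2 hb hu hs

lemma lower_gap {c C l A k₁ δ : ℝ} {m : ℕ} (hc : 0 ≤ c) (hC : 0 ≤ C) (hA : 0 ≤ A)
    (hk₁ : |k₁| * T.t₀ ≤ 1 / 2) (hδ0 : 0 ≤ δ) (hδ : δ * T.t₀ ≤ 1) (hl0 : 0 ≤ l) (hl : l ≤ b ^ 2)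
    (hloc : ∀ p : Plane, |p.2| < T.t₀ → |kap P p.1 - k₁| ≤ δ ∨ u =ᶠ[𝓝 (tub P p)] 0)
    (hmode : ∀ ζ v, ContDiff ℝ 1 v → (∀ τ, b * t₂ ≤ τ → v τ = 0) →
        c * b * (mass (b * t₂) v - en0 (b * t₂) ζ v) - C * (A + 1) * wenx (b * t₂) ζ m v ≤
          b ^ 2 * nrg (b * t₂) (b⁻¹ * k₁) ζ v - l * dens (b * t₂) (b⁻¹ * k₁) v) :
    c * b * (nsq Ω u - Qf Ω (b ^ 2) u / b ^ 2) ≤ Qf Ω (b ^ 2) u - l * nsq Ω u +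
      (5 + 4 * c / T.t₀ + 20 * C) * (A + 1 + δ * b) * Gw Ω b d (m + 3) u := by
  obtain ⟨Y, α, hY, hq, hv, h1, h3, h4⟩ :=
    exists_strip_model T ho hbd hdc hd h12 h0 h2 hb hu hs
  have ht := T.pos
  have i1 := h1 k₁ δ l hk₁ hδ hl0 hl hloc
  have i2 := h1 0 (1 / 2 / T.t₀) 0 (by simp) (by rw [div_mul_cancel₀ _ ht.ne']; norm_num) le_rfl
    (by positivity) fun p _ => Or.inl (by
      rw [sub_zero, le_div_iff₀ ht]; exact T.curv _)
  have i4 := h4 m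
  have i5 := strip_modes hY P.L_pos hq hb rfl hv hmode
  simp only [mul_zero, sub_zero, zero_div, add_zero, zero_mul] at i2
  set G := Gw Ω b d (m + 3) u with hG
  set G3 := Gw Ω b d 3 u with hG3
  have hGG : G3 ≤ G := Gw_mono ho hbd hdc hd0 hb hu (by omega)
  have hG0 : 0 ≤ G3 := Gw_nonneg ho hd0 hb 3 u
  set W := (b ^ 2)⁻¹ * (strp P.L 0 t₂ (fun t => (1 + b * t) ^ m) (dtv Y) +
        strp P.L 0 t₂ (fun t => (1 + b * t) ^ m) (cov (fun t => b ^ 2 * t) Y)) +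
        strp P.L 0 t₂ (fun t => (1 + b * t) ^ m) Y
  set D := strp P.L 0 t₂ (fun _ => 1) (dtv Y) +
    strp P.L 0 t₂ (fun _ => 1) (cov (fun t => b ^ 2 * t) Y)
  set s := strp P.L 0 t₂ (fun _ => 1) Y
  set N := nsq Ω u
  set Q := Qf Ω (b ^ 2) u
  have j1 : c * b * (N - Q / b ^ 2) ≤ c * b * (s - (b ^ 2)⁻¹ * D) + 4 * c / T.t₀ * G3 := by
    have e1 := mul_le_mul_of_nonneg_left h3 (by positivity : 0 ≤ c * b)
    have e2 := mul_le_mul_of_nonneg_left i2 (by positivity : 0 ≤ c * b * (b ^ 2)⁻¹)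
    have e3 : c * b * (s + T.t₀⁻¹ * b⁻¹ * G3) = c * b * s + c / T.t₀ * G3 := by field_simp
    have e4 : c * b * (b ^ 2)⁻¹ * (Q + 5 * (1 / 2 / T.t₀) * b * G3) =
      c * b * (Q / b ^ 2) + 5 / 2 * (c / T.t₀ * G3) := by field_simp
    have e5 : 0 ≤ c / T.t₀ * G3 := by positivity
    have e6 : 4 * c / T.t₀ * G3 = 4 * (c / T.t₀ * G3) := by ring
    rw [e6]
    linarith
  have j2 := mul_le_mul_of_nonneg_left i4 (by positivity : 0 ≤ C * (A + 1))
  have j3 := mul_le_mul_of_nonneg_left hGG (by positivity : 0 ≤ 5 * δ * b)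
  have j4 := mul_le_mul_of_nonneg_left hGG (by positivity : 0 ≤ 4 * c / T.t₀)
  have j5 : 0 ≤ (5 * (A + 1) + 4 * c / T.t₀ * (A + δ * b) + 20 * C * (δ * b)) * G := by
    have := hG0.trans hGG
    positivity
  linarith

lemma lower_theta : Theta0 * b ^ 2 * nsq Ω u ≤ Qf Ω (b ^ 2) u + 4 / T.t₀ * b * Gw Ω b d 3 u := by
  obtain ⟨Y, α, hY, hq, hv, h1, h3, -⟩ :=
    exists_strip_model T ho hbd hdc hd h12 h0 h2 hb hu hs
  have ht := T.pos
  have i2 := h1 0 (1 / 2 / T.t₀) 0 (by simp) (by rw [div_mul_cancel₀ _ ht.ne']; norm_num) le_rfl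
    (by positivity) fun p _ => Or.inl (by
      rw [sub_zero, le_div_iff₀ ht]; exact T.curv _)
  have i5 := strip_modes hY P.L_pos hq hb rfl hv (c := 0) (C := 0) (A := 0) (m := 0) (k₁ := 0)
    (l := Theta0 * b ^ 2) fun ζ v hv hvT => by
      rw [mul_zero, nrg_zero, dens_zero]
      have := mul_le_mul_of_nonneg_left (theta_mul_le hv (by positivity) hvT ζ) (sq_nonneg b)
      linarith
  simp only [mul_zero, sub_zero, zero_div, add_zero, zero_mul] at i2 i5
  set G3 := Gw Ω b d 3 u
  have hG0 : 0 ≤ G3 := Gw_nonneg ho hd0 hb 3 u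
  have hΘ := Theta0_pos
  have e1 := mul_le_mul_of_nonneg_left h3 (by positivity : 0 ≤ Theta0 * b ^ 2)
  have e2 : Theta0 * b ^ 2 * (strp P.L 0 t₂ (fun _ => 1) Y + T.t₀⁻¹ * b⁻¹ * G3) =
    Theta0 * b ^ 2 * strp P.L 0 t₂ (fun _ => 1) Y + Theta0 * (b / T.t₀ * G3) := by field_simp
  have e3 := mul_le_mul_of_nonneg_right Theta0_lt_one.le (by positivity : 0 ≤ b / T.t₀ * G3)
  have e4 : 5 * (1 / 2 / T.t₀) * b * G3 = 5 / 2 * (b / T.t₀ * G3) := by ring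
  have e5 : 4 / T.t₀ * b * G3 = 4 * (b / T.t₀ * G3) := by ring
  have e6 : 0 ≤ b / T.t₀ * G3 := by positivity
  rw [e5]
  linarith
end

end SC

namespace SC

lemma trial_point {a N b t k k₂ δ K κ₀ ζ : ℝ} (ha : 0 ≤ a) (hN : 0 ≤ N) (hb : 0 < b) (ht : 0 ≤ t)
    (hk : |t * k| ≤ 1 / 2) (hk₂ : |t * k₂| ≤ 1 / 2) (hκ : |k| ≤ κ₀) (hδ : |k - k₂| ≤ δ)
    (hδt : δ * t ≤ 1) (hζ : |ζ| ≤ K) :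
    (1 - t * k) * (b ^ 2 * a + ((1 - t * k) ^ 2)⁻¹ * (b ^ 2 * (ζ + b * t - b * t ^ 2 * k / 2) ^ 2 * N)) ≤
      b ^ 2 * ((1 - b⁻¹ * k₂ * (b * t)) * a + pot (b⁻¹ * k₂) ζ (b * t) * N) +
      (b * δ * (K + 3) ^ 2 + 2 * κ₀ ^ 2 * (K + 2) ^ 2) * ((1 + b * t) ^ 4 * (a + N)) := by
  obtain ⟨hk1, hk2⟩ := abs_le.1 hk
  obtain ⟨hj1, hj2⟩ := abs_le.1 hk₂
  obtain ⟨hd1, hd2⟩ := abs_le.1 hδ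
  obtain ⟨hz1, hz2⟩ := abs_le.1 hζ
  have hδ0 : 0 ≤ δ := (abs_nonneg _).trans hδ
  have hK0 : 0 ≤ K := (abs_nonneg _).trans hζ
  set J := 1 - t * k with hJ
  have hJ0 : 0 < J := by linarith
  set τ := b * t with hτ
  have hτ0 : 0 ≤ τ := by positivity
  set g := ζ + τ - b * t ^ 2 * k₂ / 2 with hg
  set r := -(b * t ^ 2 * (k - k₂) / 2) with hr
  have e1 : ζ + τ - b * t ^ 2 * k / 2 = g + r := by rw [hg, hr]; ring
  have e2 : pot (b⁻¹ * k₂) ζ τ = (1 + t * k₂) * g ^ 2 := by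
    rw [pot, hg, hτ]; field_simp
  have e3 : b⁻¹ * k₂ * τ = t * k₂ := by rw [hτ]; field_simp
  rw [e1, e2, e3]
  have e4 : J * (b ^ 2 * a + (J ^ 2)⁻¹ * (b ^ 2 * (g + r) ^ 2 * N)) =
      J * (b ^ 2 * a) + b ^ 2 * (J⁻¹ * (g + r) ^ 2) * N := by field_simp
  rw [e4]
  have hi1 : J⁻¹ ≤ 1 + t * k + 2 * (t * k) ^ 2 := by
    rw [inv_le_iff_one_le_mul₀ hJ0]
    have := mul_nonneg (sq_nonneg (t * k)) (by linarith : 0 ≤ 1 - 2 * (t * k))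
    rw [hJ]; linarith
  have hi2 : J⁻¹ ≤ 2 := by
    rw [inv_le_iff_one_le_mul₀ hJ0]; linarith
  have hi0 : 0 < J⁻¹ := inv_pos.2 hJ0
  have htd : t * (k - k₂) ≤ t * δ := mul_le_mul_of_nonneg_left hd2 ht
  have htd' : -(t * δ) ≤ t * (k - k₂) := by
    have := mul_le_mul_of_nonneg_left hd1 ht
    linarith
  have hgK : |g| ≤ (K + 2) * (1 + τ) := by
    have h1 : |b * t ^ 2 * k₂ / 2| ≤ τ / 4 := by
      have := mul_le_mul_of_nonneg_left hk₂ hτ0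
      rw [show b * t ^ 2 * k₂ / 2 = τ * (t * k₂) / 2 by rw [hτ]; ring, abs_div, abs_mul,
        abs_of_nonneg hτ0, abs_two]
      linarith
    obtain ⟨h2, h3⟩ := abs_le.1 h1
    have h4 : 0 ≤ K * τ := by positivity
    rw [abs_le]
    constructor <;> rw [hg] <;> linarith
  have hg2 : g ^ 2 ≤ (K + 2) ^ 2 * (1 + τ) ^ 2 := by
    rw [← sq_abs, ← mul_pow]
    exact pow_le_pow_left₀ (abs_nonneg _) hgK 2
  have hr1 : b ^ 2 * |r| ≤ b * δ * τ ^ 2 / 2 := by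
    rw [hr, abs_neg, abs_div, abs_mul, abs_of_nonneg (by positivity : 0 ≤ b * t ^ 2), abs_two, hτ]
    have := mul_le_mul_of_nonneg_left hδ (by positivity : 0 ≤ b ^ 3 * t ^ 2 / 2)
    linarith
  have hr2 : b ^ 2 * r ^ 2 ≤ b * δ * τ ^ 3 / 4 := by
    have h1 : (k - k₂) ^ 2 ≤ δ ^ 2 := by rw [← sq_abs]; exact pow_le_pow_left₀ (abs_nonneg _) hδ 2
    have h2 := mul_le_mul_of_nonneg_left h1 (by positivity : 0 ≤ b ^ 4 * t ^ 4 / 4)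
    have h3 := mul_le_mul_of_nonneg_left hδt (by positivity : 0 ≤ δ * b ^ 4 * t ^ 3 / 4)
    rw [hr, hτ]
    linarith
  have hcross : J⁻¹ * (g + r) ^ 2 ≤ J⁻¹ * g ^ 2 + 2 * (2 * (|g| * |r|) + r ^ 2) := by
    have h1 : (g + r) ^ 2 ≤ g ^ 2 + (2 * (|g| * |r|) + r ^ 2) := by
      have := le_abs_self (g * r)
      rw [abs_mul] at this
      linarith
    have h2 := mul_le_mul_of_nonneg_left h1 hi0.le
    have h3 := mul_le_mul_of_nonneg_right hi2 (by positivity : 0 ≤ 2 * (|g| * |r|) + r ^ 2)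
    linarith
  have hmain : J⁻¹ * g ^ 2 ≤ (1 + t * k₂) * g ^ 2 + (t * δ + 2 * (t * k) ^ 2) * g ^ 2 := by
    have := mul_le_mul_of_nonneg_right
      (hi1.trans (by linarith : _ ≤ 1 + t * k₂ + (t * δ + 2 * (t * k) ^ 2))) (sq_nonneg g)
    linarith
  set E := b * δ with hE
  have hE0 : 0 ≤ E := by positivity
  have b1 : b ^ 2 * (t * δ * g ^ 2) ≤ E * (τ * ((K + 2) ^ 2 * (1 + τ) ^ 2)) := by
    have := mul_le_mul_of_nonneg_left hg2 (by positivity : 0 ≤ b ^ 2 * t * δ)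
    rw [hE, hτ] at *
    linarith
  have b2 : b ^ 2 * (2 * (t * k) ^ 2 * g ^ 2) ≤
      2 * κ₀ ^ 2 * (K + 2) ^ 2 * (τ ^ 2 * (1 + τ) ^ 2) := by
    have h1 : k ^ 2 ≤ κ₀ ^ 2 := by rw [← sq_abs]; exact pow_le_pow_left₀ (abs_nonneg _) hκ 2
    have h2 := mul_le_mul h1 hg2 (sq_nonneg _) (sq_nonneg _)
    have h3 := mul_le_mul_of_nonneg_left h2 (by positivity : 0 ≤ 2 * τ ^ 2)
    rw [hτ] at *
    linarith
  have b3 : b ^ 2 * (4 * (|g| * |r|)) ≤ 2 * E * τ ^ 2 * ((K + 2) * (1 + τ)) := by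
    have := mul_le_mul hr1 hgK (abs_nonneg _) (by positivity)
    linarith
  have b4 : E * (τ * ((K + 2) ^ 2 * (1 + τ) ^ 2)) + 2 * E * τ ^ 2 * ((K + 2) * (1 + τ)) +
      2 * (E * τ ^ 3 / 4) ≤ E * (K + 3) ^ 2 * (1 + τ) ^ 4 := by
    have h : 0 ≤ E * ((K + 2) ^ 2 * (1 + 3 * τ + 4 * τ ^ 2 + 3 * τ ^ 3 + τ ^ 4) +
      2 * (K + 2) * (1 + 4 * τ + 5 * τ ^ 2 + 3 * τ ^ 3 + τ ^ 4) +
      (1 + 4 * τ + 6 * τ ^ 2 + 7 / 2 * τ ^ 3 + τ ^ 4)) := by positivity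
    linarith
  have b5 : 2 * κ₀ ^ 2 * (K + 2) ^ 2 * (τ ^ 2 * (1 + τ) ^ 2) ≤
      2 * κ₀ ^ 2 * (K + 2) ^ 2 * (1 + τ) ^ 4 := by
    have h : 0 ≤ 2 * κ₀ ^ 2 * (K + 2) ^ 2 * ((1 + τ) ^ 2 * (1 + 2 * τ)) := by positivity
    linarith
  have c1 : b ^ 2 * (J⁻¹ * (g + r) ^ 2) ≤ b ^ 2 * ((1 + t * k₂) * g ^ 2) +
      (E * (K + 3) ^ 2 + 2 * κ₀ ^ 2 * (K + 2) ^ 2) * (1 + τ) ^ 4 := by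
    have := mul_le_mul_of_nonneg_left (hcross.trans (add_le_add_left hmain _)) (sq_nonneg b)
    linarith
  have c2 := mul_le_mul_of_nonneg_right c1 hN
  have c3 : J * (b ^ 2 * a) ≤ b ^ 2 * ((1 - t * k₂) * a) + E * τ * a := by
    have := mul_le_mul_of_nonneg_right htd' (by positivity : 0 ≤ b ^ 2 * a)
    rw [hJ, hE, hτ]
    linarith
  have c4 : E * τ * a ≤ (E * (K + 3) ^ 2 + 2 * κ₀ ^ 2 * (K + 2) ^ 2) * ((1 + τ) ^ 4 * a) := by
    have h : 0 ≤ E * ((K ^ 2 + 6 * K + 8) * (1 + τ) ^ 4 +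
      (1 + 3 * τ + 6 * τ ^ 2 + 4 * τ ^ 3 + τ ^ 4)) * a := by positivity
    have h' : 0 ≤ 2 * κ₀ ^ 2 * (K + 2) ^ 2 * ((1 + τ) ^ 4 * a) := by positivity
    linarith
  linarith

variable {Ω : Set Plane}

lemma exists_arc_bump (P : BoundaryParam Ω) (s₀ : ℝ) {δ : ℝ} (hδ : 0 < δ) :
    ∃ (ρ : ℝ → ℝ) (η : ℝ), 0 < η ∧ η < P.L / 2 ∧ ContDiff ℝ (⊤ : ℕ∞) ρ ∧
      (∀ s, |s - s₀| ≤ η / 2 → ρ s = 1) ∧ (∀ s, η ≤ |s - s₀| → ρ s = 0) ∧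
      (∀ s, ρ s ∈ Icc (0 : ℝ) 1) ∧ ∀ s, |s - s₀| ≤ η → |kap P s - kap P s₀| ≤ δ := by
  obtain ⟨η₀, h1, h2⟩ := Metric.continuous_iff.1 P.contDiff_kap.continuous s₀ δ hδ
  have hL := P.L_pos
  set η := min (η₀ / 2) (P.L / 4) with hη
  have hη0 : 0 < η := by positivity
  have e1 := min_le_left (η₀ / 2) (P.L / 4)
  have e2 := min_le_right (η₀ / 2) (P.L / 4)
  obtain ⟨ρ, r1, r2, r3, r4⟩ := exists_bump (a := s₀ - η) (a' := s₀ - η / 2) (b' := s₀ + η / 2)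
    (b := s₀ + η) (by linarith) (by linarith)
  refine ⟨ρ, η, hη0, by linarith, r1, fun s hs => r2 s ?_, fun s hs => r3 s fun hc => ?_, r4,
    fun s hs => ?_⟩
  · obtain ⟨h3, h4⟩ := abs_le.1 hs
    exact ⟨by linarith, by linarith⟩
  · have : |s - s₀| < η := abs_lt.2 ⟨by linarith [hc.1], by linarith [hc.2]⟩
    linarith
  · have := h2 s (by rw [Real.dist_eq]; linarith)
    rw [Real.dist_eq] at this
    exact this.le

end SC

namespace SC

lemma fderiv_snd_eq {Y : Plane → ℂ} {p : Plane} {y : ℂ} (hY : DifferentiableAt ℝ Y p)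
    (h : HasDerivAt (fun t => Y (p.1, t)) y p.2) : fderiv ℝ Y p (0, 1) = y := by
  have h1 : HasDerivAt (fun t : ℝ => ((p.1, t) : Plane)) (0, 1) p.2 :=
    (hasDerivAt_const _ _).prodMk (hasDerivAt_id _)
  exact (HasFDerivAt.comp_hasDerivAt p.2 (f := fun t : ℝ => ((p.1, t) : Plane)) hY.hasFDerivAt h1).unique h

lemma fderiv_fst_eq {Y : Plane → ℂ} {p : Plane} {y : ℂ} (hY : DifferentiableAt ℝ Y p)
    (h : HasDerivAt (fun s => Y (s, p.2)) y p.1) : fderiv ℝ Y p (1, 0) = y := by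
  have h1 : HasDerivAt (fun s : ℝ => ((s, p.2) : Plane)) (1, 0) p.1 :=
    (hasDerivAt_id _).prodMk (hasDerivAt_const _ _)
  exact (HasFDerivAt.comp_hasDerivAt p.1 (f := fun s : ℝ => ((s, p.2) : Plane)) hY.hasFDerivAt h1).unique h

lemma rect_mono {F G : Plane → ℝ} (hF : Continuous F) (hG : Continuous G) {a b c d : ℝ}
    (hab : a ≤ b) (hcd : c ≤ d)
    (h : ∀ s ∈ Ioo a b, ∀ t ∈ Icc c d, F (s, t) ≤ G (s, t)) :
    ∫ t in c..d, ∫ s in a..b, F (s, t) ≤ ∫ t in c..d, ∫ s in a..b, G (s, t) := by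
  have hc : ∀ {H : Plane → ℝ}, Continuous H → Continuous fun t => ∫ s in a..b, H (s, t) :=
    fun {H} hH => intervalIntegral.continuous_parametric_intervalIntegral_of_continuous'
      (f := fun t s => H (s, t)) (by unfold Function.uncurry; fun_prop) a b
  refine intervalIntegral.integral_mono_on hcd ((hc hF).intervalIntegrable _ _)
    ((hc hG).intervalIntegrable _ _) fun t ht => ?_
  exact intervalIntegral.integral_mono_on_of_le_Ioo hab
    (Continuous.intervalIntegrable (by fun_prop) _ _)
    (Continuous.intervalIntegrable (by fun_prop) _ _) fun s hs => h s hs t ht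

variable {Ω : Set Plane} {P : BoundaryParam Ω}

/-- Localized trial functions in tubular coordinates. -/
lemma exists_trial_fn (T : Tube P) {r : ℝ} (h0 : 0 < r) (hr : r < T.t₀)
    {ρ : ℝ → ℝ} (hρ : ContDiff ℝ (⊤ : ℕ∞) ρ) {s₀ η : ℝ} (hη : η < P.L / 2)
    (hρ0 : ∀ s, η ≤ |s - s₀| → ρ s = 0) {b ζ : ℝ} (hb : 0 < b) {w : ℝ → ℂ} (hw : ContDiff ℝ 1 w)
    (hwT : ∀ τ, b * r ≤ τ → w τ = 0) :
    ∃ u : Plane → ℂ, ContDiff ℝ 1 u ∧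
      (∀ s ∈ Ioo (s₀ - P.L / 2) (s₀ - P.L / 2 + P.L), ∀ t ∈ Icc 0 r,
        ‖u (tub P (s, t))‖ ^ 2 = ρ s ^ 2 * ‖w (b * t)‖ ^ 2 ∧
        magSq (b ^ 2) F0 u (tub P (s, t)) = ρ s ^ 2 * (b ^ 2 * ‖deriv w (b * t)‖ ^ 2) +
          ((1 - t * kap P s) ^ 2)⁻¹ * ((deriv ρ s ^ 2 +
            ρ s ^ 2 * (b ^ 2 * (ζ + b * t - b * t ^ 2 * kap P s / 2) ^ 2)) * ‖w (b * t)‖ ^ 2)) ∧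
      ∀ x ∈ Ω, (∀ p : Plane, 0 < p.2 → p.2 ≤ r → tub P p ≠ x) →
        magSq (b ^ 2) F0 u x = 0 ∧ u x = 0 := by
  obtain ⟨χ, r', hr1, hr2, c1, c2, c3, -⟩ := T.exists_bump hr
  have hρ1 : ContDiff ℝ 1 ρ := hρ.of_le (by exact_mod_cast le_top)
  have hχ1 : ContDiff ℝ 1 χ := c1.of_le (by exact_mod_cast le_top)
  have hg1 : ContDiff ℝ 1 (gau P) := (contDiff_gau P).of_le (by exact_mod_cast le_top)
  set V : Plane → ℂ := fun q => Complex.exp ((b * ζ * q.1 : ℝ) * Complex.I) *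
    ((ρ q.1 : ℂ) * w (b * q.2)) with hV
  have hVc : ContDiff ℝ 1 V := contDiff_gauge
    ((contDiff_ofReal (hρ1.comp contDiff_fst)).mul (hw.comp (contDiff_const.mul contDiff_snd)))
    (contDiff_const.mul contDiff_fst)
  set G : Plane → ℂ := fun q => Complex.exp ((b ^ 2 * gau P q : ℝ) * Complex.I) *
    ((χ q.2 : ℂ) * V q) with hG
  have hGc : ContDiff ℝ 1 G := contDiff_gauge
    ((contDiff_ofReal (hχ1.comp contDiff_snd)).mul hVc) (contDiff_const.mul hg1)
  obtain ⟨u, u1, u2, u3, u4⟩ := exists_window_fn T hr2 (a := s₀ - P.L / 2) (b := s₀ + P.L / 2)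
    (a' := s₀ - η) (b' := s₀ + η) (by linarith) (by linarith) (by linarith)
    (by exact_mod_cast le_top) hGc (fun p hp => by
      by_cases h : p.1 ∈ Icc (s₀ - η) (s₀ + η)
      · have : χ p.2 = 0 := c3 p.2 (by by_contra hc; exact hp ⟨h, abs_le.1 (not_lt.1 hc)⟩)
        simp [hG, this]
      · have : ρ p.1 = 0 := hρ0 p.1 (by
          by_contra hc
          have := abs_lt.1 (not_le.1 hc)
          exact h ⟨by linarith, by linarith⟩)
        simp [hG, hV, this])
  have hdw : ∀ τ, b * r < τ → deriv w τ = 0 := fun τ hτ => by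
    have : w =ᶠ[𝓝 τ] fun _ => 0 := by
      filter_upwards [lt_mem_nhds hτ] with x hx using hwT x hx.le
    rw [this.deriv_eq, deriv_const]
  have hloc : ∀ p : Plane, p.1 ∈ Ioo (s₀ - P.L / 2) (s₀ + P.L / 2) → -r < p.2 → p.2 < T.t₀ →
      V =ᶠ[𝓝 p] fun q => Complex.exp ((-(b ^ 2 * gau P q) : ℝ) * Complex.I) * u (tub P q) := by
    intro p hp1 hp2 hp3
    filter_upwards [(isOpen_Ioo.prod (isOpen_Ioo (a := -r) (b := T.t₀))).mem_nhds
      (⟨hp1, hp2, hp3⟩ : p ∈ Ioo (s₀ - P.L / 2) (s₀ + P.L / 2) ×ˢ Ioo (-r) T.t₀)] with q hq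
    rw [u2 q ⟨hq.1, by linarith [hq.2.1], hq.2.2⟩, hG]
    have : (χ q.2 : ℂ) * V q = V q := by
      rcases le_or_gt q.2 r with h | h
      · rw [c2 q.2 (abs_le.2 ⟨hq.2.1.le, h⟩)]; simp
      · have : w (b * q.2) = 0 := hwT _ (mul_le_mul_of_nonneg_left h.le hb.le)
        simp [hV, this]
    dsimp only
    rw [this, ← mul_assoc, ← Complex.exp_add]
    push_cast
    rw [show -((b : ℂ) ^ 2 * (gau P q : ℂ)) * Complex.I + (b : ℂ) ^ 2 * (gau P q : ℂ) * Complex.I = 0 by ring,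
      Complex.exp_zero, one_mul]
  have hmag : ∀ p : Plane, p.1 ∈ Ioo (s₀ - P.L / 2) (s₀ + P.L / 2) → 0 ≤ p.2 → p.2 < T.t₀ →
      ‖u (tub P p)‖ ^ 2 = ρ p.1 ^ 2 * ‖w (b * p.2)‖ ^ 2 ∧
      magSq (b ^ 2) F0 u (tub P p) = ρ p.1 ^ 2 * (b ^ 2 * ‖deriv w (b * p.2)‖ ^ 2) +
          ((1 - p.2 * kap P p.1) ^ 2)⁻¹ * ((deriv ρ p.1 ^ 2 +
            ρ p.1 ^ 2 * (b ^ 2 * (ζ + b * p.2 - b * p.2 ^ 2 * kap P p.1 / 2) ^ 2)) * ‖w (b * p.2)‖ ^ 2) := by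
    intro p hp1 hp2 hp3
    have hev := hloc p hp1 (by linarith) hp3
    have hJ := T.jac_ge (p := p) (abs_le.2 ⟨by linarith [T.pos], hp3.le⟩)
    have hVd : DifferentiableAt ℝ V p := hVc.differentiable (by norm_num) p
    set e := Complex.exp ((b * ζ * p.1 : ℝ) * Complex.I) with he
    have hne : ‖e‖ = 1 := Complex.norm_exp_ofReal_mul_I _
    have hVp : ‖V p‖ ^ 2 = ρ p.1 ^ 2 * ‖w (b * p.2)‖ ^ 2 := by
      rw [hV]; dsimp only
      rw [norm_mul, ← he, hne, one_mul, norm_mul, mul_pow, Complex.norm_real, Real.norm_eq_abs, sq_abs]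
    refine ⟨?_, ?_⟩
    · rw [← hVp, hev.self_of_nhds, norm_mul, Complex.norm_exp_ofReal_mul_I, one_mul]
    · rw [magSq_tub P u1 (by linarith) hev]
      have d1 : fderiv ℝ V p (0, 1) = e * ((ρ p.1 : ℂ) * ((b : ℂ) * deriv w (b * p.2))) := by
        refine fderiv_snd_eq hVd ?_
        have h1 : HasDerivAt w (deriv w (b * p.2)) (b * p.2) :=
          ((hw.differentiable (by norm_num)) _).hasDerivAt
        have h2 : HasDerivAt (fun t => w (b * t)) (b • deriv w (b * p.2)) p.2 := by
          have h3 : HasDerivAt (fun t : ℝ => b * t) b p.2 := by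
            simpa using (hasDerivAt_id p.2).const_mul b
          exact HasDerivAt.scomp p.2 h1 h3
        rw [Complex.real_smul] at h2
        exact (h2.const_mul (ρ p.1 : ℂ)).const_mul e
      have d2 : fderiv ℝ V p (1, 0) = e * (((deriv ρ p.1 : ℝ) : ℂ) +
          (b * ζ * ρ p.1 : ℝ) * Complex.I) * w (b * p.2) := by
        refine fderiv_fst_eq hVd ?_
        have h1 : HasDerivAt (fun s => (ρ s : ℂ)) ((deriv ρ p.1 : ℝ) : ℂ) p.1 :=
          ((hρ1.differentiable (by norm_num)) _).hasDerivAt.ofReal_comp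
        have h2 : HasDerivAt (fun s : ℝ => ((b * ζ * s : ℝ) : ℂ) * Complex.I)
            (((b * ζ : ℝ) : ℂ) * Complex.I) p.1 := by
          have h3 : HasDerivAt (fun s : ℝ => b * ζ * s) (b * ζ) p.1 := by
            simpa using (hasDerivAt_id p.1).const_mul (b * ζ)
          exact h3.ofReal_comp.mul_const _
        have h4 := h2.cexp.mul (h1.mul_const (w (b * p.2)))
        refine h4.congr_deriv ?_
        rw [← he]; push_cast; ring
      have d3 : cov (fun t => b ^ 2 * (t - t ^ 2 * kap P p.1 / 2)) V p =
          e * (((deriv ρ p.1 : ℝ) : ℂ) + ((ρ p.1 * (b * (ζ + b * p.2 - b * p.2 ^ 2 * kap P p.1 / 2)) : ℝ) : ℂ)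
            * Complex.I) * w (b * p.2) := by
        rw [cov, d2, hV]; dsimp only; rw [← he]; push_cast; ring
      have hn : ∀ x y : ℝ, ‖(x : ℂ) + (y : ℂ) * Complex.I‖ ^ 2 = x ^ 2 + y ^ 2 := fun x y => by
        rw [Complex.sq_norm, Complex.normSq_add_mul_I]
      rw [dtv, d1, d3]
      simp only [norm_mul, hne, one_mul, mul_pow, hn]
      simp only [Complex.norm_real, Real.norm_eq_abs, sq_abs]
  refine ⟨u, u1, fun s hs t ht => ?_, fun x hx h => ?_⟩
  · rw [show s₀ - P.L / 2 + P.L = s₀ + P.L / 2 by ring] at hs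
    exact hmag (s, t) hs ht.1 (by linarith [ht.2])
  · by_cases hxs : x ∈ tsupport u
    · obtain ⟨p, ⟨hp1, hp2⟩, rfl⟩ := u4 hxs
      have hp0 : 0 < p.2 := by
        by_contra hcon
        exact T.notMem p (by linarith [hp2.1]) (not_lt.1 hcon) hx
      have hpr : r < p.2 := by
        by_contra hcon
        exact h p hp0 (not_lt.1 hcon) rfl
      obtain ⟨h1, h2⟩ := hmag p ⟨by linarith [hp1.1], by linarith [hp1.2]⟩ hp0.le (by linarith [hp2.2])
      have e1 : w (b * p.2) = 0 := hwT _ (mul_le_mul_of_nonneg_left hpr.le hb.le)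
      have e2 : deriv w (b * p.2) = 0 := hdw _ (mul_lt_mul_of_pos_left hpr hb)
      rw [e1, e2] at h2
      rw [e1] at h1
      refine ⟨by simpa using h2, by simpa using h1⟩
    · have := notMem_tsupport_iff_eventuallyEq.1 hxs
      exact ⟨magSq_eq_zero this, this.self_of_nhds⟩

end SC

namespace SC

variable {Ω : Set Plane} {P : BoundaryParam Ω}

/-- Energy bound for trial functions localized near a boundary point. -/
lemma exists_trial_bound (T : Tube P) (ho : IsOpen Ω) {r : ℝ} (h0 : 0 < r) (hr : r < T.t₀) (s₀ : ℝ)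
    {δ : ℝ} (hδ : 0 < δ) (hδt : δ * T.t₀ ≤ 1) {K : ℝ} (hK : 0 ≤ K) :
    ∃ C, 0 ≤ C ∧ ∀ b, 0 < b → ∀ ζ w, |ζ| ≤ K → ContDiff ℝ 1 w → (∀ τ, b * r ≤ τ → w τ = 0) →
      lam1 Ω (b ^ 2) * (dens (b * r) (b⁻¹ * kap P s₀) w - δ / b * wen (b * r) 4 w) ≤
        b ^ 2 * nrg (b * r) (b⁻¹ * kap P s₀) ζ w + (b * δ * (K + 3) ^ 2 + C) * wen (b * r) 4 w := by
  obtain ⟨ρ, η, hη0, hη, hρ, hρ1, hρ0, -, hkδ⟩ := exists_arc_bump P s₀ hδ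
  have hL := P.L_pos
  have cρ := hρ.continuous
  have cρ' : Continuous (deriv ρ) := hρ.continuous_deriv (by simp)
  have ck : Continuous (kap P) := P.contDiff_kap.continuous
  set a₀ := s₀ - P.L / 2 with ha₀
  set R := ∫ s in a₀..(a₀ + P.L), ρ s ^ 2 with hR
  set R1 := ∫ s in a₀..(a₀ + P.L), deriv ρ s ^ 2 with hR1
  have hRpos : 0 < R := intervalIntegral.integral_pos (by linarith) (by fun_prop)
    (fun s _ => by positivity) ⟨s₀, ⟨by linarith, by linarith⟩, by
      rw [hρ1 s₀ (by rw [sub_self, abs_zero]; linarith)]; norm_num⟩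
  have hR1nn : 0 ≤ R1 := intervalIntegral.integral_nonneg (by linarith) fun s _ => by positivity
  set k₂ := kap P s₀ with hk₂
  set κ₀ := 1 / (2 * T.t₀) with hκ₀
  have ht0 := T.pos
  have hκ : ∀ s, |kap P s| ≤ κ₀ := fun s => by
    rw [hκ₀, le_div_iff₀ (by linarith)]; linarith [T.curv s]
  have htk : ∀ s t, 0 ≤ t → t ≤ r → |t * kap P s| ≤ 1 / 2 := fun s t h1 h2 => by
    rw [abs_mul, abs_of_nonneg h1]
    have := mul_le_mul_of_nonneg_right (h2.trans hr.le) (abs_nonneg (kap P s))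
    linarith [T.curv s]
  refine ⟨2 * κ₀ ^ 2 * (K + 2) ^ 2 + 2 * R1 / R, by positivity, fun b hb ζ w hζ hw hwT => ?_⟩
  obtain ⟨u, hu, hu1, hu2⟩ := exists_trial_fn T h0 hr hρ hη hρ0 (ζ := ζ) hb hw hwT
  have cw := hw.continuous
  have cw' := continuous_deriv_of_contDiff_one hw
  have cpot := continuous_pot (b⁻¹ * k₂) ζ
  have ctub : Continuous (tub P) := P.contDiff_tub.continuous
  set A' := b * δ * (K + 3) ^ 2 + 2 * κ₀ ^ 2 * (K + 2) ^ 2 with hA'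
  set W : ℝ → ℝ := fun τ => (1 + τ) ^ 4 * (‖deriv w τ‖ ^ 2 + ‖w τ‖ ^ 2) with hW
  have cW : Continuous W := by rw [hW]; fun_prop
  set g : ℝ → ℝ := fun τ => b ^ 2 * ((1 - b⁻¹ * k₂ * τ) * ‖deriv w τ‖ ^ 2 +
    pot (b⁻¹ * k₂) ζ τ * ‖w τ‖ ^ 2) + A' * W τ with hg
  have cg : Continuous g := by rw [hg]; fun_prop
  set g₂ : ℝ → ℝ := fun τ => (1 - b⁻¹ * k₂ * τ) * ‖w τ‖ ^ 2 - δ / b * W τ with hg₂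
  have cg₂ : Continuous g₂ := by rw [hg₂]; fun_prop
  have hWnn : ∀ τ, 0 ≤ τ → 0 ≤ W τ := fun τ h => by rw [hW]; positivity
  have hWle : ∀ τ, 0 ≤ τ → τ * ‖w τ‖ ^ 2 ≤ W τ ∧ ‖w τ‖ ^ 2 ≤ W τ := fun τ h => by
    have h4 : 1 + τ ≤ (1 + τ) ^ 4 := le_self_pow₀ (by linarith) (by norm_num)
    have e1 : ‖w τ‖ ^ 2 ≤ ‖deriv w τ‖ ^ 2 + ‖w τ‖ ^ 2 := le_add_of_nonneg_left (by positivity)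
    have e2 : (1 + τ) * ‖w τ‖ ^ 2 ≤ W τ := mul_le_mul h4 e1 (by positivity) (by positivity)
    have e3 : 0 ≤ τ * ‖w τ‖ ^ 2 := by positivity
    have e4 : 0 ≤ ‖w τ‖ ^ 2 := by positivity
    constructor <;> linarith
  have hbr : 0 ≤ b * r := by positivity
  have iI : ∀ {f : ℝ → ℝ} {x y : ℝ}, Continuous f → IntervalIntegrable f volume x y :=
    fun h => h.intervalIntegrable _ _
  have sub : ∀ f : ℝ → ℝ, ∫ t in (0 : ℝ)..r, f (b * t) = b⁻¹ * ∫ τ in (0 : ℝ)..(b * r), f τ := fun f => by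
    rw [intervalIntegral.integral_comp_mul_left f hb.ne', mul_zero, smul_eq_mul]
  have Ig : ∫ τ in (0 : ℝ)..(b * r), g τ = b ^ 2 * nrg (b * r) (b⁻¹ * k₂) ζ w + A' * wen (b * r) 4 w := by
    rw [hg, intervalIntegral.integral_add (iI (by fun_prop)) (iI (by fun_prop)),
      intervalIntegral.integral_const_mul, intervalIntegral.integral_const_mul]; rfl
  have Ig₂ : ∫ τ in (0 : ℝ)..(b * r), g₂ τ = dens (b * r) (b⁻¹ * k₂) w - δ / b * wen (b * r) 4 w := by
    rw [hg₂, intervalIntegral.integral_sub (iI (by fun_prop)) (iI (by fun_prop)),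
      intervalIntegral.integral_const_mul]; rfl
  have IN : ∫ τ in (0 : ℝ)..(b * r), ‖w τ‖ ^ 2 ≤ wen (b * r) 4 w :=
    intervalIntegral.integral_mono_on hbr (iI (by fun_prop)) (iI cW) fun τ hτ => (hWle τ hτ.1).2
  have upper : Qf Ω (b ^ 2) u ≤ R * (b⁻¹ * ∫ τ in (0 : ℝ)..(b * r), g τ) +
      R1 * (2 * (b⁻¹ * ∫ τ in (0 : ℝ)..(b * r), ‖w τ‖ ^ 2)) := by
    rw [Qf, setIntegral_tub T ho h0.le hr (continuous_magSq hu) (fun x hx h => (hu2 x hx h).1) a₀]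
    have cm : Continuous (magSq (b ^ 2) F0 u) := continuous_magSq hu
    refine (rect_mono (F := fun p => (1 - p.2 * kap P p.1) * magSq (b ^ 2) F0 u (tub P p))
      (G := fun p => ρ p.1 ^ 2 * g (b * p.2) + deriv ρ p.1 ^ 2 * (2 * ‖w (b * p.2)‖ ^ 2))
      (by fun_prop) (by fun_prop) (by linarith) h0.le fun s hs t ht => ?_).trans (le_of_eq ?_)
    · dsimp only
      rw [(hu1 s hs t ht).2]
      have htk' := htk s t ht.1 ht.2
      have hJ : 1 / 2 ≤ 1 - t * kap P s := by linarith [(abs_le.1 htk').2]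
      have hJp : 0 < 1 - t * kap P s := by linarith
      have hJi : (1 - t * kap P s) * ((1 - t * kap P s) ^ 2)⁻¹ ≤ 2 := by
        rw [pow_two, mul_inv, ← mul_assoc, mul_inv_cancel₀ hJp.ne', one_mul]
        exact inv_le_of_inv_le₀ (by norm_num) (by linarith)
      have e1 := mul_le_mul_of_nonneg_right hJi
        (by positivity : 0 ≤ deriv ρ s ^ 2 * ‖w (b * t)‖ ^ 2)
      have e2 : ρ s ^ 2 * ((1 - t * kap P s) * (b ^ 2 * ‖deriv w (b * t)‖ ^ 2 +
          ((1 - t * kap P s) ^ 2)⁻¹ * (b ^ 2 * (ζ + b * t - b * t ^ 2 * kap P s / 2) ^ 2 *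
            ‖w (b * t)‖ ^ 2))) ≤ ρ s ^ 2 * g (b * t) := by
        rcases le_total η |s - s₀| with h | h
        · rw [hρ0 s h]; simp
        · refine mul_le_mul_of_nonneg_left ?_ (by positivity)
          refine (trial_point (by positivity) (by positivity) hb ht.1 htk' (htk s₀ t ht.1 ht.2) (hκ s)
            (hkδ s h) ?_ hζ).trans (le_of_eq (by rw [hg]))
          exact (mul_le_mul_of_nonneg_left (ht.2.trans hr.le) hδ.le).trans hδt
      nlinarith only [e1, e2]
    · rw [← sub, ← sub, ← intervalIntegral.integral_const_mul, ← intervalIntegral.integral_const_mul,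
        ← intervalIntegral.integral_const_mul,
        ← intervalIntegral.integral_add (iI (by fun_prop)) (iI (by fun_prop))]
      refine intervalIntegral.integral_congr fun t _ => ?_
      dsimp only
      rw [intervalIntegral.integral_add (iI (by fun_prop)) (iI (by fun_prop)),
        intervalIntegral.integral_mul_const, intervalIntegral.integral_mul_const]
  have lower : R * (b⁻¹ * ∫ τ in (0 : ℝ)..(b * r), g₂ τ) ≤ nsq Ω u := by
    have cu := hu.continuous
    rw [nsq, setIntegral_tub T ho h0.le hr (F := fun x => ‖u x‖ ^ 2) (by fun_prop)
      (fun x hx h => by rw [(hu2 x hx h).2]; simp) a₀]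
    refine le_trans (le_of_eq ?_) (rect_mono
      (F := fun p => ρ p.1 ^ 2 * g₂ (b * p.2))
      (G := fun p => (1 - p.2 * kap P p.1) * ‖u (tub P p)‖ ^ 2)
      (by fun_prop) (by fun_prop) (by linarith) h0.le fun s hs t ht => ?_)
    · rw [← sub, ← intervalIntegral.integral_const_mul]
      refine intervalIntegral.integral_congr fun t _ => ?_
      dsimp only
      rw [intervalIntegral.integral_mul_const]
    · dsimp only
      rw [(hu1 s hs t ht).1]
      rcases le_total η |s - s₀| with h | h
      · rw [hρ0 s h]; simp
      · have e0 : b⁻¹ * k₂ * (b * t) = t * k₂ := by field_simp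
        have e1 := (hWle (b * t) (by have := ht.1; positivity)).1
        have e2 : t * (kap P s - k₂) * ‖w (b * t)‖ ^ 2 ≤ δ / b * W (b * t) := by
          have h1 : t * (kap P s - k₂) ≤ t * δ :=
            mul_le_mul_of_nonneg_left ((le_abs_self _).trans (hkδ s h)) ht.1
          have h2 := mul_le_mul_of_nonneg_right h1 (by positivity : 0 ≤ ‖w (b * t)‖ ^ 2)
          have h3 := mul_le_mul_of_nonneg_left e1 (by positivity : 0 ≤ δ / b)
          have h4 : δ / b * (b * t * ‖w (b * t)‖ ^ 2) = t * δ * ‖w (b * t)‖ ^ 2 := by field_simp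
          linarith
        have e3 : g₂ (b * t) ≤ (1 - t * kap P s) * ‖w (b * t)‖ ^ 2 := by
          rw [hg₂]; dsimp only; rw [e0]; linarith
        have := mul_le_mul_of_nonneg_left e3 (by positivity : 0 ≤ ρ s ^ 2)
        linarith
  have h1 := mul_le_mul_of_nonneg_left lower (lam1_nonneg Ω (b ^ 2))
  have h2 := (h1.trans (lam1_mul_le (b ^ 2) hu)).trans upper
  rw [Ig₂, Ig] at h2
  have h3 : R1 * (2 * (b⁻¹ * ∫ τ in (0 : ℝ)..(b * r), ‖w τ‖ ^ 2)) ≤ R1 * (2 * (b⁻¹ * wen (b * r) 4 w)) := by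
    gcongr
  have h4 := mul_le_mul_of_nonneg_left (h2.trans (add_le_add_right h3 _)) (by positivity : 0 ≤ b / R)
  have e5 : b / R * (lam1 Ω (b ^ 2) * (R * (b⁻¹ * (dens (b * r) (b⁻¹ * k₂) w - δ / b * wen (b * r) 4 w)))) =
      lam1 Ω (b ^ 2) * (dens (b * r) (b⁻¹ * k₂) w - δ / b * wen (b * r) 4 w) := by field_simp
  have e6 : b / R * (R * (b⁻¹ * (b ^ 2 * nrg (b * r) (b⁻¹ * k₂) ζ w + A' * wen (b * r) 4 w)) +
      R1 * (2 * (b⁻¹ * wen (b * r) 4 w))) = b ^ 2 * nrg (b * r) (b⁻¹ * k₂) ζ w +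
      (b * δ * (K + 3) ^ 2 + (2 * κ₀ ^ 2 * (K + 2) ^ 2 + 2 * R1 / R)) * wen (b * r) 4 w := by
    rw [hA']; field_simp; ring
  rwa [e5, e6] at h4

end SC

namespace SC

variable {Ω : Set Plane} {P : BoundaryParam Ω}

lemma tendsto_dens (T : ℝ) {v : ℝ → ℂ} (hv : ContDiff ℝ 1 v) (k : ℝ) :
    Tendsto (fun b : ℝ => dens T (b⁻¹ * k) v) atTop (𝓝 (mass T v)) := by
  have cv := hv.continuous
  have h : Continuous fun κ => dens T κ v :=
    intervalIntegral.continuous_parametric_intervalIntegral_of_continuous'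
      (f := fun κ τ => (1 - κ * τ) * ‖v τ‖ ^ 2) (by unfold Function.uncurry; fun_prop) 0 T
  have h1 : Tendsto (fun b : ℝ => b⁻¹ * k) atTop (𝓝 0) := by
    simpa using tendsto_inv_atTop_zero.mul_const k
  rw [← dens_zero T v]
  exact (h.tendsto 0).comp h1

lemma tendsto_nrg (T ζ : ℝ) {v : ℝ → ℂ} (hv : ContDiff ℝ 1 v) (k : ℝ) :
    Tendsto (fun b : ℝ => nrg T (b⁻¹ * k) ζ v) atTop (𝓝 (en0 T ζ v)) := by
  have cv := hv.continuous
  have cd := continuous_deriv_of_contDiff_one hv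
  have h : Continuous fun κ => nrg T κ ζ v :=
    intervalIntegral.continuous_parametric_intervalIntegral_of_continuous'
      (f := fun κ τ => (1 - κ * τ) * ‖deriv v τ‖ ^ 2 + pot κ ζ τ * ‖v τ‖ ^ 2)
      (by unfold Function.uncurry pot; fun_prop) 0 T
  have h1 : Tendsto (fun b : ℝ => b⁻¹ * k) atTop (𝓝 0) := by
    simpa using tendsto_inv_atTop_zero.mul_const k
  rw [← nrg_zero T ζ v]
  exact (h.tendsto 0).comp h1

lemma integral_of_tail_zero {f : ℝ → ℝ} (hf : Continuous f) {T S : ℝ} (hTS : T ≤ S)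
    (h : ∀ τ, T < τ → f τ = 0) : ∫ τ in (0 : ℝ)..S, f τ = ∫ τ in (0 : ℝ)..T, f τ := by
  rw [← intervalIntegral.integral_add_adjacent_intervals (hf.intervalIntegrable 0 T)
    (hf.intervalIntegrable T S), add_eq_left]
  rw [intervalIntegral.integral_of_le hTS]
  exact setIntegral_eq_zero_of_forall_eq_zero fun x hx => h x hx.1

/-- The ground state energy is asymptotically at most `Θ₀ B`. -/
lemma lam1_le (ho : IsOpen Ω) (T : Tube P) {E₀ : ℝ} (hE : Theta0 < E₀) :
    ∀ᶠ b : ℝ in atTop, lam1 Ω (b ^ 2) ≤ E₀ * b ^ 2 := by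
  obtain ⟨ζ, S, v, hS, hv, hvS, hm, hen⟩ := exists_trial (sub_pos.2 hE)
  rw [add_sub_cancel] at hen
  have ht := T.pos
  have cv := hv.continuous
  have cd := continuous_deriv_of_contDiff_one hv
  obtain ⟨C, hC, hb1⟩ := exists_trial_bound T ho (r := T.t₀ / 2) (by linarith) (by linarith) 0
    (δ := T.t₀⁻¹) (by positivity) (by rw [inv_mul_cancel₀ ht.ne']) (abs_nonneg ζ)
  set k := kap P 0
  have hinv : Tendsto (fun b : ℝ => b⁻¹) atTop (𝓝 0) := tendsto_inv_atTop_zero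
  have hp : Tendsto (fun b : ℝ => nrg S (b⁻¹ * k) ζ v +
      (b⁻¹ * (T.t₀⁻¹ * (|ζ| + 3) ^ 2) + b⁻¹ * b⁻¹ * C) * wen S 4 v) atTop (𝓝 (en0 S ζ v)) := by
    simpa using (tendsto_nrg S ζ hv k).add
      (((hinv.mul_const (T.t₀⁻¹ * (|ζ| + 3) ^ 2)).add ((hinv.mul hinv).mul_const C)).mul_const (wen S 4 v))
  have hq : Tendsto (fun b : ℝ => dens S (b⁻¹ * k) v - b⁻¹ * (T.t₀⁻¹ * wen S 4 v)) atTop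
      (𝓝 (mass S v)) := by
    simpa using (tendsto_dens S hv k).sub (hinv.mul_const (T.t₀⁻¹ * wen S 4 v))
  filter_upwards [hp.eventually_lt (hq.const_mul E₀) hen, hq.eventually (lt_mem_nhds hm),
    eventually_ge_atTop (S / (T.t₀ / 2)), eventually_gt_atTop 0] with b h1 h2 h3 h4
  have hbS : S ≤ b * (T.t₀ / 2) := by rwa [div_le_iff₀ (by linarith)] at h3
  have h5 := hb1 b h4 ζ v le_rfl hv fun τ hτ => hvS τ (hbS.trans hτ)
  have hv0 : ∀ τ, S < τ → v τ = 0 := fun τ h => hvS τ h.le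
  have hd0 : ∀ τ, S < τ → deriv v τ = 0 := fun τ hτ => by
    have : v =ᶠ[𝓝 τ] fun _ => 0 := by filter_upwards [lt_mem_nhds hτ] with x hx using hvS x hx.le
    rw [this.deriv_eq, deriv_const]
  have cpot := continuous_pot (b⁻¹ * k) ζ
  have e1 : dens (b * (T.t₀ / 2)) (b⁻¹ * k) v = dens S (b⁻¹ * k) v :=
    integral_of_tail_zero (by fun_prop) hbS fun τ h => by simp [hv0 τ h]
  have e2 : nrg (b * (T.t₀ / 2)) (b⁻¹ * k) ζ v = nrg S (b⁻¹ * k) ζ v :=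
    integral_of_tail_zero (by fun_prop) hbS fun τ h => by simp [hv0 τ h, hd0 τ h]
  have e3 : wen (b * (T.t₀ / 2)) 4 v = wen S 4 v :=
    integral_of_tail_zero (by fun_prop) hbS fun τ h => by simp [hv0 τ h, hd0 τ h]
  rw [e1, e2, e3] at h5
  have h6 : b ^ 2 * (nrg S (b⁻¹ * k) ζ v +
      (b⁻¹ * (T.t₀⁻¹ * (|ζ| + 3) ^ 2) + b⁻¹ * b⁻¹ * C) * wen S 4 v) =
      b ^ 2 * nrg S (b⁻¹ * k) ζ v + (b * T.t₀⁻¹ * (|ζ| + 3) ^ 2 + C) * wen S 4 v := by field_simp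
  have h7 : T.t₀⁻¹ / b * wen S 4 v = b⁻¹ * (T.t₀⁻¹ * wen S 4 v) := by ring
  rw [h7, ← h6] at h5
  have h8 := mul_le_mul_of_nonneg_left h1.le (by positivity : 0 ≤ b ^ 2)
  refine le_of_mul_le_mul_right (h5.trans (h8.trans (le_of_eq (by ring)))) h2

end SC

namespace SC

lemma hasDerivAt_posPow (n : ℕ) (x : ℝ) :
    HasDerivAt (fun y : ℝ => (max 0 y) ^ (n + 2)) ((n + 2 : ℕ) * (max 0 x) ^ (n + 1)) x := by
  rcases lt_trichotomy x 0 with h | rfl | h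
  · rw [max_eq_left h.le, zero_pow (by lia), mul_zero]
    refine (hasDerivAt_const x (0 : ℝ)).congr_of_eventuallyEq ?_
    filter_upwards [gt_mem_nhds h] with y hy
    rw [max_eq_left (le_of_lt hy), zero_pow (by lia)]
  · rw [hasDerivAt_iff_tendsto_slope_zero]
    have h1 : Continuous fun t : ℝ => (max 0 t) ^ (n + 1) := by fun_prop
    have h2 := (h1.tendsto 0).mono_left (nhdsWithin_le_nhds (s := {0}ᶜ))
    simp only [max_self, ne_eq, Nat.add_eq_zero_iff, one_ne_zero, and_false, not_false_eq_true,
      zero_pow, mul_zero] at h2 ⊢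
    refine h2.congr' ?_
    filter_upwards [self_mem_nhdsWithin] with t ht
    have ht' : t ≠ 0 := ht
    rcases le_total t 0 with h | h
    · simp [max_eq_left h]
    · simp [max_eq_right h]
      field_simp
      ring
  · rw [max_eq_right h.le]
    have := hasDerivAt_pow (n + 2) x
    refine this.congr_of_eventuallyEq ?_
    filter_upwards [lt_mem_nhds h] with y hy
    rw [max_eq_right (le_of_lt hy)]

/-- The `(n+2)`-nd power of the positive part of `d`. -/
def dpow (d : Plane → ℝ) (n : ℕ) (x : Plane) : ℝ := (max 0 (d x)) ^ (n + 2)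

lemma contDiff_dpow {d : Plane → ℝ} (hd : ContDiff ℝ 1 d) (n : ℕ) : ContDiff ℝ 1 (dpow d n) := by
  have h : ContDiff ℝ 1 (fun y : ℝ => (max 0 y) ^ (n + 2)) := by
    rw [contDiff_one_iff_deriv]
    refine ⟨fun x => (hasDerivAt_posPow n x).differentiableAt, ?_⟩
    rw [show deriv (fun y : ℝ => (max 0 y) ^ (n + 2)) = fun x => ((n + 2 : ℕ) : ℝ) * (max 0 x) ^ (n + 1) from
      funext fun x => (hasDerivAt_posPow n x).deriv]
    fun_prop
  exact h.comp hd

lemma fderiv_dpow {d : Plane → ℝ} (hd : ContDiff ℝ 1 d) (n : ℕ) (x : Plane) :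
    fderiv ℝ (dpow d n) x = ((n + 2 : ℕ) * (max 0 (d x)) ^ (n + 1) : ℝ) • fderiv ℝ d x :=
  ((hasDerivAt_posPow n (d x)).comp_hasFDerivAt x
    ((hd.differentiable (by norm_num)) x).hasFDerivAt).fderiv

lemma gsq_dpow {d : Plane → ℝ} (hd : ContDiff ℝ 1 d) (n : ℕ) (x : Plane) :
    gsq (dpow d n) x = ((n + 2 : ℕ) * (max 0 (d x)) ^ (n + 1)) ^ 2 * gsq d x := by
  simp only [gsq, fderiv_dpow hd, smul_apply, smul_eq_mul]
  ring

lemma gsq_mul_le {f g : Plane → ℝ} (hf : ContDiff ℝ 1 f) (hg : ContDiff ℝ 1 g) (x : Plane) :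
    gsq (fun y => f y * g y) x ≤ 2 * (g x ^ 2 * gsq f x) + 2 * (f x ^ 2 * gsq g x) := by
  have h1 := ((hf.differentiable (by norm_num)) x).hasFDerivAt
  have h2 := ((hg.differentiable (by norm_num)) x).hasFDerivAt
  simp only [gsq, (h1.fun_mul h2).fderiv, add_apply,
    smul_apply, smul_eq_mul]
  nlinarith [sq_nonneg (f x * fderiv ℝ g x (1, 0) - g x * fderiv ℝ f x (1, 0)),
    sq_nonneg (f x * fderiv ℝ g x (0, 1) - g x * fderiv ℝ f x (0, 1))]

lemma sq_mul_magSq_le {u : Plane → ℂ} {w : Plane → ℝ} (hu : ContDiff ℝ 1 u) (hw : ContDiff ℝ 1 w)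
    (B : ℝ) (x : Plane) :
    w x ^ 2 * magSq B F0 u x ≤
      2 * magSq B F0 (fun y => (w y : ℂ) * u y) x + 2 * (gsq w x * ‖u x‖ ^ 2) := by
  have key : ∀ v, w x ^ 2 * ‖Pv B u x v‖ ^ 2 ≤
      2 * ‖Pv B (fun y => (w y : ℂ) * u y) x v‖ ^ 2 + 2 * ((fderiv ℝ w x v) ^ 2 * ‖u x‖ ^ 2) := by
    intro v
    rw [Pv_mul hu hw]
    generalize Pv B u x v = p
    generalize u x = z
    generalize fderiv ℝ w x v = g
    simp only [Complex.sq_norm, Complex.normSq_apply]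
    simp
    nlinarith [sq_nonneg (w x * p.re + 2 * (g * z.im)), sq_nonneg (w x * p.im - 2 * (g * z.re))]
  rw [magSq_eq, magSq_eq]
  unfold gsq
  have h1 := key (1, 0)
  have h2 := key (0, 1)
  simp only [P1, P2] at *
  linarith

lemma mul_pow_le_add {A c y : ℝ} (hA : 0 ≤ A) (hc : 0 < c) (hy : 0 ≤ y) (n : ℕ) :
    A * y ^ n ≤ c * y ^ (n + 1) + A * (A / c) ^ n := by
  rcases le_total A (c * y) with h | h
  · have := mul_le_mul_of_nonneg_right h (pow_nonneg hy n)
    have h2 : 0 ≤ A * (A / c) ^ n := by positivity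
    rw [pow_succ]
    linarith
  · have h1 : y ≤ A / c := by rw [le_div_iff₀ hc]; linarith
    have := mul_le_mul_of_nonneg_left (pow_le_pow_left₀ hy h1 n) hA
    have h2 : 0 ≤ c * y ^ (n + 1) := by positivity
    linarith

/-- The mass of `ψ` weighted by `f`. -/
def wm (Ω : Set Plane) (f : Plane → ℝ) (ψ : Plane → ℂ) : ℝ := ∫ x in Ω, f x * ‖ψ x‖ ^ 2

lemma nsq_wmul (Ω : Set Plane) (W : Plane → ℝ) (ψ : Plane → ℂ) :
    nsq Ω (fun x => (W x : ℂ) * ψ x) = wm Ω (fun x => W x ^ 2) ψ := by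
  simp only [nsq, wm, norm_mul, mul_pow, Complex.norm_real, Real.norm_eq_abs, sq_abs]

lemma wm_mono {Ω : Set Plane} (ho : IsOpen Ω) (hb : Bornology.IsBounded Ω) {f g : Plane → ℝ}
    (hf : Continuous f) (hg : Continuous g) {ψ : Plane → ℂ} (hψ : Continuous ψ)
    (h : ∀ x ∈ Ω, f x ≤ g x) : wm Ω f ψ ≤ wm Ω g ψ :=
  setIntegral_mono_on (integrableOn_of_continuous hb (by fun_prop))
    (integrableOn_of_continuous hb (by fun_prop)) ho.measurableSet
    fun x hx => mul_le_mul_of_nonneg_right (h x hx) (by positivity)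

lemma wm_add {Ω : Set Plane} (hb : Bornology.IsBounded Ω) {f g : Plane → ℝ}
    (hf : Continuous f) (hg : Continuous g) {ψ : Plane → ℂ} (hψ : Continuous ψ) :
    wm Ω (fun x => f x + g x) ψ = wm Ω f ψ + wm Ω g ψ := by
  unfold wm
  rw [← integral_add (integrableOn_of_continuous hb (by fun_prop))
    (integrableOn_of_continuous hb (by fun_prop))]
  simp only [add_mul]

lemma wm_const_mul (Ω : Set Plane) (c : ℝ) (f : Plane → ℝ) (ψ : Plane → ℂ) :
    wm Ω (fun x => c * f x) ψ = c * wm Ω f ψ := by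
  unfold wm
  rw [← integral_const_mul]
  simp only [mul_assoc]

lemma wm_nonneg {Ω : Set Plane} (ho : IsOpen Ω) {f : Plane → ℝ} (ψ : Plane → ℂ)
    (h : ∀ x ∈ Ω, 0 ≤ f x) : 0 ≤ wm Ω f ψ :=
  setIntegral_nonneg ho.measurableSet fun x hx => mul_nonneg (h x hx) (by positivity)

lemma wm_one (Ω : Set Plane) (ψ : Plane → ℂ) : wm Ω (fun _ => 1) ψ = nsq Ω ψ := by
  simp [wm, nsq]

/-- A normalized function that minimizes the quadratic form at field `b²` up to `ε` with `√ε ≤ (b ^ p)⁻¹`. -/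
def NearMin (Ω : Set Plane) (b : ℝ) (p : ℕ) (ψ : Plane → ℂ) : Prop :=
  ContDiff ℝ 1 ψ ∧ nsq Ω ψ = 1 ∧ ∃ ε, 0 < ε ∧ ε ≤ 1 ∧ Real.sqrt ε ≤ (b ^ p)⁻¹ ∧
    Qf Ω (b ^ 2) ψ ≤ lam1 Ω (b ^ 2) + ε

lemma NearMin.mono {Ω : Set Plane} {b : ℝ} (hb : 1 ≤ b) {p q : ℕ} (hqp : q ≤ p) {ψ : Plane → ℂ}
    (h : NearMin Ω b p ψ) : NearMin Ω b q ψ := by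
  obtain ⟨h1, h2, ε, h3, h4, h5, h6⟩ := h
  refine ⟨h1, h2, ε, h3, h4, h5.trans ?_, h6⟩
  gcongr

variable {Ω : Set Plane}

lemma NearMin.ims (ho : IsOpen Ω) (hb : Bornology.IsBounded Ω) {W : Plane → ℝ}
    (hW : ContDiff ℝ 1 W) : ∃ C ≥ 0, ∀ (b : ℝ) (p : ℕ) (ψ : Plane → ℂ), 1 ≤ b →
      lam1 Ω (b ^ 2) ≤ b ^ 2 → NearMin Ω b (p + 2) ψ →
      Qf Ω (b ^ 2) (fun x => (W x : ℂ) * ψ x) ≤ lam1 Ω (b ^ 2) * wm Ω (fun x => W x ^ 2) ψ +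
        wm Ω (gsq W) ψ + C * (b ^ p)⁻¹ := by
  obtain ⟨C, hC, h⟩ := SC.ims ho hb hW
  refine ⟨2 * C, by positivity, fun b p ψ h1 hl hψ => ?_⟩
  obtain ⟨h2, h3, ε, h4, h5, h6, h7⟩ := hψ
  have h8 := h (b ^ 2) ε ψ h4 h5 h2 h3 h7
  rw [nsq_wmul] at h8
  refine h8.trans (add_le_add_right ?_ _)
  have hb0 : 0 < b := by linarith
  have h9 : lam1 Ω (b ^ 2) + 1 ≤ 2 * b ^ 2 := by nlinarith
  have h10 := mul_le_mul h6 h9 (by linarith [lam1_nonneg Ω (b ^ 2)]) (by positivity)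
  have e : (b ^ (p + 2))⁻¹ * (2 * b ^ 2) = 2 * (b ^ p)⁻¹ := by field_simp; ring
  rw [e] at h10
  have := mul_le_mul_of_nonneg_left h10 hC
  linarith

end SC

namespace SC

variable {Ω : Set Plane}

lemma dpow_eq {d : Plane → ℝ} {n : ℕ} {x : Plane} (h : 0 < d x) : dpow d n x = d x ^ (n + 2) := by
  rw [dpow, max_eq_right h.le]

/-- Agmon-type step: localization by a power of the distance to the boundary. -/
lemma moment_step (ho : IsOpen Ω) (hb : Bornology.IsBounded Ω) {d : Plane → ℝ}
    (hd : ContDiff ℝ 1 d) (hd0 : ∀ x ∈ Ω, 0 < d x) (hd1 : ∀ x ∉ Ω, d x ≤ 0) {D : ℝ}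
    (hD : ∀ x ∈ Ω, gsq d x ≤ D) {E₀ : ℝ} (hE : E₀ < 1) (n : ℕ)
    {W : Plane → ℝ} (hW : ContDiff ℝ 1 W) : ∃ C ≥ 0, ∀ (b : ℝ) (ψ : Plane → ℂ), 1 ≤ b →
      lam1 Ω (b ^ 2) ≤ E₀ * b ^ 2 → NearMin Ω b (2 * n + 6) ψ → ∀ S,
      S = 2 * (n + 2) ^ 2 * D * wm Ω (fun x => (b * d x) ^ (2 * n + 2) * W x ^ 2) ψ +
        2 * (b ^ 2)⁻¹ * wm Ω (fun x => (b * d x) ^ (2 * n + 4) * gsq W x) ψ + C * (b ^ 2)⁻¹ →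
      (1 - E₀) * wm Ω (fun x => (b * d x) ^ (2 * n + 4) * W x ^ 2) ψ ≤ S ∧
      b ^ (2 * n + 2) * Qf Ω (b ^ 2) (fun x => ((dpow d n x * W x : ℝ) : ℂ) * ψ x) ≤
        E₀ * wm Ω (fun x => (b * d x) ^ (2 * n + 4) * W x ^ 2) ψ + S := by
  have hp := contDiff_dpow hd n
  have hZ : ContDiff ℝ 1 (fun x => dpow d n x * W x) := hp.mul hW
  obtain ⟨C, hC, h⟩ := NearMin.ims ho hb hZ
  refine ⟨C, hC, fun b ψ h1 hl hψ S hS => ?_⟩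
  have hb0 : 0 < b := by linarith
  have hψ1 := hψ.1
  have cψ := hψ1.continuous
  have cd := hd.continuous
  have cW := hW.continuous
  have cgW := continuous_gsq hW
  have hl1 : lam1 Ω (b ^ 2) ≤ b ^ 2 := hl.trans (by nlinarith [pow_pos hb0 2])
  have h2 := h b (2 * n + 4) ψ h1 hl1 hψ
  have hosc : b ^ 2 * nsq Ω (fun x => ((dpow d n x * W x : ℝ) : ℂ) * ψ x) ≤
      Qf Ω (b ^ 2) (fun x => ((dpow d n x * W x : ℝ) : ℂ) * ψ x) := by
    refine plane_oscillator hb (contDiff_wmul hψ1 hZ) (fun x hx => ?_) (fun x hx => ?_) _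
    · simp [dpow, max_eq_left (hd1 x hx)]
    · have e0 : dpow d n x = 0 := by simp [dpow, max_eq_left (hd1 x hx)]
      have e1 : fderiv ℝ (dpow d n) x = 0 := by
        rw [fderiv_dpow hd, max_eq_left (hd1 x hx)]; simp
      have e2 : HasFDerivAt (𝕜 := ℝ) (fun x => dpow d n x * W x) (0 : Plane →L[ℝ] ℝ) x := by
        have a1 := ((hp.differentiable (by norm_num)) x).hasFDerivAt
        have a2 := ((hW.differentiable (by norm_num)) x).hasFDerivAt
        have := a1.fun_mul a2
        rw [e0, e1] at this
        simpa using this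
      refine ContinuousLinearMap.ext fun v => ?_
      rw [fderiv_mul_plane hψ1 hZ, e2.fderiv, e0]
      simp
  rw [nsq_wmul] at hosc
  set Mz := wm Ω (fun x => (dpow d n x * W x) ^ 2) ψ with hMz
  have hMznn : 0 ≤ Mz := wm_nonneg ho ψ fun x _ => by positivity
  have eM : b ^ (2 * n + 4) * Mz = wm Ω (fun x => (b * d x) ^ (2 * n + 4) * W x ^ 2) ψ := by
    rw [hMz, ← wm_const_mul]
    refine setIntegral_congr_fun ho.measurableSet fun x hx => ?_
    dsimp only
    rw [dpow_eq (hd0 x hx), mul_pow, mul_pow, ← pow_mul]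
    ring
  have hg : wm Ω (gsq fun x => dpow d n x * W x) ψ ≤
      2 * (n + 2) ^ 2 * D * wm Ω (fun x => d x ^ (2 * n + 2) * W x ^ 2) ψ +
      2 * wm Ω (fun x => d x ^ (2 * n + 4) * gsq W x) ψ := by
    rw [← wm_const_mul, ← wm_const_mul, ← wm_add hb (by fun_prop) (by fun_prop) cψ]
    refine wm_mono ho hb (continuous_gsq hZ) (by fun_prop) cψ fun x hx => ?_
    refine (gsq_mul_le hp hW x).trans ?_
    rw [gsq_dpow hd, dpow_eq (hd0 x hx), max_eq_right (hd0 x hx).le]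
    have hdx := hd0 x hx
    have := mul_le_mul_of_nonneg_left (hD x hx)
      (by positivity : 0 ≤ 2 * ((n : ℝ) + 2) ^ 2 * (d x ^ (2 * n + 2) * W x ^ 2))
    push_cast
    have e : 2 * (W x ^ 2 * ((((n : ℝ) + 2) * d x ^ (n + 1)) ^ 2 * gsq d x)) =
      2 * ((n : ℝ) + 2) ^ 2 * (d x ^ (2 * n + 2) * W x ^ 2) * gsq d x := by ring
    rw [e]
    have e' : (d x ^ (n + 2)) ^ 2 = d x ^ (2 * n + 4) := by ring
    rw [e']
    linarith
  have eS : b ^ (2 * n + 2) * (2 * (n + 2) ^ 2 * D * wm Ω (fun x => d x ^ (2 * n + 2) * W x ^ 2) ψ +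
      2 * wm Ω (fun x => d x ^ (2 * n + 4) * gsq W x) ψ + C * (b ^ (2 * n + 4))⁻¹) = S := by
    rw [hS]
    have a1 : wm Ω (fun x => (b * d x) ^ (2 * n + 2) * W x ^ 2) ψ =
        b ^ (2 * n + 2) * wm Ω (fun x => d x ^ (2 * n + 2) * W x ^ 2) ψ := by
      rw [← wm_const_mul]; simp only [mul_pow, mul_assoc]
    have a2 : wm Ω (fun x => (b * d x) ^ (2 * n + 4) * gsq W x) ψ =
        b ^ (2 * n + 4) * wm Ω (fun x => d x ^ (2 * n + 4) * gsq W x) ψ := by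
      rw [← wm_const_mul]; simp only [mul_pow, mul_assoc]
    rw [a1, a2, show b ^ (2 * n + 4) = b ^ (2 * n + 2) * b ^ 2 by ring]
    field_simp
  have h3 := mul_le_mul_of_nonneg_left (h2.trans (add_le_add_left
    (add_le_add_right hg (lam1 Ω (b ^ 2) * Mz)) _)) (by positivity : 0 ≤ b ^ (2 * n + 2))
  have h4 := mul_le_mul_of_nonneg_left hosc (by positivity : 0 ≤ b ^ (2 * n + 2))
  have h5 := mul_le_mul_of_nonneg_left (mul_le_mul_of_nonneg_right hl hMznn)
    (by positivity : 0 ≤ b ^ (2 * n + 2))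
  have e6 : b ^ (2 * n + 2) * (b ^ 2 * Mz) = b ^ (2 * n + 4) * Mz := by ring
  have e7 : b ^ (2 * n + 2) * (E₀ * b ^ 2 * Mz) = E₀ * (b ^ (2 * n + 4) * Mz) := by ring
  rw [e6] at h4
  rw [e7] at h5
  rw [eM] at h4 h5
  constructor <;> linarith

lemma exists_gsq_bound (hb : Bornology.IsBounded Ω) {W : Plane → ℝ} (hW : ContDiff ℝ 1 W) :
    ∃ D, 0 ≤ D ∧ ∀ x ∈ Ω, gsq W x ≤ D := by
  obtain ⟨c, hc⟩ := hb.isCompact_closure.bddAbove_image (continuous_gsq hW).continuousOn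
  exact ⟨max c 0, le_max_right _ _, fun x hx =>
    (hc ⟨x, subset_closure hx, rfl⟩).trans (le_max_left _ _)⟩

lemma wm_young (ho : IsOpen Ω) (hb : Bornology.IsBounded Ω) {d W : Plane → ℝ}
    (hd : Continuous d) (hW : Continuous W) {ψ : Plane → ℂ} (hψ : Continuous ψ) (b : ℝ) (n : ℕ)
    {A c : ℝ} (hA : 0 ≤ A) (hc : 0 < c) :
    A * wm Ω (fun x => (b * d x) ^ (2 * n + 2) * W x ^ 2) ψ ≤
      c * wm Ω (fun x => (b * d x) ^ (2 * n + 4) * W x ^ 2) ψ +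
        A * (A / c) ^ (n + 1) * wm Ω (fun x => W x ^ 2) ψ := by
  rw [← wm_const_mul, ← wm_const_mul, ← wm_const_mul, ← wm_add hb (by fun_prop) (by fun_prop) hψ]
  refine wm_mono ho hb (by fun_prop) (by fun_prop) hψ fun x _ => ?_
  have h1 := mul_pow_le_add hA hc (sq_nonneg (b * d x)) (n + 1)
  rw [← pow_mul, ← pow_mul] at h1
  have h2 := mul_le_mul_of_nonneg_right h1 (sq_nonneg (W x))
  rw [show 2 * (n + 1) = 2 * n + 2 by ring, show 2 * (n + 1 + 1) = 2 * n + 4 by ring] at h2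
  linarith

/-- Moments of near-minimizers in the distance to the boundary. -/
lemma moment_bound (ho : IsOpen Ω) (hb : Bornology.IsBounded Ω) {d : Plane → ℝ}
    (hd : ContDiff ℝ 1 d) (hd0 : ∀ x ∈ Ω, 0 < d x) (hd1 : ∀ x ∉ Ω, d x ≤ 0)
    {E₀ : ℝ} (hE : E₀ < 1) (n : ℕ) : ∃ C ≥ 0, ∀ (b : ℝ) (ψ : Plane → ℂ), 1 ≤ b →
      lam1 Ω (b ^ 2) ≤ E₀ * b ^ 2 → NearMin Ω b (2 * n + 6) ψ →
      wm Ω (fun x => (b * d x) ^ (2 * n + 4)) ψ ≤ C := by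
  obtain ⟨D, hD0, hD⟩ := exists_gsq_bound hb hd
  obtain ⟨C, hC, h⟩ := moment_step ho hb hd hd0 hd1 hD hE n (W := fun _ => 1) contDiff_const
  have hc : 0 < (1 - E₀) / 2 := by linarith
  set A := 2 * ((n : ℝ) + 2) ^ 2 * D with hA
  have hA0 : 0 ≤ A := by positivity
  refine ⟨(A * (A / ((1 - E₀) / 2)) ^ (n + 1) + C) / ((1 - E₀) / 2), by positivity,
    fun b ψ h1 hl hψ => ?_⟩
  have h2 := (h b ψ h1 hl hψ _ rfl).1
  have h3 := wm_young ho hb hd.continuous continuous_const (W := fun _ => 1) hψ.1.continuous b n hA0 hc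
  have e : wm Ω (fun x => (b * d x) ^ (2 * n + 4) * gsq (fun _ => 1) x) ψ = 0 := by
    simp [gsq, wm]
  rw [e] at h2
  have e2 : wm Ω (fun _ => (1 : ℝ) ^ 2) ψ = 1 := by simpa using (wm_one Ω ψ).trans hψ.2.1
  rw [e2] at h3
  simp only [one_pow, mul_one] at h2 h3
  have h4 : C * (b ^ 2)⁻¹ ≤ C :=
    mul_le_of_le_one_right hC (inv_le_one_of_one_le₀ (one_le_pow₀ h1))
  rw [le_div_iff₀ hc]
  linarith

/-- Localized near-minimizers concentrate at the boundary length scale. -/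
lemma weighted_bound (ho : IsOpen Ω) (hb : Bornology.IsBounded Ω) {d : Plane → ℝ}
    (hd : ContDiff ℝ 1 d) (hd0 : ∀ x ∈ Ω, 0 < d x) (hd1 : ∀ x ∉ Ω, d x ≤ 0)
    {E₀ : ℝ} (hE : E₀ < 1) (n : ℕ) : ∃ C ≥ 0, ∀ W : Plane → ℝ, ContDiff ℝ 1 W → ∃ C' ≥ 0,
      ∀ (b : ℝ) (ψ : Plane → ℂ), 1 ≤ b → lam1 Ω (b ^ 2) ≤ E₀ * b ^ 2 →
      NearMin Ω b (2 * n + 6) ψ →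
      Gw Ω b d n (fun x => (W x : ℂ) * ψ x) ≤ C * wm Ω (fun x => W x ^ 2) ψ + C' * (b ^ 2)⁻¹ := by
  obtain ⟨D, hD0, hD⟩ := exists_gsq_bound hb hd
  obtain ⟨M, hM, hmom⟩ := moment_bound ho hb hd hd0 hd1 hE n
  set A := 2 * ((n : ℝ) + 2) ^ 2 * D with hA
  have hA0 : 0 ≤ A := by positivity
  set c := (1 - E₀) / 2 with hc
  have hc0 : 0 < c := by rw [hc]; linarith
  set A₁ := A * (A / c) ^ (n + 1) with hA₁
  have hA₁0 : 0 ≤ A₁ := by positivity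
  set m := 1 / c with hm
  have hm0 : 0 ≤ m := by positivity
  set K : ℝ := 2 ^ (2 * n + 4) with hK
  have hK0 : 0 ≤ K := by positivity
  refine ⟨K * (2 + 3 * A₁ + (3 + 3 * c) * (m * A₁)), by positivity, fun W hW => ?_⟩
  obtain ⟨C, hC, h⟩ := moment_step ho hb hd hd0 hd1 hD hE n hW
  obtain ⟨G, hG0, hG⟩ := exists_gsq_bound hb hW
  obtain ⟨Ci, hCi, hi⟩ := NearMin.ims ho hb hW
  set C₂ := 2 * (G * M) + C with hC₂
  have hC₂0 : 0 ≤ C₂ := by positivity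
  refine ⟨K * (G + Ci + 2 * C₂ + (3 + 3 * c) * (m * C₂)), by positivity,
    fun b ψ h1 hl hψ => ?_⟩
  have hb0 : 0 < b := by linarith
  have hψ1 := hψ.1
  have cψ := hψ1.continuous
  have cd := hd.continuous
  have cW := hW.continuous
  have cgW := continuous_gsq hW
  have hp := contDiff_dpow hd n
  have hZ : ContDiff ℝ 1 (fun x => dpow d n x * W x) := hp.mul hW
  have hWψ := contDiff_wmul hψ1 hW
  have hZψ := contDiff_wmul hψ1 hZ
  have cm1 := continuous_magSq (B := b ^ 2) hWψ
  have cm2 := continuous_magSq (B := b ^ 2) hZψ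
  have hb2 : 0 < (b ^ 2)⁻¹ := by positivity
  have hl1 : lam1 Ω (b ^ 2) ≤ b ^ 2 := hl.trans (by nlinarith [pow_pos hb0 2])
  set w0 := wm Ω (fun x => W x ^ 2) ψ with hw0
  set w1 := wm Ω (fun x => (b * d x) ^ (2 * n + 2) * W x ^ 2) ψ with hw1
  set w2 := wm Ω (fun x => (b * d x) ^ (2 * n + 4) * W x ^ 2) ψ with hw2
  have hw0nn : 0 ≤ w0 := wm_nonneg ho ψ fun x _ => by positivity
  have hw2nn : 0 ≤ w2 := wm_nonneg ho ψ fun x hx => by have := hd0 x hx; positivity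
  obtain ⟨s1, s2⟩ := h b ψ h1 hl hψ _ rfl
  have hy : A * w1 ≤ c * w2 + A₁ * w0 := wm_young ho hb cd cW cψ b n hA0 hc0
  have hgw : wm Ω (fun x => (b * d x) ^ (2 * n + 4) * gsq W x) ψ ≤ G * M := by
    refine le_trans ?_ (mul_le_mul_of_nonneg_left (hmom b ψ h1 hl hψ) hG0)
    rw [← wm_const_mul]
    refine wm_mono ho hb (by fun_prop) (by fun_prop) cψ fun x hx => ?_
    have hdx := hd0 x hx
    rw [mul_comm]
    exact mul_le_mul_of_nonneg_right (hG x hx) (by positivity)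
  have hS : A * w1 + 2 * (b ^ 2)⁻¹ * wm Ω (fun x => (b * d x) ^ (2 * n + 4) * gsq W x) ψ +
      C * (b ^ 2)⁻¹ ≤ A * w1 + C₂ * (b ^ 2)⁻¹ := by
    have := mul_le_mul_of_nonneg_left hgw (by positivity : 0 ≤ 2 * (b ^ 2)⁻¹)
    rw [hC₂]; linarith
  have hw2le : c * w2 ≤ A₁ * w0 + C₂ * (b ^ 2)⁻¹ := by
    have : (1 - E₀) * w2 = 2 * (c * w2) := by rw [hc]; ring
    linarith
  have hw2le' : w2 ≤ m * (A₁ * w0 + C₂ * (b ^ 2)⁻¹) := by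
    rw [hm, div_mul_eq_mul_div, one_mul, le_div_iff₀ hc0]; linarith
  have hQZ : b ^ (2 * n + 2) * Qf Ω (b ^ 2) (fun x => ((dpow d n x * W x : ℝ) : ℂ) * ψ x) ≤
      w2 + c * w2 + A₁ * w0 + C₂ * (b ^ 2)⁻¹ := by
    have : E₀ * w2 ≤ w2 := mul_le_of_le_one_left hw2nn hE.le
    linarith
  have hQW : (b ^ 2)⁻¹ * Qf Ω (b ^ 2) (fun x => (W x : ℂ) * ψ x) ≤ w0 + (G + Ci) * (b ^ 2)⁻¹ := by
    have a1 := hi b 0 ψ h1 hl1 (hψ.mono h1 (by lia))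
    have a2 : wm Ω (gsq W) ψ ≤ G := by
      refine (wm_mono ho hb cgW continuous_const cψ hG).trans (le_of_eq ?_)
      simpa [wm_one, hψ.2.1] using wm_const_mul Ω G (fun _ => 1) ψ
    have a3 := mul_le_mul_of_nonneg_right hl1 hw0nn
    have a4 := mul_le_mul_of_nonneg_left (a1.trans (add_le_add (add_le_add a3 a2) le_rfl)) hb2.le
    refine a4.trans (le_of_eq ?_)
    simp only [pow_zero, inv_one, mul_one]
    field_simp
    ring
  have key : Gw Ω b d n (fun x => (W x : ℂ) * ψ x) ≤
      K * ((b ^ 2)⁻¹ * Qf Ω (b ^ 2) (fun x => (W x : ℂ) * ψ x) + (w0 + w2 + A * w1) +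
        2 * (b ^ (2 * n + 2) * Qf Ω (b ^ 2) (fun x => ((dpow d n x * W x : ℝ) : ℂ) * ψ x))) := by
    have e1 : w0 + w2 + A * w1 = wm Ω (fun x => W x ^ 2 + (b * d x) ^ (2 * n + 4) * W x ^ 2 +
        A * ((b * d x) ^ (2 * n + 2) * W x ^ 2)) ψ := by
      rw [wm_add hb (by fun_prop) (by fun_prop) cψ, wm_add hb (by fun_prop) (by fun_prop) cψ,
        wm_const_mul]
    rw [e1, Gw, Qf, Qf, wm, ← integral_const_mul, ← integral_const_mul, ← integral_const_mul,
      ← integral_add (integrableOn_of_continuous hb (by fun_prop))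
        (integrableOn_of_continuous hb (by fun_prop)),
      ← integral_add (integrableOn_of_continuous hb (by fun_prop))
        (integrableOn_of_continuous hb (by fun_prop)), ← integral_const_mul]
    refine setIntegral_mono_on (integrableOn_of_continuous hb (by fun_prop))
      (integrableOn_of_continuous hb (by fun_prop)) ho.measurableSet fun x hx => ?_
    have hdx := hd0 x hx
    have hτ : 0 < b * d x := by positivity
    have p1 : (1 + b * d x) ^ n ≤ K * (1 + (b * d x) ^ (2 * n + 4)) := by
      have q1 : (1 + b * d x) ^ n ≤ (1 + b * d x) ^ (2 * n + 4) :=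
        pow_le_pow_right₀ (by linarith) (by lia)
      have q2 := add_pow_le zero_le_one hτ.le (2 * n + 4)
      rw [one_pow] at q2
      have q3 : (2 : ℝ) ^ (2 * n + 4 - 1) ≤ K := pow_le_pow_right₀ (by norm_num) (by lia)
      exact q1.trans (q2.trans (mul_le_mul_of_nonneg_right q3 (by positivity)))
    set g := magSq (b ^ 2) F0 (fun x => (W x : ℂ) * ψ x) x with hg
    have hgnn : 0 ≤ g := magSq_nonneg _ _ _ _
    have p2 := sq_mul_magSq_le hWψ hp (b ^ 2) x
    have e2 : (fun y => (dpow d n y : ℂ) * ((W y : ℂ) * ψ y)) =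
        fun y => ((dpow d n y * W y : ℝ) : ℂ) * ψ y := by
      ext y; push_cast; ring
    rw [e2, ← hg, gsq_dpow hd, dpow_eq hdx, max_eq_right hdx.le] at p2
    set z := magSq (b ^ 2) F0 (fun y => ((dpow d n y * W y : ℝ) : ℂ) * ψ y) x with hz
    have e3 : ‖(W x : ℂ) * ψ x‖ ^ 2 = W x ^ 2 * ‖ψ x‖ ^ 2 := by
      rw [norm_mul, mul_pow, Complex.norm_real, Real.norm_eq_abs, sq_abs]
    rw [e3] at p2 ⊢
    set N := W x ^ 2 * ‖ψ x‖ ^ 2 with hN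
    have hNnn : 0 ≤ N := by positivity
    have p3 : (b * d x) ^ (2 * n + 4) * (g / b ^ 2) ≤
        2 * (b ^ (2 * n + 2) * z) + A * ((b * d x) ^ (2 * n + 2) * N) := by
      have q1 := mul_le_mul_of_nonneg_left p2 (by positivity : 0 ≤ b ^ (2 * n + 2))
      have q2 := mul_le_mul_of_nonneg_left (hD x hx)
        (by positivity : 0 ≤ 2 * ((n : ℝ) + 2) ^ 2 * ((b * d x) ^ (2 * n + 2) * N))
      have q3 : b ^ (2 * n + 2) * ((d x ^ (n + 2)) ^ 2 * g) = (b * d x) ^ (2 * n + 4) * (g / b ^ 2) := by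
        rw [mul_pow, ← pow_mul, show b ^ (2 * n + 4) = b ^ (2 * n + 2) * b ^ 2 by ring]
        field_simp
        ring
      have q4 : b ^ (2 * n + 2) * (2 * z + 2 * ((((n + 2 : ℕ) : ℝ) * d x ^ (n + 1)) ^ 2 * gsq d x * N)) =
          2 * (b ^ (2 * n + 2) * z) +
            2 * ((n : ℝ) + 2) ^ 2 * ((b * d x) ^ (2 * n + 2) * N) * gsq d x := by
        push_cast; rw [mul_pow b]; ring
      have q5 : A * ((b * d x) ^ (2 * n + 2) * N) =
          2 * ((n : ℝ) + 2) ^ 2 * ((b * d x) ^ (2 * n + 2) * N) * D := by rw [hA]; ring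
      linarith
    have p4 := mul_le_mul_of_nonneg_right p1 (by positivity : 0 ≤ g / b ^ 2 + N)
    refine p4.trans ?_
    rw [mul_assoc K]
    refine mul_le_mul_of_nonneg_left ?_ hK0
    have e4 : (b ^ 2)⁻¹ * g = g / b ^ 2 := by ring
    rw [e4]
    have e5 : (W x ^ 2 + (b * d x) ^ (2 * n + 4) * W x ^ 2 + A * ((b * d x) ^ (2 * n + 2) * W x ^ 2)) *
        ‖ψ x‖ ^ 2 = N + (b * d x) ^ (2 * n + 4) * N + A * ((b * d x) ^ (2 * n + 2) * N) := by
      rw [hN]; ring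
    rw [e5]
    linarith
  refine key.trans ?_
  have e9 : K * (2 + 3 * A₁ + (3 + 3 * c) * (m * A₁)) * w0 +
      K * (G + Ci + 2 * C₂ + (3 + 3 * c) * (m * C₂)) * (b ^ 2)⁻¹ =
      K * ((2 + 3 * A₁) * w0 + (G + Ci + 2 * C₂) * (b ^ 2)⁻¹ +
        (3 + 3 * c) * (m * (A₁ * w0 + C₂ * (b ^ 2)⁻¹))) := by ring
  rw [e9]
  refine mul_le_mul_of_nonneg_left ?_ hK0
  have := mul_le_mul_of_nonneg_left hw2le' (by positivity : 0 ≤ 3 + 3 * c)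
  linarith

end SC

namespace SC

variable {Ω : Set Plane} {P : BoundaryParam Ω}

lemma exists_nearMin (ho : IsOpen Ω) (hb : Bornology.IsBounded Ω) (hne : Ω.Nonempty) {b η : ℝ}
    (h1 : 1 ≤ b) (hη : 0 < η) (p : ℕ) :
    ∃ ψ, NearMin Ω b p ψ ∧ Qf Ω (b ^ 2) ψ ≤ lam1 Ω (b ^ 2) + η := by
  have hb0 : 0 < b := by linarith
  have hε : 0 < min η ((b ^ p)⁻¹ ^ 2) := by positivity
  obtain ⟨ψ, hψ, hn, hQ⟩ := exists_near_min ho hb hne (b ^ 2) hε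
  have hp : (b ^ p)⁻¹ ≤ 1 := inv_le_one_of_one_le₀ (one_le_pow₀ h1)
  have hp0 : 0 ≤ (b ^ p)⁻¹ := by positivity
  refine ⟨ψ, ⟨hψ, hn, _, hε, (min_le_right _ _).trans (pow_le_one₀ hp0 hp), ?_, hQ⟩,
    hQ.trans (by linarith [min_le_left η ((b ^ p)⁻¹ ^ 2)])⟩
  exact (Real.sqrt_le_sqrt (min_le_right _ _)).trans (Real.sqrt_sq hp0).le

lemma lam1_ge (ho : IsOpen Ω) (hb : Bornology.IsBounded Ω) (hne : Ω.Nonempty) (T : Tube P)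
    {E₀ : ℝ} (hE : E₀ < 1) : ∃ C ≥ 0, ∀ b : ℝ, 1 ≤ b → lam1 Ω (b ^ 2) ≤ E₀ * b ^ 2 →
      Theta0 * b ^ 2 ≤ lam1 Ω (b ^ 2) + C * b := by
  have ht := T.pos
  obtain ⟨d, hd, hd0, hd1, hd2, hd3⟩ := exists_dist T ho (r := T.t₀ / 4) (by linarith) (by linarith)
  obtain ⟨χ, c1, c2, c3, c4⟩ := exists_bump (a := -(T.t₀ / 3)) (a' := -(T.t₀ / 4))
    (b' := T.t₀ / 4) (b := T.t₀ / 3) (by linarith) (by linarith)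
  obtain ⟨W, w1, w2, w3, w4⟩ := exists_strip_fn T (t₁ := T.t₀ / 3) (by linarith) c1
    (fun t ht => c3 t fun hc => ht.not_ge (abs_le.2 (Ioo_subset_Icc_self hc)))
  have hd' : ContDiff ℝ 1 d := hd.of_le (by exact_mod_cast le_top)
  have hW : ContDiff ℝ 1 W := w1.of_le (by exact_mod_cast le_top)
  have cW := hW.continuous
  have cd := hd'.continuous
  have hWle : ∀ x, W x ^ 2 ≤ 1 := fun x => by
    by_cases h : ∀ p : Plane, |p.2| < T.t₀ → tub P p ≠ x
    · rw [w3 x h]; norm_num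
    · push Not at h
      obtain ⟨p, hp, rfl⟩ := h
      rw [w2 p hp]
      exact pow_le_one₀ (c4 _).1 (c4 _).2
  have hWge : ∀ x ∈ Ω, 1 ≤ W x ^ 2 + d x ^ 4 := fun x hx => by
    have hdx := hd0 x hx
    by_cases h : ∀ p : Plane, |p.2| < T.t₀ / 4 → tub P p ≠ x
    · have := one_le_pow₀ (hd3 x hx h) (n := 4)
      linarith [sq_nonneg (W x)]
    · push Not at h
      obtain ⟨p, hp, rfl⟩ := h
      rw [w2 p (by linarith), c2 _ (abs_le.1 hp.le)]
      have := pow_pos hdx 4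
      linarith
  obtain ⟨M, hM, hmom⟩ := moment_bound ho hb hd' hd0 hd1 hE 0
  obtain ⟨Cg, hCg, hwt⟩ := weighted_bound ho hb hd' hd0 hd1 hE 3
  obtain ⟨Cg', hCg', hwt⟩ := hwt W hW
  obtain ⟨G, hG0, hG⟩ := exists_gsq_bound hb hW
  obtain ⟨Ci, hCi, hi⟩ := NearMin.ims ho hb hW
  have hΘ := Theta0_pos
  refine ⟨G + Ci + 4 / T.t₀ * (Cg + Cg') + Theta0 * M, by positivity, fun b h1 hl => ?_⟩
  have hb0 : 0 < b := by linarith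
  obtain ⟨ψ, hψ, -⟩ := exists_nearMin ho hb hne h1 one_pos 12
  have cψ := hψ.1.continuous
  have hl1 : lam1 Ω (b ^ 2) ≤ b ^ 2 := hl.trans (by nlinarith [pow_pos hb0 2])
  have a1 := lower_theta T ho hb cd (fun x hx => (hd0 x hx).le) hd2 (t₁ := T.t₀ / 3)
    (t₂ := T.t₀ / 2) (by linarith) (by linarith) (by linarith) hb0 (contDiff_wmul hψ.1 hW)
    (((closure_mono (Function.support_subset_iff'.2 fun x hx => by
        rw [Function.notMem_support.1 hx]; simp)).trans w4).trans
      (image_mono fun p hp => abs_le.2 hp.2))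
  have a2 := hwt b ψ h1 hl hψ
  have a3 := hi b 0 ψ h1 hl1 (hψ.mono h1 (by norm_num))
  have a4 := hmom b ψ h1 hl (hψ.mono h1 (by norm_num))
  rw [nsq_wmul] at a1
  set w := wm Ω (fun x => W x ^ 2) ψ with hw
  have hw1 : w ≤ 1 := by
    refine (wm_mono ho hb (by fun_prop) continuous_const cψ fun x _ => hWle x).trans ?_
    rw [wm_one, hψ.2.1]
  have hw0 : 0 ≤ w := wm_nonneg ho ψ fun x _ => by positivity
  have a5 : wm Ω (gsq W) ψ ≤ G := by
    refine (wm_mono ho hb (continuous_gsq hW) continuous_const cψ hG).trans (le_of_eq ?_)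
    simpa [wm_one, hψ.2.1] using wm_const_mul Ω G (fun _ => 1) ψ
  have a6 : b ^ 4 ≤ b ^ 4 * w + M := by
    have e1 : (1 : ℝ) ≤ w + wm Ω (fun x => d x ^ 4) ψ := by
      rw [hw, ← wm_add hb (by fun_prop) (by fun_prop) cψ, ← hψ.2.1, ← wm_one]
      exact wm_mono ho hb continuous_const (by fun_prop) cψ hWge
    have e2 : wm Ω (fun x => (b * d x) ^ (2 * 0 + 4)) ψ = b ^ 4 * wm Ω (fun x => d x ^ 4) ψ := by
      rw [← wm_const_mul]; simp only [mul_pow, mul_zero, zero_add]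
    rw [e2] at a4
    have := mul_le_mul_of_nonneg_left e1 (by positivity : 0 ≤ b ^ 4)
    linarith
  have hinv : (b ^ 2)⁻¹ ≤ 1 := inv_le_one_of_one_le₀ (one_le_pow₀ h1)
  have a7 : b ^ 2 ≤ b ^ 2 * w + M * b := by
    have e : b ^ 4 = b ^ 2 * b ^ 2 := by ring
    rw [e] at a6
    have h2 : 1 ≤ b ^ 2 := one_le_pow₀ h1
    have h3 : M ≤ b ^ 2 * (M * b) := by
      have := mul_le_mul h2 h1 zero_le_one (by positivity)
      have := mul_le_mul_of_nonneg_left this hM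
      linarith
    refine le_of_mul_le_mul_left (a6.trans ?_) (by positivity : 0 < b ^ 2)
    linarith
  have a8 : Gw Ω b d 3 (fun x => (W x : ℂ) * ψ x) ≤ Cg + Cg' := by
    have e1 := mul_le_mul_of_nonneg_left hw1 hCg
    have e2 := mul_le_mul_of_nonneg_left hinv hCg'
    linarith
  have a9 := mul_le_mul_of_nonneg_left a8 (by positivity : 0 ≤ 4 / T.t₀ * b)
  have a10 := mul_le_mul_of_nonneg_left a7 hΘ.le
  have a11 := mul_le_mul_of_nonneg_left hw1 (lam1_nonneg Ω (b ^ 2))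
  have a12 := mul_le_mul_of_nonneg_left h1 (by positivity : 0 ≤ G + Ci)
  simp only [pow_zero, inv_one, mul_one] at a3 a11 a12
  linarith

lemma tendsto_lam1_div (ho : IsOpen Ω) (hb : Bornology.IsBounded Ω) (hne : Ω.Nonempty)
    (T : Tube P) : Tendsto (fun B => lam1 Ω B / B) atTop (𝓝 Theta0) := by
  obtain ⟨E₀, hE1, hE2⟩ := exists_between Theta0_lt_one
  obtain ⟨C, hC, hlow⟩ := lam1_ge ho hb hne T hE2
  have hs := Real.tendsto_sqrt_atTop
  have key : ∀ E, Theta0 < E → ∀ᶠ B : ℝ in atTop, lam1 Ω B ≤ E * B := fun E hE => by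
    filter_upwards [hs.eventually (lam1_le ho T hE), eventually_ge_atTop 0] with B h1 h2
    rwa [Real.sq_sqrt h2] at h1
  rw [tendsto_order]
  constructor
  · intro a ha
    filter_upwards [key E₀ hE1, hs.eventually (eventually_ge_atTop 1), eventually_gt_atTop 0,
      hs.eventually (eventually_gt_atTop (C / (Theta0 - a)))] with B h1 h2 h3 h4
    have h5 := hlow _ h2 (by rwa [Real.sq_sqrt h3.le])
    rw [Real.sq_sqrt h3.le] at h5
    rw [lt_div_iff₀ h3]
    rw [div_lt_iff₀ (by linarith)] at h4
    have h6 := mul_lt_mul_of_pos_right h4 (by linarith : 0 < Real.sqrt B)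
    have h7 : Real.sqrt B * (Theta0 - a) * Real.sqrt B = (Theta0 - a) * B := by
      rw [mul_right_comm, Real.mul_self_sqrt h3.le, mul_comm]
    linarith
  · intro a ha
    obtain ⟨e, he1, he2⟩ := exists_between ha
    filter_upwards [key e he1, eventually_gt_atTop 0] with B h1 h2
    exact (((div_le_iff₀ h2).2 h1)).trans_lt he2

end SC

namespace SC

variable {Ω : Set Plane} {P : BoundaryParam Ω}

/-- Localization away from the points of maximal curvature costs a spectral gap of order `b`. -/
lemma exists_gap_bound (ho : IsOpen Ω) (hb : Bornology.IsBounded Ω) (T : Tube P) {d : Plane → ℝ}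
    (hd : ContDiff ℝ 1 d) (hd0 : ∀ x ∈ Ω, 0 < d x) (hd1 : ∀ x ∉ Ω, d x ≤ 0)
    (hd2 : ∀ p : Plane, 0 ≤ p.2 → p.2 < T.t₀ → p.2 ≤ d (tub P p)) {t₁ t₂ : ℝ} (h12 : t₁ < t₂)
    (h0 : 0 < t₂) (h2 : 2 * t₂ < T.t₀) {s₁ s₂ : ℝ} (hk : kap P s₁ < kap P s₂) {E₀ : ℝ}
    (hE0 : 0 ≤ E₀) (hE : E₀ < 1) :
    ∃ δ > 0, ∃ N : ℕ, ∃ C₀ ≥ 0, ∃ b₁ ≥ 1, ∀ W : Plane → ℝ, ContDiff ℝ 1 W →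
      tsupport W ⊆ tub P '' {p | |p.2| ≤ t₁} →
      (∀ p : Plane, |p.2| < T.t₀ → |kap P p.1 - kap P s₁| ≤ δ ∨ W =ᶠ[𝓝 (tub P p)] 0) →
      ∃ C' ≥ 0, ∀ (b : ℝ) (ψ : Plane → ℂ), b₁ ≤ b → lam1 Ω (b ^ 2) ≤ E₀ * b ^ 2 →
        NearMin Ω b N ψ →
        b * wm Ω (fun x => W x ^ 2) ψ ≤ C₀ * wm Ω (gsq W) ψ + C' * b⁻¹ := by
  have ht := T.pos
  have hE' : 0 < 1 - E₀ := by linarith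
  set k₁ := kap P s₁
  obtain ⟨K, c, C, b₀, m, hc, hC, hb₀, hpm⟩ := per_mode hk hE0 hE 4
  obtain ⟨Cg, hCg, hwt⟩ := weighted_bound ho hb hd hd0 hd1 hE (m + 3)
  set c₅ := 5 + 4 * c / T.t₀ + 20 * C with hc₅
  have hc₅0 : 0 < c₅ := by positivity
  set K' := (max K 0 + 3) ^ 2 + 2 with hK'
  have hK'0 : 0 < K' := by positivity
  set δ := min (T.t₀⁻¹) (c * (1 - E₀) / 4 / (c₅ * K' * (Cg + 1))) with hδ
  have hδ0 : 0 < δ := by positivity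
  have hδ1 : δ * T.t₀ ≤ 1 := by
    have := mul_le_mul_of_nonneg_right (min_le_left (T.t₀⁻¹) (c * (1 - E₀) / 4 / (c₅ * K' * (Cg + 1)))) ht.le
    rwa [inv_mul_cancel₀ ht.ne'] at this
  have hδ2 : c₅ * K' * Cg * δ ≤ c * (1 - E₀) / 4 := by
    have h1 : δ * (c₅ * K' * (Cg + 1)) ≤ c * (1 - E₀) / 4 :=
      (le_div_iff₀ (by positivity)).1 (min_le_right _ _)
    have h3 : 0 ≤ δ * (c₅ * K') := by positivity
    linarith
  obtain ⟨Cρ, hCρ, htr⟩ := exists_trial_bound T ho (r := 2 * t₂) (by linarith) h2 s₂ hδ0 hδ1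
    (le_max_right K 0)
  set b₁ := max b₀ (c₅ * (Cρ + 1) * Cg / (c * (1 - E₀) / 4)) with hb₁
  refine ⟨δ, hδ0, m + 3 + m + 3 + 6, 2 * (c + 1) / (c * (1 - E₀)), by positivity, b₁,
    hb₀.trans (le_max_left _ _), fun W hW hWs hWloc => ?_⟩
  obtain ⟨Cg', hCg', hwt⟩ := hwt W hW
  obtain ⟨Ci, hCi, hi⟩ := NearMin.ims ho hb hW
  set R := (c + 1) * Ci + c₅ * (δ * K' + (Cρ + 1)) * Cg' with hR
  have hR0 : 0 ≤ R := by positivity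
  refine ⟨2 * R / (c * (1 - E₀)), by positivity, fun b ψ hbb hl hψ => ?_⟩
  have h1 : 1 ≤ b := hb₀.trans ((le_max_left _ _).trans hbb)
  have hb0 : 0 < b := by linarith
  have hbb₀ : b₀ ≤ b := (le_max_left _ _).trans hbb
  have hl1 : lam1 Ω (b ^ 2) ≤ b ^ 2 := hl.trans (by nlinarith [pow_pos hb0 2])
  have hl0 := lam1_nonneg Ω (b ^ 2)
  set l := lam1 Ω (b ^ 2) with hldef
  have cd := hd.continuous
  have hk₁ : |k₁| * T.t₀ ≤ 1 / 2 := T.curv s₁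
  set A := b * δ * ((max K 0 + 3) ^ 2 + 1) + Cρ with hA
  have hA0 : 0 ≤ A := by positivity
  have hmode := hpm b l (b * t₂) A hbb₀ hl0 hl (by positivity) (by
      have h3 : |k₁| * t₂ ≤ 1 := by
        have := mul_le_mul_of_nonneg_left (by linarith : t₂ ≤ T.t₀) (abs_nonneg k₁)
        linarith
      have := mul_le_mul_of_nonneg_left h3 hb0.le
      linarith) hA0 (fun ζ w hζ hw hw0 => by
      rw [show 2 * (b * t₂) = b * (2 * t₂) by ring] at hw0 ⊢
      have h3 := htr b hb0 ζ w (hζ.trans (le_max_left _ _)) hw hw0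
      have hwen : 0 ≤ wen (b * (2 * t₂)) 4 w :=
        intervalIntegral.integral_nonneg (by positivity) fun τ hτ => by
          have := hτ.1
          positivity
      have h4 : l * (δ / b * wen (b * (2 * t₂)) 4 w) ≤ b * δ * wen (b * (2 * t₂)) 4 w := by
        have := mul_le_mul_of_nonneg_right hl1
          (by positivity : 0 ≤ δ / b * wen (b * (2 * t₂)) 4 w)
        refine this.trans (le_of_eq ?_)
        field_simp
      rw [hA]
      linarith)
  have hu := contDiff_wmul hψ.1 hW
  have a1 := lower_gap T ho hb cd (fun x hx => (hd0 x hx).le) hd2 h12 h0 (by linarith) hb0 hu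
    ((closure_mono (Function.support_subset_iff'.2 fun x hx => by
        rw [Function.notMem_support.1 hx]; simp)).trans hWs) hc.le hC hA0 hk₁ hδ0.le hδ1 hl0 hl1
    (fun p hp => (hWloc p hp).imp id fun h => by
      filter_upwards [h] with x hx
      simp [hx]) hmode
  have a2 := hwt b ψ h1 hl (hψ.mono h1 (by lia))
  have a3 := hi b 1 ψ h1 hl1 (hψ.mono h1 (by lia))
  rw [nsq_wmul, ← hc₅] at a1
  rw [pow_one, ← hldef] at a3
  set w := wm Ω (fun x => W x ^ 2) ψ with hw
  set g := wm Ω (gsq W) ψ with hg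
  set Q := Qf Ω (b ^ 2) (fun x => (W x : ℂ) * ψ x)
  have hw0 : 0 ≤ w := wm_nonneg ho ψ fun x _ => by positivity
  have hg0 : 0 ≤ g := wm_nonneg ho ψ fun x _ => gsq_nonneg W x
  have hi1 : b⁻¹ ≤ 1 := inv_le_one_of_one_le₀ h1
  have hi0 : 0 < b⁻¹ := by positivity
  have eA : A + 1 + δ * b = b * (δ * K') + (Cρ + 1) := by rw [hA, hK']; ring
  rw [eA] at a1
  have hF0 : 0 ≤ c₅ * (b * (δ * K') + (Cρ + 1)) := by positivity
  have a4 := mul_le_mul_of_nonneg_left a2 hF0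
  have a5 : c₅ * (Cρ + 1) * Cg ≤ c * (1 - E₀) / 4 * b := by
    have := (le_max_right _ _).trans hbb
    rwa [div_le_iff₀ (by positivity), mul_comm b] at this
  have a6 := mul_le_mul_of_nonneg_right a5 hw0
  have a7 := mul_le_mul_of_nonneg_right hδ2 (mul_nonneg hb0.le hw0)
  have a8 : c₅ * (b * (δ * K') + (Cρ + 1)) * (Cg' * (b ^ 2)⁻¹) ≤
      c₅ * (δ * K' + (Cρ + 1)) * Cg' * b⁻¹ := by
    have e : c₅ * (b * (δ * K') + (Cρ + 1)) * (Cg' * (b ^ 2)⁻¹) =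
        c₅ * (δ * K' + (Cρ + 1) * b⁻¹) * Cg' * b⁻¹ := by field_simp
    rw [e]
    gcongr
    exact mul_le_of_le_one_right (by positivity) hi1
  have a9 : Q / b ^ 2 ≤ E₀ * w + g * b⁻¹ + Ci * b⁻¹ * b⁻¹ := by
    have e1 := mul_le_mul_of_nonneg_right hl hw0
    rw [div_le_iff₀ (by positivity)]
    have e2 : (E₀ * w + g * b⁻¹ + Ci * b⁻¹ * b⁻¹) * b ^ 2 = E₀ * b ^ 2 * w + g * b + Ci := by
      field_simp
    rw [e2]
    have e3 := mul_le_mul_of_nonneg_left h1 hg0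
    have e4 := mul_le_mul_of_nonneg_left hi1 hCi
    linarith
  have a10 := mul_le_mul_of_nonneg_left a9 (by positivity : 0 ≤ c * b)
  have e10 : c * b * (E₀ * w + g * b⁻¹ + Ci * b⁻¹ * b⁻¹) = c * E₀ * (b * w) + c * g + c * Ci * b⁻¹ := by
    field_simp
  rw [e10] at a10
  have fin : c * (1 - E₀) / 2 * (b * w) ≤ (c + 1) * g + R * b⁻¹ := by
    rw [hR]
    linarith
  have hcE : 0 < c * (1 - E₀) := by positivity
  have e11 : 2 * (c + 1) / (c * (1 - E₀)) * g + 2 * R / (c * (1 - E₀)) * b⁻¹ =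
      ((c + 1) * g + R * b⁻¹) / (c * (1 - E₀) / 2) := by field_simp
  rw [e11, le_div_iff₀ (by positivity)]
  linarith

/-- Near-minimizers are small near a boundary point of non-maximal curvature. -/
lemma exists_window_decay (ho : IsOpen Ω) (hb : Bornology.IsBounded Ω) (T : Tube P) {d : Plane → ℝ}
    (hd : ContDiff ℝ 1 d) (hd0 : ∀ x ∈ Ω, 0 < d x) (hd1 : ∀ x ∉ Ω, d x ≤ 0)
    (hd2 : ∀ p : Plane, 0 ≤ p.2 → p.2 < T.t₀ → p.2 ≤ d (tub P p)) {s₁ s₂ : ℝ}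
    (hk : kap P s₁ < kap P s₂) {E₀ : ℝ} (hE0 : 0 ≤ E₀) (hE : E₀ < 1) :
    ∃ W : Plane → ℝ, ContDiff ℝ 1 W ∧ (∃ ℓ > 0, ∀ p : Plane, |p.1 - s₁| ≤ ℓ → 0 < p.2 →
      p.2 < T.t₀ / 4 → W (tub P p) = 1) ∧ ∃ N : ℕ, ∃ C ≥ 0, ∃ b₁ ≥ 1, ∀ (b : ℝ) (ψ : Plane → ℂ),
      b₁ ≤ b → lam1 Ω (b ^ 2) ≤ E₀ * b ^ 2 → NearMin Ω b N ψ →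
      b ^ 2 * wm Ω (fun x => W x ^ 4) ψ ≤ C := by
  have ht := T.pos
  have hL := P.L_pos
  obtain ⟨δ, hδ, N, C₀, hC₀, b₁, hb₁, hgap⟩ := exists_gap_bound ho hb T hd hd0 hd1 hd2
    (t₁ := T.t₀ / 3) (t₂ := 2 * T.t₀ / 5) (by linarith) (by linarith) (by linarith) hk hE0 hE
  obtain ⟨ρ, η, hη0, hη, r1, r2, r3, -, r5⟩ := exists_arc_bump P s₁ hδ
  obtain ⟨χ, c1, c2, c3, c4⟩ := exists_bump (a := -(T.t₀ / 3)) (a' := -(T.t₀ / 4))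
    (b' := T.t₀ / 4) (b := T.t₀ / 3) (by linarith) (by linarith)
  obtain ⟨W, w1, w2, -, w4⟩ := exists_window_fn T (t₁ := T.t₀ / 3) (by linarith)
    (a := s₁ - P.L / 2) (b := s₁ + P.L / 2) (a' := s₁ - η) (b' := s₁ + η) (by linarith) (by linarith)
    (by linarith) (n := (⊤ : ℕ∞)) le_rfl (G := fun p => ρ p.1 * χ p.2)
    ((r1.comp contDiff_fst).mul (c1.comp contDiff_snd)) (fun p hp => by
      by_cases h : p.1 ∈ Icc (s₁ - η) (s₁ + η)
      · rw [c3 p.2 fun hc => hp ⟨h, Ioo_subset_Icc_self hc⟩, mul_zero]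
      · rw [r3 p.1 (by
          by_contra hc
          have := abs_lt.1 (not_le.1 hc)
          exact h ⟨by linarith, by linarith⟩), zero_mul])
  have hW : ContDiff ℝ 1 W := w1.of_le (by exact_mod_cast le_top)
  have hs : tsupport W ⊆ tub P '' {p | |p.2| ≤ T.t₀ / 3} :=
    w4.trans (image_mono fun p hp => abs_le.2 hp.2)
  have hloc : ∀ p : Plane, |p.2| < T.t₀ →
      |kap P p.1 - kap P s₁| ≤ δ ∨ W =ᶠ[𝓝 (tub P p)] 0 := fun p hp => by
    by_cases h : tub P p ∈ tsupport W
    · left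
      obtain ⟨q, hq, hqp⟩ := w4 h
      obtain ⟨-, n, hn⟩ := T.inj p q hp ((abs_le.2 hq.2).trans_lt (by linarith)) hqp.symm
      rw [hn, P.periodic_kap.int_mul n q.1]
      exact r5 _ (abs_le.2 ⟨by linarith [hq.1.1], by linarith [hq.1.2]⟩)
    · exact Or.inr (notMem_tsupport_iff_eventuallyEq.1 h)
  have hW2 : ContDiff ℝ 1 fun x => W x * W x := hW.mul hW
  obtain ⟨C₁, hC₁, g1⟩ := hgap W hW hs hloc
  obtain ⟨C₂, hC₂, g2⟩ := hgap (fun x => W x * W x) hW2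
    ((closure_mono (Function.support_subset_iff'.2 fun x hx => by
        rw [Function.notMem_support.1 hx]; simp)).trans hs)
    fun p hp => (hloc p hp).imp id fun h => by
      filter_upwards [h] with x hx
      simp [hx]
  obtain ⟨D, hD, hgD⟩ := exists_gsq_bound hb hW
  refine ⟨W, hW, ⟨η / 2, by positivity, fun p h1 h2 h3 => ?_⟩, N,
    C₀ * (4 * D) * (C₀ * D + C₁) + C₂, by positivity, b₁, hb₁, fun b ψ h1 hl hψ => ?_⟩
  · obtain ⟨h4, h5⟩ := abs_le.1 h1
    rw [w2 p ⟨⟨by linarith, by linarith⟩, ⟨by linarith, by linarith⟩⟩]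
    rw [r2 p.1 h1, c2 p.2 ⟨by linarith, h3.le⟩, mul_one]
  · have h1' : 1 ≤ b := hb₁.le.trans h1
    have hb0 : 0 < b := by linarith
    have hi1 : b⁻¹ ≤ 1 := inv_le_one_of_one_le₀ h1'
    have cψ := hψ.1.continuous
    have cW := hW.continuous
    have e1 := g1 b ψ h1 hl hψ
    have e2 := g2 b ψ h1 hl hψ
    set w := wm Ω (fun x => W x ^ 2) ψ
    have e3 : wm Ω (gsq W) ψ ≤ D := by
      refine (wm_mono ho hb (continuous_gsq hW) continuous_const cψ hgD).trans (le_of_eq ?_)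
      simpa [wm_one, hψ.2.1] using wm_const_mul Ω D (fun _ => 1) ψ
    have e4 : wm Ω (gsq fun x => W x * W x) ψ ≤ 4 * D * w := by
      rw [← wm_const_mul]
      refine wm_mono ho hb (continuous_gsq hW2) (by fun_prop) cψ fun x hx => ?_
      have := mul_le_mul_of_nonneg_left (hgD x hx) (sq_nonneg (W x))
      linarith [gsq_mul_le hW hW x]
    have e5 : b * w ≤ C₀ * D + C₁ := by
      have := mul_le_mul_of_nonneg_left e3 hC₀
      have := mul_le_mul_of_nonneg_left hi1 hC₁
      linarith
    have e6 : (fun x => (W x * W x) ^ 2) = fun x => W x ^ 4 := by ext x; ring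
    rw [e6] at e2
    have e7 := mul_le_mul_of_nonneg_left e2 hb0.le
    have e8 := mul_le_mul_of_nonneg_left e4 (mul_nonneg hb0.le hC₀)
    have e9 := mul_le_mul_of_nonneg_left e5 (by positivity : 0 ≤ C₀ * (4 * D))
    have e10 : b * (C₂ * b⁻¹) = C₂ := by field_simp
    linarith

end SC

namespace SC

variable {Ω : Set Plane} {P : BoundaryParam Ω}

/-- The ground state energy has a quadratic upper bound with coefficient `O(1/B)`. -/
lemma exists_quadratic_upper (ho : IsOpen Ω) (hb : Bornology.IsBounded Ω) (hne : Ω.Nonempty)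
    (T : Tube P) {s₁ s₂ : ℝ} (hk : kap P s₁ < kap P s₂) :
    ∃ K ≥ 0, ∃ B₀ > 0, ∀ B ≥ B₀, ∀ η > 0, ∃ D, ∀ β, 0 < B + β →
      lam1 Ω (B + β) ≤ lam1 Ω B + η + β * D + β ^ 2 * K / B := by
  have ht := T.pos
  obtain ⟨E₀, hE1, hE⟩ := exists_between Theta0_lt_one
  have hE0 : 0 ≤ E₀ := Theta0_pos.le.trans hE1.le
  obtain ⟨d, hd, hd0, hd1, hd2, hd3⟩ := exists_dist T ho (r := T.t₀ / 4) (by linarith) (by linarith)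
  have hd' : ContDiff ℝ 1 d := hd.of_le (by exact_mod_cast le_top)
  obtain ⟨W, hW, ⟨ℓ, hℓ, hWℓ⟩, N, C, hC, b₁, hb₁, hdecay⟩ :=
    exists_window_decay ho hb T hd' hd0 hd1 hd2 hk hE0 hE
  obtain ⟨φ, hφ, Cφ, hCφ, hgauge⟩ := exists_gauge_fn T hb (r := T.t₀ / 4) (by linarith) hd2 hd3 hℓ hWℓ
  obtain ⟨M, hM, hmom⟩ := moment_bound ho hb hd' hd0 hd1 hE 0
  obtain ⟨b₂, hb₂⟩ := eventually_atTop.1 (lam1_le ho T hE1)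
  refine ⟨Cφ * (1 + M + C), by positivity, max b₁ b₂ ^ 2, by
    have := le_max_left b₁ b₂
    have : 0 < max b₁ b₂ := by linarith
    positivity, fun B hB η hη => ?_⟩
  have hm : 1 ≤ max b₁ b₂ := hb₁.le.trans (le_max_left _ _)
  have hB0 : 0 < B := lt_of_lt_of_le (by positivity) hB
  set b := Real.sqrt B
  have hbm : max b₁ b₂ ≤ b := Real.le_sqrt_of_sq_le hB
  have h1 : 1 ≤ b := hm.trans hbm
  have hb0 : 0 < b := by linarith
  have hbB : b ^ 2 = B := Real.sq_sqrt hB0.le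
  obtain ⟨ψ, hψ, hQ⟩ := exists_nearMin ho hb hne h1 hη (max N 6)
  have hl := hb₂ b ((le_max_right _ _).trans hbm)
  have a1 := hdecay b ψ ((le_max_left _ _).trans hbm) hl (hψ.mono h1 (le_max_left _ _))
  have a2 := hmom b ψ h1 hl (hψ.mono h1 (le_max_right _ _))
  have cψ := hψ.1.continuous
  have cW := hW.continuous
  have cd := hd'.continuous
  have cφ := hφ.continuous_fderiv (by norm_num)
  have cF := continuous_F0
  have a3 : b ^ 2 * wm Ω (fun x => d x ^ 2) ψ ≤ 1 + M := by
    have e1 : b ^ 2 * wm Ω (fun x => d x ^ 2) ψ ≤ 1 + wm Ω (fun x => (b * d x) ^ (2 * 0 + 4)) ψ := by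
      rw [← hψ.2.1, ← wm_one, ← wm_add hb continuous_const (by fun_prop) cψ, ← wm_const_mul]
      refine wm_mono ho hb (by fun_prop) (by fun_prop) cψ fun x _ => ?_
      simp only [mul_zero, zero_add]
      nlinarith [sq_nonneg ((b * d x) ^ 2 - 1), sq_nonneg ((b * d x) ^ 2)]
    linarith
  have hA : ∫ x in Ω, (((F0 x).1 - fderiv ℝ φ x (1, 0)) ^ 2 + ((F0 x).2 - fderiv ℝ φ x (0, 1)) ^ 2)
      * ‖ψ x‖ ^ 2 ≤ Cφ * (1 + M + C) / B := by
    have e1 := wm_mono ho hb (by fun_prop) (by fun_prop) cψ hgauge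
    rw [wm_const_mul, wm_add hb (f := fun x => d x ^ 2) (g := fun x => W x ^ 4) (by fun_prop)
      (by fun_prop) cψ] at e1
    refine e1.trans ?_
    rw [le_div_iff₀ hB0, ← hbB]
    have := mul_le_mul_of_nonneg_left (add_le_add a3 a1) hCφ
    linarith
  rw [hbB] at hQ
  obtain ⟨D, hD⟩ := lam1_quadratic_upper hb hφ hψ.1 hψ.2.1 hQ hA
  exact ⟨D, fun β _ => (hD β).trans (le_of_eq (by ring))⟩

lemma exists_kap_lt (hnd : NonDegen P) : ∃ s₁ s₂, kap P s₁ < kap P s₂ := by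
  obtain ⟨N, s, hN, -, h2, h3, -⟩ := hnd
  obtain ⟨t, ht, hts⟩ := (Ico_infinite P.L_pos).exists_notMem_finset (Finset.univ.image s)
  refine ⟨t, s ⟨0, hN⟩, ?_⟩
  unfold kap
  rw [h2]
  exact h3 t ht fun j hj => hts (Finset.mem_image.2 ⟨j, Finset.mem_univ j, hj.symm⟩)

end SC

/-- Under the non-degeneracy assumption, `λ₁(B) - M B²` is concave on
`(0,∞)` (with `M = sup_{cl Ω} |F₀|²`), both one-sided derivatives of `λ₁` exist and
tend to `Θ₀` at infinity, and `λ₁` is eventually strictly increasing. -/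
theorem lam1_onesided_derivatives_tend_to_theta0
    (Ω : Set SC.Plane) (hΩ_open : IsOpen Ω) (hΩ_bdd : Bornology.IsBounded Ω)
    (hΩ_sc : SimplyConnectedSpace ↥Ω) (P : SC.BoundaryParam Ω) (hnd : SC.NonDegen P) :
    ConcaveOn ℝ (Set.Ioi 0)
      (fun B => SC.lam1 Ω B - (sSup ((fun x => SC.esq (SC.F0 x)) '' closure Ω)) * B ^ 2) ∧
    (∀ B : ℝ, 0 < B → DifferentiableWithinAt ℝ (SC.lam1 Ω) (Set.Ici B) B ∧
      DifferentiableWithinAt ℝ (SC.lam1 Ω) (Set.Iic B) B) ∧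
    Filter.Tendsto (fun B => derivWithin (SC.lam1 Ω) (Set.Ici B) B)
      Filter.atTop (nhds SC.Theta0) ∧
    Filter.Tendsto (fun B => derivWithin (SC.lam1 Ω) (Set.Iic B) B)
      Filter.atTop (nhds SC.Theta0) ∧
    ∃ B₀ > 0, StrictMonoOn (SC.lam1 Ω) (Set.Ici B₀) := by
  obtain ⟨T⟩ := SC.exists_tube (P := P) hΩ_open hΩ_bdd
  obtain ⟨s₁, s₂, hk⟩ := SC.exists_kap_lt hnd
  have hne : Ω.Nonempty := by
    obtain ⟨ε, hε, h⟩ := P.inward 0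
    exact ⟨_, h (ε / 2) ⟨by linarith, by linarith⟩⟩
  have hconc := SC.lam1_concave hΩ_open hΩ_bdd hne
  obtain ⟨K, hK, B₀, hB₀, hquad⟩ := SC.exists_quadratic_upper hΩ_open hΩ_bdd hne T hk
  exact ⟨hconc, SC.onesided_of_bounds SC.Theta0_pos hK hB₀ hconc
    (SC.tendsto_lam1_div hΩ_open hΩ_bdd hne T) hquad⟩
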